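/- For every ε > 0 there is a constant K(ε) with the following property. Let F be a normalized holomorphic Hecke eigenform of even weight k ≥ 12 for SL(2, ℤ) with normalized Hecke eigenvalues λ. Let M, X, Z ≥ 1, let f be a nonzero integer and σ ∈ {+1, −1}. Let (α_m) and (β_n) be complex sequences with |α_m|, |β_n| ≤ 1, supported on [M, 2M] and [X, 2X] respectively, and suppose there is a real Ξ with MX/(100Z) ≤ Ξ ≤ 100(MX + |f|) such that α_m β_n = 0 unless m is squarefree and σmn + f ∈ [Ξ, 2Ξ]. Then | Σ_m Σ_n α_m β_n λ(σmn + f) | ≤ K(ε) (kMX|f|)^{ε} k^{23/4} ( k + Z(1 + |f|/(MX)) )^{4} ( X(MX + |f|) + X (MX + |f|)^{1/2} M^{5/2} + X (MX + |f|)^{3/4} M^{7/4} )^{1/2}. -/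

import Mathlib

/-- Normalized Hecke eigenvalues: `λ(n) = a(n) n^{−(k−1)/2}` for `n ≥ 1`, `λ(m) = 0` for
`m ≤ 0`. -/
noncomputable def heckeLambda (k : ℕ) (a : ℕ → ℂ) (m : ℤ) : ℂ :=
  if 0 < m then a m.toNat * ((m.toNat : ℝ) ^ (-(((k : ℝ) - 1) / 2)) : ℝ) else 0

/-- `a : ℕ → ℂ` is the sequence of Fourier coefficients of a normalized holomorphic Hecke
eigenform of even weight `k ≥ 12` for `SL(2, ℤ)`. -/
def IsNormalizedHeckeEigenform (k : ℕ) (a : ℕ → ℂ) : Prop :=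
  Even k ∧ 12 ≤ k ∧
  (∃ F : CuspForm (CongruenceSubgroup.Gamma 1) k, F ≠ 0 ∧
    ∀ z : UpperHalfPlane, F z = ∑' n : ℕ,
      a (n + 1) * Complex.exp (2 * Real.pi * Complex.I * (n + 1) * (z : ℂ))) ∧
  a 1 = 1 ∧
  ∀ m n : ℕ, 1 ≤ m → 1 ≤ n →
    a m * a n = ∑ d ∈ (Nat.gcd m n).divisors, (d : ℂ) ^ (k - 1) * a (m * n / d ^ 2)

noncomputable def fkl {F : Type*} [Field F] [Fintype F] [DecidableEq F] (ψ : AddChar F ℂ) : ℂ :=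
  ∑ w : F, if w = 0 then 0 else ψ (w + w⁻¹)
section uu
open Real Finset Complex
variable {F : Type*} [Field F] [Fintype F] [DecidableEq F]
lemma pq (hF : ringChar F ≠ 2) : (2 : F) ≠ 0 := Ring.two_ne_zero hF
lemma uv (hF : ringChar F ≠ 2) {d : F} (hd : ¬ IsSquare d) (h : F → ℂ) :
    ∑ v : F, h (v ^ 2) + ∑ v : F, h (d * v ^ 2) = 2 * ∑ t : F, h t := by
  classical
  have ep : d ≠ 0 := by rintro rfl; exact hd (by simp)
  have key : ∀ g : F → F, ∑ v : F, h (g v) =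
      ∑ t : F, ((univ.filter (fun v => g v = t)).card : ℂ) * h t := by
    intro g
    rw [← sum_fiberwise (s := univ) (g := g)]
    refine sum_congr rfl fun t _ => ?_
    rw [sum_congr rfl (g := fun _ => h t)]
    · simp
    · intro v hv; simp at hv; rw [hv]
  rw [key, key, ← sum_add_distrib, mul_sum]
  refine sum_congr rfl fun t _ => ?_
  rw [← add_mul]
  congr 1
  have Hc := quadraticChar_card_sqrts hF t
  have Hd := quadraticChar_card_sqrts hF (t / d)
  have Hi : (univ.filter (fun v : F => v ^ 2 = t)) = {x : F | x ^ 2 = t}.toFinset := by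
    ext; simp
  have Hj : (univ.filter (fun v : F => d * v ^ 2 = t)) = {x : F | x ^ 2 = t / d}.toFinset := by
    ext x; simp [eq_div_iff ep, mul_comm]
  have Hg : quadraticChar F (t / d) = - quadraticChar F t := by
    have : quadraticChar F d = -1 := quadraticChar_neg_one_iff_not_isSquare.mpr hd
    have Hl : quadraticChar F (t / d * d) = quadraticChar F t := by rw [div_mul_cancel₀ _ ep]
    rw [map_mul, this] at Hl
    linarith
  rw [Hi, Hj]
  have : ((({x : F | x ^ 2 = t}.toFinset.card : ℤ) + ({x : F | x ^ 2 = t / d}.toFinset.card : ℤ) : ℤ) : ℂ) = 2 := by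
    rw [Hc, Hd, Hg]; push_cast; ring
  exact_mod_cast this
lemma uw (hF : ringChar F ≠ 2) {d : F} (hd : ¬ IsSquare d) (ψ : AddChar F ℂ) (hψ : ψ ≠ 1) :
    (∑ u : F, ∑ v : F, if u ^ 2 - d * v ^ 2 = 0 then 0 else
      ψ (2 * u * (1 + (u ^ 2 - d * v ^ 2)⁻¹))) + fkl ψ ^ 2 = 2 * (Fintype.card F : ℂ) := by
  classical
  have Hd := pq hF
  set g : F → F → ℂ := fun s n => if n = 0 then 0 else ψ (s * (1 + n⁻¹)) with hg
  have Hi : fkl ψ ^ 2 = ∑ u : F, ∑ v : F, g (2 * u) (u ^ 2 - v ^ 2) := by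
    have : fkl ψ ^ 2 = ∑ x : F × F, g (x.1 + x.2) (x.1 * x.2) := by
      rw [Fintype.sum_prod_type, sq, fkl, sum_mul_sum]
      refine sum_congr rfl fun x _ => sum_congr rfl fun y _ => ?_
      simp only [hg]
      by_cases hx : x = 0
      · simp [hx]
      by_cases hy : y = 0
      · simp [hy]
      simp only [hx, hy, if_false, mul_eq_zero, or_self, ← AddChar.map_add_eq_mul]
      congr 1
      field_simp
      ring
    rw [this, ← Fintype.sum_prod_type (f := fun p : F × F => g (2 * p.1) (p.1 ^ 2 - p.2 ^ 2))]
    symm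
    refine Fintype.sum_equiv
      ⟨fun p => (p.1 + p.2, p.1 - p.2), fun p => ((p.1 + p.2) / 2, (p.1 - p.2) / 2), ?_, ?_⟩ _ _ ?_
    · rintro ⟨x, y⟩; ext <;> simp <;> field_simp <;> ring
    · rintro ⟨x, y⟩; ext <;> simp <;> field_simp <;> ring
    · rintro ⟨x, y⟩
      simp only [Equiv.coe_fn_mk]
      congr 1 <;> ring
  have Hj : ∀ u : F, (∑ v : F, g (2 * u) (u ^ 2 - v ^ 2)) + ∑ v : F, g (2 * u) (u ^ 2 - d * v ^ 2)
      = 2 * ∑ n : F, g (2 * u) n := by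
    intro u
    rw [uv hF hd (fun t => g (2 * u) (u ^ 2 - t))]
    congr 1
    exact Fintype.sum_equiv (Equiv.subLeft (u ^ 2)) _ _ (fun x => by simp)
  have Hu : ∀ n : F, ∑ u : F, g (2 * u) n = if n = -1 then (Fintype.card F : ℂ) else 0 := by
    intro n
    simp only [hg]
    by_cases hn : n = 0
    · simp [hn]
    simp only [hn, if_false]
    have : ∑ u : F, ψ (2 * u * (1 + n⁻¹)) = ∑ u : F, ψ (u * (2 * (1 + n⁻¹))) := by
      refine sum_congr rfl fun u _ => by ring_nf
    rw [this, AddChar.sum_mulShift _ (AddChar.IsPrimitive.of_ne_one hψ)]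
    have : (2 * (1 + n⁻¹) = 0) ↔ n = -1 := by
      constructor
      · intro h
        have er := (mul_eq_zero.mp h).resolve_left Hd
        field_simp at er
        linear_combination er
      · rintro rfl; field_simp; ring
    simp [this]
  rw [Hi, add_comm, ← sum_add_distrib, sum_congr rfl (fun u _ => Hj u), ← mul_sum,
    sum_comm, sum_congr rfl (fun n _ => Hu n)]
  simp
lemma rf (ψ : AddChar F ℂ) : (starRingEnd ℂ) (fkl ψ) = fkl ψ := by
  rw [fkl, map_sum]
  refine Fintype.sum_equiv (Equiv.neg F) _ _ fun w => ?_
  simp only [Equiv.neg_apply, neg_eq_zero]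
  split_ifs
  · simp
  · rw [inv_neg, ← neg_add, AddChar.map_neg_eq_conj]
end uu
section ux
open Real Finset Complex
open Polynomial
variable {F : Type*} [Field F] [Fintype F] [DecidableEq F]
noncomputable def stepPoly (F : Type*) [Field F] (p : ℕ) : F[X] := (X ^ p - X) ^ 2 - C 4
lemma gp {p : ℕ} (hp : 2 ≤ p) : (stepPoly F p).natDegree ≤ 2 * p := by
  have Hc : (X ^ p - X : F[X]).natDegree ≤ p := by
    refine (natDegree_sub_le _ _).trans ?_
    simp only [natDegree_X_pow, natDegree_X]; omega
  refine (natDegree_sub_le _ _).trans ?_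
  simp only [natDegree_C]
  have := natDegree_pow_le (p := (X ^ p - X : F[X])) (n := 2)
  simp; nlinarith
lemma uy {p : ℕ} [Fact p.Prime] [CharP F p] (Hz : p ≠ 2) {c : F} (hc : c ≠ 0) {R S : F[X]}
    (h : R ^ 2 = C c * S ^ 2 * stepPoly F p) : S = 0 := by
  by_contra hS
  have hp : 2 ≤ p := (Fact.out : p.Prime).two_le
  have Hd : (2 : F) ≠ 0 := by
    have := (Ring.two_ne_zero (R := F)); apply this; rwa [ringChar.eq F p]
  have Hk : (4 : F) ≠ 0 := by
    have : (4 : F) = 2 * 2 := by norm_num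
    rw [this]; exact mul_ne_zero Hd Hd
  have hdvd : S ^ 2 ∣ R ^ 2 := ⟨C c * stepPoly F p, by rw [h]; ring⟩
  obtain ⟨T, rfl⟩ := (IsIntegrallyClosed.pow_dvd_pow_iff (two_ne_zero)).mp hdvd
  have hT : T ^ 2 = C c * stepPoly F p := by
    have : S ^ 2 * T ^ 2 = S ^ 2 * (C c * stepPoly F p) := by rw [← mul_pow, h]; ring
    exact mul_left_cancel₀ (pow_ne_zero 2 hS) this
  have hf : T ∣ stepPoly F p := by
    have : T ∣ C c * stepPoly F p := by rw [← hT, sq]; exact dvd_mul_left _ _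
    exact (IsUnit.dvd_mul_left (isUnit_C.mpr hc.isUnit)).mp this
  have hder : derivative (stepPoly F p) = - (C 2 * (X ^ p - X)) := by
    simp only [stepPoly, derivative_sub, derivative_C, derivative_pow, derivative_X, CharP.cast_eq_zero]
    simp
  have uz : T ∣ derivative (stepPoly F p) := by
    have Hl := congrArg derivative hT
    simp only [derivative_pow, derivative_mul, derivative_C] at Hl
    have : T ∣ C c * derivative (stepPoly F p) := by
      refine ⟨C 2 * derivative T, ?_⟩
      simp at Hl
      rw [← Hl]; ring
    exact (IsUnit.dvd_mul_left (isUnit_C.mpr hc.isUnit)).mp this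
  have Hq : T ∣ C (4 : F) := by
    have e : C (4 : F) = - (stepPoly F p) - C (1 / 2) * (X ^ p - X) * derivative (stepPoly F p) := by
      rw [hder, stepPoly]
      have : (C (1 / 2) * C 2 : F[X]) = 1 := by rw [← C_mul, one_div, inv_mul_cancel₀ Hd]; simp
      linear_combination (-(X ^ p - X) ^ 2) * this
    rw [e]
    exact dvd_sub (dvd_neg.mpr hf) (Dvd.dvd.mul_left uz _)
  have eb : IsUnit T := isUnit_of_dvd_unit Hq (isUnit_C.mpr Hk.isUnit)
  have jl : IsUnit (stepPoly F p) := by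
    have : IsUnit (C c * stepPoly F p) := by rw [← hT]; exact eb.pow 2
    exact isUnit_of_mul_isUnit_right this
  rw [Polynomial.isUnit_iff] at jl
  obtain ⟨e, _, he⟩ := jl
  rw [← he] at hder
  simp only [derivative_C] at hder
  have cy : (X ^ p - X : F[X]) = 0 := by
    have : C 2 * (X ^ p - X : F[X]) = 0 := by rw [← neg_eq_zero, ← hder]
    exact (mul_eq_zero.mp this).resolve_left (by simpa using Hd)
  have := congrArg (fun q => coeff q 1) cy
  simp [coeff_X_pow, show (1:ℕ) ≠ p by omega] at this
lemma va {p : ℕ} [Fact p.Prime] [CharP F p] (Hz : p ≠ 2) {r a b : ℕ}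
    (ha : 2 * a = p ^ r + 1) (hb : b + p = a) {R S : F[X]} (hR : R.degree < a) (hS : S.degree < b)
    (hdvd : X ^ (p ^ r) ∣ R + S * stepPoly F p ^ a) : R = 0 ∧ S = 0 := by
  have hp : 2 ≤ p := (Fact.out : p.Prime).two_le
  set f := stepPoly F p with hf
  set s := p ^ r with hs
  set c : F := (f.eval 0) ^ s with hc
  have Hd : (2 : F) ≠ 0 := by
    have := (Ring.two_ne_zero (R := F)); apply this; rwa [ringChar.eq F p]
  have cz : f.eval 0 ≠ 0 := by
    simp only [hf, stepPoly, eval_sub, eval_pow, eval_X, eval_C]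
    have : (4 : F) = 2 * 2 := by norm_num
    rw [this]; simp [show p ≠ 0 by omega]; exact Hd
  have eu : c ≠ 0 := pow_ne_zero _ cz
  have Hc : X ^ s ∣ f ^ s - C c := by
    have : X ∣ f - C (f.eval 0) := by
      rw [X_dvd_iff]; simp [coeff_zero_eq_eval_zero]
    have h := pow_dvd_pow_of_dvd this s
    rwa [hs, sub_pow_char_pow, ← hs, ← C_pow] at h
  have Hg : X ^ s ∣ R ^ 2 - C c * S ^ 2 * f := by
    have e : R ^ 2 - C c * S ^ 2 * f = (R + S * f ^ a) * (R - S * f ^ a) + S ^ 2 * f * (f ^ s - C c) := by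
      have : (f ^ a) ^ 2 = f ^ s * f := by rw [← pow_mul, mul_comm, ha, pow_succ]
      linear_combination (S ^ 2) * this
    rw [e]
    exact dvd_add (Dvd.dvd.mul_right hdvd _) (Dvd.dvd.mul_left Hc _)
  have hdeg : (R ^ 2 - C c * S ^ 2 * f).degree < (X ^ s : F[X]).degree := by
    rw [degree_X_pow]
    have hfd : f.degree ≤ ((2 * p : ℕ) : WithBot ℕ) := natDegree_le_iff_degree_le.mp (gp hp)
    refine (degree_sub_le _ _).trans_lt (max_lt ?_ ?_)
    · by_cases jz : R = 0
      · simp [jz]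
      rw [degree_eq_natDegree jz] at hR
      rw [degree_eq_natDegree (pow_ne_zero 2 jz), natDegree_pow]
      norm_cast at hR ⊢; omega
    · by_cases jb : S = 0
      · simp [jb]
      rw [degree_eq_natDegree jb] at hS
      have rg : f ≠ 0 := by rintro h; simp [h] at cz
      rw [degree_eq_natDegree (by simp [jb, rg, eu]), natDegree_mul (by simp [jb, eu]) rg, natDegree_C_mul eu, natDegree_pow]
      have := gp (F := F) hp
      rw [← hf] at this
      norm_cast at hS ⊢; omega
  have Hk := eq_zero_of_dvd_of_degree_lt Hg hdeg
  have jb : S = 0 := uy Hz eu (sub_eq_zero.mp Hk)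
  refine ⟨?_, jb⟩
  rw [jb] at Hk; simpa using Hk
lemma stepanov {p : ℕ} [Fact p.Prime] [CharP F p] (Hz : p ≠ 2) {r : ℕ} (hr : 2 ≤ r)
    (hq : Fintype.card F = (p ^ r) ^ 2) :
    2 * (univ.filter (fun z : F => ((z ^ p - z) ^ 2 - 4) ^ ((Fintype.card F - 1) / 2) = -1)).card
      ≤ (p ^ r) ^ 2 + (6 * p + 4) * p ^ r := by
  classical
  have hpp : p.Prime := Fact.out
  have dj : 3 ≤ p := by have := hpp.two_le; omega
  have hodd : Odd p := hpp.odd_of_ne_two Hz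
  set s := p ^ r with hs
  have hsodd : Odd s := hodd.pow
  obtain ⟨es, rh⟩ := hsodd
  set a := es + 1 with haa
  have ha : 2 * a = s + 1 := by omega
  have hsp : p * p ≤ s := by rw [hs, ← sq]; exact Nat.pow_le_pow_right (by omega) hr
  have vb : 3 * p ≤ s := le_trans (by nlinarith) hsp
  obtain ⟨b, hb⟩ : ∃ b, b + p = a := ⟨a - p, by omega⟩
  set J := a + p with hJ
  set L := s * es + p + J with hL
  set f := stepPoly F p with hf
  have hfd : f.natDegree ≤ 2 * p := gp (by omega)
  let D := Fin J → (degreeLT F a) × (degreeLT F b)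
  let H : D → F[X] := fun x => ∑ j : Fin J, (((x j).1 : F[X]) ^ s - ((x j).2 : F[X]) ^ s * f ^ a) * X ^ (j : ℕ)
  let G : D → F[X] := fun x => ∑ j : Fin J, (((x j).1 : F[X]) + ((x j).2 : F[X]) * f ^ a) * X ^ ((j : ℕ) * s)
  have nd : ∀ (n : ℕ) (P : degreeLT F n), (P : F[X]).natDegree ≤ n - 1 := by
    intro n P
    have := mem_degreeLT.mp P.2
    by_cases Hm : (P : F[X]) = 0
    · simp [Hm]
    rw [degree_eq_natDegree Hm] at this
    norm_cast at this; omega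
  have jm : 0 < s := by omega
  have hHmem : ∀ x, H x ∈ degreeLT F L := by
    intro x
    refine Submodule.sum_mem _ fun j _ => ?_
    rw [mem_degreeLT]
    refine lt_of_le_of_lt (degree_le_natDegree) ?_
    norm_cast
    refine (natDegree_mul_le).trans_lt ?_
    rw [natDegree_X_pow]
    have Hc : ((x j).1 : F[X]).natDegree ≤ es := by simpa [haa] using nd a (x j).1
    have Hd := nd b (x j).2
    have Hg : (((x j).1 : F[X]) ^ s).natDegree ≤ s * es :=
      (natDegree_pow_le).trans (Nat.mul_le_mul_left _ Hc)
    have Hk : (((x j).2 : F[X]) ^ s * f ^ a).natDegree ≤ s * es + p := by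
      refine natDegree_mul_le.trans ?_
      have Hl := (natDegree_pow_le (p := ((x j).2 : F[X])) (n := s)).trans (Nat.mul_le_mul_left _ Hd)
      have Hq := (natDegree_pow_le (p := f) (n := a)).trans (Nat.mul_le_mul_left _ hfd)
      refine (add_le_add Hl Hq).trans ?_
      have dk : 1 ≤ b := by omega
      obtain ⟨cl, rfl⟩ : ∃ cl, b = cl + 1 := ⟨b - 1, by omega⟩
      have : es = cl + p := by omega
      simp only [Nat.add_sub_cancel]
      have e : a * (2 * p) = (s + 1) * p := by rw [← ha]; ring
      rw [e, this]; nlinarith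
    have eb := (natDegree_sub_le (((x j).1 : F[X]) ^ s) (((x j).2 : F[X]) ^ s * f ^ a))
    have jl := j.2
    have cy := eb.trans (max_le (Hg.trans (Nat.le_add_right _ p)) Hk)
    omega
  have fin : ∀ n, Finite (degreeLT F n) := fun n => Finite.of_equiv _ (degreeLTEquiv F n).symm.toEquiv
  have fint : ∀ n, Fintype (degreeLT F n) := fun n => Fintype.ofFinite _
  have card : ∀ n, Fintype.card (degreeLT F n) = Fintype.card F ^ n := by
    intro n
    rw [Fintype.card_congr (degreeLTEquiv F n).toEquiv]; simp
  have ga : 1 < Fintype.card F := Fintype.one_lt_card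
  obtain ⟨x, y, hxy, hHxy⟩ : ∃ x y : D, x ≠ y ∧ (⟨H x, hHmem x⟩ : degreeLT F L) = ⟨H y, hHmem y⟩ := by
    refine Fintype.exists_ne_map_eq_of_card_lt (fun x : D => (⟨H x, hHmem x⟩ : degreeLT F L)) ?_
    rw [card L]
    have : Fintype.card D = Fintype.card F ^ ((a + b) * J) := by
      simp only [D, Fintype.card_pi, Fintype.card_prod, card, prod_const, card_univ, Fintype.card_fin, ← pow_add, ← pow_mul]
    rw [this]
    refine Nat.pow_lt_pow_right ga ?_
    rw [hL, hJ]
    have Hi : a = b + p := hb.symm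
    have Hj : es + 1 = b + p := by omega
    have Hu : s = 2 * (b + p) - 1 := by omega
    have et : s + 1 = 2 * (b + p) := by omega
    have ew : p + 1 ≤ 2 * b := by omega
    have gb : s * es + s = s * (b + p) := by rw [← Hj]; ring
    rw [Hi]
    nlinarith
  have cm : H (x - y) = 0 := by
    have Hc : H x = H y := congrArg Subtype.val hHxy
    have Hd : H (x - y) = H x - H y := by
      simp only [H, ← sum_sub_distrib]
      refine sum_congr rfl fun j _ => ?_
      have e : (x - y) j = x j - y j := rfl
      rw [e]
      simp only [Prod.fst_sub, Prod.snd_sub, Submodule.coe_sub]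
      rw [hs, sub_pow_char_pow, sub_pow_char_pow]; ring
    rw [Hd, Hc, sub_self]
  set w := x - y with hw
  have vc : w ≠ 0 := sub_ne_zero.mpr hxy
  have jf : G w ≠ 0 := by
    intro hG
    have hne : (univ.filter (fun j => w j ≠ 0)).Nonempty := by
      by_contra h
      rw [not_nonempty_iff_eq_empty, filter_eq_empty_iff] at h
      exact vc (funext fun j => not_not.mp (h (mem_univ j)))
    obtain ⟨jc, ca, hmin⟩ := exists_min_image _ (fun j : Fin J => j) hne
    simp only [mem_filter, mem_univ, true_and] at ca hmin
    have Hc : X ^ (((jc : ℕ) + 1) * s) ∣ ∑ j ∈ univ.erase jc, (((w j).1 : F[X]) + ((w j).2 : F[X]) * f ^ a) * X ^ ((j : ℕ) * s) := by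
      refine dvd_sum fun j hj => ?_
      have vd := ne_of_mem_erase hj
      by_cases h : w j = 0
      · simp [h]
      · have Hg := hmin j h
        have Hk : (jc : ℕ) < j := lt_of_le_of_ne Hg (fun e => vd (Fin.ext e.symm))
        exact Dvd.dvd.mul_left (pow_dvd_pow _ (Nat.mul_le_mul_right _ Hk)) _
    have Hd : X ^ (((jc : ℕ) + 1) * s) ∣ (((w jc).1 : F[X]) + ((w jc).2 : F[X]) * f ^ a) * X ^ ((jc : ℕ) * s) := by
      have e := add_sum_erase univ (fun j : Fin J => (((w j).1 : F[X]) + ((w j).2 : F[X]) * f ^ a) * X ^ ((j : ℕ) * s)) (mem_univ jc)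
      change _ = G w at e
      rw [hG] at e
      rw [eq_neg_of_add_eq_zero_left e]
      exact (dvd_neg).mpr Hc
    have Hg : X ^ s ∣ ((w jc).1 : F[X]) + ((w jc).2 : F[X]) * f ^ a := by
      rw [add_mul, one_mul, pow_add, mul_comm (X ^ _) (X ^ s)] at Hd
      exact (mul_dvd_mul_iff_right (pow_ne_zero _ X_ne_zero)).mp Hd
    obtain ⟨Hk, Hl⟩ := va Hz ha hb (mem_degreeLT.mp (w jc).1.2) (mem_degreeLT.mp (w jc).2.2) Hg
    exact ca (Prod.ext (Subtype.ext Hk) (Subtype.ext Hl))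
  have hroots : ∀ z ∈ (univ.filter (fun z : F => ((z ^ p - z) ^ 2 - 4) ^ ((Fintype.card F - 1) / 2) = -1)), (G w).eval z = 0 := by
    intro z hz
    simp only [mem_filter, mem_univ, true_and] at hz
    have hfz : f.eval z = (z ^ p - z) ^ 2 - 4 := by simp [hf, stepPoly]
    rw [← hfz] at hz
    have hfas : (f.eval z) ^ (a * s) = - (f.eval z) ^ a := by
      have : a * s = (Fintype.card F - 1) / 2 + a := by
        rw [hq]
        have Hi : s ^ 2 - 1 = 2 * (a * s - a) := by
          zify [show 1 ≤ s ^ 2 from Nat.one_le_pow _ _ jm, show a ≤ a * s from Nat.le_mul_of_pos_right _ jm]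
          have : (2 : ℤ) * a = s + 1 := by exact_mod_cast ha
          linear_combination (1 - (s : ℤ)) * this
        rw [Hi, Nat.mul_div_cancel_left _ (by norm_num)]
        have : a ≤ a * s := Nat.le_mul_of_pos_right _ jm
        omega
      rw [this, pow_add, hz]; ring
    have Hc : ((G w).eval z) ^ s = (H w).eval z := by
      simp only [G, H, eval_finsetSum]
      rw [hs, sum_pow_char_pow, ← hs]
      refine sum_congr rfl fun j _ => ?_
      simp only [eval_mul, eval_add, eval_pow, eval_sub, eval_X]
      rw [mul_pow, hs, add_pow_char_pow, ← hs, mul_pow, ← pow_mul, hfas, ← pow_mul]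
      have : z ^ ((j : ℕ) * s * s) = z ^ (j : ℕ) := by
        rw [mul_assoc, ← sq, ← hq, mul_comm, pow_mul, FiniteField.pow_card]
      rw [this]; ring
    rw [cm, eval_zero] at Hc
    exact pow_eq_zero_iff jm.ne' |>.mp Hc
  have hcard : (univ.filter (fun z : F => ((z ^ p - z) ^ 2 - 4) ^ ((Fintype.card F - 1) / 2) = -1)).card ≤ (G w).natDegree := by
    refine (card_le_card (t := (G w).roots.toFinset) fun z hz => ?_).trans
      ((Multiset.toFinset_card_le _).trans (card_roots' _))
    simp [jf, hroots z hz, IsRoot]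
  have hdeg : (G w).natDegree ≤ (2 * p + 1) * a + (J - 1) * s := by
    refine natDegree_sum_le_of_forall_le _ _ fun j _ => ?_
    refine natDegree_mul_le.trans ?_
    rw [natDegree_X_pow]
    have Hc := nd a (w j).1
    have Hd := nd b (w j).2
    have Hq := (natDegree_pow_le (p := f) (n := a)).trans (Nat.mul_le_mul_left _ hfd)
    have Hg : (((w j).2 : F[X]) * f ^ a).natDegree ≤ (b - 1) + a * (2 * p) := natDegree_mul_le.trans (add_le_add Hd Hq)
    have Hk := natDegree_add_le ((w j).1 : F[X]) (((w j).2 : F[X]) * f ^ a)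
    have Hl : (j : ℕ) * s ≤ (J - 1) * s := Nat.mul_le_mul_right _ (by have := j.2; omega)
    have eb : (((w j).1 : F[X]) + ((w j).2 : F[X]) * f ^ a).natDegree ≤ (2 * p + 1) * a := by
      have Hi : (2 * p + 1) * a = a * (2 * p) + a := by ring
      have Hj : b - 1 ≤ a := by omega
      refine Hk.trans (max_le (Hc.trans ?_) (Hg.trans ?_))
      · rw [Hi]; exact (Nat.sub_le a 1).trans (Nat.le_add_left _ _)
      · rw [Hi, add_comm]; exact Nat.add_le_add_left Hj _
    exact add_le_add eb Hl
  have ve : J - 1 = es + p := by omega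
  rw [ve] at hdeg
  have jg : s = 2 * es + 1 := rh
  have vf : a ≤ s := by omega
  have hfin := hcard.trans hdeg
  have Hi : (2 * p + 1) * a ≤ (2 * p + 1) * s := Nat.mul_le_mul_left _ vf
  have Hj : 2 * ((es + p) * s) + s = s * s + 2 * p * s := by
    calc 2 * ((es + p) * s) + s = (2 * es + 1) * s + 2 * p * s := by ring
      _ = s * s + 2 * p * s := by rw [← jg]
  have Hu : s ^ 2 + (6 * p + 4) * s = s * s + 2 * p * s + 2 * ((2 * p + 1) * s) + 2 * s := by ring
  rw [Hu]
  omega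
end ux
section vg
open Real Finset Complex
open Polynomial
lemma vh {F : Type} [Field F] [Fintype F] [DecidableEq F] {p : ℕ} [Fact p.Prime] [CharP F p]
    (Hz : p ≠ 2) {r : ℕ} (hr : 2 ≤ r) (hq : Fintype.card F = (p ^ r) ^ 2) (tr : F →+ ZMod p)
    (htr : ∀ x, tr (x ^ p) = tr x) (ψ : AddChar (ZMod p) ℂ) (hψ : ψ ≠ 1) :
    ∃ n : ℕ, ∑ a : ZMod p, fkl ((ψ.mulShift a).compAddMonoidHom tr) = n ∧
      (p ^ r) ^ 2 ≤ n + 4 * p + (6 * p + 4) * p ^ r := by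
  classical
  have hpp : p.Prime := Fact.out
  have hchar : ringChar F ≠ 2 := by rwa [ringChar.eq F p]
  have Hd := pq hchar
  set W := univ.filter (fun w : F => w ≠ 0 ∧ tr (w + w⁻¹) = 0) with hW
  refine ⟨p * W.card, ?_, ?_⟩
  · simp only [fkl]
    rw [sum_comm]
    have : ∀ w : F, (∑ a : ZMod p, if w = 0 then (0 : ℂ) else
        ((ψ.mulShift a).compAddMonoidHom tr) (w + w⁻¹)) = if w ∈ W then (p : ℂ) else 0 := by
      intro w
      by_cases hw : w = 0
      · simp [hw, hW]
      · simp only [hw, if_false, AddChar.compAddMonoidHom_apply, AddChar.mulShift_apply]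
        have := AddChar.sum_mulShift (tr (w + w⁻¹)) (AddChar.IsPrimitive.of_ne_one hψ)
        rw [this]
        simp [hW, hw, ZMod.card]
    rw [sum_congr rfl (fun w _ => this w)]
    simp [sum_ite_mem, mul_comm]
  · set P := univ.filter (fun zw : F × F => zw.2 ^ 2 - (zw.1 ^ p - zw.1) * zw.2 + 1 = 0) with hP
    have hPne : ∀ zw ∈ P, zw.2 ≠ 0 ∧ zw.2 + zw.2⁻¹ = zw.1 ^ p - zw.1 := by
      intro zw h
      simp only [hP, mem_filter, mem_univ, true_and] at h
      have Hm : zw.2 ≠ 0 := by intro Hm; simp [Hm] at h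
      refine ⟨Hm, ?_⟩
      field_simp
      linear_combination h
    have hPW : P.card ≤ p * W.card := by
      refine (card_le_mul_card_image (f := Prod.snd) P p ?_).trans
        (Nat.mul_le_mul_left _ (card_le_card ?_))
      · intro w _
        set g : F[X] := X ^ p - X - C (w + w⁻¹) with hg
        have cc : 1 < p := hpp.one_lt
        have hgd : g.natDegree = p := by
          rw [hg, natDegree_sub_C]
          rw [natDegree_sub_eq_left_of_natDegree_lt] <;> simp [cc]
        have ri : g ≠ 0 := by intro h; rw [h] at hgd; simp at hgd; omega
        rw [← hgd]
        refine le_trans ?_ (card_roots' g)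
        refine le_trans ?_ (Multiset.toFinset_card_le _)
        refine card_le_card_of_injOn Prod.fst ?_ ?_
        · intro zw hzw
          simp only [coe_filter, Set.mem_ofPred_eq] at hzw
          have := (hPne zw hzw.1).2
          rw [hzw.2] at this
          have hr : g.eval zw.1 = 0 := by rw [hg]; simp [← this]
          simpa [ri, IsRoot] using hr
        · rintro ⟨z, Ht⟩ Hc ⟨dl, Hy⟩ Hd h
          simp at Hc Hd h
          ext
          · exact h
          · simp [Hc.2, Hd.2]
      · intro w hw
        obtain ⟨zw, hzw, rfl⟩ := mem_image.mp hw
        obtain ⟨Hm, Hc⟩ := hPne zw hzw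
        simp only [hW, mem_filter, mem_univ, true_and]
        refine ⟨Hm, ?_⟩
        rw [Hc, map_sub, htr, sub_self]
    set f := stepPoly F p with hf
    have hfz : ∀ z, f.eval z = (z ^ p - z) ^ 2 - 4 := by intro z; simp [hf, stepPoly]
    have hPsum : (P.card : ℤ) = ∑ z : F, (quadraticChar F (f.eval z) + 1) := by
      have : (P.card : ℤ) = ∑ z : F, ((univ.filter (fun w : F => w ^ 2 - (z ^ p - z) * w + 1 = 0)).card : ℤ) := by
        rw [hP, card_filter, Fintype.sum_prod_type]
        push_cast
        refine sum_congr rfl fun z _ => ?_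
        rw [card_filter]; push_cast; rfl
      rw [this]
      refine sum_congr rfl fun z _ => ?_
      rw [← quadraticChar_card_sqrts hchar]
      congr 1
      refine card_bij (fun w _ => 2 * w - (z ^ p - z)) ?_ ?_ ?_
      · intro w hw
        simp only [mem_filter, mem_univ, true_and] at hw
        simp only [Set.mem_toFinset, Set.mem_ofPred_eq, hfz]
        linear_combination 4 * hw
      · intro w _ pr _ h
        have : 2 * w = 2 * pr := by linear_combination h
        exact mul_left_cancel₀ Hd this
      · intro v hv
        simp only [Set.mem_toFinset, Set.mem_ofPred_eq, hfz] at hv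
        refine ⟨(v + (z ^ p - z)) / 2, ?_, by field_simp; ring⟩
        simp only [mem_filter, mem_univ, true_and]
        field_simp
        linear_combination hv
    set N := univ.filter (fun z : F => ((z ^ p - z) ^ 2 - 4) ^ ((Fintype.card F - 1) / 2) = -1) with hN
    have hNc := stepanov (F := F) Hz hr hq
    rw [← hN] at hNc
    set Zr := univ.filter (fun z : F => f.eval z = 0) with hZr
    have hZc : Zr.card ≤ 2 * p := by
      have cz : f ≠ 0 := by
        intro h
        have := hfz 0
        rw [h] at this
        simp [hpp.ne_zero] at this
        have Hk : (4 : F) = 2 * 2 := by norm_num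
        rw [Hk] at this
        exact Hd (by simpa using this)
      refine le_trans ?_ (gp (F := F) hpp.two_le)
      refine le_trans ?_ (card_roots' f)
      refine le_trans (card_le_card ?_) (Multiset.toFinset_card_le _)
      intro z hz
      simpa [hZr, cz, IsRoot] using hz
    have hlow : (2 * Fintype.card F : ℤ) ≤ P.card + 2 * Zr.card + 2 * N.card := by
      rw [hPsum]
      have Hi : (Zr.card : ℤ) = ∑ z : F, if f.eval z = 0 then 1 else 0 := by
        rw [hZr, card_filter]; push_cast; rfl
      have Hj : (N.card : ℤ) = ∑ z : F, if ((z ^ p - z) ^ 2 - 4) ^ ((Fintype.card F - 1) / 2) = -1 then 1 else 0 := by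
        rw [hN, card_filter]; push_cast; rfl
      have Hu : (2 * Fintype.card F : ℤ) = ∑ z : F, 2 := by simp [mul_comm]
      rw [Hi, Hj, Hu, mul_sum, mul_sum, ← sum_add_distrib, ← sum_add_distrib]
      refine sum_le_sum fun z _ => ?_
      rw [← hfz]
      by_cases hz : f.eval z = 0
      · simp [hz]; split_ifs <;> norm_num
      · rcases quadraticChar_dichotomy hz with h | h
        · rw [h]; split_ifs <;> norm_num
        · have Hg := quadraticChar_eq_pow_of_char_ne_two' hchar (f.eval z)
          rw [h] at Hg
          have Hk : (f.eval z) ^ ((Fintype.card F - 1) / 2) = -1 := by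
            have Hl : Fintype.card F % 2 = 1 := FiniteField.odd_card_of_char_ne_two hchar
            have : (Fintype.card F - 1) / 2 = Fintype.card F / 2 := by omega
            rw [this, ← Hg]; simp
          rw [h, Hk]; simp [hz]
    rw [hq] at hlow
    zify at hNc hPW hZc ⊢
    push_cast at hlow
    linarith
lemma vi {F : Type} [Field F] [Fintype F] [DecidableEq F] {p : ℕ} [Fact p.Prime] [CharP F p]
    (Hz : p ≠ 2) (tr : F →+ ZMod p) (htr : ∀ x, tr (x ^ p) = tr x) (hsurj : Function.Surjective tr) :
    ∃ (E : Type) (_ : Field E) (_ : Fintype E) (_ : DecidableEq E) (_ : CharP E p) (cn : E →+ ZMod p),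
      Fintype.card E = (Fintype.card F) ^ 2 ∧ (∀ x, cn (x ^ p) = cn x) ∧ Function.Surjective cn ∧
      ∀ ψ : AddChar (ZMod p) ℂ, ψ ≠ 1 → fkl (ψ.compAddMonoidHom cn) + fkl (ψ.compAddMonoidHom tr) ^ 2
        = 2 * (Fintype.card F : ℂ) := by
  classical
  have hchar : ringChar F ≠ 2 := by rwa [ringChar.eq F p]
  have Hd := pq hchar
  obtain ⟨d, hd⟩ := FiniteField.exists_nonsquare hchar
  have fact : Fact (∀ r : F, r ^ 2 ≠ d + 0 * r) := ⟨fun r h => hd ⟨r, by rw [← sq, h]; ring⟩⟩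
  let E := QuadraticAlgebra F d 0
  let e : E ≃ F × F := QuadraticAlgebra.equivProd d 0
  let _ : Fintype E := Fintype.ofEquiv _ e.symm
  have hcp : CharP E p := charP_of_injective_algebraMap (algebraMap F E).injective p
  let t : E →+ F := { toFun := fun x => 2 * x.re, map_zero' := by simp, map_add' := fun x y => by rw [QuadraticAlgebra.re_add, mul_add] }
  have ht : ∀ x : E, algebraMap F E (t x) = x + star x := by
    intro x
    rw [← QuadraticAlgebra.algebraMap_trace_eq_add_star]
    congr 1
    simp [QuadraticAlgebra.trace_def, t]
  refine ⟨E, inferInstance, inferInstance, inferInstance, hcp, tr.comp t, ?_, ?_, ?_, ?_⟩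
  · rw [Fintype.card_congr e, Fintype.card_prod, sq]
  · intro x
    have : t (x ^ p) = (t x) ^ p := by
      apply (algebraMap F E).injective
      rw [map_pow (algebraMap F E), ht, ht, add_pow_char, star_pow]
    simp only [AddMonoidHom.comp_apply]
    rw [this, htr]
  · intro y
    obtain ⟨x, rfl⟩ := hsurj y
    refine ⟨algebraMap F E (x / 2), ?_⟩
    simp only [AddMonoidHom.comp_apply]
    congr 1
    change 2 * (x / 2) = x
    field_simp
  · intro ψ hψ
    have vj : ψ.compAddMonoidHom tr ≠ 1 := by
      intro h
      apply hψ
      ext y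
      obtain ⟨x, rfl⟩ := hsurj y
      have := DFunLike.congr_fun h x
      simpa using this
    rw [← uw hchar hd _ vj]
    congr 1
    rw [fkl, ← Fintype.sum_prod_type' (f := fun u v : F => if u ^ 2 - d * v ^ 2 = 0 then (0:ℂ) else
      (ψ.compAddMonoidHom tr) (2 * u * (1 + (u ^ 2 - d * v ^ 2)⁻¹)))]
    refine Fintype.sum_equiv e _ _ fun x => ?_
    have hn : QuadraticAlgebra.norm x = x.re ^ 2 - d * x.im ^ 2 := by
      rw [QuadraticAlgebra.norm_def]; ring
    have hz : x = 0 ↔ x.re ^ 2 - d * x.im ^ 2 = 0 := by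
      rw [← hn]; exact QuadraticAlgebra.norm_eq_zero_iff_eq_zero.symm
    change _ = if x.re ^ 2 - d * x.im ^ 2 = 0 then (0:ℂ) else (ψ.compAddMonoidHom tr) (2 * x.re * (1 + (x.re ^ 2 - d * x.im ^ 2)⁻¹))
    by_cases h : x = 0
    · rw [if_pos h, if_pos (hz.mp h)]
    · rw [if_neg h, if_neg (fun er => h (hz.mpr er))]
      simp only [AddChar.compAddMonoidHom_apply, AddMonoidHom.comp_apply]
      congr 2
      have : (x⁻¹).re = (x.re ^ 2 - d * x.im ^ 2)⁻¹ * x.re := by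
        rw [← hn]
        change (QuadraticAlgebra.norm x)⁻¹ * (x.re + 0 * x.im) = _
        rw [zero_mul, add_zero]
      change 2 * (x + x⁻¹).re = _
      rw [QuadraticAlgebra.re_add, this]
      ring
noncomputable def kapIter (x : ℝ) : ℕ → ℝ
  | 0 => x
  | n + 1 => 2 - (kapIter x n) ^ 2
lemma vk {p : ℕ} [Fact p.Prime] (Hz : p ≠ 2) (ψ : AddChar (ZMod p) ℂ) (hψ : ψ ≠ 1) (j : ℕ) :
    ∃ (F : Type) (_ : Field F) (_ : Fintype F) (_ : DecidableEq F) (_ : CharP F p) (tr : F →+ ZMod p),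
      Fintype.card F = p ^ (2 ^ j) ∧ (∀ x, tr (x ^ p) = tr x) ∧ Function.Surjective tr ∧
      ∀ a : ZMod p, a ≠ 0 → fkl ((ψ.mulShift a).compAddMonoidHom tr)
        = ((√((p : ℝ) ^ (2 ^ j)) * kapIter ((fkl (ψ.mulShift a)).re / √p) j : ℝ) : ℂ) := by
  have hpp : p.Prime := Fact.out
  have vl : (0 : ℝ) < p := by exact_mod_cast hpp.pos
  induction j with
  | zero =>
    refine ⟨ZMod p, inferInstance, inferInstance, inferInstance, inferInstance, AddMonoidHom.id _,
      by simp [ZMod.card], by simp, fun x => ⟨x, rfl⟩, fun a _ => ?_⟩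
    have Hc : (ψ.mulShift a).compAddMonoidHom (AddMonoidHom.id _) = ψ.mulShift a := by ext; simp
    rw [Hc]
    have Hd := conj_eq_iff_real.mp (rf (ψ.mulShift a))
    obtain ⟨x, hx⟩ := Hd
    have : √(p : ℝ) ≠ 0 := by positivity
    rw [hx]
    simp only [kapIter, pow_zero, pow_one, ofReal_re]
    congr 1
    field_simp
  | succ j ih =>
    obtain ⟨F, _, _, _, _, tr, hc, htr, hs, hk⟩ := ih
    obtain ⟨E, cp, gq, ps, vm, cn, ef, vn, jg, js⟩ := vi Hz tr htr hs
    refine ⟨E, cp, gq, ps, vm, cn, ?_, vn, jg, ?_⟩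
    · rw [ef, hc, ← pow_mul, pow_succ]
    · intro a ha
      have hne : ψ.mulShift a ≠ 1 := AddChar.IsPrimitive.of_ne_one hψ ha
      have h := js _ hne
      rw [hk a ha, hc] at h
      have e : (p : ℝ) ^ (2 ^ (j + 1)) = ((p : ℝ) ^ (2 ^ j)) ^ 2 := by rw [← pow_mul, pow_succ]
      rw [e, sqrt_sq (by positivity), eq_sub_of_add_eq h]
      have Hj : (√((p : ℝ) ^ (2 ^ j))) ^ 2 = (p : ℝ) ^ (2 ^ j) := sq_sqrt (by positivity)
      rw [kapIter]
      have et : (p : ℝ) ^ 2 ^ j * (2 - kapIter ((fkl (ψ.mulShift a)).re / √p) j ^ 2) =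
        √((p : ℝ) ^ (2 ^ j)) ^ 2 * (2 - kapIter ((fkl (ψ.mulShift a)).re / √p) j ^ 2) := by rw [Hj]
      rw [et]
      push_cast
      have Hu : ((√((p : ℝ) ^ (2 ^ j)) : ℝ) : ℂ) ^ 2 = (p : ℂ) ^ (2 ^ j) := by
        rw [← ofReal_pow, Hj]; push_cast; rfl
      rw [← Hu]; ring
lemma vo (x : ℝ) (j : ℕ) : kapIter x (j + 1) ≤ 2 := by
  rw [kapIter]; nlinarith [sq_nonneg (kapIter x j)]
lemma vp {x : ℝ} {η : ℝ} (hη : 0 ≤ η) (hx : 2 + η ≤ |x|) (j : ℕ) :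
    kapIter x (j + 1) ≤ - (2 + (j + 1) * η) := by
  have Hm : kapIter x 1 ≤ -(2 + η) := by
    simp only [kapIter]
    have : (2 + η) ^ 2 ≤ x ^ 2 := by rw [← sq_abs x]; gcongr
    nlinarith
  induction j with
  | zero => simpa using Hm
  | succ j ih =>
    rw [kapIter]
    push_cast
    have hj : (0 : ℝ) ≤ (j + 1) * η := by positivity
    have : (2 + (j + 1) * η) ^ 2 ≤ (kapIter x (j + 1)) ^ 2 := by
      rw [← neg_sq (kapIter x (j+1))]
      gcongr; linarith
    nlinarith
theorem vq {p : ℕ} [Fact p.Prime] (ψ : AddChar (ZMod p) ℂ) (hψ : ψ ≠ 1) :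
    ‖fkl ψ‖ ≤ 2 * √p := by
  have hpp : p.Prime := Fact.out
  have vl : (0 : ℝ) < p := by exact_mod_cast hpp.pos
  by_cases Hz : p = 2
  · refine (norm_sum_le _ _).trans ?_
    have : ∀ w : ZMod p, ‖(if w = 0 then (0 : ℂ) else ψ (w + w⁻¹))‖ ≤ 1 := by
      intro w; split_ifs
      · simp
      · rw [AddChar.norm_apply]
    refine (sum_le_sum fun w _ => this w).trans ?_
    simp only [sum_const, card_univ, ZMod.card, nsmul_eq_mul, mul_one]
    subst Hz
    push_cast
    have : (1 : ℝ) ≤ √2 := one_le_sqrt.mpr (by norm_num)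
    linarith
  by_contra hcon
  push Not at hcon
  have hreal := conj_eq_iff_real.mp (rf ψ)
  obtain ⟨x, hx⟩ := hreal
  have hsp : 0 < √(p : ℝ) := by positivity
  have vr : 2 < |x / √p| := by
    rw [hx, norm_real, norm_eq_abs] at hcon
    rw [abs_div, abs_of_pos hsp, lt_div_iff₀ hsp]; exact hcon
  set η := |x / √p| - 2 with hη
  have cd : 0 < η := by linarith
  obtain ⟨n, hn⟩ := exists_nat_gt ((2 * p + 20 * p + 20 : ℝ) / η)
  have jh : (2 * p + 20 * p + 20 : ℝ) < n * η := by rwa [div_lt_iff₀ cd] at hn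
  obtain ⟨F, _, _, _, _, tr, hc, htr, hs, hk⟩ := vk Hz ψ hψ (n + 1 + 1)
  have hr : 2 ≤ 2 ^ (n + 1) := by rw [pow_succ]; have := Nat.one_le_two_pow (n := n); omega
  have hq : Fintype.card F = (p ^ (2 ^ (n + 1))) ^ 2 := by rw [hc, ← pow_mul, pow_succ]
  obtain ⟨N, hN, hle⟩ := vh Hz hr hq tr htr ψ hψ
  set s := p ^ (2 ^ (n + 1)) with hsdef
  have hsq : √((p : ℝ) ^ (2 ^ (n + 1 + 1))) = s := by
    have : (p : ℝ) ^ (2 ^ (n + 1 + 1)) = (s : ℝ) ^ 2 := by rw [hsdef]; push_cast; rw [← pow_mul, pow_succ 2 (n+1)]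
    rw [this, sqrt_sq (by positivity)]
  rw [hsq] at hk
  have gr : (1 : ℝ) ≤ s := by exact_mod_cast Nat.one_le_pow _ _ hpp.pos
  rw [← add_sum_erase _ _ (mem_univ (0 : ZMod p))] at hN
  have Hm : fkl ((ψ.mulShift 0).compAddMonoidHom tr) = ((s : ℝ) ^ 2 - 1 : ℝ) := by
    have : ∀ w : F, (if w = 0 then (0 : ℂ) else ((ψ.mulShift 0).compAddMonoidHom tr) (w + w⁻¹)) = 1 - if w = 0 then 1 else 0 := by
      intro w; split_ifs <;> simp
    rw [fkl, sum_congr rfl fun w _ => this w, sum_sub_distrib]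
    simp [hq]
  rw [Hm, sum_congr rfl (fun a ha => hk a (ne_of_mem_erase ha))] at hN
  rw [← ofReal_sum, ← ofReal_add, ← mul_sum] at hN
  have vs : (s : ℝ) ^ 2 - 1 + s * ∑ a ∈ univ.erase (0 : ZMod p), kapIter ((fkl (ψ.mulShift a)).re / √p) (n + 1 + 1) = N := by
    exact_mod_cast hN
  have vt : (1 : ZMod p) ∈ univ.erase (0 : ZMod p) := by simp
  have hsum : ∑ a ∈ univ.erase (0 : ZMod p), kapIter ((fkl (ψ.mulShift a)).re / √p) (n + 1 + 1) ≤ - (n * η) + 2 * p := by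
    rw [← add_sum_erase _ _ vt]
    have Hi : kapIter ((fkl (ψ.mulShift 1)).re / √p) (n + 1 + 1) ≤ -(n * η) := by
      have : ψ.mulShift 1 = ψ := by ext; simp
      rw [this, hx, ofReal_re]
      have := vp cd.le (by rw [hη]; linarith : 2 + η ≤ |x / √p|) (n + 1)
      push_cast at this
      nlinarith
    have Hj : ∑ a ∈ (univ.erase (0 : ZMod p)).erase 1, kapIter ((fkl (ψ.mulShift a)).re / √p) (n + 1 + 1) ≤ 2 * p := by
      refine (sum_le_card_nsmul _ _ 2 fun a _ => vo _ _).trans ?_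
      rw [nsmul_eq_mul]
      have : (((univ.erase (0 : ZMod p)).erase 1).card : ℝ) ≤ p := by
        have : ((univ.erase (0 : ZMod p)).erase 1).card ≤ p := by
          refine (card_le_univ _).trans (by simp [ZMod.card])
        exact_mod_cast this
      linarith
    linarith
  have vu : (s : ℝ) ^ 2 ≤ N + 4 * p + (6 * p + 4) * s := by exact_mod_cast hle
  rw [← vs] at vu
  have ew : s * ∑ a ∈ univ.erase (0 : ZMod p), kapIter ((fkl (ψ.mulShift a)).re / √p) (n + 1 + 1) ≤ s * (- (n * η) + 2 * p) := by gcongr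
  nlinarith
end vg
section eg
open Real Finset Complex
noncomputable def rkl {R : Type} [CommRing R] [Fintype Rˣ] (Ψ : AddChar R ℂ) : ℂ :=
  ∑ w : Rˣ, Ψ ((w : R) + ((w⁻¹ : Rˣ) : R))
lemma vv {p : ℕ} [Fact p.Prime] [Fintype (ZMod p)ˣ] (Ψ : AddChar (ZMod p) ℂ) : rkl Ψ = fkl Ψ := by
  classical
  rw [rkl, fkl]
  have Hc : (∑ w : ZMod p, if w = 0 then (0 : ℂ) else Ψ (w + w⁻¹)) =
      ∑ w ∈ univ.filter (fun w : ZMod p => w ≠ 0), Ψ (w + w⁻¹) := by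
    rw [sum_filter]
    exact sum_congr rfl fun w _ => by by_cases h : w = 0 <;> simp [h]
  rw [Hc]
  refine sum_bij (fun w _ => (w : ZMod p)) ?_ ?_ ?_ ?_
  · intro w _; simp
  · intro w _ pr _ h; exact Units.ext h
  · intro w hw
    simp at hw
    exact ⟨Units.mk0 w hw, by simp, rfl⟩
  · intro w _; rw [Units.val_inv_eq_inv_val]
lemma vw {R : Type} [CommRing R] [Fintype R] [Fintype Rˣ] (Ψ : AddChar R ℂ) :
    ‖rkl Ψ‖ ≤ Fintype.card R := by
  refine (norm_sum_le _ _).trans ?_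
  simp only [AddChar.norm_apply, sum_const, card_univ, nsmul_eq_mul, mul_one]
  exact_mod_cast Fintype.card_le_of_injective (fun w : Rˣ => (w : R)) (fun a b h => Units.ext h)
lemma vx {R S : Type} [CommRing R] [CommRing S] [Fintype Rˣ] [Fintype Sˣ] (e : R ≃+* S) (Ψ : AddChar S ℂ) :
    rkl (Ψ.compAddMonoidHom (e : R →+* S).toAddMonoidHom) = rkl Ψ := by
  rw [rkl, rkl]
  refine Fintype.sum_equiv (Units.mapEquiv e.toMulEquiv).toEquiv _ _ fun w => ?_
  simp only [AddChar.compAddMonoidHom_apply]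
  congr 1
  simp [← map_inv]
lemma vy {A B : Type} [CommRing A] [CommRing B] [Fintype Aˣ] [Fintype Bˣ] [Fintype (A × B)ˣ]
    (Ψ : AddChar (A × B) ℂ) :
    rkl Ψ = rkl (Ψ.compAddMonoidHom (AddMonoidHom.inl A B)) * rkl (Ψ.compAddMonoidHom (AddMonoidHom.inr A B)) := by
  rw [rkl, rkl, rkl, sum_mul_sum, ← Fintype.sum_prod_type']
  refine Fintype.sum_equiv MulEquiv.prodUnits.toEquiv _ _ fun w => ?_
  simp only [AddChar.compAddMonoidHom_apply, ← AddChar.map_add_eq_mul]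
  congr 1
  ext <;> simp [MulEquiv.prodUnits] <;> rfl
lemma rj {A : Type} [CommRing A] [Fintype A] {n k : ℕ} (h : (n : A) = 0) (hk : n.Coprime k) :
    (Fintype.card A).Coprime k := by
  rw [Nat.coprime_iff_gcd_eq_one]
  by_contra hne
  obtain ⟨q, hq, hqd⟩ := Nat.exists_prime_and_dvd hne
  have := Fact.mk hq
  obtain ⟨x, hx⟩ := exists_prime_addOrderOf_dvd_card q (hqd.trans (Nat.gcd_dvd_left _ _))
  have : q ∣ n := by
    rw [← hx]
    apply addOrderOf_dvd_of_nsmul_eq_zero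
    rw [nsmul_eq_mul, h, zero_mul]
  exact Nat.Prime.not_coprime_iff_dvd.mpr ⟨q, hq, this, hqd.trans (Nat.gcd_dvd_right _ _)⟩ hk
lemma vz {R : Type} [CommRing R] [Fintype R] {p n : ℕ} (hp : p.Prime) (hpn : p.Coprime n)
    (hc : Fintype.card R = p * n) : ∃ (B : Type) (_ : CommRing B) (_ : Fintype B),
      Fintype.card B = n ∧ Nonempty (R ≃+* (ZMod p × B)) := by
  classical
  set I : Ideal R := Ideal.span {(p : R)} with hI
  set J : Ideal R := Ideal.span {(n : R)} with hJ
  have hcop : IsCoprime I J := by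
    rw [hI, hJ, Ideal.isCoprime_span_singleton_iff]
    simpa using (Nat.isCoprime_iff_coprime.mpr hpn).map (Int.castRingHom R)
  have Hm : I * J = ⊥ := by
    rw [hI, hJ, Ideal.span_singleton_mul_span_singleton, Ideal.span_singleton_eq_bot]
    have := Nat.cast_card_eq_zero (R := R)
    rw [hc] at this
    exact_mod_cast this
  have Hi : R ≃+* (R ⧸ I) × (R ⧸ J) :=
    ((RingEquiv.quotientBot R).symm.trans (Ideal.quotEquivOfEq Hm.symm)).trans
      (Ideal.quotientMulEquivQuotientProd I J hcop)
  let _ : Fintype (R ⧸ I) := Fintype.ofFinite _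
  let _ : Fintype (R ⧸ J) := Fintype.ofFinite _
  have ce : ((p : ℕ) : R ⧸ I) = 0 := by
    have : Ideal.Quotient.mk I (p : R) = 0 := Ideal.Quotient.eq_zero_iff_mem.mpr (Ideal.mem_span_singleton_self _)
    simpa using this
  have gc : ((n : ℕ) : R ⧸ J) = 0 := by
    have : Ideal.Quotient.mk J (n : R) = 0 := Ideal.Quotient.eq_zero_iff_mem.mpr (Ideal.mem_span_singleton_self _)
    simpa using this
  have hA := rj ce hpn
  have hB := rj gc hpn.symm
  have hprod : Fintype.card (R ⧸ I) * Fintype.card (R ⧸ J) = p * n := by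
    rw [← Fintype.card_prod, ← Fintype.card_congr Hi.toEquiv, hc]
  have rk : Fintype.card (R ⧸ I) ∣ p := hA.dvd_of_dvd_mul_right (Dvd.intro _ hprod)
  have wa : p ∣ Fintype.card (R ⧸ I) := hB.symm.dvd_of_dvd_mul_right (Dvd.intro _ hprod.symm)
  have hcA : Fintype.card (R ⧸ I) = p := Nat.dvd_antisymm rk wa
  have hcB : Fintype.card (R ⧸ J) = n := by
    rw [hcA] at hprod
    exact Nat.eq_of_mul_eq_mul_left hp.pos hprod
  exact ⟨R ⧸ J, inferInstance, inferInstance, hcB,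
    ⟨Hi.trans (RingEquiv.prodCongr (ZMod.ringEquivOfPrime _ hp hcA).symm (RingEquiv.refl _))⟩⟩
theorem wb (Hv : ℕ) : Squarefree Hv → ∀ (Hn : ℕ), Hv.Coprime Hn →
    ∀ (R : Type) [CommRing R] [Fintype R] [Fintype Rˣ] (Ψ : AddChar R ℂ), Fintype.card R = Hv * Hn →
    (∀ p : ℕ, p.Prime → p ∣ Hv → Ψ ((Hv * Hn / p : ℕ) : R) ≠ 1) →
    ‖rkl Ψ‖ ≤ Hv.divisors.card * √Hv * Hn := by
  classical
  induction Hv using induction_on_primes with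
  | zero => intro h; simp at h
  | one =>
    intro _ Hn _ R _ _ _ Ψ hc _
    refine (vw Ψ).trans ?_
    rw [hc]; simp
  | prime_mul p a hp ih =>
    intro hsq Hn hcop R _ _ _ Ψ hc hne
    have hpF := Fact.mk hp
    have hpa : p.Coprime a := by
      have := Nat.squarefree_mul_iff.mp hsq
      exact this.1
    have hasq : Squarefree a := (Nat.squarefree_mul_iff.mp hsq).2.2
    have hpn : p.Coprime (a * Hn) := Nat.Coprime.mul_right hpa (hcop.coprime_dvd_left (Dvd.intro _ rfl))
    have han : a.Coprime Hn := hcop.coprime_dvd_left (Dvd.intro_left _ rfl)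
    obtain ⟨B, _, _, hcB, ⟨e⟩⟩ := vz hp hpn (hc.trans (mul_assoc _ _ _))
    let _ : Fintype Bˣ := Fintype.ofFinite _
    let _ : Fintype (ZMod p × B)ˣ := Fintype.ofFinite _
    set Φ : AddChar (ZMod p × B) ℂ := Ψ.compAddMonoidHom (e.symm : (ZMod p × B) →+* R).toAddMonoidHom with hΦ
    have hΦe : rkl Ψ = rkl Φ := (vx e.symm Ψ).symm
    have hΦnat : ∀ k : ℕ, Φ (k : ZMod p × B) = Ψ (k : R) := by
      intro k
      simp [hΦ]
    rw [hΦe, vy, norm_mul, vv]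
    have cq : ((a * Hn : ℕ) : B) = 0 := by rw [← hcB]; exact Nat.cast_card_eq_zero B
    have Hc : ‖fkl (Φ.compAddMonoidHom (AddMonoidHom.inl (ZMod p) B))‖ ≤ 2 * √p := by
      refine vq _ fun h => ?_
      have Hd := hne p hp (Dvd.intro _ rfl)
      rw [mul_assoc, Nat.mul_div_cancel_left _ hp.pos, ← hΦnat] at Hd
      apply Hd
      have Hg := DFunLike.congr_fun h ((a * Hn : ℕ) : ZMod p)
      rw [AddChar.compAddMonoidHom_apply] at Hg
      have : (((a * Hn : ℕ)) : ZMod p × B) = AddMonoidHom.inl (ZMod p) B ((a * Hn : ℕ) : ZMod p) := by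
        ext
        · simp
        · simpa using cq
      rw [this, Hg]; rfl
    have Hd : ‖rkl (Φ.compAddMonoidHom (AddMonoidHom.inr (ZMod p) B))‖ ≤ a.divisors.card * √a * Hn := by
      refine ih hasq Hn han B _ hcB fun q hq hqa h => ?_
      refine hne q hq (Dvd.dvd.mul_left hqa _) ?_
      obtain ⟨t, ht⟩ := hqa
      rw [AddChar.compAddMonoidHom_apply] at h
      have Hi : a * Hn / q = t * Hn := by rw [ht, mul_assoc, Nat.mul_div_cancel_left _ hq.pos]
      have Hj : p * a * Hn / q = p * (t * Hn) := by
        rw [ht, show p * (q * t) * Hn = q * (p * (t * Hn)) by ring, Nat.mul_div_cancel_left _ hq.pos]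
      rw [Hj, ← hΦnat]
      rw [Hi] at h
      have : ((p * (t * Hn) : ℕ) : ZMod p × B) = p • AddMonoidHom.inr (ZMod p) B ((t * Hn : ℕ) : B) := by
        ext
        · simp
        · simp
      rw [this, AddChar.map_nsmul_eq_pow, h, one_pow]
    have Hg : (p * a).divisors.card = 2 * a.divisors.card := by
      rw [Nat.Coprime.card_divisors_mul hpa, hp.divisors, card_pair hp.one_lt.ne]
    rw [Hg]
    calc _ ≤ (2 * √p) * (a.divisors.card * √a * Hn) := by gcongr
      _ = _ := by push_cast; rw [sqrt_mul (by positivity)]; ring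
end eg
section eh
open Real Finset Complex
open Complex
abbrev FR (c o Ha : ℕ) : Subring (ZMod (c * o) × ZMod (c * Ha)) :=
  RingHom.eqLocus ((ZMod.castHom (Dvd.intro o rfl) (ZMod c)).comp (RingHom.fst (ZMod (c * o)) (ZMod (c * Ha))))
    ((ZMod.castHom (Dvd.intro Ha rfl) (ZMod c)).comp (RingHom.snd (ZMod (c * o)) (ZMod (c * Ha))))
def felt (c o Ha : ℕ) (Ht Hy : ℤ) (h : (Ht : ZMod c) = Hy) : FR c o Ha :=
  ⟨((Ht : ZMod (c * o)), (Hy : ZMod (c * Ha))), by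
    change ZMod.castHom (Dvd.intro o rfl) (ZMod c) (Ht : ZMod (c * o)) = ZMod.castHom (Dvd.intro Ha rfl) (ZMod c) (Hy : ZMod (c * Ha))
    rw [map_intCast, map_intCast, h]⟩
noncomputable def fPsi (c o Ha : ℕ) [NeZero (c * o)] [NeZero (c * Ha)] (f : ℤ) : AddChar (FR c o Ha) ℂ :=
  ((ZMod.stdAddChar (N := c * o)).mulShift (f : ZMod (c * o))).compAddMonoidHom
    ((AddMonoidHom.fst _ _).comp (FR c o Ha).subtype.toAddMonoidHom) *
  ((ZMod.stdAddChar (N := c * Ha)).mulShift (-f : ZMod (c * Ha))).compAddMonoidHom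
    ((AddMonoidHom.snd _ _).comp (FR c o Ha).subtype.toAddMonoidHom)
lemma rl (c o Ha : ℕ) [NeZero (c * o)] [NeZero (c * Ha)] (f : ℤ) (Ht Hy : ℤ) (h) :
    fPsi c o Ha f (felt c o Ha Ht Hy h) =
      cexp (2 * Real.pi * I * (f * Ht / (c * o) - f * Hy / (c * Ha))) := by
  have Hc : fPsi c o Ha f (felt c o Ha Ht Hy h) =
      ZMod.stdAddChar ((f * Ht : ℤ) : ZMod (c * o)) * ZMod.stdAddChar ((-f * Hy : ℤ) : ZMod (c * Ha)) := by
    push_cast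
    rfl
  rw [Hc, ZMod.stdAddChar_coe, ZMod.stdAddChar_coe, ← Complex.exp_add]
  congr 1
  push_cast
  ring
lemma wc {R : Type} [CommRing R] [Fintype R] [DecidableEq R] [Fintype Rˣ] (Ψ : AddChar R ℂ) :
    ∑ w : R, ∑ v : R, (if w * v = 1 then Ψ (w + v) else 0) = rkl Ψ := by
  rw [rkl, ← sum_product', ← sum_filter]
  symm
  refine sum_bij (fun w _ => ((w : R), ((w⁻¹ : Rˣ) : R))) ?_ ?_ ?_ ?_
  · intro w _; simp
  · intro w _ pr _ h; exact Units.ext (by simpa using (Prod.mk.inj h).1)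
  · rintro ⟨w, v⟩ hw
    simp at hw
    exact ⟨⟨w, v, hw, by rw [mul_comm]; exact hw⟩, by simp, rfl⟩
  · intro w _; rfl
noncomputable def kbox (Hx : ℤ) (c o Ha : ℕ) : Finset (ℤ × ℤ × ℤ) :=
  Ico Hx (Hx + c) ×ˢ (Ico 0 (o : ℤ) ×ˢ Ico 0 (Ha : ℤ))
def ftheta (c o Ha : ℕ) (s : ℤ) (p : ℤ × ℤ × ℤ) : FR c o Ha :=
  felt c o Ha (p.1 + s * (c * p.2.1)) (p.1 + s * (c * p.2.2)) (by simp)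
lemma rm {c o Ha : ℕ} {Ht Hy h gd ge er} (Hi : ((c * o : ℕ) : ℤ) ∣ gd - Ht) (Hj : ((c * Ha : ℕ) : ℤ) ∣ ge - Hy) :
    felt c o Ha Ht Hy h = felt c o Ha gd ge er := by
  apply Subtype.ext
  exact Prod.ext ((ZMod.intCast_eq_intCast_iff_dvd_sub _ _ _).mpr Hi) ((ZMod.intCast_eq_intCast_iff_dvd_sub _ _ _).mpr Hj)
lemma rn {c o Ha : ℕ} {Ht Hy h gd ge er} :
    felt c o Ha Ht Hy h = felt c o Ha gd ge er ↔ ((c * o : ℕ) : ℤ) ∣ gd - Ht ∧ ((c * Ha : ℕ) : ℤ) ∣ ge - Hy := by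
  refine ⟨fun h => ?_, fun h => rm h.1 h.2⟩
  have := congrArg Subtype.val h
  exact ⟨(ZMod.intCast_eq_intCast_iff_dvd_sub _ _ _).mp (congrArg Prod.fst this),
    (ZMod.intCast_eq_intCast_iff_dvd_sub _ _ _).mp (congrArg Prod.snd this)⟩
lemma gf {m a b D : ℤ} (h : m ∣ b - a) (ha : D ≤ a) (rh : a < D + m) (hb : D ≤ b) (dm : b < D + m) :
    a = b := by
  have := Int.eq_zero_of_abs_lt_dvd h (by rw [abs_lt]; constructor <;> linarith)
  linarith
lemma ro (c o Ha : ℕ) (hc : 0 < c) (Hc : 0 < o) (Hd : 0 < Ha) (s : ℤ) (hs : s * s = 1) (Hx : ℤ) :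
    Set.BijOn (ftheta c o Ha s) (kbox Hx c o Ha) Set.univ := by
  have ef : (c : ℤ) ≠ 0 := by positivity
  refine ⟨fun _ _ => Set.mem_univ _, ?_, ?_⟩
  · rintro ⟨d, pt, dn⟩ hp ⟨gs, pu, dp⟩ jv h
    simp only [kbox, coe_product, Set.mem_prod, mem_coe, mem_Ico] at hp jv
    rw [ftheta, ftheta, rn] at h
    simp only at h
    obtain ⟨Hi, Hj⟩ := h
    have hd : d = gs := by
      refine gf (m := c) (D := Hx) ?_ hp.1.1 hp.1.2 jv.1.1 jv.1.2
      have : (c : ℤ) ∣ (gs + s * (c * pu) - (d + s * (c * pt))) := (Dvd.intro _ (by push_cast; rfl)).trans Hi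
      have Hg : gs - d = (gs + s * (c * pu) - (d + s * (c * pt))) - c * (s * (pu - pt)) := by ring
      rw [Hg]
      exact dvd_sub this (Dvd.intro _ rfl)
    subst hd
    have key : ∀ (m : ℕ) (u Hf : ℤ), ((c * m : ℕ) : ℤ) ∣ d + s * (c * Hf) - (d + s * (c * u)) → (m : ℤ) ∣ Hf - u := by
      intro m u Hf h
      have Hg : d + s * (c * Hf) - (d + s * (c * u)) = c * (s * (Hf - u)) := by ring
      rw [Hg, Nat.cast_mul] at h
      have Hk := Int.dvd_of_mul_dvd_mul_left ef h
      have Hl : Hf - u = s * (s * (Hf - u)) := by rw [← mul_assoc, hs, one_mul]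
      rw [Hl]
      exact Hk.mul_left _
    have gt := gf (D := 0) (key _ _ _ Hi) hp.2.1.1 (by linarith [hp.2.1.2]) jv.2.1.1 (by linarith [jv.2.1.2])
    have pv := gf (D := 0) (key _ _ _ Hj) hp.2.2.1 (by linarith [hp.2.2.2]) jv.2.2.1 (by linarith [jv.2.2.2])
    rw [gt, pv]
  · rintro ⟨⟨Ht, Hy⟩, hw⟩ _
    obtain ⟨Ht, rfl⟩ := ZMod.intCast_surjective Ht
    obtain ⟨Hy, rfl⟩ := ZMod.intCast_surjective Hy
    have rp : (Ht : ZMod c) = Hy := by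
      change ZMod.castHom (Dvd.intro o rfl) (ZMod c) (Ht : ZMod (c * o)) = ZMod.castHom (Dvd.intro Ha rfl) (ZMod c) (Hy : ZMod (c * Ha)) at hw
      rwa [map_intCast, map_intCast] at hw
    have wd := (ZMod.intCast_eq_intCast_iff_dvd_sub _ _ _).mp rp
    obtain ⟨t, ht⟩ := wd
    set d := Hx + (Ht - Hx) % c with hd
    set q := (Ht - Hx) / c with hq
    have Hi : Ht = d + c * q := by have := Int.emod_add_mul_ediv (Ht - Hx) c; rw [hd, hq]; linarith
    have Hj : Hy = d + c * (q + t) := by linarith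
    refine ⟨(d, (s * q) % o, (s * (q + t)) % Ha), ?_, ?_⟩
    · simp only [kbox, coe_product, Set.mem_prod, mem_coe, mem_Ico]
      have hcp : (0 : ℤ) < c := by exact_mod_cast hc
      have rq : (0 : ℤ) < o := by exact_mod_cast Hc
      have rr : (0 : ℤ) < Ha := by exact_mod_cast Hd
      refine ⟨⟨?_, ?_⟩, ⟨Int.emod_nonneg _ rq.ne', Int.emod_lt_of_pos _ rq⟩, ⟨Int.emod_nonneg _ rr.ne', Int.emod_lt_of_pos _ rr⟩⟩
      · have := Int.emod_nonneg (Ht - Hx) ef; linarith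
      · have := Int.emod_lt_of_pos (Ht - Hx) hcp; linarith
    · change felt _ _ _ _ _ _ = felt c o Ha Ht Hy rp
      have key : ∀ (m : ℕ) (q : ℤ), ((c * m : ℕ) : ℤ) ∣ d + c * q - (d + s * (c * ((s * q) % m))) := by
        intro m q
        have Hg : d + c * q - (d + s * (c * ((s * q) % m))) = c * m * (s * ((s * q) / m)) := by
          have := Int.emod_add_mul_ediv (s * q) m
          have Hk : (s * q) % m = s * q - m * (s * q / m) := by linarith
          rw [Hk]
          linear_combination (- c * q) * hs
        rw [Hg]
        push_cast
        exact Dvd.intro _ rfl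
      apply rm
      · conv => rhs; rw [Hi]
        exact key _ _
      · conv => rhs; rw [Hj]
        exact key _ _
open Classical in
noncomputable def KK (c o Ha : ℕ) (f : ℤ) (Hx jd : ℤ) : ℂ :=
  ∑ p ∈ kbox Hx c o Ha, ∑ q ∈ kbox jd c o Ha,
    if ((c * o : ℕ) : ℤ) ∣ (p.1 + c * p.2.1) * (q.1 - c * q.2.1) - 1 ∧
       ((c * Ha : ℕ) : ℤ) ∣ (p.1 + c * p.2.2) * (q.1 - c * q.2.2) - 1 then
      cexp (2 * π * I * (f * ((p.1 + c * p.2.1) + (q.1 - c * q.2.1)) / (c * o) -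
        f * ((p.1 + c * p.2.2) + (q.1 - c * q.2.2)) / (c * Ha))) else 0
lemma pw (c o Ha : ℕ) (hc : 0 < c) (Hc : 0 < o) (Hd : 0 < Ha) [NeZero (c * o)] [NeZero (c * Ha)]
    [Fintype (FR c o Ha)ˣ] (f Hx jd : ℤ) :
    KK c o Ha f Hx jd = rkl (fPsi c o Ha f) := by
  classical
  let _ : Fintype (FR c o Ha) := Fintype.ofFinite _
  rw [← wc, KK]
  have conv : ∀ (s : ℤ) (hs : s * s = 1) (Hx : ℤ) (g : FR c o Ha → ℂ),
      ∑ w : FR c o Ha, g w = ∑ p ∈ kbox Hx c o Ha, g (ftheta c o Ha s p) := by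
    intro s hs Hx g
    have hb := ro c o Ha hc Hc Hd s hs Hx
    symm
    refine sum_bij (fun p _ => ftheta c o Ha s p) (fun _ _ => mem_univ _) ?_ ?_ (fun _ _ => rfl)
    · intro p hp q hq h; exact hb.injOn hp hq h
    · intro w _
      obtain ⟨p, hp, rfl⟩ := hb.surjOn (Set.mem_univ w)
      exact ⟨p, hp, rfl⟩
  rw [conv 1 (by norm_num) Hx]
  refine sum_congr rfl fun p _ => ?_
  rw [conv (-1) (by norm_num) jd]
  refine sum_congr rfl fun q _ => ?_
  have hmul : ftheta c o Ha 1 p * ftheta c o Ha (-1) q =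
      felt c o Ha ((p.1 + c * p.2.1) * (q.1 - c * q.2.1)) ((p.1 + c * p.2.2) * (q.1 - c * q.2.2)) (by simp) := by
    apply Subtype.ext
    simp [ftheta, felt, sub_eq_add_neg]
  have hadd : ftheta c o Ha 1 p + ftheta c o Ha (-1) q =
      felt c o Ha ((p.1 + c * p.2.1) + (q.1 - c * q.2.1)) ((p.1 + c * p.2.2) + (q.1 - c * q.2.2)) (by simp) := by
    apply Subtype.ext
    simp [ftheta, felt, sub_eq_add_neg]
  have hone : (1 : FR c o Ha) = felt c o Ha 1 1 rfl := by
    apply Subtype.ext; simp [felt]; rfl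
  rw [hmul, hadd, hone, rl]
  have hiff : felt c o Ha ((p.1 + c * p.2.1) * (q.1 - c * q.2.1)) ((p.1 + c * p.2.2) * (q.1 - c * q.2.2)) (by simp) =
      felt c o Ha 1 1 rfl ↔ (((c * o : ℕ) : ℤ) ∣ (p.1 + c * p.2.1) * (q.1 - c * q.2.1) - 1 ∧
       ((c * Ha : ℕ) : ℤ) ∣ (p.1 + c * p.2.2) * (q.1 - c * q.2.2) - 1) := by
    rw [eq_comm, rn]
  refine if_congr hiff.symm ?_ rfl
  push_cast
  rfl
lemma we (c o Ha : ℕ) (hc : 0 < c) (Hc : 0 < o) (Hd : 0 < Ha) [Fintype (FR c o Ha)] :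
    Fintype.card (FR c o Ha) = c * o * Ha := by
  classical
  have hb := ro c o Ha hc Hc Hd 1 (by norm_num) 0
  have := card_bij (s := kbox 0 c o Ha) (t := (univ : Finset (FR c o Ha)))
    (fun p _ => ftheta c o Ha 1 p) (fun _ _ => mem_univ _)
    (fun p hp q hq h => hb.injOn hp hq h) (fun w _ => by
      obtain ⟨p, hp, rfl⟩ := hb.surjOn (Set.mem_univ w)
      exact ⟨p, hp, rfl⟩)
  rw [← card_univ, ← this, kbox]
  simp [mul_assoc]
end eh
section wf
open Real Finset Complex
open Complex
lemma wg (c o Ha : ℕ) (hc : 0 < c) (Hc : 0 < o) (Hd : 0 < Ha) [NeZero (c * o)] [NeZero (c * Ha)] (f : ℤ) (p : ℕ)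
    (hp : p.Prime) (hpn : p ∣ c * o * Ha) (hne : ¬ (p : ℤ) ∣ f * (Ha - o)) :
    fPsi c o Ha f (((c * o * Ha / p : ℕ)) : FR c o Ha) ≠ 1 := by
  obtain ⟨t, ht⟩ := hpn
  have Hg : c * o * Ha / p = t := by rw [ht, Nat.mul_div_cancel_left _ hp.pos]
  rw [Hg]
  have Hk : ((t : ℕ) : FR c o Ha) = felt c o Ha t t rfl := by
    apply Subtype.ext; simp [felt]; rfl
  rw [Hk, rl, Ne, Complex.exp_eq_one_iff]
  rintro ⟨n, hn⟩
  apply hne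
  have ef : (c : ℂ) ≠ 0 := by exact_mod_cast hc.ne'
  have rs : (o : ℂ) ≠ 0 := by exact_mod_cast Hc.ne'
  have rt : (Ha : ℂ) ≠ 0 := by exact_mod_cast Hd.ne'
  have jv : (p : ℂ) ≠ 0 := by exact_mod_cast hp.ne_zero
  have px : (c : ℂ) * o * Ha = p * t := by exact_mod_cast ht
  have hpi : (2 * Real.pi * I : ℂ) ≠ 0 := Complex.two_pi_I_ne_zero
  rw [mul_comm (n : ℂ)] at hn
  have Hl := mul_left_cancel₀ hpi hn
  have Hq : (f : ℂ) * (Ha - o) = p * n := by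
    have ru : (t : ℂ) ≠ 0 := by
      intro Hm
      rw [Hm, mul_zero] at px
      exact (mul_ne_zero (mul_ne_zero ef rs) rt) px
    have e : (f : ℂ) * (t : ℤ) / (c * o) - f * (t : ℤ) / (c * Ha) = f * t * (Ha - o) / (c * o * Ha) := by
      push_cast
      field_simp
    rw [e, px] at Hl
    field_simp at Hl
    linear_combination Hl
  exact ⟨n, by exact_mod_cast Hq⟩
lemma rv (a b s : ℕ) (ha : 0 < a) (hb : 0 < b) (hs : 0 < s) :
    a.gcd s * b.gcd s ≤ a.gcd b * s.gcd (a * b) := by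
  rw [← Nat.gcd_mul_lcm (a.gcd s) (b.gcd s)]
  refine Nat.mul_le_mul (Nat.le_of_dvd (Nat.gcd_pos_of_pos_left _ ha) ?_) (Nat.le_of_dvd (Nat.gcd_pos_of_pos_left _ hs) ?_)
  · exact Nat.gcd_dvd_gcd_of_dvd_left _ (Nat.gcd_dvd_left _ _) |>.trans (Nat.gcd_dvd_gcd_of_dvd_right _ (Nat.gcd_dvd_left _ _))
  · refine Nat.dvd_gcd (Nat.lcm_dvd (Nat.gcd_dvd_right _ _) (Nat.gcd_dvd_right _ _)) (Nat.lcm_dvd ?_ ?_)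
    · exact (Nat.gcd_dvd_left _ _).trans (Dvd.intro _ rfl)
    · exact (Nat.gcd_dvd_left _ _).trans (Dvd.intro_left _ rfl)
lemma rx (m s j f t : ℕ) (hm : 0 < m) :
    m.gcd (s * j * f * t) ≤ m.gcd s * m.gcd j * m.gcd f * m.gcd t := by
  refine Nat.le_of_dvd ?_ ?_
  · have := fun x => Nat.gcd_pos_of_pos_left x hm
    exact Nat.mul_pos (Nat.mul_pos (Nat.mul_pos (this _) (this _)) (this _)) (this _)
  · refine (Nat.gcd_mul_right_dvd_mul_gcd _ _ _).trans (Nat.mul_dvd_mul_right ?_ _)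
    refine (Nat.gcd_mul_right_dvd_mul_gcd _ _ _).trans (Nat.mul_dvd_mul_right ?_ _)
    exact Nat.gcd_mul_right_dvd_mul_gcd _ _ _
lemma wh (D g r s j t G τ : ℝ) (hr : 0 < r) (hrs : r * r = s) :
    τ * (r * j * D * (j * g * t * G)) = τ * D * (g / r) * t * G * (s * j ^ 2) := by
  rw [← hrs]; field_simp
lemma wi (s j o Ha : ℕ) (hs : Squarefree s) (hj : 0 < j) (Hc : Squarefree o) (Hd : Squarefree Ha)
    (hm : o ≠ Ha) (f : ℤ) (hf : f ≠ 0) (Hx jd : ℤ) :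
    ‖KK (s * j ^ 2) o Ha f Hx jd‖ / ((s * j ^ 2 : ℕ) : ℝ) ≤
      (s * j ^ 2 * o * Ha).divisors.card * √(o * Ha) *
        ((s.gcd (j * (o * Ha) * (f * (Ha - o)).natAbs) : ℝ) / √s) * √(j.gcd (o * Ha)) *
        ((o.gcd Ha : ℝ) ^ 2 * √(o.gcd f.natAbs * Ha.gcd f.natAbs)) := by
  have jm : 0 < s := Nat.pos_of_ne_zero hs.ne_zero
  have ex : 0 < o := Nat.pos_of_ne_zero Hc.ne_zero
  have je : 0 < Ha := Nat.pos_of_ne_zero Hd.ne_zero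
  have cz : 0 < f.natAbs := Int.natAbs_pos.mpr hf
  set H : ℕ := (f * (Ha - o)).natAbs with hH
  have cm : 0 < H := by
    rw [hH, Int.natAbs_pos]
    refine mul_ne_zero hf (sub_ne_zero.mpr ?_)
    exact_mod_cast hm.symm
  set c := s * j ^ 2 with hc
  have eu : 0 < c := by positivity
  have : NeZero (c * o) := ⟨by positivity⟩
  have : NeZero (c * Ha) := ⟨by positivity⟩
  let _ : Fintype (FR c o Ha) := Fintype.ofFinite _
  let _ : Fintype (FR c o Ha)ˣ := Fintype.ofFinite _
  rw [pw c o Ha eu ex je]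
  set ei := s.gcd (j * (o * Ha) * H) with ri
  set Hr := o.gcd (s * j * f.natAbs * Ha) with ry
  set Hs := Ha.gcd (s * j * f.natAbs * o) with rz
  have ed : (s / ei).Coprime (j * (o * Ha) * H) := Nat.coprime_div_gcd_of_squarefree hs (by positivity)
  have ey : (o / Hr).Coprime (s * j * f.natAbs * Ha) := Nat.coprime_div_gcd_of_squarefree Hc (by positivity)
  have jn : (Ha / Hs).Coprime (s * j * f.natAbs * o) := Nat.coprime_div_gcd_of_squarefree Hd (by positivity)
  have gu : ei ∣ s := Nat.gcd_dvd_left _ _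
  have cf : Hr ∣ o := Nat.gcd_dvd_left _ _
  have cg : Hs ∣ Ha := Nat.gcd_dvd_left _ _
  have ch : ei ∣ _ := Nat.gcd_dvd_right s (j * (o * Ha) * H)
  have Hi : Hr ∣ _ := Nat.gcd_dvd_right o (s * j * f.natAbs * Ha)
  have Hj : Hs ∣ _ := Nat.gcd_dvd_right Ha (s * j * f.natAbs * o)
  obtain ⟨jw, jg⟩ := gu
  obtain ⟨a, ha⟩ := cf
  obtain ⟨b, hb⟩ := cg
  have sa : 0 < ei := Nat.gcd_pos_of_pos_left _ jm
  have wj : 0 < Hr := Nat.gcd_pos_of_pos_left _ ex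
  have wk : 0 < Hs := Nat.gcd_pos_of_pos_left _ je
  have wl : s / ei = jw := by nth_rw 1 [jg]; exact Nat.mul_div_cancel_left _ sa
  have wm : o / Hr = a := by nth_rw 1 [ha]; exact Nat.mul_div_cancel_left _ wj
  have jt : Ha / Hs = b := by nth_rw 1 [hb]; exact Nat.mul_div_cancel_left _ wk
  rw [wl] at ed
  rw [wm] at ey
  rw [jt] at jn
  have wn : jw ∣ s := Dvd.intro_left _ jg.symm
  have am : a ∣ o := Dvd.intro_left _ ha.symm
  have bm : b ∣ Ha := Dvd.intro_left _ hb.symm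
  have gu : ei ∣ s := Nat.gcd_dvd_left _ _
  have cf : Hr ∣ o := Nat.gcd_dvd_left _ _
  have cg : Hs ∣ Ha := Nat.gcd_dvd_left _ _
  have wo : jw.Coprime j := ed.coprime_dvd_right ⟨o * Ha * H, by ring⟩
  have sb : jw.Coprime o := ed.coprime_dvd_right ⟨j * Ha * H, by ring⟩
  have sc : jw.Coprime Ha := ed.coprime_dvd_right ⟨j * o * H, by ring⟩
  have wp : jw.Coprime H := ed.coprime_dvd_right ⟨j * (o * Ha), by ring⟩
  have as : a.Coprime s := ey.coprime_dvd_right ⟨j * f.natAbs * Ha, by ring⟩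
  have aj : a.Coprime j := ey.coprime_dvd_right ⟨s * f.natAbs * Ha, by ring⟩
  have af : a.Coprime f.natAbs := ey.coprime_dvd_right ⟨s * j * Ha, by ring⟩
  have cr : a.Coprime Ha := ey.coprime_dvd_right ⟨s * j * f.natAbs, by ring⟩
  have bs : b.Coprime s := jn.coprime_dvd_right ⟨j * f.natAbs * o, by ring⟩
  have bj : b.Coprime j := jn.coprime_dvd_right ⟨s * f.natAbs * o, by ring⟩
  have bf : b.Coprime f.natAbs := jn.coprime_dvd_right ⟨s * j * o, by ring⟩
  have ez : b.Coprime o := jn.coprime_dvd_right ⟨s * j * f.natAbs, by ring⟩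
  set Hv := jw * a * b with jo
  set Hn := j ^ 2 * ei * Hr * Hs with py
  have hn : c * o * Ha = Hv * Hn := by
    have : c * o * Ha = (ei * jw) * j ^ 2 * (Hr * a) * (Hs * b) := by rw [← jg, ← ha, ← hb]
    rw [this, jo, py]; ring
  have hsq : Squarefree Hv := by
    rw [jo, Nat.squarefree_mul_iff, Nat.squarefree_mul_iff]
    refine ⟨Nat.Coprime.mul_left ?_ ?_, ⟨?_, hs.squarefree_of_dvd wn, Hc.squarefree_of_dvd am⟩, Hd.squarefree_of_dvd bm⟩
    · exact sc.coprime_dvd_right bm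
    · exact cr.coprime_dvd_right bm
    · exact sb.coprime_dvd_right am
  have hcop : Hv.Coprime Hn := by
    rw [jo, py]
    refine Nat.Coprime.mul_left (Nat.Coprime.mul_left ?_ ?_) ?_
    · exact (((wo.pow_right 2).mul_right (ed.coprime_dvd_right ch)).mul_right (sb.coprime_dvd_right cf)).mul_right (sc.coprime_dvd_right cg)
    · exact (((aj.pow_right 2).mul_right (as.coprime_dvd_right gu)).mul_right (ey.coprime_dvd_right Hi)).mul_right (cr.coprime_dvd_right cg)
    · exact (((bj.pow_right 2).mul_right (bs.coprime_dvd_right gu)).mul_right (ez.coprime_dvd_right cf)).mul_right (jn.coprime_dvd_right Hj)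
  have hpr : ∀ p : ℕ, p.Prime → p ∣ Hv → ¬ (p : ℤ) ∣ f * (Ha - o) := by
    intro p hp hpn hd
    have nd : ∀ {x y : ℕ}, x.Coprime y → p ∣ x → p ∣ y → False := fun h Hc Hd =>
      Nat.Prime.not_coprime_iff_dvd.mpr ⟨p, hp, Hc, Hd⟩ h
    rw [jo, hp.dvd_mul, hp.dvd_mul] at hpn
    rcases hpn with (h | h) | h
    · exact nd wp h (Int.natCast_dvd.mp hd)
    · rcases (Nat.prime_iff_prime_int.mp hp).dvd_or_dvd hd with er | er
      · exact nd af h (Int.natCast_dvd.mp er)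
      · have : (p : ℤ) ∣ o := Int.natCast_dvd_natCast.mpr (h.trans am)
        have Hg := dvd_add er this
        rw [sub_add_cancel] at Hg
        exact nd cr h (Int.natCast_dvd_natCast.mp Hg)
    · rcases (Nat.prime_iff_prime_int.mp hp).dvd_or_dvd hd with er | er
      · exact nd bf h (Int.natCast_dvd.mp er)
      · have : (p : ℤ) ∣ Ha := Int.natCast_dvd_natCast.mpr (h.trans bm)
        have Hg := dvd_sub this er
        rw [sub_sub_cancel] at Hg
        exact nd ez h (Int.natCast_dvd_natCast.mp Hg)
  have dq : 0 < Hv := Nat.pos_of_ne_zero hsq.ne_zero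
  have dr : 0 < Hn := by positivity
  have key := wb Hv hsq Hn hcop (FR c o Ha) (fPsi c o Ha f) ((we c o Ha eu ex je).trans hn)
    (fun p hp hpn => by
      rw [← hn]
      exact wg c o Ha eu ex je f p hp (hn ▸ hpn.mul_right Hn) (hpr p hp hpn))
  have hdiv : (Hv.divisors.card : ℝ) ≤ (c * o * Ha).divisors.card := by
    have hd : Hv ∣ c * o * Ha := ⟨Hn, hn⟩
    have Hm : c * o * Ha ≠ 0 := by positivity
    exact_mod_cast card_le_card (Nat.divisors_subset_of_dvd Hm hd)
  have wq : Hn ≤ j ^ 2 * ei ^ 2 * (j.gcd (o * Ha)) * ((o.gcd Ha) ^ 4 * (o.gcd f.natAbs * Ha.gcd f.natAbs)) := by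
    have ds := rx o s j f.natAbs Ha ex
    have dt := rx Ha s j f.natAbs o je
    have wr := rv o Ha s ex je jm
    have ws := rv o Ha j ex je hj
    have wu : s.gcd (o * Ha) ≤ ei := Nat.le_of_dvd sa (Nat.gcd_dvd_gcd_of_dvd_right _ ⟨j * H, by ring⟩)
    have wv : Ha.gcd o = o.gcd Ha := Nat.gcd_comm _ _
    calc Hn ≤ j ^ 2 * ei * (o.gcd s * o.gcd j * o.gcd f.natAbs * o.gcd Ha) * (Ha.gcd s * Ha.gcd j * Ha.gcd f.natAbs * Ha.gcd o) := by
          rw [py]; gcongr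
      _ = j ^ 2 * ei * (o.gcd s * Ha.gcd s) * (o.gcd j * Ha.gcd j) * (o.gcd Ha) ^ 2 * (o.gcd f.natAbs * Ha.gcd f.natAbs) := by
          rw [wv]; ring
      _ ≤ j ^ 2 * ei * (o.gcd Ha * ei) * (o.gcd Ha * j.gcd (o * Ha)) * (o.gcd Ha) ^ 2 * (o.gcd f.natAbs * Ha.gcd f.natAbs) := by
          have ww := wr.trans (Nat.mul_le_mul_left _ wu)
          exact Nat.mul_le_mul_right _ (Nat.mul_le_mul_right _ (Nat.mul_le_mul (Nat.mul_le_mul_left _ ww) ws))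
      _ = _ := by ring
  have hsqrt : √(Hn : ℝ) ≤ j * ei * √(j.gcd (o * Ha)) * ((o.gcd Ha : ℝ) ^ 2 * √(o.gcd f.natAbs * Ha.gcd f.natAbs)) := by
    apply sqrt_le_iff.mpr
    refine ⟨by positivity, ?_⟩
    have : (Hn : ℝ) ≤ (j ^ 2 * ei ^ 2 * (j.gcd (o * Ha)) * ((o.gcd Ha) ^ 4 * (o.gcd f.natAbs * Ha.gcd f.natAbs)) : ℕ) := by exact_mod_cast wq
    refine this.trans (le_of_eq ?_)
    push_cast
    rw [mul_pow, mul_pow, mul_pow, mul_pow, sq_sqrt (by positivity), sq_sqrt (by positivity)]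
    ring
  have hprod : √(Hv : ℝ) * Hn = √s * j * √(o * Ha) * √Hn := by
    have eb : (Hv : ℝ) * Hn = s * j ^ 2 * (o * Ha) := by
      have : ((c * o * Ha : ℕ) : ℝ) = ((Hv * Hn : ℕ) : ℝ) := by rw [hn]
      rw [hc] at this; push_cast at this; linarith
    have jl : √(Hv : ℝ) * √Hn = √s * j * √(o * Ha) := by
      rw [← sqrt_mul (by positivity), eb, sqrt_mul (by positivity), sqrt_mul (by positivity), sqrt_sq (by positivity)]
    rw [← jl, mul_assoc, mul_self_sqrt (by positivity)]
  have hss : √(s : ℝ) * √s = s := mul_self_sqrt (by positivity)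
  have hspos : 0 < √(s : ℝ) := sqrt_pos.mpr (by exact_mod_cast jm)
  have hcpos : (0 : ℝ) < ((c : ℕ) : ℝ) := Nat.cast_pos.mpr eu
  rw [div_le_iff₀ hcpos]
  have hcc : ((c : ℕ) : ℝ) = s * (j : ℝ) ^ 2 := by rw [hc]; push_cast; ring
  rw [hcc]
  have fin := wh (√(o * Ha)) (ei : ℝ) (√s) s j (√(j.gcd (o * Ha)))
    ((o.gcd Ha : ℝ) ^ 2 * √(o.gcd f.natAbs * Ha.gcd f.natAbs)) ((c * o * Ha).divisors.card) hspos hss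
  rw [← fin]
  calc ‖rkl (fPsi c o Ha f)‖ ≤ Hv.divisors.card * (√Hv * Hn) := by rw [← mul_assoc]; exact key
    _ ≤ _ := by
        rw [hprod]
        exact mul_le_mul hdiv (mul_le_mul_of_nonneg_left hsqrt
          (mul_nonneg (mul_nonneg (sqrt_nonneg _) (Nat.cast_nonneg _)) (sqrt_nonneg _)))
          (mul_nonneg (mul_nonneg (mul_nonneg (sqrt_nonneg _) (Nat.cast_nonneg _)) (sqrt_nonneg _)) (sqrt_nonneg _))
          (Nat.cast_nonneg _)
end wf
section wx
open Real Finset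
open Complex
lemma pz (ε : ℝ) (hε : 0 < ε) : ∃ K : ℝ, 1 ≤ K ∧ ∀ n : ℕ, 0 < n → (n.divisors.card : ℝ) ≤ K * (n : ℝ) ^ ε := by
  set gg : ℝ := 2 ^ (1 / ε) with wy
  set C : ℝ := 1 + 1 / (ε * Real.log 2) with hC
  have du : 0 < Real.log 2 := log_pos (by norm_num)
  have ct : 1 ≤ C := by
    rw [hC]
    have : 0 < 1 / (ε * Real.log 2) := by positivity
    linarith
  refine ⟨C ^ (⌈gg⌉₊), one_le_pow₀ ct, fun n hn => ?_⟩
  rw [Nat.card_divisors hn.ne']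
  push_cast
  have step : ∀ p ∈ n.primeFactors, ((n.factorization p : ℝ) + 1) ≤
      (if p < ⌈gg⌉₊ then C else 1) * ((p : ℝ) ^ (n.factorization p)) ^ ε := by
    intro p hp
    have hpp := Nat.prime_of_mem_primeFactors hp
    have Hz : (2 : ℝ) ≤ p := by exact_mod_cast hpp.two_le
    set a := n.factorization p
    have Hi : ((p : ℝ) ^ a) ^ ε = ((p : ℝ) ^ ε) ^ a := by
      rw [← rpow_natCast, ← rpow_natCast, ← rpow_mul (by positivity), ← rpow_mul (by positivity), mul_comm]
    rw [Hi]
    split_ifs with h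
    · have Hc : (1 : ℝ) + ε * Real.log 2 ≤ (p : ℝ) ^ ε := by
        calc (1 : ℝ) + ε * Real.log 2 ≤ Real.exp (ε * Real.log 2) := by linarith [add_one_le_exp (ε * Real.log 2)]
          _ = 2 ^ ε := by rw [rpow_def_of_pos (by norm_num), mul_comm]
          _ ≤ _ := by gcongr
      have Hd := one_add_mul_le_pow (a := ε * Real.log 2) (by
        have : 0 < ε * Real.log 2 := by positivity
        linarith) a
      have Hg : (1 + ε * Real.log 2) ^ a ≤ ((p : ℝ) ^ ε) ^ a := by gcongr
      have Hk : (a : ℝ) + 1 ≤ C * (1 + a * (ε * Real.log 2)) := by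
        have : C * (1 + a * (ε * Real.log 2)) = 1 + a + a * (ε * Real.log 2) + 1 / (ε * Real.log 2) := by
          rw [hC]; field_simp; ring
        rw [this]
        have : 0 ≤ a * (ε * Real.log 2) + 1 / (ε * Real.log 2) := by positivity
        linarith
      exact Hk.trans (mul_le_mul_of_nonneg_left (Hd.trans Hg) (by linarith))
    · have Hc : (2 : ℝ) ≤ (p : ℝ) ^ ε := by
        have Hl : gg ≤ p := (Nat.le_ceil _).trans (by exact_mod_cast not_lt.mp h)
        calc (2 : ℝ) = gg ^ ε := by rw [wy, ← rpow_mul (by norm_num), one_div_mul_cancel hε.ne', rpow_one]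
          _ ≤ _ := by gcongr
      have Hd : ((a : ℝ) + 1) ≤ 2 ^ a := by
        have := Nat.lt_two_pow_self (n := a)
        exact_mod_cast this
      rw [one_mul]
      exact Hd.trans (by gcongr)
  refine (prod_le_prod (fun p _ => by positivity) step).trans ?_
  rw [prod_mul_distrib, finsetProd_rpow _ _ (fun p _ => by positivity)]
  have Hj : ∏ p ∈ n.primeFactors, (p : ℝ) ^ n.factorization p = n := by
    have := Nat.prod_factorization_pow_eq_self hn.ne'
    rw [Finsupp.prod, Nat.support_factorization] at this
    exact_mod_cast this
  rw [Hj]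
  gcongr
  rw [prod_ite, prod_const, prod_const_one, mul_one]
  refine pow_le_pow_right₀ ct ?_
  calc _ ≤ (range ⌈gg⌉₊).card := card_le_card (fun p hp => by simpa using (mem_filter.mp hp).2)
    _ = _ := by simp
lemma qa (S H : ℕ) (hH : 0 < H) (φ : ℕ → ℝ) (hφ : ∀ n, 0 ≤ φ n) :
    ∑ s ∈ Icc 1 S, (s.gcd H : ℝ) * φ s ≤ ∑ d ∈ H.divisors, (d : ℝ) * ∑ t ∈ Icc 1 (S / d), φ (d * t) := by
  have Hc : ∀ d ∈ H.divisors, ∑ t ∈ Icc 1 (S / d), φ (d * t) = ∑ s ∈ Icc 1 S, if d ∣ s then φ s else 0 := by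
    intro d hd
    have ep : 0 < d := Nat.pos_of_mem_divisors hd
    rw [← sum_filter]
    refine sum_bij (fun t _ => d * t) ?_ ?_ ?_ (fun _ _ => rfl)
    · intro t ht
      simp only [mem_Icc, mem_filter] at ht ⊢
      refine ⟨⟨Nat.mul_pos ep ht.1, ?_⟩, Dvd.intro _ rfl⟩
      rw [mul_comm]
      exact (Nat.le_div_iff_mul_le ep).mp ht.2
    · intro t _ dv _ h; exact Nat.eq_of_mul_eq_mul_left ep h
    · intro s hs
      simp only [mem_Icc, mem_filter] at hs
      obtain ⟨t, rfl⟩ := hs.2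
      refine ⟨t, ?_, rfl⟩
      simp only [mem_Icc]
      refine ⟨Nat.pos_of_mul_pos_left hs.1.1, (Nat.le_div_iff_mul_le ep).mpr (by rw [mul_comm]; exact hs.1.2)⟩
  have Hd : ∑ d ∈ H.divisors, (d : ℝ) * ∑ t ∈ Icc 1 (S / d), φ (d * t) =
      ∑ d ∈ H.divisors, (d : ℝ) * ∑ s ∈ Icc 1 S, (if d ∣ s then φ s else 0) :=
    sum_congr rfl fun d hd => by rw [Hc d hd]
  rw [Hd]
  simp_rw [mul_sum]
  rw [sum_comm]
  refine sum_le_sum fun s hs => ?_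
  have hmem : s.gcd H ∈ H.divisors := Nat.mem_divisors.mpr ⟨Nat.gcd_dvd_right _ _, hH.ne'⟩
  calc (s.gcd H : ℝ) * φ s = (s.gcd H : ℝ) * (if s.gcd H ∣ s then φ s else 0) := by rw [if_pos (Nat.gcd_dvd_left _ _)]
    _ ≤ _ := single_le_sum (f := fun d : ℕ => (d : ℝ) * (if d ∣ s then φ s else 0))
        (fun d _ => by split_ifs <;> first | (exact mul_nonneg (Nat.cast_nonneg _) (hφ _)) | simp) hmem
lemma wz (S : ℕ) : ∑ t ∈ Icc 1 S, 1 / √(t : ℝ) ≤ 2 * √S := by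
  induction S with
  | zero => simp
  | succ n ih =>
    rw [sum_Icc_succ_top (by omega)]
    have Hc : 1 / √((n + 1 : ℕ) : ℝ) ≤ 2 * √((n + 1 : ℕ) : ℝ) - 2 * √n := by
      have hp : 0 < √((n + 1 : ℕ) : ℝ) := sqrt_pos.mpr (by positivity)
      rw [div_le_iff₀ hp]
      have Hi : √((n + 1 : ℕ) : ℝ) * √((n + 1 : ℕ) : ℝ) = n + 1 := by rw [mul_self_sqrt (by positivity)]; push_cast; ring
      have Hj : √(n : ℝ) * √(n : ℝ) = n := mul_self_sqrt (by positivity)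
      nlinarith [sq_nonneg (√((n + 1 : ℕ) : ℝ) - √n)]
    linarith
lemma xa (S H : ℕ) (hH : 0 < H) :
    ∑ s ∈ Icc 1 S, (s.gcd H : ℝ) / √s ≤ 2 * H.divisors.card * √S := by
  have h := qa S H hH (fun s => 1 / √(s : ℝ)) (fun _ => by positivity)
  simp only [mul_one_div] at h
  refine h.trans ?_
  have : ∀ d ∈ H.divisors, (d : ℝ) * ∑ t ∈ Icc 1 (S / d), 1 / √((d * t : ℕ) : ℝ) ≤ 2 * √S := by
    intro d hd
    have ep : (0 : ℝ) < d := by exact_mod_cast Nat.pos_of_mem_divisors hd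
    have e : ∀ t : ℕ, 1 / √((d * t : ℕ) : ℝ) = (1 / √d) * (1 / √(t : ℝ)) := by
      intro t; push_cast; rw [sqrt_mul ep.le]; field_simp
    simp_rw [e, ← mul_sum]
    have Hd := wz (S / d)
    have Hg : √((S / d : ℕ) : ℝ) ≤ √S / √d := by
      rw [← sqrt_div (by positivity)]
      exact sqrt_le_sqrt Nat.cast_div_le
    have hsd : 0 < √(d : ℝ) := sqrt_pos.mpr ep
    calc (d : ℝ) * (1 / √d * ∑ t ∈ Icc 1 (S / d), 1 / √(t : ℝ)) ≤ d * (1 / √d * (2 * (√S / √d))) := by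
          gcongr; exact Hd.trans (by linarith)
      _ = 2 * √S * (d / (√d * √d)) := by field_simp
      _ = 2 * √S := by rw [mul_self_sqrt ep.le, div_self ep.ne', mul_one]
  refine (sum_le_sum this).trans ?_
  rw [sum_const, nsmul_eq_mul]
  linarith
lemma xb (S H : ℕ) (hH : 0 < H) :
    ∑ s ∈ Icc 1 S, (s.gcd H : ℝ) / s ≤ H.divisors.card * (1 + Real.log S) := by
  have h := qa S H hH (fun s => 1 / (s : ℝ)) (fun _ => by positivity)
  simp only [mul_one_div] at h
  refine h.trans ?_
  have : ∀ d ∈ H.divisors, (d : ℝ) * ∑ t ∈ Icc 1 (S / d), 1 / ((d * t : ℕ) : ℝ) ≤ 1 + Real.log S := by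
    intro d hd
    have ep : (0 : ℝ) < d := by exact_mod_cast Nat.pos_of_mem_divisors hd
    have e : ∀ t : ℕ, 1 / ((d * t : ℕ) : ℝ) = (1 / d) * (t : ℝ)⁻¹ := by
      intro t; push_cast; field_simp
    simp_rw [e, ← mul_sum]
    rw [← mul_assoc, mul_one_div_cancel ep.ne', one_mul]
    calc ∑ t ∈ Icc 1 (S / d), (t : ℝ)⁻¹ ≤ ∑ t ∈ Icc 1 S, (t : ℝ)⁻¹ := by
          refine sum_le_sum_of_subset_of_nonneg (Icc_subset_Icc_right (Nat.div_le_self _ _)) fun _ _ _ => by positivity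
      _ ≤ 1 + Real.log S := by
          have := harmonic_le_one_add_log S
          rw [harmonic_eq_sum_Icc] at this
          push_cast at this
          exact this
  refine (sum_le_sum this).trans ?_
  rw [sum_const, nsmul_eq_mul]
lemma xc (c o Ha : ℕ) (hc : 0 < c) (Hc : 0 < o) (Hd : 0 < Ha) (f Hx jd : ℤ) :
    KK c o Ha f Hx jd = KK c o Ha f 0 0 := by
  have : NeZero (c * o) := ⟨by positivity⟩
  have : NeZero (c * Ha) := ⟨by positivity⟩
  let _ : Fintype (FR c o Ha)ˣ := Fintype.ofFinite _
  rw [pw c o Ha hc Hc Hd, pw c o Ha hc Hc Hd]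
lemma xd (C : ℕ) (φ : ℕ → ℝ) (hφ : ∀ n, 0 ≤ φ n) :
    ∑ c ∈ Icc 1 C, φ c ≤
      ∑ j ∈ Icc 1 C, ∑ s ∈ Icc 1 (C / j ^ 2), if Squarefree s then φ (s * j ^ 2) else 0 := by
  classical
  have h := fun c : ℕ => Nat.sq_mul_squarefree c
  choose a b hab hsq using h
  have key : ∀ c ∈ Icc 1 C, φ c ≤ ∑ j ∈ Icc 1 C, ∑ s ∈ Icc 1 (C / j ^ 2),
      if (j, s) = (b c, a c) then φ c else 0 := by
    intro c hc
    simp only [mem_Icc] at hc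
    have gh : 0 < b c := Nat.pos_of_ne_zero fun Hm => by have := hab c; simp [Hm] at this; omega
    have qb : 0 < a c := Nat.pos_of_ne_zero fun Hm => by have := hab c; simp [Hm] at this; omega
    have hbC : b c ≤ C := by
      have := hab c
      nlinarith [Nat.mul_le_mul gh qb, Nat.mul_le_mul_left (b c * b c) qb]
    have xe : b c ∈ Icc 1 C := mem_Icc.mpr ⟨gh, hbC⟩
    have xf : a c ∈ Icc 1 (C / (b c) ^ 2) := by
      refine mem_Icc.mpr ⟨qb, (Nat.le_div_iff_mul_le (by positivity)).mpr ?_⟩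
      rw [mul_comm, hab c]; exact hc.2
    refine le_trans ?_ (single_le_sum (f := fun j => ∑ s ∈ Icc 1 (C / j ^ 2),
      if (j, s) = (b c, a c) then φ c else 0) (fun j _ => sum_nonneg fun s _ => by split_ifs; exacts [hφ _, le_rfl]) xe)
    refine le_trans ?_ (single_le_sum (f := fun s => if (b c, s) = (b c, a c) then φ c else 0)
      (fun s _ => by split_ifs; exacts [hφ _, le_rfl]) xf)
    simp
  refine (sum_le_sum key).trans ?_
  rw [sum_comm]
  refine sum_le_sum fun j _ => ?_
  rw [sum_comm]
  refine sum_le_sum fun s _ => ?_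
  by_cases hex : ∃ c ∈ Icc 1 C, (j, s) = (b c, a c)
  · obtain ⟨c, hc, he⟩ := hex
    have hj : j = b c := (Prod.mk.inj he).1
    have hs : s = a c := (Prod.mk.inj he).2
    rw [if_pos (hs ▸ hsq c)]
    have hcc : s * j ^ 2 = c := by rw [hs, hj, mul_comm]; exact hab c
    rw [hcc, sum_eq_single c]
    · split_ifs; exact le_rfl
    · intro xg _ hne
      rw [if_neg]
      intro sd
      apply hne
      rw [← hab xg, ← (Prod.mk.inj sd).1, ← (Prod.mk.inj sd).2, mul_comm, hcc]
    · intro h; exact absurd hc h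
  · have : ∑ c ∈ Icc 1 C, (if (j, s) = (b c, a c) then φ c else 0) = 0 :=
      sum_eq_zero fun c hc => if_neg fun h => hex ⟨c, hc, h⟩
    rw [this]
    split_ifs; exacts [hφ _, le_rfl]
theorem xh (ε : ℝ) (hε : 0 < ε) : ∃ K : ℝ, 1 ≤ K ∧ ∀ (o Ha C : ℕ) (f : ℤ), Squarefree o → Squarefree Ha →
    o ≠ Ha → f ≠ 0 → 1 ≤ C →
    ∑ c ∈ Icc 1 C, ‖KK c o Ha f 0 0‖ / (c : ℝ) ≤
      K * ((C : ℝ) * o * Ha * |(f : ℝ)|) ^ ε * √(o * Ha) * √C *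
        ((o.gcd Ha : ℝ) ^ 2 * √(o.gcd f.natAbs * Ha.gcd f.natAbs)) := by
  set δ := ε / 5 with hδ
  have gi : 0 < δ := by positivity
  obtain ⟨K, cu, hK⟩ := pz δ gi
  have hKc : 1 ≤ K * (2 * K) * (K * (1 + 1 / δ)) := by
    have Hc : 0 < 1 / δ := by positivity
    have Hd : 1 ≤ K * (2 * K) := by nlinarith
    have Hg : 1 ≤ K * (1 + 1 / δ) := by nlinarith
    nlinarith
  refine ⟨K * (2 * K) * (K * (1 + 1 / δ)), hKc, fun o Ha C f Hc Hd hm hf hC => ?_⟩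
  have ex : 0 < o := Nat.pos_of_ne_zero Hc.ne_zero
  have je : 0 < Ha := Nat.pos_of_ne_zero Hd.ne_zero
  have hfa : 0 < f.natAbs := Int.natAbs_pos.mpr hf
  set Qn : ℕ := C * o * Ha * f.natAbs with hQn
  have xi : 0 < Qn := by positivity
  have hQe : (C : ℝ) * o * Ha * |(f : ℝ)| = Qn := by
    rw [hQn]; push_cast; rw [Nat.cast_natAbs]; push_cast; ring
  rw [hQe]
  set q : ℝ := (Qn : ℝ) ^ δ with hq
  have gv : 0 < q := by positivity
  have xj : (Qn : ℝ) ^ ε = q ^ 5 := by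
    rw [hq, ← rpow_natCast, ← rpow_mul (by positivity), hδ]; norm_num
  rw [xj]
  set H : ℕ := (f * (Ha - o)).natAbs with hH
  have cm : 0 < H := by
    rw [hH, Int.natAbs_pos]
    refine mul_ne_zero hf (sub_ne_zero.mpr ?_)
    exact_mod_cast hm.symm
  have hHle : H ≤ f.natAbs * (o * Ha) := by
    rw [hH, Int.natAbs_mul]
    refine Nat.mul_le_mul_left _ ?_
    have : ((Ha : ℤ) - o).natAbs ≤ max o Ha := by omega
    refine this.trans (max_le ?_ ?_)
    · exact Nat.le_mul_of_pos_right _ je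
    · exact Nat.le_mul_of_pos_left _ ex
  set G : ℝ := ((o.gcd Ha : ℝ) ^ 2 * √(o.gcd f.natAbs * Ha.gcd f.natAbs)) with hG
  have jf : 0 ≤ G := by positivity
  have tle : ∀ n : ℕ, 0 < n → n ≤ Qn → (n.divisors.card : ℝ) ≤ K * q := by
    intro n hn hle
    refine (hK n hn).trans ?_
    rw [hq]; gcongr
  have xk : ∀ n : ℕ, 0 < n → n ≤ Qn ^ 2 → (n.divisors.card : ℝ) ≤ K * q ^ 2 := by
    intro n hn hle
    refine (hK n hn).trans ?_
    have : (n : ℝ) ≤ (Qn : ℝ) ^ 2 := by exact_mod_cast hle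
    have e : q ^ 2 = ((Qn : ℝ) ^ 2) ^ δ := by
      rw [hq, ← rpow_natCast, ← rpow_natCast, ← rpow_mul (by positivity), ← rpow_mul (by positivity), mul_comm]
    rw [e]; gcongr
  refine (xd C (fun c => ‖KK c o Ha f 0 0‖ / (c : ℝ)) (fun _ => by positivity)).trans ?_
  have dw : 1 ≤ f.natAbs := hfa
  have se : 1 ≤ o * Ha := Nat.mul_pos ex je
  have term : ∀ j ∈ Icc 1 C, (∑ s ∈ Icc 1 (C / j ^ 2), if Squarefree s then
      ‖KK (s * j ^ 2) o Ha f 0 0‖ / ((s * j ^ 2 : ℕ) : ℝ) else 0) ≤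
      (K * q * √(o * Ha) * G * (2 * (K * q ^ 2)) * √C) * ((j.gcd (o * Ha) : ℝ) / j) := by
    intro j hj
    simp only [mem_Icc] at hj
    have ca : 0 < j := hj.1
    have hjr : (0 : ℝ) < j := by exact_mod_cast ca
    have inner : ∀ s ∈ Icc 1 (C / j ^ 2), (if Squarefree s then
      ‖KK (s * j ^ 2) o Ha f 0 0‖ / ((s * j ^ 2 : ℕ) : ℝ) else 0) ≤
        (K * q * √(o * Ha) * G * √(j.gcd (o * Ha))) * ((s.gcd (j * (o * Ha) * H) : ℝ) / √s) := by
      intro s hs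
      simp only [mem_Icc] at hs
      split_ifs with hsq
      · refine (wi s j o Ha hsq ca Hc Hd hm f hf 0 0).trans ?_
        have ht : ((s * j ^ 2 * o * Ha).divisors.card : ℝ) ≤ K * q := by
          have gr : 0 < s := hs.1
          refine tle _ (by positivity) ?_
          have : s * j ^ 2 ≤ C := (Nat.le_div_iff_mul_le (by positivity)).mp hs.2
          rw [hQn]
          calc s * j ^ 2 * o * Ha ≤ C * o * Ha := by gcongr
            _ ≤ C * o * Ha * f.natAbs := Nat.le_mul_of_pos_right _ hfa
        calc _ ≤ K * q * √(o * Ha) * ((s.gcd (j * (o * Ha) * H) : ℝ) / √s) * √(j.gcd (o * Ha)) * G := by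
              rw [hG]; gcongr
          _ = _ := by ring
      · positivity
    refine (sum_le_sum inner).trans ?_
    rw [← mul_sum]
    have hgs := xa (C / j ^ 2) (j * (o * Ha) * H) (by positivity)
    have hτ : ((j * (o * Ha) * H).divisors.card : ℝ) ≤ K * q ^ 2 := by
      refine xk _ (by positivity) ?_
      rw [hQn]
      calc j * (o * Ha) * H ≤ C * (o * Ha) * (f.natAbs * (o * Ha)) := by gcongr; exact hj.2
        _ = (C * o * Ha * f.natAbs) * (o * Ha) := by ring
        _ ≤ (C * o * Ha * f.natAbs) * (C * o * Ha * f.natAbs) := by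
            refine Nat.mul_le_mul_left _ ?_
            calc o * Ha = 1 * (o * Ha) * 1 := by ring
              _ ≤ C * (o * Ha) * f.natAbs := by gcongr
              _ = _ := by ring
        _ = _ := by ring
    have hsq : √((C / j ^ 2 : ℕ) : ℝ) ≤ √C / j := by
      calc √((C / j ^ 2 : ℕ) : ℝ) ≤ √((C : ℝ) / (j : ℝ) ^ 2) := sqrt_le_sqrt (by exact_mod_cast Nat.cast_div_le (α := ℝ))
        _ = √C / j := by rw [sqrt_div (by positivity), sqrt_sq hjr.le]
    have hgg : √(j.gcd (o * Ha) : ℝ) ≤ j.gcd (o * Ha) := by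
      have : (1 : ℝ) ≤ j.gcd (o * Ha) := by exact_mod_cast Nat.gcd_pos_of_pos_left _ ca
      rw [sqrt_le_left (by linarith)]
      nlinarith
    calc _ ≤ (K * q * √(o * Ha) * G * (j.gcd (o * Ha) : ℝ)) * (2 * (K * q ^ 2) * (√C / j)) := by
          refine mul_le_mul (by gcongr) (hgs.trans (by gcongr)) (sum_nonneg fun _ _ => by positivity) (by positivity)
      _ = _ := by ring
  refine (sum_le_sum term).trans ?_
  rw [← mul_sum]
  have hlast := xb C (o * Ha) se
  have hτD : ((o * Ha).divisors.card : ℝ) ≤ K * q := by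
    refine tle _ se ?_
    calc o * Ha = 1 * (o * Ha) * 1 := by ring
      _ ≤ C * (o * Ha) * f.natAbs := by gcongr
      _ = _ := by rw [hQn]; ring
  have hlog : 1 + Real.log C ≤ (1 + 1 / δ) * q := by
    have hCr : (1 : ℝ) ≤ C := by exact_mod_cast hC
    have Hg := log_le_rpow_div (x := (C : ℝ)) (by linarith) gi
    have Hk : (C : ℝ) ^ δ ≤ q := by
      rw [hq]
      have : C ≤ Qn := by
        rw [hQn]
        calc C = C * 1 * 1 := by ring
          _ ≤ C * (o * Ha) * f.natAbs := by gcongr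
          _ = _ := by ring
      gcongr
    have Hl : (1 : ℝ) ≤ (C : ℝ) ^ δ := one_le_rpow hCr gi.le
    have Hq : (C : ℝ) ^ δ / δ ≤ q / δ := by gcongr
    calc 1 + Real.log C ≤ q + q / δ := by linarith
      _ = _ := by ring
  have xl : 0 ≤ 1 + Real.log C := by
    have hCr : (1 : ℝ) ≤ C := by exact_mod_cast hC
    linarith [log_nonneg hCr]
  calc _ ≤ (K * q * √(o * Ha) * G * (2 * (K * q ^ 2)) * √C) * ((K * q) * ((1 + 1 / δ) * q)) := by
        refine mul_le_mul_of_nonneg_left (hlast.trans ?_) (by positivity)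
        exact mul_le_mul hτD hlog xl (by positivity)
    _ = _ := by ring
end wx
section xm
open Real Finset Complex
open MeasureTheory Complex
open scoped ENNReal ComplexConjugate
variable {H Γ : Type*} [MeasurableSpace H] [Group Γ] [Countable Γ] [MulAction Γ H] [MeasurableSpace Γ]
  [MeasurableConstSMul Γ H] {μ : Measure H} [SMulInvariantMeasure Γ H μ]
noncomputable def nuN (Γ : Type*) [Group Γ] [MulAction Γ H] (Hh : Set H) (z : H) : ℝ≥0∞ := ∑' γ : Γ, Hh.indicator (fun _ => (1:ℝ≥0∞)) (γ • z)
noncomputable def nuR (Γ : Type*) [Group Γ] [MulAction Γ H] (Hh : Set H) (z : H) : ℝ := ((nuN Γ Hh z).toReal)⁻¹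
lemma xn (Hh : Set H) (g : Γ) (z : H) : nuN Γ Hh (g • z) = nuN Γ Hh z := by
  unfold nuN
  rw [← Equiv.tsum_eq (Equiv.mulRight g) (fun γ : Γ => Hh.indicator (fun _ => (1:ℝ≥0∞)) (γ • z))]
  simp [mul_smul]
lemma xo (Hh : Set H) (g : Γ) (z : H) : nuR Γ Hh (g • z) = nuR Γ Hh z := by
  unfold nuR; rw [xn]
lemma sf (Hh : Set H) (hK : MeasurableSet Hh) : Measurable (nuR Γ Hh) := by
  unfold nuR nuN
  refine Measurable.inv (Measurable.ennreal_toReal ?_)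
  refine Measurable.tsum fun γ => ?_
  exact (measurable_const.indicator hK).comp (measurable_const_smul γ)
lemma gx (Hh : Set H) (z : H) : 0 ≤ nuR Γ Hh z := by unfold nuR; positivity
lemma gy (Hh : Set H) (g : Γ) (z : H) (h : g • z ∈ Hh) : nuR Γ Hh z ≤ 1 := by
  unfold nuR
  by_cases ht : nuN Γ Hh z = ⊤
  · simp [ht]
  · apply inv_le_one_of_one_le₀
    rw [← ENNReal.toReal_one]
    apply ENNReal.toReal_mono ht
    have := ENNReal.le_tsum (f := fun γ : Γ => Hh.indicator (fun _ => (1:ℝ≥0∞)) (γ • z)) g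
    simpa [h, nuN] using this
lemma xp (A Hh : Set H) (Hp : Finset Γ) (hcov : ∀ z ∈ A, ∃ γ : Γ, γ • z ∈ Hh)
    (jf : ∀ z ∈ A, ∀ γ : Γ, γ • z ∈ Hh → γ ∈ Hp) (z : H) (hz : z ∈ A) :
    ∑ γ ∈ Hp, Hh.indicator (fun _ => (1:ℝ)) (γ • z) * nuR Γ Hh z = 1 := by
  rw [← sum_mul]
  have e : nuN Γ Hh z = ∑ γ ∈ Hp, Hh.indicator (fun _ => (1:ℝ≥0∞)) (γ • z) := by
    unfold nuN
    apply tsum_eq_sum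
    intro b hb
    rw [Set.indicator_of_notMem]
    exact fun h => hb (jf z hz b h)
  have Hj : (nuN Γ Hh z).toReal = ∑ γ ∈ Hp, Hh.indicator (fun _ => (1:ℝ)) (γ • z) := by
    rw [e, ENNReal.toReal_sum]
    · refine sum_congr rfl fun γ _ => ?_
      by_cases h : γ • z ∈ Hh <;> simp [h]
    · intro γ _
      by_cases h : γ • z ∈ Hh <;> simp [h]
  unfold nuR
  rw [Hj]
  apply mul_inv_cancel₀
  obtain ⟨g, hg⟩ := hcov z hz
  have : (0:ℝ) < ∑ γ ∈ Hp, Hh.indicator (fun _ => (1:ℝ)) (γ • z) := by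
    apply sum_pos'
    · intro i _; apply Set.indicator_nonneg; simp
    · exact ⟨g, jf z hz g hg, by simp [hg]⟩
  exact this.ne'
lemma sg (A Hh : Set H) (hA : MeasurableSet A) (hK : MeasurableSet Hh) (μA : μ A ≠ ⊤) (μK : μ Hh ≠ ⊤)
    (Hp : Finset Γ) (h : Γ → H → ℂ) (hm : ∀ γ, Measurable (h γ)) (C : ℝ) (hC : ∀ γ z, ‖h γ z‖ ≤ C) :
    ∫ z in A, ∑ γ ∈ Hp, (Hh.indicator (fun _ => (1:ℂ)) (γ • z)) * (nuR Γ Hh z : ℂ) * h γ z ∂μ =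
    ∫ w in Hh, ∑ γ ∈ Hp, (A.indicator (fun _ => (1:ℂ)) (γ⁻¹ • w)) * (nuR Γ Hh w : ℂ) * h γ (γ⁻¹ • w) ∂μ := by
  have sh : ∀ γ : Γ, ∀ z : H, 0 ≤ C := fun γ z => (norm_nonneg _).trans (hC γ z)
  have hnu := sf (Γ := Γ) Hh hK
  rw [integral_finsetSum, integral_finsetSum]
  · refine sum_congr rfl fun γ _ => ?_
    rw [← integral_indicator hA, ← integral_indicator hK,
      ← integral_smul_eq_self (μ := μ) (G := Γ) (fun w => Hh.indicator (fun w => (A.indicator (fun _ => (1:ℂ)) (γ⁻¹ • w)) * (nuR Γ Hh w : ℂ) * h γ (γ⁻¹ • w)) w) (g := γ)]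
    congr 1
    funext z
    by_cases Hc : z ∈ A <;> by_cases Hd : γ • z ∈ Hh <;> simp [Hc, Hd, xo]
  · intro γ _
    refine IntegrableOn.of_bound (C := 1 * 1 * C) (lt_top_iff_ne_top.2 μK) ?_ ?_
    · apply Measurable.aestronglyMeasurable
      exact (((measurable_const.indicator hA).comp (measurable_const_smul γ⁻¹)).mul
        (measurable_ofReal.comp hnu)).mul ((hm γ).comp (measurable_const_smul γ⁻¹))
    · rw [ae_restrict_iff' hK]
      refine Filter.Eventually.of_forall fun z hz => ?_
      rw [norm_mul, norm_mul]
      have Hc : ‖A.indicator (fun _ => (1:ℂ)) (γ⁻¹ • z)‖ ≤ 1 := by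
        by_cases Hd : γ⁻¹ • z ∈ A <;> simp [Hd]
      have Hg : ‖(nuR Γ Hh z : ℂ)‖ ≤ 1 := by
        rw [Complex.norm_of_nonneg (gx _ _)]
        exact gy Hh 1 z (by simpa using hz)
      have := sh γ z
      gcongr
      exact hC _ _
  · intro γ _
    refine IntegrableOn.of_bound (C := 1 * C) (lt_top_iff_ne_top.2 μA) ?_ ?_
    · apply Measurable.aestronglyMeasurable
      exact (((measurable_const.indicator hK).comp (measurable_const_smul γ)).mul
        (measurable_ofReal.comp hnu)).mul (hm γ)
    · refine Filter.Eventually.of_forall fun z => ?_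
      rw [norm_mul]
      have Hc : ‖Hh.indicator (fun _ => (1:ℂ)) (γ • z) * (nuR Γ Hh z : ℂ)‖ ≤ 1 := by
        by_cases Hd : γ • z ∈ Hh
        · simp only [Hd, Set.indicator_of_mem, one_mul]
          rw [Complex.norm_of_nonneg (gx _ _)]
          exact gy Hh γ z Hd
        · simp [Hd]
      have := sh γ z
      gcongr
      exact hC _ _
open Classical in
lemma xq {ι Ω : Type*} [Fintype Ω] (s : Finset ι) (ell : ι → Ω) (S : ι → ℂ) (W : Ω → ℂ) (B t : ℝ) (ht : 0 < t)
    (hW : ∀ l, ‖W l‖ ≤ B) :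
    ‖∑ p ∈ s, S p * W (ell p)‖ ≤ t / 2 * (Fintype.card Ω * B ^ 2) +
      1 / (2 * t) * (∑ p ∈ s, ∑ q ∈ s, if ell p = ell q then S p * conj (S q) else 0).re := by
  set T : Ω → ℂ := fun l => ∑ p ∈ s, if ell p = l then S p else 0 with hT
  have Hi : ∑ p ∈ s, S p * W (ell p) = ∑ l, T l * W l := by
    simp only [hT, sum_mul]
    rw [sum_comm (s := univ)]
    refine sum_congr rfl fun p _ => ?_
    simp
  have Hj : (∑ p ∈ s, ∑ q ∈ s, if ell p = ell q then S p * conj (S q) else 0) = ∑ l, T l * conj (T l) := by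
    simp only [hT, map_sum, sum_mul, mul_sum]
    rw [sum_comm (s := univ)]
    conv_rhs => enter [2, x]; rw [sum_comm]
    rw [sum_comm]
    refine sum_congr rfl fun p _ => ?_
    refine sum_congr rfl fun q _ => ?_
    simp [apply_ite conj, eq_comm]
  rw [Hi, Hj]
  have Hu : (∑ l, T l * conj (T l)).re = ∑ l, ‖T l‖ ^ 2 := by
    rw [re_sum]
    refine sum_congr rfl fun l _ => ?_
    rw [mul_conj, ofReal_re, normSq_eq_norm_sq]
  rw [Hu]
  calc ‖∑ l, T l * W l‖ ≤ ∑ l, ‖T l * W l‖ := norm_sum_le _ _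
    _ ≤ ∑ l : Ω, (t / 2 * B ^ 2 + 1 / (2 * t) * ‖T l‖ ^ 2) := by
        refine sum_le_sum fun l _ => ?_
        rw [norm_mul]
        have Hc : ‖T l‖ * ‖W l‖ ≤ ‖T l‖ * B := by gcongr; exact hW l
        have Hd : t / 2 * B ^ 2 + 1 / (2 * t) * ‖T l‖ ^ 2 - ‖T l‖ * B = (t * B - ‖T l‖) ^ 2 / (2 * t) := by
          field_simp; ring
        have Hg : 0 ≤ (t * B - ‖T l‖) ^ 2 / (2 * t) := by positivity
        linarith
    _ = _ := by
        rw [sum_add_distrib, ← mul_sum, ← mul_sum, sum_const, card_univ, nsmul_eq_mul]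
lemma xr (x P Q : ℝ) (hx : 0 ≤ x) (hP : 0 ≤ P) (hQ : 0 ≤ Q) (h : ∀ t : ℝ, 0 < t → x ≤ t / 2 * P + 1 / (2 * t) * Q) : x ^ 2 ≤ P * Q := by
  by_contra hc
  push Not at hc
  have si : 0 < x := by
    rcases hx.eq_or_lt with Hm | Hm
    · rw [← Hm] at hc; have := mul_nonneg hP hQ; norm_num at hc; linarith
    · exact Hm
  rcases hP.eq_or_lt with Hm | Hm
  · have Hc := h ((Q + 1) / x) (by positivity)
    rw [← Hm] at Hc
    have : 1 / (2 * ((Q + 1) / x)) * Q = x * (Q / (2 * (Q + 1))) := by field_simp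
    rw [this] at Hc
    have Hd : Q / (2 * (Q + 1)) < 1 := by rw [div_lt_one (by positivity)]; linarith
    nlinarith
  · have Hc := h (x / P) (by positivity)
    have : 1 / (2 * (x / P)) * Q = (P * Q) / (2 * x) := by field_simp
    rw [this] at Hc
    have Hg : x / P / 2 * P = x / 2 := by field_simp
    rw [Hg] at Hc
    have : P * Q / (2 * x) < x / 2 := by
      rw [div_lt_div_iff₀ (by positivity) (by norm_num)]; nlinarith
    linarith
open Classical in
lemma xs (A Hh : Set H) (Hp E : Finset Γ) (jf : ∀ z ∈ A, ∀ γ : Γ, γ • z ∈ Hh → γ ∈ Hp)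
    (hE : ∀ z ∈ A, ∀ η : Γ, η • z ∈ A → η ∈ E) (z : H) (hz : z ∈ A) (γ : Γ) (hγ : γ • z ∈ Hh) (g : Γ → ℂ)
    (hg : ∀ η : Γ, η • z ∉ A → g η = 0) : ∑ ju ∈ Hp, g (ju⁻¹ * γ) = ∑ η ∈ E, g η := by
  rw [← sum_filter_of_ne (s := Hp) (p := fun ju => (ju⁻¹ * γ) • z ∈ A) (fun x _ hx => by by_contra h; exact hx (hg _ h)),
    ← sum_filter_of_ne (s := E) (p := fun η => η • z ∈ A) (fun x _ hx => by by_contra h; exact hx (hg _ h))]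
  refine sum_nbij' (fun ju => ju⁻¹ * γ) (fun η => γ * η⁻¹) ?_ ?_ ?_ ?_ ?_
  · intro x hx
    simp only [mem_filter] at hx ⊢
    exact ⟨hE z hz _ hx.2, hx.2⟩
  · intro η hη
    simp only [mem_filter] at hη ⊢
    refine ⟨jf _ hη.2 _ ?_, ?_⟩
    · simpa [mul_smul] using hγ
    · simpa [mul_smul] using hη.2
  · intro x _; simp
  · intro x _; simp
  · intro x _; rfl
open Classical in
lemma xt {U Ω : Type*} [Fintype U] [Fintype Ω] (A Hh : Set H) (hA : MeasurableSet A) (hK : MeasurableSet Hh)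
    (μA : μ A ≠ ⊤) (μK : μ Hh ≠ ⊤)
    (Hp E : Finset Γ) (hcov : ∀ z ∈ A, ∃ γ : Γ, γ • z ∈ Hh)
    (jf : ∀ z ∈ A, ∀ γ : Γ, γ • z ∈ Hh → γ ∈ Hp)
    (hE : ∀ z ∈ A, ∀ η : Γ, η • z ∈ A → η ∈ E)
    (ell : U → Γ → Ω) (V Φ : U → H → ℂ) (W : Ω → H → ℂ) (B : ℝ) (hW : ∀ l w, ‖W l w‖ ≤ B)
    (hVW : ∀ u γ w, V u (γ⁻¹ • w) = W (ell u γ) w) (hVm : ∀ u, Measurable (V u))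
    (hΦm : ∀ u, Measurable (Φ u)) (hΦ : ∀ u z, ‖Φ u z‖ ≤ 1)
    (r : Γ → U → U → Prop) (hr : ∀ γ η u Hf, ell u γ = ell Hf (γ * η⁻¹) ↔ r η u Hf) :
    ‖∫ z in A, ∑ u, Φ u z * V u z ∂μ‖ ^ 2 ≤ Fintype.card Ω * B ^ 2 * μ.real Hh *
      ‖∫ z in A, ∑ η ∈ E, ∑ u, ∑ Hf, (if r η u Hf then A.indicator (fun _ => (1:ℂ)) (η • z) * (Φ u z * conj (Φ Hf (η • z))) else 0) ∂μ‖ := by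
  have hnu := sf (Γ := Γ) Hh hK
  have hV : ∀ u z, ‖V u z‖ ≤ B := fun u z => by
    have := hVW u 1 z
    simp only [inv_one, one_smul] at this
    rw [this]; exact hW _ _
  have xu : ∀ γ : Γ, ∀ z : H, (Hh.indicator (fun _ => (1:ℂ)) (γ • z)) = ((Hh.indicator (fun _ => (1:ℝ)) (γ • z) : ℝ) : ℂ) := by
    intro γ z; by_cases h : γ • z ∈ Hh <;> simp [h]
  have hsum : ∀ z ∈ A, ∑ γ ∈ Hp, Hh.indicator (fun _ => (1:ℂ)) (γ • z) * (nuR Γ Hh z : ℂ) = 1 := by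
    intro z hz
    have := xp A Hh Hp hcov jf z hz
    simp only [xu]
    exact_mod_cast this
  have iAn : ∀ z : H, ‖A.indicator (fun _ => (1:ℂ)) z‖ ≤ 1 := by
    intro z; by_cases h : z ∈ A <;> simp [h]
  have iAm : Measurable (A.indicator (fun _ => (1:ℂ))) := measurable_const.indicator hA
  have xv : ∫ z in A, ∑ u, Φ u z * V u z ∂μ =
      ∫ w in Hh, ∑ γ ∈ Hp, (A.indicator (fun _ => (1:ℂ)) (γ⁻¹ • w)) * (nuR Γ Hh w : ℂ) * (∑ u, Φ u (γ⁻¹ • w) * V u (γ⁻¹ • w)) ∂μ := by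
    rw [← sg A Hh hA hK μA μK Hp (fun _ z => ∑ u, Φ u z * V u z) ?_ (∑ u : U, 1 * B) ?_]
    · refine setIntegral_congr_fun hA fun z hz => ?_
      rw [← sum_mul, hsum z hz, one_mul]
    · intro _
      exact measurable_sum _ fun u _ => (hΦm u).mul (hVm u)
    · intro _ z
      refine norm_sum_le_of_le _ fun u _ => ?_
      rw [norm_mul]
      gcongr
      · exact hΦ _ _
      · exact hV _ _
  set hh : Γ → H → ℂ := fun γ z => ∑ u, ∑ q ∈ Hp ×ˢ (univ : Finset U), if ell u γ = ell q.2 q.1 then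
      A.indicator (fun _ => (1:ℂ)) ((q.1⁻¹ * γ) • z) * (Φ u z * conj (Φ q.2 ((q.1⁻¹ * γ) • z))) else 0 with hhd
  have hhm : ∀ γ, Measurable (hh γ) := by
    intro γ
    refine measurable_sum _ fun u _ => measurable_sum _ fun q _ => ?_
    split_ifs
    · exact (iAm.comp (measurable_const_smul _)).mul ((hΦm u).mul (continuous_conj.measurable.comp ((hΦm q.2).comp (measurable_const_smul _))))
    · exact measurable_const
  have hhb : ∀ γ z, ‖hh γ z‖ ≤ ∑ u : U, ∑ q ∈ Hp ×ˢ (univ : Finset U), (1:ℝ) * (1 * 1) := by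
    intro γ z
    refine norm_sum_le_of_le _ fun u _ => norm_sum_le_of_le _ fun q _ => ?_
    split_ifs
    · rw [norm_mul, norm_mul, RCLike.norm_conj]
      gcongr
      · exact iAn _
      · exact hΦ _ _
      · exact hΦ _ _
    · simp
  have sj := sg (μ := μ) A Hh hA hK μA μK Hp hh hhm _ hhb
  have xw : ∫ z in A, ∑ γ ∈ Hp, (Hh.indicator (fun _ => (1:ℂ)) (γ • z)) * (nuR Γ Hh z : ℂ) * hh γ z ∂μ =
      ∫ z in A, ∑ η ∈ E, ∑ u, ∑ Hf, (if r η u Hf then A.indicator (fun _ => (1:ℂ)) (η • z) * (Φ u z * conj (Φ Hf (η • z))) else 0) ∂μ := by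
    refine setIntegral_congr_fun hA fun z hz => ?_
    have gen : ∀ y : ℂ, y = ∑ γ ∈ Hp, Hh.indicator (fun _ => (1:ℂ)) (γ • z) * (nuR Γ Hh z : ℂ) * y := by
      intro y; rw [← sum_mul, hsum z hz, one_mul]
    refine Eq.trans ?_ (gen _).symm
    refine sum_congr rfl fun γ _ => ?_
    by_cases hγ : γ • z ∈ Hh
    swap
    · simp [hγ]
    congr 1
    rw [← xs A Hh Hp E jf hE z hz γ hγ _ (fun η hη => by simp [hη]), sum_comm]
    simp only [hhd]
    refine sum_congr rfl fun u _ => ?_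
    rw [sum_product]
    refine sum_congr rfl fun ju _ => ?_
    refine sum_congr rfl fun Hf _ => ?_
    have := hr γ (ju⁻¹ * γ) u Hf
    rw [show γ * (ju⁻¹ * γ)⁻¹ = ju by group] at this
    simp only [this]
  rw [xw] at sj
  set Q := ∫ z in A, ∑ η ∈ E, ∑ u, ∑ Hf, (if r η u Hf then A.indicator (fun _ => (1:ℂ)) (η • z) * (Φ u z * conj (Φ Hf (η • z))) else 0) ∂μ with hQ
  set jt : H → ℂ := fun w => ∑ γ ∈ Hp, (A.indicator (fun _ => (1:ℂ)) (γ⁻¹ • w)) * (nuR Γ Hh w : ℂ) * hh γ (γ⁻¹ • w) with xx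
  have qc : IntegrableOn jt Hh μ := by
    refine IntegrableOn.of_bound (C := ∑ γ ∈ Hp, 1 * 1 * (∑ u : U, ∑ q ∈ Hp ×ˢ (univ : Finset U), (1:ℝ) * (1 * 1))) (lt_top_iff_ne_top.2 μK) ?_ ?_
    · apply Measurable.aestronglyMeasurable
      refine measurable_sum _ fun γ _ => ?_
      exact ((iAm.comp (measurable_const_smul γ⁻¹)).mul
        (measurable_ofReal.comp hnu)).mul ((hhm γ).comp (measurable_const_smul γ⁻¹))
    · rw [ae_restrict_iff' hK]
      refine Filter.Eventually.of_forall fun z hz => ?_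
      refine norm_sum_le_of_le _ fun γ _ => ?_
      rw [norm_mul, norm_mul]
      have Hg : ‖(nuR Γ Hh z : ℂ)‖ ≤ 1 := by
        rw [Complex.norm_of_nonneg (gx _ _)]
        exact gy Hh (1:Γ) z (by simpa using hz)
      gcongr
      · exact iAn _
      · exact hhb _ _
  rw [show (Fintype.card Ω * B ^ 2 * μ.real Hh) * ‖Q‖ = (Fintype.card Ω * B ^ 2 * μ.real Hh) * ‖Q‖ from rfl]
  refine xr _ _ _ (norm_nonneg _) (by positivity) (norm_nonneg _) fun t ht => ?_
  rw [xv]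
  have ptw : ∀ w ∈ Hh, ‖∑ γ ∈ Hp, (A.indicator (fun _ => (1:ℂ)) (γ⁻¹ • w)) * (nuR Γ Hh w : ℂ) * (∑ u, Φ u (γ⁻¹ • w) * V u (γ⁻¹ • w))‖
      ≤ t / 2 * (Fintype.card Ω * B ^ 2) + 1 / (2 * t) * (jt w).re := by
    intro w hw
    have jo : nuR Γ Hh w ≤ 1 := gy Hh (1:Γ) w (by simpa using hw)
    have cq := gx (Γ := Γ) Hh w
    have := xq (Hp ×ˢ (univ : Finset U)) (fun p => ell p.2 p.1) (fun p => A.indicator (fun _ => (1:ℂ)) (p.1⁻¹ • w) * Φ p.2 (p.1⁻¹ • w)) (fun l => W l w) B t ht (fun l => hW l w)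
    have Hi : ∑ γ ∈ Hp, (A.indicator (fun _ => (1:ℂ)) (γ⁻¹ • w)) * (nuR Γ Hh w : ℂ) * (∑ u, Φ u (γ⁻¹ • w) * V u (γ⁻¹ • w)) =
      (nuR Γ Hh w : ℂ) * ∑ p ∈ Hp ×ˢ (univ : Finset U), A.indicator (fun _ => (1:ℂ)) (p.1⁻¹ • w) * Φ p.2 (p.1⁻¹ • w) * W (ell p.2 p.1) w := by
      rw [sum_product, mul_sum]
      refine sum_congr rfl fun γ _ => ?_
      rw [mul_sum, mul_sum]
      refine sum_congr rfl fun u _ => ?_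
      rw [hVW]; ring
    have Hj : jt w = (nuR Γ Hh w : ℂ) * ∑ p ∈ Hp ×ˢ (univ : Finset U), ∑ q ∈ Hp ×ˢ (univ : Finset U), (if ell p.2 p.1 = ell q.2 q.1 then
        (A.indicator (fun _ => (1:ℂ)) (p.1⁻¹ • w) * Φ p.2 (p.1⁻¹ • w)) * conj (A.indicator (fun _ => (1:ℂ)) (q.1⁻¹ • w) * Φ q.2 (q.1⁻¹ • w)) else 0) := by
      simp only [xx, hhd]
      rw [sum_product, mul_sum]
      refine sum_congr rfl fun γ _ => ?_
      rw [mul_sum, mul_sum]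
      refine sum_congr rfl fun u _ => ?_
      rw [mul_sum, mul_sum]
      refine sum_congr rfl fun q _ => ?_
      have Hu : (q.1⁻¹ * γ) • γ⁻¹ • w = q.1⁻¹ • w := by rw [mul_smul, smul_inv_smul]
      rw [Hu]
      have et : conj (A.indicator (fun _ => (1:ℂ)) (q.1⁻¹ • w)) = A.indicator (fun _ => (1:ℂ)) (q.1⁻¹ • w) := by
        by_cases h : q.1⁻¹ • w ∈ A <;> simp [h]
      split_ifs
      · rw [map_mul, et]; ring
      · simp
    rw [Hi, Hj, norm_mul, Complex.norm_of_nonneg cq, Complex.re_ofReal_mul]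
    calc _ ≤ nuR Γ Hh w * _ := mul_le_mul_of_nonneg_left this cq
      _ ≤ _ := by
        rw [mul_add]
        refine add_le_add ?_ (le_of_eq (by ring))
        exact mul_le_of_le_one_left (by positivity) jo
  calc _ ≤ ∫ w in Hh, (t / 2 * (Fintype.card Ω * B ^ 2) + 1 / (2 * t) * (jt w).re) ∂μ := by
        refine norm_integral_le_of_norm_le ?_ ?_
        · exact (integrableOn_const μK).add (qc.re.const_mul _)
        · rw [ae_restrict_iff' hK]
          exact Filter.Eventually.of_forall ptw
    _ = t / 2 * (Fintype.card Ω * B ^ 2 * μ.real Hh) + 1 / (2 * t) * Q.re := by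
        have ic : Integrable (fun _ : H => t / 2 * (Fintype.card Ω * B ^ 2)) (μ.restrict Hh) := integrableOn_const μK
        have ir : Integrable (fun w : H => (jt w).re) (μ.restrict Hh) := qc.re
        rw [integral_add ic (ir.const_mul _), setIntegral_const, integral_const_mul, sj]
        have : ∫ w in Hh, (jt w).re ∂μ = (∫ w in Hh, jt w ∂μ).re := integral_re qc
        rw [← this]
        simp only [smul_eq_mul]
        congr 1
        ring
    _ ≤ _ := by
        have := re_le_norm Q
        gcongr
end xm
section xy
open Real Finset Complex
open MeasureTheory UpperHalfPlane
open Complex hiding I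
open scoped ENNReal ComplexConjugate MatrixGroups
instance : SMulInvariantMeasure SL(2, ℤ) ℍ volume := ⟨fun c s hs => by
  have := measure_preimage_smul (volume : Measure ℍ) ((Matrix.SpecialLinearGroup.mapGL ℝ c : GL (Fin 2) ℝ)) s
  exact this⟩
instance : MeasurableConstSMul SL(2, ℤ) ℍ := ⟨fun c => by
  exact (continuous_const_smul (Matrix.SpecialLinearGroup.mapGL ℝ c : GL (Fin 2) ℝ)).measurable⟩
instance : Countable SL(2, ℤ) := by
  have : Countable (Matrix (Fin 2) (Fin 2) ℤ) := by unfold Matrix; infer_instance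
  exact Subtype.countable
def hbox (a b Y Hb : ℝ) : Set ℍ := {z | (a ≤ z.re ∧ z.re < b) ∧ (Y ≤ z.im ∧ z.im ≤ Hb)}
lemma jp (a b Y Hb : ℝ) : MeasurableSet (hbox a b Y Hb) := by
  have Hc : Measurable (fun z : ℍ => z.re) := UpperHalfPlane.continuous_re.measurable
  have Hd : Measurable (fun z : ℍ => z.im) := UpperHalfPlane.continuous_im.measurable
  exact ((measurableSet_le measurable_const Hc).inter (measurableSet_lt Hc measurable_const)).inter
    ((measurableSet_le measurable_const Hd).inter (measurableSet_le Hd measurable_const))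
lemma xz (a b Y Hb : ℝ) (hY : 0 < Y) : ((↑) : ℍ → ℂ) '' (hbox a b Y Hb) = Set.Ico a b ×ℂ Set.Icc Y Hb := by
  ext z
  simp only [Set.mem_image, hbox, Set.mem_ofPred_eq, mem_reProdIm, Set.mem_Ico, Set.mem_Icc]
  constructor
  · rintro ⟨w, h, rfl⟩; exact h
  · intro h
    exact ⟨⟨z, hY.trans_le h.2.1⟩, h, rfl⟩
lemma qd (a b Y Hb : ℝ) (hY : 0 < Y) : IsCompact {z : ℍ | (a ≤ z.re ∧ z.re ≤ b) ∧ (Y ≤ z.im ∧ z.im ≤ Hb)} := by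
  rw [isOpenEmbedding_coe.isInducing.isCompact_iff]
  have : ((↑) : ℍ → ℂ) '' {z : ℍ | (a ≤ z.re ∧ z.re ≤ b) ∧ (Y ≤ z.im ∧ z.im ≤ Hb)} = Set.Icc a b ×ℂ Set.Icc Y Hb := by
    ext z
    simp only [Set.mem_image, Set.mem_ofPred_eq, mem_reProdIm, Set.mem_Icc]
    constructor
    · rintro ⟨w, h, rfl⟩; exact h
    · intro h
      exact ⟨⟨z, hY.trans_le h.2.1⟩, h, rfl⟩
  rw [this]
  exact isCompact_Icc.reProdIm isCompact_Icc
lemma sk (a b Y Hb es cl T sl : ℝ) (hY : 0 < Y) (hT : 0 < T) :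
    Set.Finite {γ : SL(2, ℤ) | ∃ z ∈ hbox a b Y Hb, γ • z ∈ hbox es cl T sl} := by
  have h := ProperlyDiscontinuousSMul.finite_disjoint_inter_image (Γ := 𝒮ℒ) (qd a b Y Hb hY) (qd es cl T sl hT)
  have inj : Function.Injective (Matrix.SpecialLinearGroup.mapGL ℝ : SL(2, ℤ) →* GL (Fin 2) ℝ).rangeRestrict := by
    intro x y hxy
    have : Matrix.SpecialLinearGroup.mapGL ℝ x = Matrix.SpecialLinearGroup.mapGL ℝ y := by
      have := congrArg Subtype.val hxy
      exact this
    exact Matrix.SpecialLinearGroup.mapGL_injective this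
  refine (h.preimage inj.injOn).subset ?_
  rintro γ ⟨z, hz, hγ⟩
  simp only [Set.mem_preimage, Set.mem_ofPred_eq]
  refine ⟨γ • z, ⟨z, ⟨⟨hz.1.1, hz.1.2.le⟩, hz.2⟩, ?_⟩, ⟨⟨hγ.1.1, hγ.1.2.le⟩, hγ.2⟩⟩
  rfl
lemma sn (g : ℍ → ℂ) (hg : Continuous g) (a b Y Hb : ℝ) (hab : a ≤ b) (hY : 0 < Y) (hYY : Y ≤ Hb) :
    ∫ z in hbox a b Y Hb, g z = ∫ y in Y..Hb, ((1 / y ^ 2 : ℝ) : ℂ) * ∫ x in a..b, g (ofComplex (x + y * Complex.I)) := by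
  have hm := jp a b Y Hb
  have mp : MeasurePreserving UpperHalfPlane.coe (volume.comap UpperHalfPlane.coe)
      (volume.restrict (.range UpperHalfPlane.coe)) :=
    ⟨measurable_coe, by rw [measurableEmbedding_coe.map_comap]⟩
  have Hi : ∫ z in hbox a b Y Hb, g z = ∫ z in Set.Ico a b ×ℂ Set.Icc Y Hb, ((1 / z.im ^ 2 : ℝ) : ℂ) * g (ofComplex z) := by
    rw [volume_def, setIntegral_withDensity_eq_setIntegral_smul]
    · rw [← xz a b Y Hb hY, ← Set.inter_eq_self_of_subset_left (Set.image_subset_range _ (hbox a b Y Hb)),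
        ← Measure.restrict_restrict', mp.setIntegral_image_emb measurableEmbedding_coe]
      · refine setIntegral_congr_fun hm fun z hz => ?_
        simp only [ofComplex_apply, NNReal.smul_def, Complex.real_smul]
        congr 1
        simp
      · exact measurableEmbedding_coe.measurableSet_range
    · apply Measurable.pow_const
      apply Measurable.div measurable_const
      exact UpperHalfPlane.continuous_im.measurable.subtype_mk
    · exact hm
  rw [Hi]
  have ya := Complex.volume_preserving_equiv_real_prod
  have Hj : Set.Ico a b ×ℂ Set.Icc Y Hb = Complex.measurableEquivRealProd ⁻¹' (Set.Ico a b ×ˢ Set.Icc Y Hb) := by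
    ext z; simp [Complex.mem_reProdIm, Complex.measurableEquivRealProd]
  have Hu : ∫ z in Set.Ico a b ×ℂ Set.Icc Y Hb, ((1 / z.im ^ 2 : ℝ) : ℂ) * g (ofComplex z) =
     ∫ p in Set.Ico a b ×ˢ Set.Icc Y Hb, ((1 / p.2 ^ 2 : ℝ) : ℂ) * g (ofComplex (p.1 + p.2 * Complex.I)) := by
    rw [Hj, ← ya.setIntegral_preimage_emb Complex.measurableEquivRealProd.measurableEmbedding]
    refine setIntegral_congr_fun (Complex.measurableEquivRealProd.measurable (measurableSet_Ico.prod measurableSet_Icc)) fun z hz => ?_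
    simp [Complex.measurableEquivRealProd, Complex.re_add_im]
  rw [Hu]
  have co : ContinuousOn (fun p : ℝ × ℝ => ((1 / p.2 ^ 2 : ℝ) : ℂ) * g (ofComplex (p.1 + p.2 * Complex.I))) (Set.Icc a b ×ˢ Set.Icc Y Hb) := by
    have hp : ∀ p ∈ Set.Icc a b ×ˢ Set.Icc Y Hb, 0 < p.2 := fun p hp => hY.trans_le hp.2.1
    refine ContinuousOn.mul ?_ ?_
    · apply Complex.continuous_ofReal.comp_continuousOn
      refine continuousOn_const.div (continuousOn_snd.pow 2) fun p h => ?_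
      exact (pow_pos (hp p h) 2).ne'
    · intro p h
      have Hc : ContinuousAt (fun p : ℝ × ℝ => ((p.1 : ℂ) + p.2 * Complex.I)) p := by fun_prop
      have Hd : ContinuousAt (ofComplex : ℂ → ℍ) ((p.1 : ℂ) + p.2 * Complex.I) := by
        apply (contMDiffAt_ofComplex (n := 0) _).continuousAt
        simpa using hp p h
      have Hg : ContinuousAt (fun p : ℝ × ℝ => ofComplex ((p.1 : ℂ) + p.2 * Complex.I)) p := ContinuousAt.comp (f := fun p : ℝ × ℝ => ((p.1 : ℂ) + p.2 * Complex.I)) Hd Hc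
      exact (ContinuousAt.comp (g := g) hg.continuousAt Hg).continuousWithinAt
  have io : IntegrableOn (fun p : ℝ × ℝ => ((1 / p.2 ^ 2 : ℝ) : ℂ) * g (ofComplex (p.1 + p.2 * Complex.I))) (Set.Ico a b ×ˢ Set.Icc Y Hb) (volume.prod volume) := by
    refine IntegrableOn.mono_set (co.integrableOn_compact (isCompact_Icc.prod isCompact_Icc)) (Set.prod_mono Set.Ico_subset_Icc_self le_rfl)
  rw [Measure.volume_eq_prod, ← setIntegral_prod_swap, setIntegral_prod]
  · rw [intervalIntegral.integral_of_le hYY, integral_Icc_eq_integral_Ioc]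
    refine setIntegral_congr_fun measurableSet_Ioc fun y _ => ?_
    simp only [Prod.swap_prod_mk]
    rw [integral_const_mul, intervalIntegral.integral_of_le hab, integral_Ico_eq_integral_Ioo, integral_Ioc_eq_integral_Ioo]
  · exact io.swap
lemma qe (a b Y Hb : ℝ) (hab : a ≤ b) (hY : 0 < Y) (hYY : Y ≤ Hb) :
    (volume : Measure ℍ).real (hbox a b Y Hb) = (b - a) * (1 / Y - 1 / Hb) := by
  have h := sn (fun _ => 1) continuous_const a b Y Hb hab hY hYY
  rw [setIntegral_const] at h
  have Hg : ∫ y in Y..Hb, ((1 / y ^ 2 : ℝ) : ℂ) * ∫ x in a..b, (1:ℂ) = ((∫ y in Y..Hb, (1 / y ^ 2) * (b - a) : ℝ) : ℂ) := by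
    rw [← intervalIntegral.integral_ofReal]
    congr 1; funext y; simp
  rw [Hg] at h
  have Hk : ∫ y in Y..Hb, (1 / y ^ 2) * (b - a) = (b - a) * (1 / Y - 1 / Hb) := by
    rw [intervalIntegral.integral_mul_const, mul_comm]
    congr 1
    have : ∫ y in Y..Hb, (1 / y ^ 2 : ℝ) = ∫ y in Y..Hb, y ^ (-2 : ℤ) := by
      congr 1; funext y; rw [zpow_neg]; simp
    rw [this, integral_zpow]
    · norm_num; ring
    · right
      refine ⟨by norm_num, ?_⟩
      rw [Set.uIcc_of_le hYY]; intro h; exact absurd h.1 (not_le.2 hY)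
  rw [Hk] at h
  rw [real_smul, mul_one] at h
  exact_mod_cast h
lemma gj (a b Y Hb : ℝ) (hY : 0 < Y) : (volume : Measure ℍ) (hbox a b Y Hb) ≠ ⊤ := by
  have := (qd a b Y Hb hY).measure_lt_top (μ := (volume : Measure ℍ))
  refine ((measure_mono ?_).trans_lt this).ne
  exact fun z hz => ⟨⟨hz.1.1, hz.1.2.le⟩, hz.2⟩
lemma yb (γ : SL(2, ℤ)) (z : ℍ) : (γ • z).im ≤ max z.im (1 / z.im) := by
  have h := ModularGroup.im_smul_eq_div_normSq γ z
  have hz := z.im_pos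
  rw [h]
  have hd : normSq (denom γ z) = ((γ 1 0 : ℝ) * z.re + γ 1 1) ^ 2 + ((γ 1 0 : ℝ) * z.im) ^ 2 := by
    rw [ModularGroup.denom_apply, normSq_apply]
    simp; ring
  rw [hd]
  by_cases hc : γ 1 0 = 0
  · apply le_max_of_le_left
    have hdet := γ.det_coe
    rw [Matrix.det_fin_two, hc] at hdet
    have : (γ 1 1) ≠ 0 := by rintro Hm; rw [Hm] at hdet; simp at hdet
    have Hc : (1:ℝ) ≤ (γ 1 1 : ℝ) ^ 2 := by
      have : 1 ≤ (γ 1 1) ^ 2 := by have := sq_pos_of_ne_zero this; omega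
      exact_mod_cast this
    rw [hc]
    apply div_le_self hz.le
    simpa using Hc
  · apply le_max_of_le_right
    have Hc : (1:ℝ) ≤ (γ 1 0 : ℝ) ^ 2 := by
      have : 1 ≤ (γ 1 0) ^ 2 := by have := sq_pos_of_ne_zero hc; omega
      exact_mod_cast this
    have Hd : z.im ^ 2 ≤ ((γ 1 0 : ℝ) * z.re + γ 1 1) ^ 2 + ((γ 1 0 : ℝ) * z.im) ^ 2 := by
      nlinarith [sq_nonneg ((γ 1 0 : ℝ) * z.re + γ 1 1), sq_nonneg z.im]
    rw [div_le_div_iff₀ (lt_of_lt_of_le (pow_pos hz 2) Hd) hz]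
    nlinarith
lemma yc (a b Y Hb : ℝ) (hY : 0 < Y) (z : ℍ) (hz : z ∈ hbox a b Y Hb) :
    ∃ γ : SL(2, ℤ), γ • z ∈ hbox (-1/2) 1 (1/2) (max (max Hb (1 / Y)) 1) := by
  obtain ⟨g, hg⟩ := ModularGroup.exists_smul_mem_fd z
  refine ⟨g, ⟨?_, ?_⟩, ?_, ?_⟩
  · have := abs_le.1 hg.2; linarith [this.1]
  · have := abs_le.1 hg.2; linarith [this.2]
  · have := ModularGroup.three_le_four_mul_im_sq_of_mem_fd hg
    have := (g • z).im_pos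
    nlinarith
  · refine (yb g z).trans (le_max_of_le_left (max_le_max hz.2.2 ?_))
    exact one_div_le_one_div_of_le hY hz.2.1
end xy
section yd
open Real Finset Complex
open MeasureTheory UpperHalfPlane
open scoped ENNReal ComplexConjugate MatrixGroups ModularForm
open FixedDetMatrices
abbrev FDM (m : ℕ) := FixedDetMatrix (Fin 2) ℤ (m : ℤ)
lemma ye {m : ℤ} (A : FixedDetMatrix (Fin 2) ℤ m) : ∃ g : SL(2, ℤ), reduce A = g • A := by
  induction A using reduce_rec with
  | base A h =>
    by_cases Hc : 0 < A.1 0 0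
    · rw [reduce_of_pos h Hc]; exact ⟨_, rfl⟩
    · rw [reduce_of_not_pos h Hc]
      exact ⟨ModularGroup.T ^ (-(-A.1 0 1 / -A.1 1 1)) * (ModularGroup.S * ModularGroup.S), by simp only [mul_smul]⟩
  | step A Hc Hd =>
    obtain ⟨g, hg⟩ := Hd
    rw [reduce_reduceStep Hc] at hg
    refine ⟨g * (ModularGroup.S * ModularGroup.T ^ (-(A.1 0 0 / A.1 1 0))), ?_⟩
    rw [hg, reduceStep]; simp only [mul_smul]
abbrev OrbQ (m : ℕ) := MulAction.orbitRel.Quotient SL(2, ℤ) (FDM m)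
lemma so (m : ℕ) (hm : 0 < m) : Function.Surjective (fun A : reps (m:ℤ) => (Quotient.mk _ A.1 : OrbQ m)) := by
  intro q
  induction q using Quotient.inductionOn with
  | h A =>
    obtain ⟨g, hg⟩ := ye A
    refine ⟨⟨reduce A, reduce_mem_reps (by exact_mod_cast hm.ne') A⟩, ?_⟩
    apply Quotient.sound
    exact ⟨g, hg.symm⟩
lemma sp (m : ℕ) (hm : 0 < m) : Finite (OrbQ m) := Finite.of_surjective _ (so m hm)
lemma sr (m : ℕ) (hm : 0 < m) : Nat.card (OrbQ m) ≤ m.divisors.card * m := by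
  refine (Nat.card_le_card_of_surjective _ (so m hm)).trans ?_
  have key : ∀ A : reps (m:ℤ), 0 < A.1.1 1 1 ∧ A.1.1 0 0 * A.1.1 1 1 = m ∧ A.1.1 1 0 = 0 ∧ 0 ≤ A.1.1 0 1 ∧ A.1.1 0 1 < A.1.1 1 1 := by
    intro A
    obtain ⟨Hc, Hd, Hg, Hk⟩ := A.2
    have hd := A.1.2
    rw [Matrix.det_fin_two, Hc, mul_zero, sub_zero] at hd
    have Hl : 0 < A.1.1 1 1 := by
      have : (0:ℤ) < A.1.1 0 0 * A.1.1 1 1 := by rw [hd]; exact_mod_cast hm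
      exact pos_of_mul_pos_right this Hd.le
    rw [abs_of_nonneg Hg, abs_of_pos Hl] at Hk
    exact ⟨Hl, hd, Hc, Hg, Hk⟩
  have : Function.Injective (fun A : reps (m:ℤ) => ((⟨((A.1.1 1 1).toNat, (A.1.1 0 1).toNat), by
      obtain ⟨Hc, Hd, Hg, Hk, Hl⟩ := key A
      rw [mem_product]
      refine ⟨?_, ?_⟩
      · rw [Nat.mem_divisors]
        refine ⟨?_, hm.ne'⟩
        zify; rw [Int.toNat_of_nonneg Hc.le]
        exact ⟨A.1.1 0 0, Hd.symm.trans (mul_comm _ _)⟩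
      · rw [mem_range]
        zify; rw [Int.toNat_of_nonneg Hk]
        refine Hl.trans_le (Int.le_of_dvd (by exact_mod_cast hm) ⟨A.1.1 0 0, Hd.symm.trans (mul_comm _ _)⟩)⟩ : ↥(m.divisors ×ˢ range m)))) := by
    intro A B h
    obtain ⟨Hc, Hd, Hg, Hk, Hl⟩ := key A
    obtain ⟨Hr, Hs, qf, dx, dy⟩ := key B
    simp only [Subtype.mk.injEq, Prod.mk.injEq] at h
    have Hi : A.1.1 1 1 = B.1.1 1 1 := by omega
    have Hj : A.1.1 0 1 = B.1.1 0 1 := by omega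
    have Hu : A.1.1 0 0 = B.1.1 0 0 := by
      rw [Hi] at Hd; exact mul_right_cancel₀ Hr.ne' (Hd.trans Hs.symm)
    apply Subtype.ext
    apply FixedDetMatrices.ext
    intro i j
    fin_cases i <;> fin_cases j
    · exact Hu
    · exact Hj
    · exact Hg.trans qf.symm
    · exact Hi
  refine (Nat.card_le_card_of_injective _ this).trans ?_
  rw [Nat.card_eq_fintype_card, Fintype.card_coe, card_product, card_range]
noncomputable def toGL (m : ℕ) (hm : 0 < m) (A : FDM m) : GL (Fin 2) ℝ :=
  Matrix.GeneralLinearGroup.mkOfDetNeZero (A.1.map (Int.cast : ℤ → ℝ)) (by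
    have : (A.1.map (Int.cast : ℤ → ℝ)).det = ((A.1.det : ℤ) : ℝ) := by
      rw [Matrix.det_fin_two, Matrix.det_fin_two]; simp
    rw [this, A.2]; exact_mod_cast hm.ne')
lemma qg (m : ℕ) (hm : 0 < m) (A : FDM m) : (toGL m hm A).det.val = m := by
  have : (A.1.map (Int.cast : ℤ → ℝ)).det = ((A.1.det : ℤ) : ℝ) := by
      rw [Matrix.det_fin_two, Matrix.det_fin_two]; simp
  have Hd : (toGL m hm A).det.val = (A.1.map (Int.cast : ℤ → ℝ)).det := rfl
  rw [Hd, this, A.2]; simp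
def rmul (m : ℕ) (A : FDM m) (g : SL(2, ℤ)) : FDM m := ⟨A.1 * g.1, by rw [Matrix.det_mul, A.2, g.2, mul_one]⟩
lemma yf (m : ℕ) (hm : 0 < m) (A : FDM m) (g : SL(2, ℤ)) :
    toGL m hm (g • A) = (Matrix.SpecialLinearGroup.mapGL ℝ g) * toGL m hm A := by
  ext i j
  simp [toGL, Matrix.GeneralLinearGroup.mkOfDetNeZero, FixedDetMatrices.smul_coe, Matrix.mul_apply]
lemma yg (m : ℕ) (hm : 0 < m) (A : FDM m) (g : SL(2, ℤ)) :
    toGL m hm (rmul m A g) = toGL m hm A * (Matrix.SpecialLinearGroup.mapGL ℝ g) := by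
  ext i j
  simp [toGL, Matrix.GeneralLinearGroup.mkOfDetNeZero, rmul, Matrix.mul_apply]
def dlt (m : ℕ) (u : ℤ) : FDM m := ⟨!![1, -u; 0, (m:ℤ)], by simp [Matrix.det_fin_two]⟩
variable (F : ℍ → ℂ) (k : ℕ)
lemma qh (m : ℕ) (hm : 0 < m) (u : ℤ) (z : ℍ) :
    (F ∣[(k:ℤ)] (toGL m hm (dlt m u))) z = F (ofComplex (((z:ℂ) - u) / m)) / m := by
  rw [ModularForm.slash_apply, qg]
  have ej : (m:ℂ) ≠ 0 := by exact_mod_cast hm.ne'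
  have hd : denom (toGL m hm (dlt m u)) z = (m:ℂ) := by
    simp [denom, toGL, dlt, Matrix.GeneralLinearGroup.mkOfDetNeZero]
  have hs : σ (toGL m hm (dlt m u)) = ContinuousAlgEquiv.refl ℝ ℂ := by
    unfold σ; rw [if_pos]; rw [qg]; exact_mod_cast hm
  have hz : (toGL m hm (dlt m u)) • z = ofComplex (((z:ℂ) - u) / m) := by
    have hp : 0 < (((z:ℂ) - u) / m).im := by
      have : (((z:ℂ) - u) / m).im = z.im / m := by
        rw [← ofReal_natCast, div_ofReal_im]; simp
      rw [this]; have := z.im_pos; positivity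
    apply UpperHalfPlane.ext
    rw [ofComplex_apply_of_im_pos hp, UpperHalfPlane.coe_smul, hd, hs]
    simp [num, toGL, dlt, Matrix.GeneralLinearGroup.mkOfDetNeZero, sub_eq_add_neg]
  rw [hd, hs, hz]
  simp only [ContinuousAlgEquiv.refl_apply, Nat.abs_cast, zpow_neg, zpow_natCast]
  push_cast
  rw [zpow_sub₀ ej]
  simp
  field_simp
variable {F k}
lemma yh (hF : ∀ g : SL(2, ℤ), F ∣[(k:ℤ)] g = F) (m : ℕ) (hm : 0 < m) (A : FDM m) (g : SL(2, ℤ)) :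
    F ∣[(k:ℤ)] (toGL m hm (g • A)) = F ∣[(k:ℤ)] (toGL m hm A) := by
  rw [yf, SlashAction.slash_mul]
  congr 1
  exact hF g
lemma ss (m : ℕ) (hm : 0 < m) (A : FDM m) (g : SL(2, ℤ)) :
    F ∣[(k:ℤ)] (toGL m hm (rmul m A g)) = (F ∣[(k:ℤ)] (toGL m hm A)) ∣[(k:ℤ)] g := by
  rw [yg, SlashAction.slash_mul]; rfl
lemma st (hF : ∀ g : SL(2, ℤ), F ∣[(k:ℤ)] g = F) (m : ℕ) (hm : 0 < m) (A : FDM m) :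
    F ∣[(k:ℤ)] (toGL m hm (Quotient.mk _ A : OrbQ m).out) = F ∣[(k:ℤ)] (toGL m hm A) := by
  have := Quotient.mk_out (s := MulAction.orbitRel SL(2, ℤ) (FDM m)) A
  obtain ⟨g, hg⟩ := this
  rw [← hg]
  exact yh hF m hm A g
lemma su (B2 : ℝ) (hB : ∀ z, ‖petersson k F F z‖ ≤ B2) (m : ℕ) (hm : 0 < m) (A : FDM m) (hk : 2 ≤ k) (z : ℍ) :
    ‖(F ∣[(k:ℤ)] (toGL m hm A)) z‖ ^ 2 * z.im ^ k ≤ (m:ℝ) ^ (k - 2) * B2 := by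
  have Hc := petersson_slash k F F (toGL m hm A) z
  have Hd : ‖petersson k (F ∣[(k:ℤ)] (toGL m hm A)) (F ∣[(k:ℤ)] (toGL m hm A)) z‖ = ‖(F ∣[(k:ℤ)] (toGL m hm A)) z‖ ^ 2 * z.im ^ k := by
    rw [petersson, norm_mul, norm_mul, RCLike.norm_conj, norm_zpow, Complex.norm_of_nonneg z.im_pos.le, zpow_natCast, sq]
  rw [← Hd, Hc, norm_mul, norm_σ, qg, Nat.abs_cast, norm_zpow]
  have Hg : ‖((m:ℝ):ℂ)‖ ^ ((k:ℤ) - 2) = (m:ℝ) ^ (k - 2) := by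
    rw [Complex.norm_of_nonneg (by positivity), ← zpow_natCast]; congr 1; omega
  rw [Hg]
  gcongr
  exact hB _
lemma yi (B2 : ℝ) (gc : 0 ≤ B2) (hB : ∀ z, ‖petersson k F F z‖ ≤ B2) (o Ha : ℕ) (Hc : 0 < o) (Hd : 0 < Ha) (sv : FDM o) (sw : FDM Ha) (hk : 2 ≤ k) (z : ℍ) :
    ‖petersson k (F ∣[(k:ℤ)] (toGL Ha Hd sw)) (F ∣[(k:ℤ)] (toGL o Hc sv)) z‖ ≤ √(((o:ℝ) * Ha) ^ (k - 2)) * B2 := by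
  have Hi := su B2 hB o Hc sv hk z
  have Hj := su B2 hB Ha Hd sw hk z
  rw [petersson, norm_mul, norm_mul, RCLike.norm_conj, norm_zpow, Complex.norm_of_nonneg z.im_pos.le, zpow_natCast]
  apply abs_le_of_sq_le_sq' _ (by positivity) |>.2
  rw [mul_pow √_, sq_sqrt (by positivity), mul_pow (o:ℝ)]
  have Hg := mul_le_mul Hi Hj (by have := z.im_pos; positivity) (by positivity)
  calc _ = _ := by ring
    _ ≤ _ := Hg
    _ = _ := by ring
def rrel (m : ℕ) (ee : SL(2, ℤ)) (u Hf : ℤ) : Prop := (m:ℤ) ∣ ee 0 0 * u + ee 0 1 - Hf * (ee 1 0 * u + ee 1 1)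
lemma sx (m : ℕ) (hm : 0 < m) (γ ee : SL(2, ℤ)) (u Hf : ℤ) :
    (Quotient.mk _ (rmul m (dlt m u) γ⁻¹) : OrbQ m) = Quotient.mk _ (rmul m (dlt m Hf) (γ * ee⁻¹)⁻¹) ↔ rrel m ee u Hf := by
  have ej : (m:ℤ) ≠ 0 := by exact_mod_cast hm.ne'
  have hdet := ee.det_coe
  rw [Matrix.det_fin_two] at hdet
  have red : (∃ g : SL(2, ℤ), g.1 * ((dlt m Hf).1 * ee.1) = (dlt m u).1) ↔ rrel m ee u Hf := by
    constructor
    · rintro ⟨g, hg⟩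
      have hgd := g.det_coe
      rw [Matrix.det_fin_two] at hgd
      have qi := congrFun (congrFun hg 0) 0
      have cr := congrFun (congrFun hg 0) 1
      simp [dlt, Matrix.mul_apply, Fin.sum_univ_two, Matrix.vecMul, dotProduct] at qi cr
      refine ⟨-g.1 0 1, ?_⟩
      have sy : g.1 0 0 * (ee 0 0 - Hf * ee 1 0) + g.1 0 1 * (m * ee 1 0) = 1 := by linarith
      have sz : g.1 0 0 * (ee 0 1 - Hf * ee 1 1) + g.1 0 1 * (m * ee 1 1) = -u := by linarith
      have ez : g.1 0 0 = ee 1 1 + u * ee 1 0 := by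
        linear_combination (ee 1 1) * sy - ee 1 0 * sz - g.1 0 0 * hdet
      linear_combination (ee 0 0 - Hf * ee 1 0) * sz - (ee 0 1 - Hf * ee 1 1) * sy - g.1 0 1 * m * hdet
    · rintro ⟨t, ht⟩
      refine ⟨⟨!![ee 1 1 + u * ee 1 0, -t; -m * ee 1 0, ee 0 0 - Hf * ee 1 0], ?_⟩, ?_⟩
      · rw [Matrix.det_fin_two]; simp
        linear_combination hdet + ee 1 0 * ht
      · ext i j
        fin_cases i <;> fin_cases j <;> simp [dlt, Matrix.mul_apply, Fin.sum_univ_two, Matrix.vecMul, dotProduct]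
        · linear_combination hdet + ee 1 0 * ht
        · linear_combination -u * hdet + ee 1 1 * ht
        · ring
        · linear_combination m * hdet
  rw [← red, Quotient.eq]
  constructor
  · rintro ⟨g, hg⟩
    refine ⟨g, ?_⟩
    have := congrArg Subtype.val hg
    change g.1 * ((dlt m Hf).1 * ((γ * ee⁻¹)⁻¹).1) = (dlt m u).1 * (γ⁻¹).1 at this
    have Hd := congrArg (fun A => A * γ.1) this
    simp only [mul_inv_rev, inv_inv, Matrix.SpecialLinearGroup.coe_mul] at Hd
    simp only [Matrix.mul_assoc, ← Matrix.SpecialLinearGroup.coe_mul, inv_mul_cancel, Matrix.SpecialLinearGroup.coe_one, mul_one] at Hd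
    rw [← Hd, inv_mul_cancel_right]
  · rintro ⟨g, hg⟩
    refine ⟨g, ?_⟩
    apply Subtype.ext
    change g.1 * ((dlt m Hf).1 * ((γ * ee⁻¹)⁻¹).1) = (dlt m u).1 * (γ⁻¹).1
    simp only [mul_inv_rev, inv_inv, Matrix.SpecialLinearGroup.coe_mul]
    rw [← hg]
    simp only [Matrix.mul_assoc]
end yd
section yj
open Real Finset Complex
open MeasureTheory UpperHalfPlane
open scoped ENNReal ComplexConjugate MatrixGroups
open Classical in
noncomputable def Phi (f : ℤ) (o Ha : ℕ) (u : ℤ × ℤ) (x : ℝ) : ℂ :=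
  Complex.exp (2 * Real.pi * Complex.I * (-(f * (x - u.1) / o) + f * (x - u.2) / Ha))
lemma qj (f : ℤ) (o Ha : ℕ) (u : ℤ × ℤ) (x : ℝ) : ‖Phi f o Ha u x‖ = 1 := by
  have : 2 * (Real.pi:ℂ) * Complex.I * (-(f * (x - u.1) / o) + f * (x - u.2) / Ha) =
    ((2 * Real.pi * (-(f * (x - u.1) / o) + f * (x - u.2) / Ha) : ℝ) : ℂ) * Complex.I := by push_cast; ring
  rw [Phi, this, norm_exp_ofReal_mul_I]
lemma yk (f : ℤ) (o Ha : ℕ) (u : ℤ × ℤ) (x : ℝ) : conj (Phi f o Ha u x) =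
   Complex.exp (-(2 * Real.pi * Complex.I * (-(f * (x - u.1) / o) + f * (x - u.2) / Ha))) := by
  have : 2 * (Real.pi:ℂ) * Complex.I * (-(f * (x - u.1) / o) + f * (x - u.2) / Ha) =
    ((2 * Real.pi * (-(f * (x - u.1) / o) + f * (x - u.2) / Ha) : ℝ) : ℂ) * Complex.I := by push_cast; ring
  rw [Phi, this, ← exp_conj, map_mul, conj_ofReal, conj_I, mul_neg]
lemma qk (f : ℤ) (o Ha : ℕ) (u : ℤ × ℤ) : Continuous (Phi f o Ha u) := by
  unfold Phi; fun_prop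
noncomputable def Uf (o Ha : ℕ) : Finset (ℤ × ℤ) := Ico 0 (o : ℤ) ×ˢ Ico 0 (Ha : ℤ)
open Classical in
noncomputable def gterm (f : ℤ) (o Ha : ℕ) (ee : SL(2, ℤ)) (u Hf : ℤ × ℤ) (x ek : ℝ) : ℂ :=
  if rrel o ee u.1 Hf.1 ∧ rrel Ha ee u.2 Hf.2 then Phi f o Ha u x * conj (Phi f o Ha Hf ek) else 0
lemma ql (c : ℕ) (hc : 0 < c) (ee : SL(2, ℤ)) (he : ee 1 0 = c) (w : ℍ) :
    (ee • ((-((ee 1 1 : ℤ) : ℝ) / c : ℝ) +ᵥ w)).re = (ee 0 0 : ℤ) / c - w.re / (c ^ 2 * normSq w) ∧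
    (ee • ((-((ee 1 1 : ℤ) : ℝ) / c : ℝ) +ᵥ w)).im = w.im / (c ^ 2 * normSq w) := by
  have hdet := ee.det_coe
  rw [Matrix.det_fin_two] at hdet
  have ef : (c:ℂ) ≠ 0 := by exact_mod_cast hc.ne'
  have hcr : (c:ℝ) ≠ 0 := by exact_mod_cast hc.ne'
  have hw : (w:ℂ) ≠ 0 := UpperHalfPlane.ne_zero w
  have hN : normSq (w:ℂ) ≠ 0 := by simpa using hw
  have key : ((ee • ((-((ee 1 1 : ℤ) : ℝ) / c : ℝ) +ᵥ w) : ℍ) : ℂ) = (((ee 0 0 : ℤ) / c : ℝ) : ℂ) - ((1 / c ^ 2 : ℝ) : ℂ) * (w:ℂ)⁻¹ := by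
    rw [UpperHalfPlane.coe_specialLinearGroup_apply]
    simp only [algebraMap_int_eq, eq_intCast, coe_vadd]
    have yl : ((ee 0 0 : ℤ) : ℂ) * (ee 1 1 : ℤ) - (ee 0 1 : ℤ) * c = 1 := by
      rw [he] at hdet; exact_mod_cast hdet
    rw [he]
    push_cast
    have hd : (c:ℂ) * (-((ee 1 1 : ℤ) : ℂ) / c + w) + (ee 1 1 : ℤ) = c * w := by field_simp; ring
    rw [hd]
    field_simp
    linear_combination (-1) * yl
  constructor
  · rw [← UpperHalfPlane.coe_re, key, sub_re, ofReal_re, re_ofReal_mul, inv_re, UpperHalfPlane.coe_re]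
    field_simp
  · rw [← UpperHalfPlane.coe_im, key, sub_im, ofReal_im, im_ofReal_mul, inv_im, UpperHalfPlane.coe_im]
    field_simp; ring
lemma ym (c : ℕ) (hc : 0 < c) (x : ℝ) (d : ℤ) :
    (0 ≤ -(d:ℝ) / c + x ∧ -(d:ℝ) / c + x < 1) ↔ d ∈ Ico (⌊c * x⌋ - c + 1) (⌊c * x⌋ - c + 1 + c) := by
  have ef : (0:ℝ) < c := by exact_mod_cast hc
  have e : -(d:ℝ) / c + x = (c * x - d) / c := by field_simp; ring
  rw [e, mem_Ico, le_div_iff₀ ef, div_lt_iff₀ ef, zero_mul, one_mul, sub_nonneg, ← Int.le_floor]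
  have : c * x - d < c ↔ ⌊c * x⌋ < d + c := by rw [Int.floor_lt]; push_cast; constructor <;> intro h <;> linarith
  rw [this]
  constructor <;> rintro ⟨Hc, Hd⟩ <;> constructor <;> omega
lemma yn (c : ℕ) (hc : 0 < c) (x : ℝ) (a : ℤ) :
    (0 ≤ (a:ℝ) / c - x ∧ (a:ℝ) / c - x < 1) ↔ a ∈ Ico (⌈c * x⌉) (⌈c * x⌉ + c) := by
  have ef : (0:ℝ) < c := by exact_mod_cast hc
  have e : (a:ℝ) / c - x = (a - c * x) / c := by field_simp
  rw [e, mem_Ico, le_div_iff₀ ef, div_lt_iff₀ ef, zero_mul, one_mul, sub_nonneg, ← Int.ceil_le]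
  have : a - c * x < c ↔ a - c < ⌈c * x⌉ := by rw [Int.lt_ceil]; push_cast; constructor <;> intro h <;> linarith
  rw [this]
  constructor <;> rintro ⟨Hc, Hd⟩ <;> constructor <;> omega
open Classical in
noncomputable def kterm (c o Ha : ℕ) (f : ℤ) (x : ℤ × ℤ) : ℂ :=
  ∑ u ∈ Uf o Ha, ∑ Hf ∈ Uf o Ha, 
    if ((c * o : ℕ) : ℤ) ∣ (x.1 + c * u.1) * (x.2 - c * Hf.1) - 1 ∧
       ((c * Ha : ℕ) : ℤ) ∣ (x.1 + c * u.2) * (x.2 - c * Hf.2) - 1 then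
      Complex.exp (2 * Real.pi * Complex.I * (f * ((x.1 + c * u.1) + (x.2 - c * Hf.1)) / (c * o) -
        f * ((x.1 + c * u.2) + (x.2 - c * Hf.2)) / (c * Ha))) else 0
lemma yo (c o Ha : ℕ) (f Hx jd : ℤ) : KK c o Ha f Hx jd =
    ∑ x ∈ Ico Hx (Hx + c) ×ˢ Ico jd (jd + c), kterm c o Ha f x := by
  rw [KK, kbox, kbox, sum_product, sum_product]
  refine sum_congr rfl fun d _ => ?_
  unfold kterm
  conv_rhs => rw [sum_comm]
  refine sum_congr rfl fun u _ => ?_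
  rw [sum_product]
  rfl
lemma ta (c o Ha : ℕ) (hc : 0 < c) (Hc : 0 < o) (Hd : 0 < Ha) (f : ℤ) (ee : SL(2, ℤ)) (he : ee 1 0 = c) (x ek : ℝ) :
    ∑ u ∈ Uf o Ha, ∑ Hf ∈ Uf o Ha, gterm f o Ha ee u Hf (-((ee 1 1 : ℤ) : ℝ) / c + x) ((ee 0 0 : ℤ) / c - ek) =
    Complex.exp (2 * Real.pi * Complex.I * (-(f * (x + ek) / o) + f * (x + ek) / Ha)) * kterm c o Ha f (ee 1 1, ee 0 0) := by
  rw [kterm, mul_sum]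
  refine sum_congr rfl fun u _ => ?_
  rw [mul_sum]
  refine sum_congr rfl fun Hf _ => ?_
  have hdet := ee.det_coe
  rw [Matrix.det_fin_two, he] at hdet
  have eu : (c:ℤ) ≠ 0 := by exact_mod_cast hc.ne'
  have ef : (c:ℂ) ≠ 0 := by exact_mod_cast hc.ne'
  have rs : (o:ℂ) ≠ 0 := by exact_mod_cast Hc.ne'
  have rt : (Ha:ℂ) ≠ 0 := by exact_mod_cast Hd.ne'
  have hrel : ∀ (m : ℕ) (v gk : ℤ), rrel m ee v gk ↔ ((c * m : ℕ) : ℤ) ∣ (ee 1 1 + c * v) * (ee 0 0 - c * gk) - 1 := by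
    intro m v gk
    rw [rrel, he, ← Int.mul_dvd_mul_iff_left eu]
    push_cast
    have : (c:ℤ) * (ee 0 0 * v + ee 0 1 - gk * (c * v + ee 1 1)) = (ee 1 1 + c * v) * (ee 0 0 - c * gk) - 1 := by
      linear_combination (-1) * hdet
    rw [this]
  unfold gterm
  rw [hrel, hrel]
  dsimp only
  split_ifs with hh
  · rw [yk, Phi, ← Complex.exp_add, ← Complex.exp_add]
    congr 1
    push_cast
    field_simp
    ring
  · rw [mul_zero]
open Classical in
lemma ptw (c o Ha : ℕ) (hc : 0 < c) (Hc : 0 < o) (Hd : 0 < Ha) (f : ℤ) (E : Finset SL(2, ℤ)) (hEc : ∀ ee ∈ E, ee 1 0 = c)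
    (Y Hb : ℝ) (hE : ∀ ee : SL(2, ℤ), ee 1 0 = c → ∀ z ∈ hbox 0 1 Y Hb, ee • z ∈ hbox 0 1 Y Hb → ee ∈ E) (w : ℍ) :
    ‖∑ ee ∈ E, (if ((-((ee 1 1 : ℤ) : ℝ) / c : ℝ) +ᵥ w) ∈ hbox 0 1 Y Hb ∧ ee • ((-((ee 1 1 : ℤ) : ℝ) / c : ℝ) +ᵥ w) ∈ hbox 0 1 Y Hb then
      ∑ u ∈ Uf o Ha, ∑ Hf ∈ Uf o Ha, gterm f o Ha ee u Hf ((-((ee 1 1 : ℤ) : ℝ) / c : ℝ) +ᵥ w).re (ee • ((-((ee 1 1 : ℤ) : ℝ) / c : ℝ) +ᵥ w)).re else 0)‖ ≤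
    if (Y ≤ w.im ∧ w.im ≤ Hb) ∧ (Y ≤ w.im / (c ^ 2 * normSq w) ∧ w.im / (c ^ 2 * normSq w) ≤ Hb) then ‖KK c o Ha f 0 0‖ else 0 := by
  set ek := w.re / (c ^ 2 * normSq w) with dz
  set gz := w.im / (c ^ 2 * normSq w) with qm
  have hmem : ∀ ee : SL(2, ℤ), ee 1 0 = c → ((((-((ee 1 1 : ℤ) : ℝ) / c : ℝ) +ᵥ w) ∈ hbox 0 1 Y Hb ∧ ee • ((-((ee 1 1 : ℤ) : ℝ) / c : ℝ) +ᵥ w) ∈ hbox 0 1 Y Hb) ↔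
     ((Y ≤ w.im ∧ w.im ≤ Hb) ∧ (Y ≤ gz ∧ gz ≤ Hb)) ∧ (ee 1 1 ∈ Ico (⌊c * w.re⌋ - c + 1) (⌊c * w.re⌋ - c + 1 + c) ∧ ee 0 0 ∈ Ico (⌈c * ek⌉) (⌈c * ek⌉ + c))) := by
    intro ee he
    rw [← ym c hc, ← yn c hc]
    have := ql c hc ee he w
    simp only [hbox, Set.mem_ofPred_eq, this.1, this.2, vadd_re, vadd_im]
    tauto
  by_cases hcond : (Y ≤ w.im ∧ w.im ≤ Hb) ∧ (Y ≤ gz ∧ gz ≤ Hb)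
  swap
  · rw [if_neg hcond, sum_eq_zero, norm_zero]
    intro ee hee
    rw [if_neg]
    rw [hmem ee (hEc ee hee)]
    tauto
  rw [if_pos hcond]
  have : ∑ ee ∈ E, (if ((-((ee 1 1 : ℤ) : ℝ) / c : ℝ) +ᵥ w) ∈ hbox 0 1 Y Hb ∧ ee • ((-((ee 1 1 : ℤ) : ℝ) / c : ℝ) +ᵥ w) ∈ hbox 0 1 Y Hb then
      ∑ u ∈ Uf o Ha, ∑ Hf ∈ Uf o Ha, gterm f o Ha ee u Hf ((-((ee 1 1 : ℤ) : ℝ) / c : ℝ) +ᵥ w).re (ee • ((-((ee 1 1 : ℤ) : ℝ) / c : ℝ) +ᵥ w)).re else 0) =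
      Complex.exp (2 * Real.pi * Complex.I * (-(f * (w.re + ek) / o) + f * (w.re + ek) / Ha)) * KK c o Ha f (⌊c * w.re⌋ - c + 1) (⌈c * ek⌉) := by
    rw [yo, mul_sum]
    refine sum_bij_ne_zero (fun ee _ _ => ((ee 1 1 : ℤ), (ee 0 0 : ℤ))) ?_ ?_ ?_ ?_
    · intro ee hee hne
      have h := (ite_ne_right_iff.mp hne).1
      rw [hmem ee (hEc ee hee)] at h
      exact mem_product.mpr h.2
    · intro Hi tb _ Hj tc _ heq
      rw [Prod.mk.injEq] at heq
      have cf := Hi.det_coe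
      have cg := Hj.det_coe
      rw [Matrix.det_fin_two, hEc Hi tb, heq.1, heq.2] at cf
      rw [Matrix.det_fin_two, hEc Hj tc] at cg
      have eu : (c:ℤ) ≠ 0 := by exact_mod_cast hc.ne'
      have : Hi 0 1 = Hj 0 1 := mul_right_cancel₀ eu (by linarith)
      ext i j
      fin_cases i <;> fin_cases j
      · exact heq.2
      · exact this
      · exact (hEc Hi tb).trans (hEc Hj tc).symm
      · exact heq.1
    · rintro ⟨d, a⟩ hx hne
      have hk := right_ne_zero_of_mul hne
      obtain ⟨u, hu, yp⟩ := exists_ne_zero_of_sum_ne_zero hk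
      obtain ⟨Hf, pa, yq⟩ := exists_ne_zero_of_sum_ne_zero yp
      have hd := (ite_ne_right_iff.mp yq).1.1
      dsimp only at hd
      have hcd : (c:ℤ) ∣ d * a - 1 := by
        have : (c:ℤ) ∣ (d + c * u.1) * (a - c * Hf.1) - 1 := (Dvd.intro _ (by push_cast; rfl)).trans hd
        have Hg : d * a - 1 = ((d + c * u.1) * (a - c * Hf.1) - 1) - c * (u.1 * a - (d + c * u.1) * Hf.1) := by ring
        rw [Hg]
        exact dvd_sub this (Dvd.intro _ rfl)
      obtain ⟨b, hb⟩ := hcd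
      let ee : SL(2, ℤ) := ⟨!![a, b; (c:ℤ), d], by rw [Matrix.det_fin_two]; simp; linarith⟩
      have ci : ee 1 0 = c := rfl
      have td : ee 1 1 = d := rfl
      have te : ee 0 0 = a := rfl
      have hm := (hmem ee ci).mpr ⟨hcond, by rw [td, te]; exact mem_product.mp hx⟩
      refine ⟨ee, hE ee ci _ hm.1 hm.2, ?_, by rw [td, te]⟩
      rw [if_pos hm, (ql c hc ee ci w).1, vadd_re, ta c o Ha hc Hc Hd f ee ci]
      exact hne
    · intro ee hee hne
      have h := (ite_ne_right_iff.mp hne).1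
      rw [if_pos h, (ql c hc ee (hEc ee hee) w).1, vadd_re, ta c o Ha hc Hc Hd f ee (hEc ee hee)]
  rw [this, norm_mul, xc c o Ha hc Hc Hd]
  have e : 2 * (Real.pi:ℂ) * Complex.I * (-(f * (w.re + ek) / o) + f * (w.re + ek) / Ha) =
    ((2 * Real.pi * (-(f * (w.re + ek) / o) + f * (w.re + ek) / Ha) : ℝ) : ℂ) * Complex.I := by push_cast; ring
  rw [e, norm_exp_ofReal_mul_I, one_mul]
end yj
section yr
open Real Finset Complex
open MeasureTheory UpperHalfPlane
open scoped ENNReal ComplexConjugate MatrixGroups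
lemma qn (t : ℝ) : ∃ g : GL (Fin 2) ℝ, ∀ w : ℍ, t +ᵥ w = g • w := by
  refine ⟨Matrix.GeneralLinearGroup.mkOfDetNeZero !![1, t; 0, 1] (by simp), fun w => ?_⟩
  have hs : σ (Matrix.GeneralLinearGroup.mkOfDetNeZero !![1, t; 0, 1] (by simp)) = ContinuousAlgEquiv.refl ℝ ℂ := by
    unfold σ; rw [if_pos]; 
    simp [Matrix.GeneralLinearGroup.mkOfDetNeZero]
  apply UpperHalfPlane.ext
  rw [UpperHalfPlane.coe_smul, hs]
  simp [num, denom, Matrix.GeneralLinearGroup.mkOfDetNeZero, add_comm]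
lemma fa (t : ℝ) : Measurable (fun w : ℍ => t +ᵥ w) := by
  obtain ⟨g, hg⟩ := qn t
  simp only [hg]
  exact (continuous_const_smul g).measurable
lemma ys (h : ℍ → ℂ) (t : ℝ) : ∫ z, h z = ∫ w : ℍ, h (t +ᵥ w) := by
  obtain ⟨g, hg⟩ := qn t
  simp only [hg]
  exact (integral_smul_eq_self h (g := g)).symm
lemma yt (h : ℍ → ℂ) (hh : Integrable h) (t : ℝ) : Integrable (fun w : ℍ => h (t +ᵥ w)) := by
  obtain ⟨g, hg⟩ := qn t
  simp only [hg]
  exact (measurePreserving_smul g (volume : Measure ℍ)).integrable_comp_of_integrable hh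
lemma tf (f : ℤ) (o Ha : ℕ) (ee : SL(2, ℤ)) (u Hf : ℤ × ℤ) (x ek : ℝ) : ‖gterm f o Ha ee u Hf x ek‖ ≤ 1 := by
  unfold gterm; split_ifs
  · rw [norm_mul, RCLike.norm_conj, qj, qj, one_mul]
  · simp
noncomputable def gsum (f : ℤ) (o Ha : ℕ) (ee : SL(2, ℤ)) (z : ℍ) : ℂ :=
  ∑ u ∈ Uf o Ha, ∑ Hf ∈ Uf o Ha, gterm f o Ha ee u Hf z.re (ee • z).re
lemma yu (f : ℤ) (o Ha : ℕ) (ee : SL(2, ℤ)) : Continuous (gsum f o Ha ee) := by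
  unfold gsum
  refine continuous_finsetSum _ fun u _ => continuous_finsetSum _ fun Hf _ => ?_
  have Hd : Continuous fun z : ℍ => (ee • z).re := UpperHalfPlane.continuous_re.comp (continuous_const_smul (Matrix.SpecialLinearGroup.mapGL ℝ ee : GL (Fin 2) ℝ))
  unfold gterm
  split_ifs
  · exact ((qk f o Ha u).comp UpperHalfPlane.continuous_re).mul (continuous_conj.comp ((qk f o Ha Hf).comp Hd))
  · exact continuous_const
lemma yv (f : ℤ) (o Ha : ℕ) (ee : SL(2, ℤ)) (z : ℍ) : ‖gsum f o Ha ee z‖ ≤ (Uf o Ha).card * (Uf o Ha).card := by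
  unfold gsum
  refine (norm_sum_le _ _).trans ?_
  rw [← nsmul_eq_mul]
  refine sum_le_card_nsmul _ _ _ fun u _ => ?_
  refine (norm_sum_le _ _).trans ?_
  have := sum_le_card_nsmul (Uf o Ha) (fun Hf => ‖gterm f o Ha ee u Hf z.re (ee • z).re‖) 1 fun Hf _ => tf _ _ _ _ _ _ _ _
  simpa using this
open Classical in
noncomputable def hterm (f : ℤ) (o Ha : ℕ) (Y Hb : ℝ) (ee : SL(2, ℤ)) (z : ℍ) : ℂ :=
  if z ∈ hbox 0 1 Y Hb ∧ ee • z ∈ hbox 0 1 Y Hb then gsum f o Ha ee z else 0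
lemma tg (f : ℤ) (o Ha : ℕ) (Y Hb : ℝ) (hY : 0 < Y) (ee : SL(2, ℤ)) : Integrable (hterm f o Ha Y Hb ee) := by
  have hS : MeasurableSet {z : ℍ | z ∈ hbox 0 1 Y Hb ∧ ee • z ∈ hbox 0 1 Y Hb} :=
    (jp 0 1 Y Hb).inter ((jp 0 1 Y Hb).preimage (measurable_const_smul ee))
  have e : hterm f o Ha Y Hb ee = {z : ℍ | z ∈ hbox 0 1 Y Hb ∧ ee • z ∈ hbox 0 1 Y Hb}.indicator (gsum f o Ha ee) := by
    ext z
    by_cases h : z ∈ hbox 0 1 Y Hb ∧ ee • z ∈ hbox 0 1 Y Hb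
    · rw [hterm, if_pos h, Set.indicator_of_mem (by exact h)]
    · rw [hterm, if_neg h, Set.indicator_of_notMem (by exact h)]
  rw [e, integrable_indicator_iff hS]
  refine Measure.integrableOn_of_bounded (M := (Uf o Ha).card * (Uf o Ha).card) ?_ (yu f o Ha ee).aestronglyMeasurable (Filter.Eventually.of_forall (yv f o Ha ee))
  exact ne_top_of_le_ne_top (gj 0 1 Y Hb hY) (measure_mono fun z hz => hz.1)
lemma yw (c : ℕ) (hc : 0 < c) (Y Hb : ℝ) (hY : 0 < Y) (ev : Hb ≤ 2 * Y) (w : ℍ)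
    (h : (Y ≤ w.im ∧ w.im ≤ Hb) ∧ (Y ≤ w.im / (c ^ 2 * normSq w) ∧ w.im / (c ^ 2 * normSq w) ≤ Hb)) :
    w ∈ hbox (-3 / (2 * c)) (3 / (2 * c)) Y Hb := by
  obtain ⟨⟨Hc, Hd⟩, Hg, -⟩ := h
  have ef : (0:ℝ) < c := by exact_mod_cast hc
  have hw := w.im_pos
  have hN : 0 < normSq (w:ℂ) := UpperHalfPlane.normSq_pos w
  rw [le_div_iff₀ (by positivity), normSq_apply, UpperHalfPlane.coe_re, UpperHalfPlane.coe_im] at Hg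
  have Hk : (c * w.re) ^ 2 ≤ 2 := by
    have : Y * (c * w.re) ^ 2 ≤ Y * 2 := by
      have : 0 ≤ Y * (c * w.im) ^ 2 := by positivity
      nlinarith
    exact le_of_mul_le_mul_left this hY
  have Hl := abs_lt_of_sq_lt_sq' (show (c * w.re) ^ 2 < (3/2) ^ 2 by linarith) (by norm_num)
  refine ⟨⟨?_, ?_⟩, Hc, Hd⟩
  · rw [div_le_iff₀ (by positivity)]; linarith
  · rw [lt_div_iff₀ (by positivity)]; linarith
open Classical in
lemma yx (c o Ha : ℕ) (hc : 0 < c) (Hc : 0 < o) (Hd : 0 < Ha) (f : ℤ) (E : Finset SL(2, ℤ)) (hEc : ∀ ee ∈ E, ee 1 0 = c)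
    (Y Hb : ℝ) (hY : 0 < Y) (hYY : Y ≤ Hb) (ev : Hb ≤ 2 * Y) (hE : ∀ ee : SL(2, ℤ), ee 1 0 = c → ∀ z ∈ hbox 0 1 Y Hb, ee • z ∈ hbox 0 1 Y Hb → ee ∈ E) :
    ‖∑ ee ∈ E, ∫ z, hterm f o Ha Y Hb ee z‖ ≤ 3 * (1 / Y - 1 / Hb) * (‖KK c o Ha f 0 0‖ / c) := by
  have Hi : ∑ ee ∈ E, ∫ z, hterm f o Ha Y Hb ee z = ∫ w : ℍ, ∑ ee ∈ E, hterm f o Ha Y Hb ee ((-((ee 1 1 : ℤ) : ℝ) / c : ℝ) +ᵥ w) := by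
    rw [integral_finsetSum]
    · refine sum_congr rfl fun ee _ => ys _ _
    · intro ee _
      exact yt _ (tg f o Ha Y Hb hY ee) _
  rw [Hi]
  have ef : (0:ℝ) < c := by exact_mod_cast hc
  have hle : ∀ w : ℍ, ‖∑ ee ∈ E, hterm f o Ha Y Hb ee ((-((ee 1 1 : ℤ) : ℝ) / c : ℝ) +ᵥ w)‖ ≤
      (hbox (-3 / (2 * c)) (3 / (2 * c)) Y Hb).indicator (fun _ => ‖KK c o Ha f 0 0‖) w := by
    intro w
    refine (ptw c o Ha hc Hc Hd f E hEc Y Hb hE w).trans ?_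
    split_ifs with h
    · rw [Set.indicator_of_mem (yw c hc Y Hb hY ev w h)]
    · exact Set.indicator_nonneg (fun _ _ => norm_nonneg _) _
  refine (norm_integral_le_of_norm_le ?_ (Filter.Eventually.of_forall hle)).trans ?_
  · rw [integrable_indicator_iff (jp _ _ _ _)]
    exact integrableOn_const (gj _ _ _ _ hY)
  · rw [integral_indicator (jp _ _ _ _), setIntegral_const, qe _ _ _ _ _ hY hYY, smul_eq_mul]
    · apply le_of_eq; field_simp; ring
    · rw [div_le_div_iff_of_pos_right (by positivity)]; norm_num
lemma qo (ee : SL(2, ℤ)) (z : ℍ) : (-ee) • z = ee • z := ModularGroup.SL_neg_smul ee z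
open Classical in
lemma th (f : ℤ) (o Ha : ℕ) (Y Hb : ℝ) (ee : SL(2, ℤ)) (z : ℍ) : hterm f o Ha Y Hb (-ee) z = hterm f o Ha Y Hb ee z := by
  have hr : ∀ (m : ℕ) (u Hf : ℤ), rrel m (-ee) u Hf ↔ rrel m ee u Hf := by
    intro m u Hf
    unfold rrel
    rw [← dvd_neg]
    simp only [Matrix.SpecialLinearGroup.coe_neg, Matrix.neg_apply]
    ring_nf
  have hg : gsum f o Ha (-ee) z = gsum f o Ha ee z := by
    unfold gsum
    refine sum_congr rfl fun u _ => sum_congr rfl fun Hf _ => ?_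
    unfold gterm
    rw [qo]
    exact if_congr (by rw [hr, hr]) rfl rfl
  unfold hterm
  rw [hg]
  exact if_congr (by rw [qo]) rfl rfl
lemma yy (Y Hb : ℝ) (ee : SL(2, ℤ)) (Hm : ee 1 0 = 0) (z : ℍ) (hz : z ∈ hbox 0 1 Y Hb) (eo : ee • z ∈ hbox 0 1 Y Hb) : ee = 1 ∨ ee = -1 := by
  have hdet := ee.det_coe
  rw [Matrix.det_fin_two, Hm, mul_zero, sub_zero] at hdet
  have hre : (ee • z).re = z.re + ee 0 1 * ee 0 0 ∧ (ee 0 0 = 1 ∧ ee 1 1 = 1 ∨ ee 0 0 = -1 ∧ ee 1 1 = -1) := by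
    have hh := Int.mul_eq_one_iff_eq_one_or_neg_one.mp hdet
    refine ⟨?_, hh⟩
    rw [← UpperHalfPlane.coe_re, UpperHalfPlane.coe_specialLinearGroup_apply]
    simp only [algebraMap_int_eq, eq_intCast, Hm]
    rcases hh with ⟨Hi, Hj⟩ | ⟨Hi, Hj⟩
    · rw [Hi, Hj]; simp
    · rw [Hi, Hj]; simp [div_neg]; ring
  obtain ⟨hre, hh⟩ := hre
  obtain ⟨⟨qi, cr⟩, -⟩ := hz
  obtain ⟨⟨ez, cj⟩, -⟩ := eo
  rw [hre] at ez cj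
  have hb : ee 0 1 * ee 0 0 = 0 := by
    have ey : (-1:ℝ) < ((ee 0 1 * ee 0 0 : ℤ) : ℝ) := by push_cast; linarith
    have jn : ((ee 0 1 * ee 0 0 : ℤ) : ℝ) < 1 := by push_cast; linarith
    have fb : -1 < ee 0 1 * ee 0 0 := by exact_mod_cast ey
    have fc : ee 0 1 * ee 0 0 < 1 := by exact_mod_cast jn
    omega
  rcases hh with ⟨Hi, Hj⟩ | ⟨Hi, Hj⟩
  · left
    rw [Hi, mul_one] at hb
    ext i j; fin_cases i <;> fin_cases j
    · exact Hi
    · exact hb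
    · exact Hm
    · exact Hj
  · right
    rw [Hi] at hb
    ext i j; fin_cases i <;> fin_cases j
    · exact Hi
    · change ee 0 1 = 0; omega
    · exact Hm
    · exact Hj
lemma yz (f : ℤ) (o Ha : ℕ) (z : ℍ) : ‖gsum f o Ha 1 z‖ ≤ o * Ha := by
  unfold gsum
  have hle : ∀ u ∈ Uf o Ha, ‖∑ Hf ∈ Uf o Ha, gterm f o Ha 1 u Hf z.re ((1 : SL(2, ℤ)) • z).re‖ ≤ 1 := by
    intro u hu
    rw [sum_eq_single_of_mem u hu]
    · exact tf _ _ _ _ _ _ _ _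
    · intro Hf pa hne
      unfold gterm
      rw [if_neg]
      rintro ⟨pb, pc⟩
      apply hne
      simp only [rrel, Matrix.SpecialLinearGroup.coe_one, Matrix.one_apply_eq, ne_eq, zero_ne_one, not_false_eq_true, Matrix.one_apply_ne, one_ne_zero] at pb pc
      simp only [Uf, mem_product, mem_Ico] at hu pa
      refine Prod.ext (gf (m := o) (D := 0) (by convert pb using 1; ring) ?_ ?_ ?_ ?_) (gf (m := Ha) (D := 0) (by convert pc using 1; ring) ?_ ?_ ?_ ?_) <;> omega
  refine (norm_sum_le _ _).trans ?_
  have := sum_le_card_nsmul _ _ _ hle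
  simpa [Uf] using this
lemma za (o Ha : ℕ) (f : ℤ) (E : Finset SL(2, ℤ)) (ti : ∀ ee ∈ E, ee = 1 ∨ ee = -1)
    (Y Hb : ℝ) (hY : 0 < Y) (hYY : Y ≤ Hb) :
    ‖∑ ee ∈ E, ∫ z, hterm f o Ha Y Hb ee z‖ ≤ 2 * (1 / Y - 1 / Hb) * (o * Ha) := by
  have hone : ‖∫ z, hterm f o Ha Y Hb 1 z‖ ≤ (1 / Y - 1 / Hb) * (o * Ha) := by
    have hle : ∀ z : ℍ, ‖hterm f o Ha Y Hb 1 z‖ ≤ (hbox 0 1 Y Hb).indicator (fun _ => (o * Ha : ℝ)) z := by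
      intro z
      unfold hterm
      split_ifs with h
      · rw [Set.indicator_of_mem h.1]; exact yz _ _ _ _
      · rw [norm_zero]; exact Set.indicator_nonneg (fun _ _ => by positivity) _
    refine (norm_integral_le_of_norm_le ?_ (Filter.Eventually.of_forall hle)).trans ?_
    · rw [integrable_indicator_iff (jp _ _ _ _)]
      exact integrableOn_const (gj _ _ _ _ hY)
    · rw [integral_indicator (jp _ _ _ _), setIntegral_const, qe _ _ _ _ (by norm_num) hY hYY, smul_eq_mul]
      apply le_of_eq; ring
  have hall : ∀ ee ∈ E, ‖∫ z, hterm f o Ha Y Hb ee z‖ ≤ (1 / Y - 1 / Hb) * (o * Ha) := by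
    intro ee hee
    rcases ti ee hee with rfl | rfl
    · exact hone
    · simp only [th]; exact hone
  refine (norm_sum_le _ _).trans ((sum_le_card_nsmul _ _ _ hall).trans ?_)
  have hcard : E.card ≤ 2 := by
    have : E ⊆ {1, -1} := fun ee hee => by simpa using ti ee hee
    exact (card_le_card this).trans card_le_two
  have Hm := (norm_nonneg _).trans hone
  rw [nsmul_eq_mul]
  have : (E.card:ℝ) ≤ 2 := by exact_mod_cast hcard
  calc _ ≤ 2 * ((1 / Y - 1 / Hb) * (o * Ha)) := by gcongr
    _ = _ := by ring
open Classical in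
lemma tj (C o Ha : ℕ) (Hc : 0 < o) (Hd : 0 < Ha) (f : ℤ) (E : Finset SL(2, ℤ)) (hEc : ∀ ee ∈ E, 0 < ee 1 0 ∧ ee 1 0 ≤ C)
    (Y Hb : ℝ) (hY : 0 < Y) (hYY : Y ≤ Hb) (ev : Hb ≤ 2 * Y) (hE : ∀ ee : SL(2, ℤ), 0 < ee 1 0 → ∀ z ∈ hbox 0 1 Y Hb, ee • z ∈ hbox 0 1 Y Hb → ee ∈ E) :
    ‖∑ ee ∈ E, ∫ z, hterm f o Ha Y Hb ee z‖ ≤ 3 * (1 / Y - 1 / Hb) * ∑ c ∈ Icc 1 C, ‖KK c o Ha f 0 0‖ / c := by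
  have : ∀ ee ∈ E, (ee 1 0).toNat ∈ Icc 1 C := by
    intro ee hee
    have := hEc ee hee
    rw [mem_Icc]; omega
  rw [← sum_fiberwise_of_maps_to this, mul_sum]
  refine norm_sum_le_of_le _ fun c hc => ?_
  rw [mem_Icc] at hc
  refine yx c o Ha (by omega) Hc Hd f _ ?_ Y Hb hY hYY ev ?_
  · intro ee hee
    rw [mem_filter] at hee
    have := hEc ee hee.1
    omega
  · intro ee ef z hz eo
    rw [mem_filter]
    exact ⟨hE ee (by omega) z hz eo, by omega⟩
lemma zb (Y Hb : ℝ) (hY : 0 < Y) (C : ℕ) (hC : 1 / Y ≤ C) (ee : SL(2, ℤ)) (z : ℍ) (hz : z ∈ hbox 0 1 Y Hb) (eo : ee • z ∈ hbox 0 1 Y Hb) : |ee 1 0| ≤ C := by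
  obtain ⟨-, qi, -⟩ := hz
  obtain ⟨-, ez, -⟩ := eo
  have him := UpperHalfPlane.specialLinearGroup_apply ee z
  have hn : (ee • z).im = z.im / normSq (((ee 1 0 : ℤ) : ℂ) * z + (ee 1 1 : ℤ)) := by
    have := ModularGroup.im_smul_eq_div_normSq ee z
    rw [this, ModularGroup.denom_apply]
  rw [hn] at ez
  have hzp := z.im_pos
  have hge : ((ee 1 0 : ℤ) : ℝ) ^ 2 * z.im ^ 2 ≤ normSq (((ee 1 0 : ℤ) : ℂ) * z + (ee 1 1 : ℤ)) := by
    rw [normSq_apply]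
    simp
    nlinarith [mul_self_nonneg (((ee 1 0 : ℤ) : ℝ) * z.re + (ee 1 1 : ℤ))]
  by_contra hcon
  push Not at hcon
  have Hg : (C:ℝ) < |((ee 1 0 : ℤ) : ℝ)| := by exact_mod_cast hcon
  have Hk : 1 < |((ee 1 0 : ℤ) : ℝ)| * Y := by
    rw [div_le_iff₀ hY] at hC
    nlinarith
  have Hl : 1 < (|((ee 1 0 : ℤ) : ℝ)| * z.im) := by nlinarith
  have eb : (|((ee 1 0 : ℤ) : ℝ)| * z.im) * 1 < (|((ee 1 0 : ℤ) : ℝ)| * z.im) * (|((ee 1 0 : ℤ) : ℝ)| * Y) := mul_lt_mul_of_pos_left Hk (by linarith)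
  have Hq : 0 < normSq (((ee 1 0 : ℤ) : ℂ) * z + (ee 1 1 : ℤ)) := by
    refine lt_of_lt_of_le ?_ hge
    rw [← mul_pow, ← sq_abs, abs_mul, abs_of_pos hzp]; positivity
  rw [le_div_iff₀ Hq] at ez
  have jl : Y * (((ee 1 0 : ℤ) : ℝ) ^ 2 * z.im ^ 2) ≤ z.im := (mul_le_mul_of_nonneg_left hge hY.le).trans ez
  have cy : Y * (|((ee 1 0 : ℤ) : ℝ)| ^ 2 * z.im) ≤ 1 := by
    rw [sq_abs]
    have : z.im * (Y * (((ee 1 0 : ℤ) : ℝ) ^ 2 * z.im)) ≤ z.im * 1 := by linarith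
    exact le_of_mul_le_mul_left this hzp
  have ex : Y * (|((ee 1 0 : ℤ) : ℝ)| ^ 2 * z.im) = (|((ee 1 0 : ℤ) : ℝ)| * z.im) * (|((ee 1 0 : ℤ) : ℝ)| * Y) := by ring
  linarith
open Classical in
lemma zc (C o Ha : ℕ) (Hc : 0 < o) (Hd : 0 < Ha) (f : ℤ) (E : Finset SL(2, ℤ)) 
    (Y Hb : ℝ) (hY : 0 < Y) (hYY : Y ≤ Hb) (ev : Hb ≤ 2 * Y) (hC : 1 / Y ≤ C)
    (hE : ∀ ee : SL(2, ℤ), ee ∈ E ↔ ∃ z ∈ hbox 0 1 Y Hb, ee • z ∈ hbox 0 1 Y Hb) :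
    ‖∑ ee ∈ E, ∫ z, hterm f o Ha Y Hb ee z‖ ≤ 6 * (1 / Y - 1 / Hb) * (o * Ha + ∑ c ∈ Icc 1 C, ‖KK c o Ha f 0 0‖ / c) := by
  have hcl : ∀ ee ∈ E, |ee 1 0| ≤ C := fun ee hee => by
    obtain ⟨z, hz, eo⟩ := (hE ee).mp hee
    exact zb Y Hb hY C hC ee z hz eo
  rw [← sum_filter_add_sum_filter_not E (fun ee => ee 1 0 = 0), ← sum_filter_add_sum_filter_not (E.filter (fun ee => ¬ ee 1 0 = 0)) (fun ee => 0 < ee 1 0)]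
  have ea := za o Ha f (E.filter (fun ee => ee 1 0 = 0)) (fun ee hee => by
    rw [mem_filter, hE] at hee
    obtain ⟨⟨z, hz, eo⟩, h⟩ := hee
    exact yy Y Hb ee h z hz eo) Y Hb hY hYY
  have ez := tj C o Ha Hc Hd f ((E.filter (fun ee => ¬ ee 1 0 = 0)).filter (fun ee => 0 < ee 1 0)) (fun ee hee => by
    rw [mem_filter, mem_filter] at hee
    have := hcl ee hee.1.1
    rw [abs_le] at this
    exact ⟨hee.2, this.2⟩) Y Hb hY hYY ev (fun ee hp z hz eo => by
      rw [mem_filter, mem_filter, hE]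
      exact ⟨⟨⟨z, hz, eo⟩, by omega⟩, hp⟩)
  have ci : ∀ ee : SL(2, ℤ), (-ee) 1 0 = - ee 1 0 := fun ee => by simp
  have cj := tj C o Ha Hc Hd f (((E.filter (fun ee => ¬ ee 1 0 = 0)).filter (fun ee => ¬ 0 < ee 1 0)).map (Equiv.neg _).toEmbedding) (fun ee hee => by
    rw [mem_map] at hee
    obtain ⟨g, hg, rfl⟩ := hee
    rw [mem_filter, mem_filter] at hg
    have := hcl g hg.1.1
    rw [abs_le] at this
    change 0 < (-g) 1 0 ∧ (-g) 1 0 ≤ C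
    rw [ci]; omega) Y Hb hY hYY ev (fun ee hp z hz eo => by
      rw [mem_map]
      refine ⟨-ee, ?_, neg_neg ee⟩
      rw [mem_filter, mem_filter, hE, ci]
      exact ⟨⟨⟨z, hz, by rwa [qo]⟩, by omega⟩, by omega⟩)
  rw [sum_map] at cj
  simp only [Equiv.coe_toEmbedding, Equiv.neg_apply, th] at cj
  refine (norm_add_le _ _).trans ((add_le_add ea ((norm_add_le _ _).trans (add_le_add ez cj))).trans ?_)
  have hp : 0 ≤ 1 / Y - 1 / Hb := by
    rw [sub_nonneg]; exact one_div_le_one_div_of_le hY hYY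
  have : 0 ≤ (1 / Y - 1 / Hb) * (o * Ha : ℝ) := by positivity
  linarith
end yr
section zd
open Real Finset Complex
open MeasureTheory UpperHalfPlane
open scoped ENNReal ComplexConjugate MatrixGroups ModularForm
variable {F : ℍ → ℂ} {k : ℕ}
lemma qp (hc : Continuous F) (m : ℕ) (hm : 0 < m) (u : ℤ) : Continuous (F ∣[(k:ℤ)] (toGL m hm (dlt m u))) := by
  have : (F ∣[(k:ℤ)] (toGL m hm (dlt m u))) = fun z : ℍ => F (ofComplex (((z:ℂ) - u) / m)) / m := by
    ext z; exact qh F k m hm u z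
  rw [this]
  refine Continuous.div_const (hc.comp ?_) _
  have hpos : ∀ z : ℍ, 0 < (((z:ℂ) - u) / m).im := by
    intro z
    have : (((z:ℂ) - u) / m).im = z.im / m := by
      rw [← ofReal_natCast, div_ofReal_im]; simp
    rw [this]; have := z.im_pos; positivity
  rw [UpperHalfPlane.isEmbedding_coe.continuous_iff]
  have : ((↑) ∘ fun z : ℍ => ofComplex (((z:ℂ) - u) / m) : ℍ → ℂ) = fun z : ℍ => ((z:ℂ) - u) / m := by
    ext z; simp only [Function.comp]; rw [ofComplex_apply_of_im_pos (hpos z)]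
  rw [this]
  exact (UpperHalfPlane.continuous_coe.sub continuous_const).div_const _
lemma ze {g h : ℍ → ℂ} (hg : Continuous g) (hh : Continuous h) : Continuous (petersson k g h) := by
  unfold petersson
  refine ((continuous_conj.comp hg).mul hh).mul ?_
  simp only [zpow_natCast]
  exact (continuous_ofReal.comp UpperHalfPlane.continuous_im).pow k
lemma zf (o Ha : ℕ) (f : ℤ) (Y Hb : ℝ) (ee : SL(2, ℤ)) [dec : ∀ u Hf : ↥(Uf o Ha), Decidable (rrel o ee u.1.1 Hf.1.1 ∧ rrel Ha ee u.1.2 Hf.1.2)] (z : ℍ) (hz : z ∈ hbox 0 1 Y Hb) :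
    ∑ u : ↥(Uf o Ha), ∑ Hf : ↥(Uf o Ha), 
      (if rrel o ee u.1.1 Hf.1.1 ∧ rrel Ha ee u.1.2 Hf.1.2 then (hbox 0 1 Y Hb).indicator (fun _ => (1:ℂ)) (ee • z) * (Phi f o Ha u.1 z.re * conj (Phi f o Ha Hf.1 (ee • z).re)) else 0) 
      = hterm f o Ha Y Hb ee z := by
  unfold hterm
  by_cases eo : ee • z ∈ hbox 0 1 Y Hb
  · rw [if_pos ⟨hz, eo⟩, gsum]
    refine Eq.trans ?_ (sum_coe_sort (Uf o Ha) (fun u => ∑ Hf ∈ Uf o Ha, gterm f o Ha ee u Hf z.re (ee • z).re))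
    refine sum_congr rfl fun u _ => ?_
    refine Eq.trans ?_ (sum_coe_sort (Uf o Ha) (fun Hf => gterm f o Ha ee u Hf z.re (ee • z).re))
    refine sum_congr rfl fun Hf _ => ?_
    rw [Set.indicator_of_mem eo, one_mul, gterm]
    by_cases hh : rrel o ee u.1.1 Hf.1.1 ∧ rrel Ha ee u.1.2 Hf.1.2
    · rw [if_pos hh, if_pos hh]
    · rw [if_neg hh, if_neg hh]
  · rw [if_neg (fun h => eo h.2)]
    refine sum_eq_zero fun u _ => sum_eq_zero fun Hf _ => ?_
    rw [Set.indicator_of_notMem eo, zero_mul, ite_self]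
lemma zg (o Ha : ℕ) (f : ℤ) (Y Hb : ℝ) (hY : 0 < Y) (E : Finset SL(2, ℤ)) [dec : ∀ (ee : SL(2, ℤ)) (u Hf : ↥(Uf o Ha)), Decidable (rrel o ee u.1.1 Hf.1.1 ∧ rrel Ha ee u.1.2 Hf.1.2)] :
    ∫ z in hbox 0 1 Y Hb, ∑ ee ∈ E, ∑ u : ↥(Uf o Ha), ∑ Hf : ↥(Uf o Ha), 
      (if rrel o ee u.1.1 Hf.1.1 ∧ rrel Ha ee u.1.2 Hf.1.2 then (hbox 0 1 Y Hb).indicator (fun _ => (1:ℂ)) (ee • z) * (Phi f o Ha u.1 z.re * conj (Phi f o Ha Hf.1 (ee • z).re)) else 0) 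
      = ∑ ee ∈ E, ∫ z, hterm f o Ha Y Hb ee z := by
  rw [← integral_finsetSum _ (fun ee _ => tg f o Ha Y Hb hY ee)]
  have Hi : ∫ z in hbox 0 1 Y Hb, ∑ ee ∈ E, hterm f o Ha Y Hb ee z = ∫ z : ℍ, ∑ ee ∈ E, hterm f o Ha Y Hb ee z := by
    apply setIntegral_eq_integral_of_forall_compl_eq_zero
    intro z hz
    exact sum_eq_zero fun ee _ => by rw [hterm, if_neg (fun h => hz h.1)]
  rw [← Hi]
  refine setIntegral_congr_fun (jp _ _ _ _) fun z hz => ?_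
  exact sum_congr rfl fun ee _ => zf o Ha f Y Hb ee z hz
open Classical in
lemma zh (hF : ∀ g : SL(2, ℤ), F ∣[(k:ℤ)] g = F) (hFc : Continuous F) (hk : 2 ≤ k) (B2 : ℝ) (gc : 0 ≤ B2)
    (hB : ∀ z, ‖petersson k F F z‖ ≤ B2) (o Ha : ℕ) (Hc : 0 < o) (Hd : 0 < Ha) (f : ℤ)
    (Y Hb : ℝ) (hY : 0 < Y) (hYY : Y ≤ Hb) (ev : Hb ≤ 2 * Y) (C : ℕ) (hC : 1 / Y ≤ C) :
    ‖∫ z in hbox 0 1 Y Hb, ∑ u ∈ Uf o Ha, Phi f o Ha u z.re *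
      petersson k (F ∣[(k:ℤ)] (toGL Ha Hd (dlt Ha u.2))) (F ∣[(k:ℤ)] (toGL o Hc (dlt o u.1))) z‖ ^ 2 ≤
    18 * (o.divisors.card * o * (Ha.divisors.card * Ha)) * (((o:ℝ) * Ha) ^ (k - 2) * B2 ^ 2) * (1 / Y - 1 / Hb) *
      (o * Ha + ∑ c ∈ Icc 1 C, ‖KK c o Ha f 0 0‖ / c) := by
  haveI := sp o Hc
  haveI := sp Ha Hd
  letI : Fintype (OrbQ o) := Fintype.ofFinite _
  letI : Fintype (OrbQ Ha) := Fintype.ofFinite _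
  letI : MeasurableSpace SL(2, ℤ) := ⊤
  set T := max (max Hb (1 / Y)) 1 with hT
  have zi : 1 ≤ T := le_max_right _ _
  have zj := sk 0 1 Y Hb (-1/2) 1 (1/2) T hY (by norm_num)
  have pd := sk 0 1 Y Hb 0 1 Y Hb hY hY
  have hEm : ∀ ee : SL(2, ℤ), ee ∈ pd.toFinset ↔ ∃ z ∈ hbox 0 1 Y Hb, ee • z ∈ hbox 0 1 Y Hb := by
    intro ee; rw [Set.Finite.mem_toFinset]; rfl
  have cs := xt (μ := (volume : Measure ℍ)) (U := ↥(Uf o Ha)) (Ω := OrbQ o × OrbQ Ha) (hbox 0 1 Y Hb) (hbox (-1/2) 1 (1/2) T)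
    (jp _ _ _ _) (jp _ _ _ _) (gj _ _ _ _ hY) (gj _ _ _ _ (by norm_num))
    zj.toFinset pd.toFinset (fun z hz => yc 0 1 Y Hb hY z hz)
    (fun z hz γ hγ => by rw [Set.Finite.mem_toFinset]; exact ⟨z, hz, hγ⟩)
    (fun z hz γ hγ => by rw [Set.Finite.mem_toFinset]; exact ⟨z, hz, hγ⟩)
    (fun u γ => ((Quotient.mk _ (rmul o (dlt o u.1.1) γ⁻¹) : OrbQ o), (Quotient.mk _ (rmul Ha (dlt Ha u.1.2) γ⁻¹) : OrbQ Ha)))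
    (fun u z => petersson k (F ∣[(k:ℤ)] (toGL Ha Hd (dlt Ha u.1.2))) (F ∣[(k:ℤ)] (toGL o Hc (dlt o u.1.1))) z)
    (fun u z => Phi f o Ha u.1 z.re)
    (fun l z => petersson k (F ∣[(k:ℤ)] (toGL Ha Hd l.2.out)) (F ∣[(k:ℤ)] (toGL o Hc l.1.out)) z)
    (√(((o:ℝ) * Ha) ^ (k - 2)) * B2)
    (fun l w => yi B2 gc hB o Ha Hc Hd _ _ hk w)
    (fun u γ w => by
      dsimp only
      rw [st hF, st hF, ss, ss, petersson_slash_SL])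
    (fun u => (ze (qp hFc _ _ _) (qp hFc _ _ _)).measurable)
    (fun u => ((qk f o Ha u.1).comp UpperHalfPlane.continuous_re).measurable)
    (fun u z => (qj _ _ _ _ _).le)
    (fun ee u Hf => rrel o ee u.1.1 Hf.1.1 ∧ rrel Ha ee u.1.2 Hf.1.2)
    (fun γ ee u Hf => by
      rw [Prod.mk.injEq, sx o Hc, sx Ha Hd])
  have el : ∀ z : ℍ, ∑ u ∈ Uf o Ha, Phi f o Ha u z.re *
      petersson k (F ∣[(k:ℤ)] (toGL Ha Hd (dlt Ha u.2))) (F ∣[(k:ℤ)] (toGL o Hc (dlt o u.1))) z = 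
      ∑ u : ↥(Uf o Ha), Phi f o Ha u.1 z.re *
      petersson k (F ∣[(k:ℤ)] (toGL Ha Hd (dlt Ha u.1.2))) (F ∣[(k:ℤ)] (toGL o Hc (dlt o u.1.1))) z := by
    intro z; rw [← sum_coe_sort]
  simp only [el]
  refine cs.trans ?_
  rw [zg o Ha f Y Hb hY pd.toFinset (dec := fun _ _ _ => Classical.propDecidable _), Fintype.card_prod, ← Nat.card_eq_fintype_card, ← Nat.card_eq_fintype_card, qe _ _ _ _ (by norm_num) (by norm_num) (by linarith)]
  have q := zc C o Ha Hc Hd f pd.toFinset Y Hb hY hYY ev hC hEm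
  have ey : (Nat.card (OrbQ o) : ℝ) ≤ o.divisors.card * o := by exact_mod_cast sr o Hc
  have jn : (Nat.card (OrbQ Ha) : ℝ) ≤ Ha.divisors.card * Ha := by exact_mod_cast sr Ha Hd
  have hv : (1 - (-1 / 2 : ℝ)) * (1 / (1 / 2) - 1 / T) ≤ 3 := by
    have : 0 ≤ 1 / T := by positivity
    linarith
  have pe : 0 ≤ (1 - (-1 / 2 : ℝ)) * (1 / (1 / 2) - 1 / T) := by
    have : 1 / T ≤ 1 := by rw [div_le_one (by linarith)]; exact zi
    nlinarith
  push_cast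
  rw [mul_pow √_, sq_sqrt (by positivity)]
  calc _ ≤ (o.divisors.card * o * (Ha.divisors.card * Ha)) * (((o:ℝ) * Ha) ^ (k - 2) * B2 ^ 2) * 3 * (6 * (1 / Y - 1 / Hb) * (o * Ha + ∑ c ∈ Icc 1 C, ‖KK c o Ha f 0 0‖ / c)) := by
        refine mul_le_mul ?_ q (norm_nonneg _) (by positivity)
        refine mul_le_mul ?_ hv pe (by positivity)
        gcongr
    _ = _ := by ring
end zd
section
open Real Finset Complex
open UpperHalfPlane hiding I
open Complex hiding I
open scoped ModularForm MatrixGroups Manifold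
open Function CongruenceSubgroup
def ac (a : ℕ → ℂ) (n : ℕ) : ℂ := if n = 0 then 0 else a n
lemma qpow (z : ℂ) (n : ℕ) : (Periodic.qParam 1 z) ^ n = Complex.exp (2 * Real.pi * Complex.I * n * z) := by
  rw [Periodic.qParam, ← Complex.exp_nat_mul]
  congr 1; push_cast; ring
lemma zk {c : ℕ → ℂ} {g : ℂ → ℂ} (hg : AnalyticAt ℂ g 0) (r : ℝ) (hr : 0 < r)
    (hs : ∀ q : ℂ, ‖q‖ < r → q ≠ 0 → HasSum (fun n => c n * q ^ n) (g q)) (m : ℕ) :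
    c m = ((m.factorial : ℂ))⁻¹ * iteratedDeriv m g 0 := by
  have qq : HasFPowerSeriesOnBall (update g 0 (c 0)) (.ofScalars ℂ c) 0 (ENNReal.ofReal r) := by
    constructor
    · refine le_of_forall_lt_imp_le_of_dense fun s jg ↦ ?_
      rcases eq_or_ne s 0 with rfl | zl
      · simp
      · lift s to NNReal using jg.ne_top
        have tk : (s : ℝ) < r := by
          rw [← ENNReal.ofReal_coe_nnreal] at jg
          exact (ENNReal.ofReal_lt_ofReal_iff hr).1 jg
        apply FormalMultilinearSeries.le_radius_of_summable
        simpa [smul_eq_mul, norm_mul, mul_comm, mul_left_comm, mul_assoc] using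
          (hs (s : ℝ) (by simpa using tk) (by exact_mod_cast zl)).summable.norm
    · simpa using hr
    · intro y hy
      have ja : ‖y‖ < r := by
        rw [Metric.mem_eball, edist_dist, dist_zero_right] at hy
        exact (ENNReal.ofReal_lt_ofReal_iff hr).1 hy
      rcases eq_or_ne y 0 with rfl | qm
      · simpa +contextual [zero_pow_eq] using hasSum_ite_eq 0 (c 0)
      · simpa [update_of_ne qm, mul_comm] using hs y ja qm
  have zm : c 0 = g 0 := by
    have L1 := qq.hasFPowerSeriesAt.continuousAt
    have L2 := hg.continuousAt
    have := (L1.eventuallyEq_nhds_iff_eventuallyEq_nhdsNE L2).mp <|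
      by filter_upwards [self_mem_nhdsWithin] with a ha using update_of_ne ha ..
    simpa [update_self] using this.eq_of_nhds
  rw [update_eq_self_iff.mpr zm] at qq
  have Hg := qq.hasFPowerSeriesAt.eq_formalMultilinearSeries hg.hasFPowerSeriesAt
  have Hk := congr_arg (FormalMultilinearSeries.coeff · m) Hg
  simp [div_eq_mul_inv, mul_comm] at Hk
  rw [Hk]
lemma zn {k : ℕ} {a : ℕ → ℂ} (h : IsNormalizedHeckeEigenform k a) :
    ∃ F : ℍ → ℂ, (∀ g : SL(2, ℤ), F ∣[(k:ℤ)] g = F) ∧ Continuous F ∧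
      (∃ B : ℝ, ∀ z, ‖petersson k F F z‖ ≤ B) ∧ (∃ z, F z ≠ 0) ∧
      ∀ z : ℍ, HasSum (fun n : ℕ => ac a n * exp (2 * π * I * n * (z : ℂ))) (F z) := by
  obtain ⟨-, -, ⟨F, zo, hF⟩, -, -⟩ := h
  have hne : ∃ z, F z ≠ 0 := by
    by_contra hcon
    push Not at hcon
    exact zo (DFunLike.ext _ _ (by simpa using hcon))
  have hstr : (1:ℝ) ∈ ((Gamma 1 : Subgroup SL(2,ℤ)) : Subgroup (GL (Fin 2) ℝ)).strictPeriods := by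
    simp
  refine ⟨F, ?_, ?_, ?_, hne, ?_⟩
  · intro g
    have := SlashInvariantFormClass.slash_action_eq F (g : GL (Fin 2) ℝ)
      (by rw [Gamma_one_top]; exact ⟨g, trivial, rfl⟩)
    exact this
  · exact (CuspFormClass.holo F).continuous
  · exact CuspFormClass.petersson_bounded_left k ((Gamma 1 : Subgroup SL(2,ℤ)) : Subgroup (GL (Fin 2) ℝ)) F F
  · obtain ⟨ji, tl⟩ := hne
    have jm : Summable (fun n : ℕ => a (n+1) * exp (2 * π * I * (n + 1) * (ji : ℂ))) := by
      by_contra hcon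
      rw [hF, tsum_eq_zero_of_not_summable hcon] at tl
      exact tl rfl
    have gr : Summable (fun n : ℕ => ac a n * (Periodic.qParam 1 (ji:ℂ)) ^ n) := by
      rw [← summable_nat_add_iff 1]
      refine jm.congr fun n => ?_
      rw [qpow]; simp [ac]
    have hper : Periodic (F ∘ ofComplex) (1:ℝ) := SlashInvariantFormClass.periodic_comp_ofComplex F hstr
    have zp : ∀ q : ℂ, ‖q‖ < ‖Periodic.qParam 1 (ji:ℂ)‖ → Summable (fun n => ac a n * q ^ n) := by
      intro q hq
      obtain ⟨C, hC⟩ := gr.norm.tendsto_atTop_zero.bddAbove_range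
      have hpos : 0 < ‖Periodic.qParam 1 (ji:ℂ)‖ := (norm_nonneg _).trans_lt hq
      refine Summable.of_norm_bounded (g := fun n => C * (‖q‖ / ‖Periodic.qParam 1 (ji:ℂ)‖) ^ n) ?_ ?_
      · refine (summable_geometric_of_lt_one (by positivity) ?_).mul_left _
        rwa [div_lt_one hpos]
      · intro n
        have Hc : ‖ac a n * (Periodic.qParam 1 (ji:ℂ)) ^ n‖ ≤ C := hC ⟨n, rfl⟩
        rw [norm_mul, norm_pow] at Hc ⊢
        calc ‖ac a n‖ * ‖q‖ ^ n = (‖ac a n‖ * ‖Periodic.qParam 1 (ji:ℂ)‖ ^ n) * (‖q‖ / ‖Periodic.qParam 1 (ji:ℂ)‖) ^ n := by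
              rw [div_pow]; field_simp
          _ ≤ _ := by gcongr
    have hcf : ∀ q : ℂ, ‖q‖ < ‖Periodic.qParam 1 (ji:ℂ)‖ → q ≠ 0 → HasSum (fun n => ac a n * q ^ n) (cuspFunction 1 F q) := by
      intro q hq gv
      have zq : ‖Periodic.qParam 1 (ji:ℂ)‖ < 1 := Periodic.norm_qParam_lt_one one_pos ji.im_pos
      have Hc := Periodic.im_invQParam_pos_of_norm_lt_one one_pos (hq.trans zq) gv
      let τ : ℍ := ⟨Periodic.invQParam 1 q, Hc⟩
      have Hd := (Periodic.cuspFunction_eq_of_nonzero 1 (F ∘ ofComplex) gv)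
      have Hg : cuspFunction 1 F q = F τ := by simpa [UpperHalfPlane.ofComplex_apply_of_im_pos Hc] using! Hd
      have Hk : Periodic.qParam 1 (τ:ℂ) = q := Periodic.qParam_right_inv one_ne_zero gv
      rw [Hg]
      have Hl := zp q hq
      have Hq : F τ = ∑' n, ac a n * q ^ n := by
        rw [Hl.tsum_eq_zero_add, hF]
        simp only [ac, if_true, zero_mul, zero_add]
        refine tsum_congr fun n => ?_
        rw [← Hk, qpow]; simp
      rw [Hq]; exact Hl.hasSum
    have hcoef := zk (analyticAt_cuspFunction_zero one_pos hper (CuspFormClass.holo F) (ModularFormClass.bdd_at_infty F)) _ (norm_pos_iff.2 (Periodic.qParam_ne_zero _)) hcf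
    intro z
    have eb := ModularForm.hasSum_qExpansion (f := F) one_pos hstr z
    convert eb using 2 with n
    rw [qpow, qExpansion_coeff, ← hcoef]
end
section
open Real Finset Complex
open MeasureTheory
noncomputable def en (n : ℤ) (x : ℝ) : ℂ := exp (2 * π * I * n * x)
lemma cv (n : ℤ) (x : ℝ) : ‖en n x‖ = 1 := by
  rw [en, show (2 * π * I * n * x : ℂ) = ((2 * π * n * x : ℝ):ℂ) * I by push_cast; ring]
  exact norm_exp_ofReal_mul_I _
lemma pf (n : ℤ) : Continuous (en n) := by unfold en; fun_prop
lemma zr (n : ℤ) (x : ℝ) : (starRingEnd ℂ) (en n x) = en (-n) x := by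
  rw [en, en, ← exp_conj]; congr 1; simp [map_ofNat]
lemma zs (n m : ℤ) (x : ℝ) : en n x * en m x = en (n + m) x := by
  rw [en, en, en, ← Complex.exp_add]; congr 1; push_cast; ring
lemma zt (n : ℤ) : ∫ x in (0:ℝ)..1, en n x = if n = 0 then 1 else 0 := by
  split_ifs with h
  · subst h; simp [en]
  · have hc : (2 * π * I * n : ℂ) ≠ 0 := by
      simp [pi_ne_zero, h]
    unfold en
    rw [integral_exp_mul_complex hc]
    have : exp (2 * π * I * n * (1:ℝ)) = 1 := by
      rw [Complex.exp_eq_one_iff]; exact ⟨n, by push_cast; ring⟩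
    rw [this]; simp
lemma qr {c : ℤ → ℂ} {g : ℝ → ℂ} (h : ∀ x, HasSum (fun n => c n * en n x) (g x)) :
    Continuous g := by
  have hs : Summable (fun n => ‖c n‖) := by
    have := (h 0).summable.norm
    simpa [norm_mul, cv] using this
  have : g = fun x => ∑' n, c n * en n x := funext fun x => (h x).tsum_eq.symm
  rw [this]
  refine continuous_tsum (fun n => continuous_const.mul (pf n)) hs fun n x => ?_
  simp [cv]
lemma zu {c : ℤ → ℂ} {g : ℝ → ℂ} (h : ∀ x, HasSum (fun n => c n * en n x) (g x)) (m : ℤ) :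
    ∫ x in (0:ℝ)..1, en (-m) x * g x = c m := by
  have hs : Summable (fun n => ‖c n‖) := by
    have := (h 0).summable.norm
    simpa [norm_mul, cv] using this
  have Hc := intervalIntegral.hasSum_integral_of_dominated_convergence (μ := volume) (a := 0) (b := 1)
    (F := fun n x => en (-m) x * (c n * en n x)) (f := fun x => en (-m) x * g x)
    (fun n _ => ‖c n‖) (fun n => by
      have := (pf (-m)).mul (continuous_const.mul (pf n) : Continuous (fun x => c n * en n x))
      exact this.aestronglyMeasurable)
    (fun n => by filter_upwards with x _; simp [cv])
    (by filter_upwards with x _; exact hs) (by simp)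
    (by filter_upwards with x _; exact (h x).mul_left _)
  have Hd : ∀ n, ∫ x in (0:ℝ)..1, en (-m) x * (c n * en n x) = if n = m then c m else 0 := by
    intro n
    have : ∀ x, en (-m) x * (c n * en n x) = c n * en (n - m) x := by
      intro x; rw [mul_left_comm, zs, show -m + n = n - m by ring]
    simp_rw [this]
    rw [intervalIntegral.integral_const_mul, zt]
    by_cases hh : n = m
    · simp [hh]
    · simp [hh, sub_eq_zero]
  simp_rw [Hd] at Hc
  exact Hc.unique (hasSum_ite_eq m (c m))
lemma parseval {c : ℤ → ℂ} {g : ℝ → ℂ} (h : ∀ x, HasSum (fun n => c n * en n x) (g x)) :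
    HasSum (fun n => ‖c n‖ ^ 2) (∫ x in (0:ℝ)..1, ‖g x‖ ^ 2) := by
  have hs : Summable (fun n => ‖c n‖) := by
    have := (h 0).summable.norm
    simpa [norm_mul, cv] using this
  have hg := qr h
  obtain ⟨C, hC⟩ := (isCompact_Icc (a := (0:ℝ)) (b := 1)).exists_bound_of_continuousOn hg.continuousOn
  have Hc := intervalIntegral.hasSum_integral_of_dominated_convergence (μ := volume) (a := 0) (b := 1)
    (F := fun n x => (starRingEnd ℂ) (c n) * (en (-n) x * g x)) (f := fun x => (starRingEnd ℂ) (g x) * g x)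
    (fun n _ => ‖c n‖ * C) (fun n => by
      have := (continuous_const.mul ((pf (-n)).mul hg) : Continuous (fun x => (starRingEnd ℂ) (c n) * (en (-n) x * g x)))
      exact this.aestronglyMeasurable)
    (fun n => by
      filter_upwards with x hx
      rw [norm_mul, norm_mul, cv, one_mul, RCLike.norm_conj]
      gcongr
      apply hC
      rw [Set.uIoc_of_le zero_le_one] at hx
      exact ⟨hx.1.le, hx.2⟩)
    (by filter_upwards with x _; exact hs.mul_right C) (by simp)
    (by
      filter_upwards with x _
      have := ((h x).map (starRingEnd ℂ) continuous_conj).mul_right (g x)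
      refine this.congr_fun ?_
      intro n
      simp [zr, mul_assoc])
  have Hd : ∀ n, ∫ x in (0:ℝ)..1, (starRingEnd ℂ) (c n) * (en (-n) x * g x) = ((‖c n‖^2 : ℝ) : ℂ) := by
    intro n
    rw [intervalIntegral.integral_const_mul, zu h, mul_comm, mul_conj']
    simp
  simp_rw [Hd] at Hc
  have Hg : ∫ x in (0:ℝ)..1, (starRingEnd ℂ) (g x) * g x = ((∫ x in (0:ℝ)..1, ‖g x‖ ^ 2 : ℝ) : ℂ) := by
    rw [← intervalIntegral.integral_ofReal]
    congr 1; funext x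
    rw [mul_comm, mul_conj']; simp
  rw [Hg] at Hc
  exact_mod_cast Hc
lemma bessel {c : ℤ → ℂ} {g : ℝ → ℂ} (h : ∀ x, HasSum (fun n => c n * en n x) (g x)) (s : Finset ℤ) :
    ∑ n ∈ s, ‖c n‖ ^ 2 ≤ ∫ x in (0:ℝ)..1, ‖g x‖ ^ 2 :=
  sum_le_hasSum s (fun _ _ => by positivity) (parseval h)
end
section
open Real Finset
open UpperHalfPlane hiding I
open Complex hiding I
open scoped ModularForm MatrixGroups
open MeasureTheory
def az (a : ℕ → ℂ) (l : ℤ) : ℂ := if 0 < l then a l.toNat else 0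
structure FD (k : ℕ) (a : ℕ → ℂ) (F : ℍ → ℂ) (B2 : ℝ) : Prop where
  inv : ∀ g : SL(2, ℤ), F ∣[(k:ℤ)] g = F
  cont : Continuous F
  bd : ∀ z, ‖petersson k F F z‖ ≤ B2
  sm : ∀ z : ℍ, HasSum (fun n : ℤ => az a n * Complex.exp (2 * π * Complex.I * n * (z : ℂ))) (F z)
lemma zv {k : ℕ} {a : ℕ → ℂ} (h : IsNormalizedHeckeEigenform k a) :
    ∃ (F : ℍ → ℂ), FD k a F (⨆ z, ‖petersson k F F z‖) := by
  obtain ⟨F, Hc, Hd, ⟨B, Hg⟩, -, Hl⟩ := zn h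
  refine ⟨F, Hc, Hd, fun z => le_ciSup (f := fun z => ‖petersson k F F z‖) ⟨B, by rintro _ ⟨z, rfl⟩; exact Hg z⟩ z, fun z => ?_⟩
  have hinj : Function.Injective (Nat.cast : ℕ → ℤ) := Nat.cast_injective
  rw [← hinj.hasSum_iff]
  · convert Hl z using 2 with n
    simp only [az, ac, Function.comp]
    rcases Nat.eq_zero_or_pos n with rfl | hn
    · simp
    · simp [hn, hn.ne']
  · intro x hx
    rcases lt_or_ge 0 x with hp | hp
    · exact absurd ⟨x.toNat, by simp [hp.le]⟩ hx
    · simp [az, not_lt.2 hp]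
lemma FD.B2_nonneg {k a F B2} (h : FD k a F B2) : 0 ≤ B2 := (norm_nonneg _).trans (h.bd UpperHalfPlane.I)
lemma tm (k : ℕ) (F : ℍ → ℂ) (z : ℍ) : ‖petersson k F F z‖ = ‖F z‖ ^ 2 * z.im ^ k := by
  simp only [petersson, norm_mul, RCLike.norm_conj, zpow_natCast, norm_pow, Complex.norm_real,
    Real.norm_eq_abs, abs_of_pos z.im_pos]
  ring
lemma FD.F_le {k a F B2} (h : FD k a F B2) (z : ℍ) : ‖F z‖ ^ 2 ≤ B2 / z.im ^ k := by
  have := h.bd z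
  rw [tm] at this
  rwa [le_div_iff₀ (pow_pos z.im_pos k)]
lemma FD.four {k a F B2} (h : FD k a F B2) (y : ℝ) (hy : 0 < y) (x : ℝ) :
    HasSum (fun n : ℤ => (az a n * (Real.exp (-(2 * π * n * y)) : ℝ)) * en n x)
      (F (ofComplex (x + y * Complex.I))) := by
  have Hc : 0 < ((x:ℂ) + y * Complex.I).im := by simpa using hy
  have := h.sm (ofComplex (x + y * Complex.I))
  rw [ofComplex_apply_of_im_pos Hc] at this ⊢
  convert this using 2 with n
  rw [en, Complex.ofReal_exp, mul_assoc, ← Complex.exp_add]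
  congr 2
  change _ = 2 * (π:ℂ) * Complex.I * n * (x + y * Complex.I)
  push_cast
  linear_combination (-2 * (π:ℂ) * n * y) * Complex.I_sq
lemma FD.rankin {k a F B2} (h : FD k a F B2) (y : ℝ) (hy : 0 < y) :
    Summable (fun n : ℤ => ‖az a n‖ ^ 2 * Real.exp (-(4 * π * n * y))) ∧
    ∑' n : ℤ, ‖az a n‖ ^ 2 * Real.exp (-(4 * π * n * y)) ≤ B2 / y ^ k := by
  have Hc := parseval (h.four y hy)
  have Hd : ∀ n : ℤ, ‖az a n * (Real.exp (-(2 * π * n * y)) : ℝ)‖ ^ 2 = ‖az a n‖ ^ 2 * Real.exp (-(4 * π * n * y)) := by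
    intro n
    rw [norm_mul, mul_pow, Complex.norm_real, Real.norm_eq_abs, abs_of_pos (Real.exp_pos _), ← Real.exp_nat_mul]
    congr 2; push_cast; ring
  simp_rw [Hd] at Hc
  refine ⟨Hc.summable, ?_⟩
  rw [Hc.tsum_eq]
  have hc : Continuous fun x : ℝ => ‖F (ofComplex (x + y * Complex.I))‖ ^ 2 := (qr (h.four y hy)).norm.pow 2
  calc ∫ x in (0:ℝ)..1, ‖F (ofComplex (x + y * Complex.I))‖ ^ 2 ≤ ∫ x in (0:ℝ)..1, B2 / y ^ k := by
        refine intervalIntegral.integral_mono_on zero_le_one (hc.intervalIntegrable _ _) (by simp) fun x _ => ?_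
        have Hg : 0 < ((x:ℂ) + y * Complex.I).im := by simpa using hy
        have := h.F_le (ofComplex (x + y * Complex.I))
        rw [ofComplex_apply_of_im_pos Hg] at this ⊢
        convert this using 3
        change y = ((x:ℂ) + y * Complex.I).im
        simp
    _ = _ := by simp
lemma peak (κ : ℕ) (hκ : 0 < κ) (v : ℝ) (hv : 0 ≤ v) :
    v ^ κ * Real.exp (-v) ≤ ((κ:ℝ) / Real.exp 1) ^ κ := by
  have hk : (0:ℝ) < κ := by exact_mod_cast hκ
  have Hc : v / κ ≤ Real.exp (v / κ - 1) := by linarith [add_one_le_exp (v/κ - 1)]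
  have Hd : (v / κ) ^ κ ≤ Real.exp (v - κ) := by
    calc (v/κ)^κ ≤ (Real.exp (v / κ - 1)) ^ κ := by gcongr
      _ = _ := by rw [← Real.exp_nat_mul]; congr 1; field_simp
  have Hg : v ^ κ ≤ κ ^ κ * Real.exp (v - κ) := by
    rw [div_pow, div_le_iff₀ (by positivity)] at Hd; linarith
  calc v ^ κ * Real.exp (-v) ≤ κ ^ κ * Real.exp (v - κ) * Real.exp (-v) := by gcongr
    _ = _ := by
      rw [div_pow, ← Real.exp_nat_mul, mul_assoc, ← Real.exp_add, div_eq_mul_inv, ← Real.exp_neg]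
      congr 2; ring
noncomputable def ea (k : ℕ) : ℝ := ((k:ℝ) / (4 * π * Real.exp 1)) ^ k
lemma tn {k : ℕ} (hk : 0 < k) : 0 < ea k := by
  have : (0:ℝ) < k := by exact_mod_cast hk
  unfold ea; positivity
lemma FD.coef {k a F B2} (h : FD k a F B2) (hk : 0 < k) (n : ℤ) (hn : 0 < n) :
    ‖az a n‖ ^ 2 ≤ B2 / ea k * (n:ℝ) ^ k := by
  have js : (0:ℝ) < k := by exact_mod_cast hk
  have jh : (0:ℝ) < n := by exact_mod_cast hn
  have hy : 0 < k / (4 * π * n) := by positivity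
  obtain ⟨Hc, Hd⟩ := h.rankin _ hy
  have Hg := (Hc.le_tsum n (fun _ _ => by positivity)).trans Hd
  have Hk : (4 * π * n * (k / (4 * π * n))) = k := by field_simp
  rw [Hk] at Hg
  have Hl : ‖az a n‖ ^ 2 ≤ B2 / (k / (4 * π * n)) ^ k * Real.exp k := by
    calc ‖az a n‖ ^ 2 = (‖az a n‖ ^ 2 * Real.exp (-k)) * Real.exp k := by
          rw [mul_assoc, ← Real.exp_add]; simp
      _ ≤ _ := by gcongr
  refine Hl.trans (le_of_eq ?_)
  have Hq : Real.exp k = (Real.exp 1) ^ k := by rw [← Real.exp_nat_mul]; simp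
  rw [ea, Hq, div_mul_eq_mul_div, div_mul_eq_mul_div, div_eq_div_iff (by positivity) (by positivity)]
  have eb : Real.exp 1 ^ k * (k / (4 * π * Real.exp 1)) ^ k = (n:ℝ) ^ k * (k / (4 * π * n)) ^ k := by
    rw [← mul_pow, ← mul_pow]; congr 1; field_simp
  linear_combination B2 * eb
end
section
open Real Finset
open UpperHalfPlane hiding I
open Complex hiding I
open scoped ModularForm MatrixGroups
open MeasureTheory
lemma zx {k : ℕ} {a : ℕ → ℂ} (h : IsNormalizedHeckeEigenform k a) (E : ℝ) (cw : 0 ≤ E) (κ : ℕ) (hκ : k = κ + κ)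
    (hE : ∀ n : ℕ, 0 < n → ‖a n‖ ≤ E * (n:ℝ) ^ κ) (n : ℕ) (hn : 0 < n) :
    ‖a n‖ ≤ √(E * n) * (n:ℝ) ^ κ := by
  have Hc := h.2.2.2.2 n n hn hn
  have jo : (1:ℝ) ≤ n := by exact_mod_cast hn
  have Hd : ‖a n‖ ^ 2 ≤ (E * n) * ((n:ℝ) ^ κ) ^ 2 := by
    rw [sq, ← norm_mul, Hc, Nat.gcd_self]
    calc ‖∑ d ∈ n.divisors, (d:ℂ) ^ (k-1) * a (n * n / d ^ 2)‖ ≤ ∑ d ∈ n.divisors, E * ((n:ℝ) ^ κ) ^ 2 := by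
          refine norm_sum_le_of_le _ fun d hd => ?_
          obtain ⟨j, hj⟩ := Nat.dvd_of_mem_divisors hd
          have ep : 0 < d := Nat.pos_of_mem_divisors hd
          have ca : 0 < j := by
            rcases Nat.eq_zero_or_pos j with rfl | h; · simp at hj; omega
            exact h
          have Hg : n * n / d ^ 2 = j ^ 2 := by
            rw [hj, show d * j * (d * j) = j ^ 2 * d ^ 2 by ring, Nat.mul_div_cancel _ (by positivity)]
          rw [Hg, norm_mul, norm_pow, Complex.norm_natCast]
          have Hk := hE (j ^ 2) (by positivity)
          have rk : (1:ℝ) ≤ d := by exact_mod_cast ep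
          calc (d:ℝ) ^ (k-1) * ‖a (j^2)‖ ≤ (d:ℝ) ^ k * (E * ((j ^ 2 : ℕ):ℝ) ^ κ) := by
                gcongr
                omega
            _ = _ := by rw [hj, hκ]; push_cast; ring
      _ = n.divisors.card * (E * ((n:ℝ) ^ κ) ^ 2) := by rw [sum_const, nsmul_eq_mul]
      _ ≤ n * (E * ((n:ℝ) ^ κ) ^ 2) := by
          gcongr; exact Nat.card_divisors_le_self n
      _ = _ := by ring
  apply abs_le_of_sq_le_sq' _ (by positivity) |>.2
  rw [mul_pow, sq_sqrt (by positivity)]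
  exact Hd
lemma zy (n : ℕ) (y : ℝ) (hy : 1 / 2 ≤ y) : Real.exp (-(π * n * y)) ≤ (1/2) ^ n * (1/2) ^ n := by
  have Hc : Real.exp (-(π * y)) ≤ 1/4 := by
    have Hd : (4:ℝ) ≤ Real.exp (π * y) := by
      have Hg : (1.5:ℝ) ≤ π * y := by nlinarith [pi_gt_three]
      have Hl : (2.7:ℝ) ≤ Real.exp 1 := by linarith [Real.exp_one_gt_d9]
      have Hq : (1.5:ℝ) ≤ Real.exp 0.5 := by linarith [add_one_le_exp (0.5:ℝ)]
      calc (4:ℝ) ≤ 2.7 * 1.5 := by norm_num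
        _ ≤ Real.exp 1 * Real.exp 0.5 := by gcongr
        _ = Real.exp 1.5 := by rw [← Real.exp_add]; norm_num
        _ ≤ _ := Real.exp_le_exp.2 Hg
    rw [Real.exp_neg, inv_eq_one_div]
    exact one_div_le_one_div_of_le (by norm_num) Hd
  calc Real.exp (-(π * n * y)) = Real.exp (-(π * y)) ^ n := by
        rw [← Real.exp_nat_mul]; congr 1; ring
    _ ≤ (1/4) ^ n := by gcongr
    _ = _ := by rw [← mul_pow]; norm_num
noncomputable def Hw (κ : ℕ) : ℝ := ((κ:ℝ) / (2 * π * Real.exp 1)) ^ κ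
lemma tp {κ : ℕ} (h : 0 < κ) : 0 < Hw κ := by
  have : (0:ℝ) < κ := by exact_mod_cast h
  unfold Hw; positivity
lemma zz (κ : ℕ) : Hw κ ^ 2 = ea (κ + κ) := by
  rw [Hw, ea, ← pow_mul, mul_two]; congr 1; push_cast; field_simp; ring
lemma tq (κ : ℕ) (hκ : 0 < κ) (v c : ℝ) (hv : 0 ≤ v) (hc : 0 < c) :
    v ^ κ * Real.exp (-(2 * π * v / c)) ≤ c ^ κ * Hw κ := by
  have Hc := peak κ hκ (2 * π * v / c) (by positivity)
  have Hd : (2 * π * v / c) ^ κ = (2 * π) ^ κ / c ^ κ * v ^ κ := by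
    rw [div_pow, mul_pow]; ring
  have Hg : Hw κ = ((κ:ℝ) / Real.exp 1) ^ κ / (2 * π) ^ κ := by
    rw [Hw, ← div_pow]; congr 1; field_simp
  rw [Hd] at Hc
  rw [Hg]
  rw [mul_div_assoc', le_div_iff₀ (by positivity)]
  calc _ = c ^ κ * ((2 * π) ^ κ / c ^ κ * v ^ κ * Real.exp (-(2 * π * v / c))) := by
        field_simp
    _ ≤ _ := by gcongr
lemma aa (κ : ℕ) (hκ : 0 < κ) (k : ℕ) (hk : k = κ + κ) (E : ℝ) (cw : 0 ≤ E) (A : ℝ) (n : ℕ) (y : ℝ)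
    (hy : 1 / 2 ≤ y) (hE : A ≤ E * (n:ℝ) ^ κ) (fd : A ≤ √(E * n) * (n:ℝ) ^ κ) :
    A * Real.exp (-(2 * π * n * y)) * y ^ κ ≤
      if n ≤ k then √(E * k) * Hw κ else E * Hw κ * (1 / 2) ^ n := by
  have jj : 0 < y := by linarith
  have hs := tp hκ
  split_ifs with h
  · calc A * Real.exp (-(2 * π * n * y)) * y ^ κ
        ≤ (√(E * n) * (n:ℝ) ^ κ) * Real.exp (-(2 * π * n * y)) * y ^ κ := by gcongr
      _ = √(E * n) * ((n * y) ^ κ * Real.exp (-(2 * π * (n * y) / 1))) := by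
          rw [mul_pow, div_one, ← mul_assoc (2 * π)]; ring
      _ ≤ √(E * k) * (1 ^ κ * Hw κ) := by
          have := tq κ hκ (n * y) 1 (by positivity) one_pos
          gcongr ?_ * ?_
          gcongr
      _ = _ := by ring
  · push Not at h
    have Hc := tq κ hκ (n * y) 2 (by positivity) two_pos
    have Hd := zy n y hy
    calc A * Real.exp (-(2 * π * n * y)) * y ^ κ
        ≤ (E * (n:ℝ) ^ κ) * Real.exp (-(2 * π * n * y)) * y ^ κ := by gcongr
      _ = E * ((n * y) ^ κ * Real.exp (-(2 * π * (n * y) / 2))) * Real.exp (-(π * n * y)) := by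
          rw [mul_pow, show -(2 * π * n * y) = -(2 * π * (n * y) / 2) + -(π * n * y) by ring, Real.exp_add]; ring
      _ ≤ E * (2 ^ κ * Hw κ) * ((1/2) ^ n * (1/2) ^ n) := by gcongr
      _ = E * Hw κ * (1/2) ^ n * (2 ^ κ * (1/2) ^ n) := by ring
      _ ≤ E * Hw κ * (1/2) ^ n * 1 := by
          gcongr
          calc (2:ℝ) ^ κ * (1/2) ^ n ≤ 2 ^ n * (1/2) ^ n := by
                gcongr
                · norm_num
                · omega
            _ = 1 := by rw [← mul_pow]; norm_num
      _ = _ := by ring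
lemma ab (k : ℕ) (P Q : ℝ) :
    HasSum (fun n : ℤ => if n ≤ 0 then (0:ℝ) else if n.toNat ≤ k then P else Q * (1/2) ^ n.toNat) (k * P + Q * (1/2)^k) := by
  have hinj : Function.Injective (Nat.cast : ℕ → ℤ) := Nat.cast_injective
  rw [← hinj.hasSum_iff]
  swap
  · intro x hx
    rcases lt_or_ge 0 x with hp | hp
    · exact absurd ⟨x.toNat, by simp [hp.le]⟩ hx
    · simp [hp]
  rw [← hasSum_nat_add_iff' (k+1)]
  have Hc : ∑ i ∈ range (k+1), ((fun n : ℤ => if n ≤ 0 then (0:ℝ) else if n.toNat ≤ k then P else Q * (1/2) ^ n.toNat) ∘ Nat.cast) i = k * P := by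
    rw [sum_range_succ']
    simp only [Function.comp]
    rw [sum_congr rfl (g := fun _ => P)]
    · simp
    · intro i hi
      rw [mem_range] at hi
      rw [if_neg (by push_cast; omega), if_pos (by simp; omega)]
  rw [Hc, add_sub_cancel_left]
  have Hd : ∀ n : ℕ, ((fun n : ℤ => if n ≤ 0 then (0:ℝ) else if n.toNat ≤ k then P else Q * (1/2) ^ n.toNat) ∘ Nat.cast) (n + (k+1)) = Q * (1/2)^(k+1) * (1/2)^n := by
    intro n
    simp only [Function.comp]
    rw [if_neg (by push_cast; omega), if_neg (by simp; omega), Int.toNat_natCast, pow_add]; ring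
  simp_rw [Hd]
  have Hg := hasSum_geometric_two.mul_left (Q * (1/2)^(k+1))
  rw [show Q * (1/2)^(k+1) * 2 = Q * (1/2)^k by rw [pow_succ]; ring] at Hg
  exact Hg
lemma ad {k : ℕ} {a : ℕ → ℂ} (h : IsNormalizedHeckeEigenform k a) :
    ∃ (F : ℍ → ℂ) (B2 : ℝ), FD k a F B2 ∧ B2 ≤ 16 * (k:ℝ) ^ 6 * ea k := by
  obtain ⟨F, hF⟩ := zv h
  refine ⟨F, _, hF, ?_⟩
  set S := ⨆ z, ‖petersson k F F z‖ with hS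
  obtain ⟨κ, hκ⟩ := h.1
  have ts := h.2.1
  have tt : 0 < κ := by omega
  have gl : 0 < k := by omega
  have hs := tp tt
  have jb := hF.B2_nonneg
  set B := √S with hB
  have hBS : B ^ 2 = S := sq_sqrt jb
  have gc : 0 ≤ B := sqrt_nonneg _
  set E := B / Hw κ with hE
  have cw : 0 ≤ E := by positivity
  have hb : ea k = Hw κ ^ 2 := by rw [zz, hκ]
  have hSE : S = E ^ 2 * Hw κ ^ 2 := by rw [← hBS, hE]; field_simp
  have qs : ∀ n : ℕ, 0 < n → ‖a n‖ ≤ E * (n:ℝ) ^ κ := by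
    intro n hn
    have Hc := hF.coef gl n (by exact_mod_cast hn)
    have Hd : az a n = a n := by simp [az, hn]
    rw [Hd, hb, hSE] at Hc
    apply abs_le_of_sq_le_sq' _ (by positivity) |>.2
    refine Hc.trans (le_of_eq ?_)
    rw [hκ]; push_cast; field_simp; ring
  have ag := zx h E cw κ hκ qs
  have key : ∀ z : ℍ, 1/2 ≤ z.im → ‖F z‖ * z.im ^ κ ≤ k * (√(E * k) * Hw κ) + E * Hw κ * (1/2)^k := by
    intro z hz
    have Hc := (hF.sm z).mul_right (((z.im ^ κ : ℝ)) : ℂ)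
    have Hd := Hc.norm_le_of_bounded (ab k (√(E * k) * Hw κ) (E * Hw κ)) ?_
    · rwa [norm_mul, Complex.norm_real, Real.norm_eq_abs, abs_of_nonneg (by have := z.im_pos; positivity)] at Hd
    · intro n
      rw [norm_mul, norm_mul, Complex.norm_real, Real.norm_eq_abs, abs_of_nonneg (by have := z.im_pos; positivity), Complex.norm_exp]
      have Hg : (2 * π * Complex.I * n * (z:ℂ)).re = -(2 * π * n * z.im) := by
        simp
      rw [Hg]
      rcases lt_or_ge 0 n with hn | hn
      · lift n to ℕ using hn.le
        have jh : 0 < n := by exact_mod_cast hn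
        rw [if_neg (not_le.2 hn)]
        have Hd : az a n = a n := by simp [az, jh]
        rw [Hd]
        simpa using aa κ tt k hκ E cw _ n z.im hz (qs n jh) (ag n jh)
      · rw [if_pos hn, az, if_neg (not_lt.2 hn)]; simp
  have fe : (1:ℝ) ≤ k := by exact_mod_cast gl
  set W := k * (√(E * k) * Hw κ) + E * Hw κ * (1/2)^k with hW
  have tu : 0 ≤ W := by positivity
  have hSW : S ≤ W ^ 2 := by
    refine ciSup_le fun z => ?_
    obtain ⟨g, hg⟩ := ModularGroup.exists_smul_mem_fd z
    have Hg := ModularGroup.three_le_four_mul_im_sq_of_mem_fd hg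
    have Hk : 1/2 ≤ (g • z).im := by
      have := (g • z).im_pos
      nlinarith
    have Hl : petersson k F F (g • z) = petersson k F F z := by
      rw [← petersson_slash_SL, hF.inv]
    rw [← Hl, tm]
    have Hq := key _ Hk
    calc ‖F (g • z)‖ ^ 2 * (g • z).im ^ k = (‖F (g • z)‖ * (g • z).im ^ κ) ^ 2 := by rw [hκ]; ring
      _ ≤ _ := by
        have := (g • z).im_pos
        gcongr
  have hBW : E * Hw κ ≤ W := by
    have eb : E * Hw κ = B := by rw [hE]; field_simp
    rw [eb]
    exact sqrt_le_iff.2 ⟨tu, hSW⟩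
  have hhalf : ((1:ℝ)/2)^k ≤ 1/2 := by
    calc ((1:ℝ)/2)^k ≤ (1/2)^1 := pow_le_pow_of_le_one (by norm_num) (by norm_num) gl
      _ = _ := by norm_num
  have jl : E ≤ 2 * (k * √(E * k)) := by
    have : E * Hw κ ≤ (2 * (k * √(E * k))) * Hw κ := by
      have cy : E * Hw κ * (1/2)^k ≤ E * Hw κ * (1/2) := by gcongr
      rw [hW] at hBW; linarith
    exact le_of_mul_le_mul_right this hs
  have ex : E ^ 2 ≤ 4 * k ^ 3 * E := by
    calc E ^ 2 ≤ (2 * (k * √(E * k))) ^ 2 := by gcongr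
      _ = 4 * k ^ 2 * (√(E * k)) ^ 2 := by ring
      _ = 4 * k ^ 2 * (E * k) := by rw [sq_sqrt (by positivity)]
      _ = _ := by ring
  have tv : E ≤ 4 * k ^ 3 := by
    rcases cw.eq_or_lt with Hm | Hm
    · rw [← Hm]; positivity
    · exact le_of_mul_le_mul_right (by linarith [sq E]) Hm
  rw [hSE, hb]
  calc E ^ 2 * Hw κ ^ 2 ≤ (4 * k ^ 3) ^ 2 * Hw κ ^ 2 := by gcongr
    _ = _ := by ring
end
section
open Real Finset Complex
open UpperHalfPlane hiding I
open Complex hiding I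
open scoped ModularForm MatrixGroups
open MeasureTheory
noncomputable def gm (F : ℍ → ℂ) (f : ℤ) (m : ℕ) (z : ℍ) : ℂ :=
  ∑ u ∈ Ico (0:ℤ) m, exp (-(2 * π * I * (f * (z.re - u) / m))) *
    (F (ofComplex (((z:ℂ) - u) / m)) / m)
lemma ah (F : ℍ → ℂ) (f : ℤ) (k o Ha : ℕ) (Hc : 0 < o) (Hd : 0 < Ha) (z : ℍ) :
    ∑ u ∈ Uf o Ha, Phi f o Ha u z.re * petersson k (F ∣[(k:ℤ)] (toGL Ha Hd (dlt Ha u.2)))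
      (F ∣[(k:ℤ)] (toGL o Hc (dlt o u.1))) z
    = gm F f o z * (starRingEnd ℂ) (gm F f Ha z) * (z.im:ℂ) ^ k := by
  rw [gm, gm, map_sum, Finset.sum_mul_sum, Uf, Finset.sum_product, Finset.sum_mul]
  refine Finset.sum_congr rfl fun u _ => ?_
  rw [Finset.sum_mul]
  refine sum_congr rfl fun v _ => ?_
  simp only [petersson, qh, Phi, zpow_natCast]
  rw [map_mul, ← exp_conj]
  have Hg : (starRingEnd ℂ) (-(2 * π * I * (f * (z.re - v) / Ha))) = 2 * π * I * (f * (z.re - v) / Ha) := by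
    simp [map_ofNat]
  rw [Hg, show (2 * Real.pi * Complex.I * (-(f * (z.re - u) / o) + f * (z.re - v) / Ha) : ℂ) = -(2 * Real.pi * Complex.I * (f * (z.re - u) / o)) + 2 * Real.pi * Complex.I * (f * (z.re - v) / Ha) by ring, Complex.exp_add]
  ring
lemma pg (F : ℍ → ℂ) (hF : Continuous F) (f : ℤ) (m : ℕ) (hm : 0 < m) : Continuous (gm F f m) := by
  have h : gm F f m = fun z : ℍ => ∑ u ∈ Ico (0:ℤ) m, exp (-(2 * π * I * (f * (z.re - u) / m))) * (F ∣[((2:ℕ):ℤ)] (toGL m hm (dlt m u))) z := by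
    funext z; simp only [gm, qh]
  rw [h]
  refine continuous_finsetSum _ fun u _ => ?_
  refine Continuous.mul ?_ (qp hF m hm u)
  have : Continuous (fun z : ℍ => z.re) := continuous_re
  fun_prop
lemma ai (m : ℕ) (hm : 0 < m) (j : ℤ) :
    ∑ u ∈ Ico (0:ℤ) m, exp (-(2 * π * I * (j * u / m))) = if (m:ℤ) ∣ j then (m:ℂ) else 0 := by
  have tw : (m:ℂ) ≠ 0 := by exact_mod_cast hm.ne'
  have Hc : ∑ u ∈ Ico (0:ℤ) m, exp (-(2 * π * I * (j * u / m))) = ∑ u ∈ range m, (exp (-(2 * π * I * (j / m)))) ^ u := by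
    refine (sum_nbij (fun u : ℕ => (u:ℤ)) ?_ ?_ ?_ ?_).symm
    · intro u hu; simp at hu ⊢; exact hu
    · intro u _ v _ h; simpa using h
    · intro u hu; simp at hu; exact ⟨u.toNat, by simp; omega, by simp; omega⟩
    · intro u _; rw [← Complex.exp_nat_mul]; congr 1; push_cast; ring
  rw [Hc]
  split_ifs with h
  · obtain ⟨t, rfl⟩ := h
    have : exp (-(2 * π * I * (((m * t : ℤ):ℂ) / m))) = 1 := by
      rw [Complex.exp_eq_one_iff]; exact ⟨-t, by push_cast; field_simp⟩
    rw [this]; simp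
  · have hne : exp (-(2 * π * I * (j / m))) ≠ 1 := by
      rw [Ne, Complex.exp_eq_one_iff]
      rintro ⟨t, ht⟩
      apply h
      refine ⟨-t, ?_⟩
      have Hd : (j:ℂ) = m * (-t) := by
        have Hg : (2 * π * I : ℂ) ≠ 0 := two_pi_I_ne_zero
        have Hk : (j:ℂ) / m = -t := by
          apply mul_left_cancel₀ Hg; linear_combination -ht
        rw [← Hk]; field_simp
      exact_mod_cast Hd
    rw [geom_sum_eq hne, ← Complex.exp_nat_mul]
    have : exp (m * -(2 * π * I * (j / m))) = 1 := by
      rw [Complex.exp_eq_one_iff]; exact ⟨-j, by push_cast; field_simp⟩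
    rw [this]; simp
lemma FD.gm_four {k a F B2} (h : FD k a F B2) (f : ℤ) (m : ℕ) (hm : 0 < m) (y : ℝ) (hy : 0 < y) (x : ℝ) :
    HasSum (fun n : ℤ => (az a (m * n + f) * (exp (-(2 * π * (n + f / m) * y)) : ℝ)) * en n x)
      (gm F f m (ofComplex (x + y * I))) := by
  have tw : (m:ℂ) ≠ 0 := by exact_mod_cast hm.ne'
  have hmr : (0:ℝ) < m := by exact_mod_cast hm
  have Hc : 0 < ((x:ℂ) + y * I).im := by simpa using hy
  rw [ofComplex_apply_of_im_pos Hc]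
  set z : ℍ := ⟨(x:ℂ) + y * I, Hc⟩ with hz
  have hzc : (z:ℂ) = x + y * I := rfl
  have hzr : z.re = x := by change ((x:ℂ) + y * I).re = x; simp
  have hw : ∀ u : ℤ, 0 < (((z:ℂ) - u) / m).im := by
    intro u
    rw [hzc, div_natCast_im]; simp; positivity
  have Hd : HasSum (fun l : ℤ => ∑ u ∈ Ico (0:ℤ) m, exp (-(2 * π * I * (f * (z.re - u) / m))) *
      (az a l * exp (2 * π * I * l * (((z:ℂ) - u) / m)) / m)) (gm F f m z) := by
    refine hasSum_sum fun u _ => ?_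
    refine HasSum.mul_left _ ?_
    refine HasSum.div_const ?_ _
    have := h.sm (ofComplex (((z:ℂ) - u) / m))
    rwa [ofComplex_apply_of_im_pos (hw u)] at this ⊢
  have Hg : ∀ l : ℤ, ∑ u ∈ Ico (0:ℤ) m, exp (-(2 * π * I * (f * (z.re - u) / m))) *
      (az a l * exp (2 * π * I * l * (((z:ℂ) - u) / m)) / m)
      = if (m:ℤ) ∣ (l - f) then az a l * Complex.exp (2 * Real.pi * Complex.I * (((l:ℂ) - f) / m * x)) * Complex.exp (-(2 * Real.pi * (l / m) * y)) else 0 := by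
    intro l
    have Hk : ∀ u : ℤ, exp (-(2 * π * I * (f * (z.re - u) / m))) *
      (az a l * Complex.exp (2 * Real.pi * Complex.I * l * (((z:ℂ) - u) / m)) / m) = (az a l * Complex.exp (2 * Real.pi * Complex.I * (((l:ℂ) - f) / m * x)) * Complex.exp (-(2 * Real.pi * (l / m) * y)) / m) * Complex.exp (-(2 * Real.pi * Complex.I * (((l - f : ℤ):ℂ) * u / m))) := by
      intro u
      have Hi : Complex.exp (-(2 * Real.pi * Complex.I * (f * (z.re - u) / m))) * Complex.exp (2 * Real.pi * Complex.I * l * (((z:ℂ) - u) / m)) = Complex.exp (2 * Real.pi * Complex.I * (((l:ℂ) - f) / m * x)) * Complex.exp (-(2 * Real.pi * (l / m) * y)) * Complex.exp (-(2 * Real.pi * Complex.I * (((l - f : ℤ):ℂ) * u / m))) := by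
        rw [← Complex.exp_add, ← Complex.exp_add, ← Complex.exp_add, hzr, hzc]
        congr 1
        push_cast
        linear_combination (2 * π * l * y / m : ℂ) * I_sq
      linear_combination (az a l / m) * Hi
    rw [sum_congr rfl fun u _ => Hk u, ← mul_sum, ai m hm]
    split_ifs
    · field_simp
    · simp
  simp_rw [Hg] at Hd
  have hinj : Function.Injective (fun n : ℤ => (m:ℤ) * n + f) := by
    intro p q hpq
    simpa [hm.ne'] using hpq
  rw [← hinj.hasSum_iff] at Hd
  · convert Hd using 2 with n
    simp only [Function.comp]
    rw [if_pos ⟨n, by ring⟩, en, ofReal_exp, mul_assoc (az _ _), mul_assoc (az _ _)]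
    congr 1
    rw [← Complex.exp_add, ← Complex.exp_add]
    congr 1
    push_cast; field_simp; ring
  · intro l hl
    rw [if_neg]
    rintro ⟨n, hn⟩
    exact hl ⟨n, by simp only; omega⟩
end
section
open Real Finset Complex
open UpperHalfPlane hiding I
open Complex hiding I
open scoped ModularForm MatrixGroups
open MeasureTheory
noncomputable def kap (F : ℍ → ℂ) (f : ℤ) (k o Ha : ℕ) (y : ℝ) : ℂ :=
  (∫ x in (0:ℝ)..1, gm F f o (ofComplex (x + y * I)) * (starRingEnd ℂ) (gm F f Ha (ofComplex (x + y * I)))) * (y:ℂ) ^ k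
lemma ak (g : ℍ → ℂ) (hg : Continuous g) (Y : ℝ) (hY : 0 < Y) :
    ContinuousOn (fun y : ℝ => ∫ x in (0:ℝ)..1, g (ofComplex (x + y * I))) (Set.Ici Y) := by
  have hpos : ∀ p : ℝ × ℝ, 0 < ((p.2:ℂ) + (max p.1 Y : ℝ) * I).im := by
    intro p; simp [hY]
  have Hc : Continuous (fun p : ℝ × ℝ => g (ofComplex (p.2 + (max p.1 Y : ℝ) * I))) := by
    have Hd : (fun p : ℝ × ℝ => g (ofComplex (p.2 + (max p.1 Y : ℝ) * I))) = fun p => g ⟨(p.2:ℂ) + (max p.1 Y : ℝ) * I, hpos p⟩ := by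
      funext p; rw [ofComplex_apply_of_im_pos (hpos p)]
    rw [Hd]
    refine hg.comp ?_
    rw [UpperHalfPlane.isEmbedding_coe.continuous_iff]
    change Continuous fun p : ℝ × ℝ => (p.2:ℂ) + (max p.1 Y : ℝ) * I
    fun_prop
  have Hg : Continuous fun y : ℝ => ∫ x in (0:ℝ)..1, g (ofComplex (x + (max y Y : ℝ) * I)) :=
    intervalIntegral.continuous_parametric_intervalIntegral_of_continuous' (f := fun y x : ℝ => g (ofComplex (x + (max y Y : ℝ) * I))) Hc 0 1
  refine Hg.continuousOn.congr fun y hy => ?_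
  simp only [max_eq_left (Set.mem_Ici.1 hy)]
lemma al (F : ℍ → ℂ) (hF : Continuous F) (f : ℤ) (k o Ha : ℕ) (Hc : 0 < o) (Hd : 0 < Ha) (Y : ℝ) (hY : 0 < Y) :
    ContinuousOn (kap F f k o Ha) (Set.Ici Y) := by
  unfold kap
  refine ContinuousOn.mul (ak (fun z => gm F f o z * (starRingEnd ℂ) (gm F f Ha z)) ?_ Y hY) (by fun_prop)
  exact (pg F hF f o Hc).mul (continuous_conj.comp (pg F hF f Ha Hd))
lemma an {k a F B2} (h : FD k a F B2) (hk : 2 ≤ k) (f : ℤ) (o Ha : ℕ) (Hc : 0 < o) (Hd : 0 < Ha)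
    (Y Hb : ℝ) (hY : 0 < Y) (hYY : Y ≤ Hb) (ev : Hb ≤ 2 * Y) (C : ℕ) (hC : 1 / Y ≤ C) :
    ‖∫ y in Y..Hb, ((1 / y ^ 2 : ℝ) : ℂ) * kap F f k o Ha y‖ ^ 2 ≤
      18 * (o.divisors.card * o * (Ha.divisors.card * Ha)) * (((o:ℝ) * Ha) ^ (k - 2) * B2 ^ 2) * (1 / Y - 1 / Hb) * (o * Ha + ∑ c ∈ Icc 1 C, ‖KK c o Ha f 0 0‖ / c) := by
  refine le_trans (le_of_eq ?_) (zh h.inv h.cont hk B2 h.B2_nonneg h.bd o Ha Hc Hd f Y Hb hY hYY ev C hC)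
  congr 2
  simp_rw [ah]
  rw [sn _ _ 0 1 Y Hb zero_le_one hY hYY]
  · refine intervalIntegral.integral_congr fun y hy => ?_
    rw [Set.uIcc_of_le hYY] at hy
    have jj : 0 < y := hY.trans_le hy.1
    rw [kap, ← intervalIntegral.integral_mul_const]
    congr 1
    refine intervalIntegral.integral_congr fun x _ => ?_
    have Hg : 0 < ((x:ℂ) + y * I).im := by simpa using jj
    have Hk : (ofComplex ((x:ℂ) + y * I)).im = y := by
      rw [ofComplex_apply_of_im_pos Hg]
      change ((x:ℂ) + y * I).im = y
      simp
    simp only [Hk]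
  · refine ((pg F h.cont f o Hc).mul (continuous_conj.comp (pg F h.cont f Ha Hd))).mul ?_
    exact (continuous_ofReal.comp UpperHalfPlane.continuous_im).pow k
lemma FD.comb_four {k a F B2} (h : FD k a F B2) (f : ℤ) (S : Finset ℕ) (hS : ∀ m ∈ S, 0 < m) (γ : ℕ → ℂ) (y : ℝ) (hy : 0 < y) (x : ℝ) :
    HasSum (fun n : ℤ => (∑ m ∈ S, γ m * (az a (m * n + f) * (exp (-(2 * π * (n + f / m) * y)) : ℝ))) * en n x)
      (∑ m ∈ S, γ m * gm F f m (ofComplex (x + y * I))) := by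
  have := hasSum_sum (s := S) (fun m hm => (h.gm_four f m (hS m hm) y hy x).mul_left (γ m))
  refine this.congr_fun ?_
  intro n
  simp only [sum_mul, mul_assoc]
lemma FD.comb_expand {k a F B2} (h : FD k a F B2) (f : ℤ) (S : Finset ℕ) (hS : ∀ m ∈ S, 0 < m) (γ : ℕ → ℂ) (y : ℝ) (hy : 0 < y) :
    (((∫ x in (0:ℝ)..1, ‖∑ m ∈ S, γ m * gm F f m (ofComplex (x + y * I))‖ ^ 2) * y ^ k : ℝ) : ℂ) =
      ∑ o ∈ S, ∑ Ha ∈ S, γ o * (starRingEnd ℂ) (γ Ha) * kap F f k o Ha y := by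
  have hc : ∀ m ∈ S, Continuous fun x : ℝ => gm F f m (ofComplex (x + y * I)) := fun m hm =>
    qr (h.gm_four f m (hS m hm) y hy)
  push_cast
  rw [← intervalIntegral.integral_ofReal]
  have Hc : ∀ x : ℝ, (((‖∑ m ∈ S, γ m * gm F f m (ofComplex (x + y * I))‖ ^ 2 : ℝ)) : ℂ) =
      ∑ o ∈ S, ∑ Ha ∈ S, γ o * (starRingEnd ℂ) (γ Ha) * (gm F f o (ofComplex (x + y * I)) * (starRingEnd ℂ) (gm F f Ha (ofComplex (x + y * I)))) := by
    intro x
    push_cast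
    rw [← mul_conj', map_sum, sum_mul_sum]
    refine sum_congr rfl fun o _ => sum_congr rfl fun Ha _ => ?_
    rw [map_mul]; ring
  simp_rw [Hc]
  have hii : ∀ o ∈ S, ∀ Ha ∈ S, Continuous fun x : ℝ => γ o * (starRingEnd ℂ) (γ Ha) * (gm F f o (ofComplex (x + y * I)) * (starRingEnd ℂ) (gm F f Ha (ofComplex (x + y * I)))) := by
    intro o Hc Ha Hd
    exact continuous_const.mul ((hc o Hc).mul (continuous_conj.comp (hc Ha Hd)))
  rw [intervalIntegral.integral_finsetSum, sum_mul]
  · refine sum_congr rfl fun o ph => ?_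
    rw [intervalIntegral.integral_finsetSum, sum_mul]
    · refine sum_congr rfl fun Ha gn => ?_
      rw [intervalIntegral.integral_const_mul, kap]; ring
    · intro Ha gn
      exact (hii o ph Ha gn).intervalIntegrable _ _
  · intro o ph
    exact (continuous_finsetSum _ fun Ha gn => hii o ph Ha gn).intervalIntegrable _ _
lemma FD.bess {k a F B2} (h : FD k a F B2) (f : ℤ) (S : Finset ℕ) (hS : ∀ m ∈ S, 0 < m) (γ : ℕ → ℂ) (y : ℝ) (hy : 0 < y) (s : Finset ℤ) :
    y ^ k * ∑ n ∈ s, ‖∑ m ∈ S, γ m * (az a (m * n + f) * (exp (-(2 * π * (n + f / m) * y)) : ℝ))‖ ^ 2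
      ≤ (∑ o ∈ S, ∑ Ha ∈ S, γ o * (starRingEnd ℂ) (γ Ha) * kap F f k o Ha y).re := by
  rw [← h.comb_expand f S hS γ y hy, ofReal_re, mul_comm]
  gcongr
  exact bessel (h.comb_four f S hS γ y hy) s
lemma FD.kap_diag {k a F B2} (h : FD k a F B2) (f : ℤ) (m : ℕ) (hm : 0 < m) (y : ℝ) (hy : 0 < y) :
    HasSum (fun n : ℤ => y ^ k * (‖az a (m * n + f)‖ ^ 2 * Real.exp (-(4 * Real.pi * (n + f / m) * y)))) (kap F f k m m y).re := by
  have Hc := h.comb_expand f {m} (by simpa using hm) (fun _ => 1) y hy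
  simp only [Finset.sum_singleton, one_mul, map_one] at Hc
  rw [← Hc, Complex.ofReal_re]
  have Hd := (parseval (h.gm_four f m hm y hy)).mul_left (y ^ k)
  rw [mul_comm (y ^ k) (∫ x in (0:ℝ)..1, _)] at Hd
  refine Hd.congr_fun fun n => ?_
  rw [norm_mul, mul_pow, Complex.norm_real, Real.norm_eq_abs, abs_of_pos (Real.exp_pos _), ← Real.exp_nat_mul]
  congr 3
  push_cast; ring
end
section
open Real Finset
lemma ao (S : Finset ℕ) (hS : ∀ m ∈ S, 0 < m) (T : Finset ℤ) (hT : (0:ℤ) ∉ T) (f : ℤ) (l : ℤ) :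
    ((S ×ˢ T).filter (fun p => (p.1:ℤ) * p.2 + f = l)).card ≤ (l - f).natAbs.divisors.card := by
  refine card_le_card_of_injOn (fun p => p.1) ?_ ?_
  · intro p hp
    simp only [coe_filter, mem_product, Set.mem_ofPred_eq] at hp
    obtain ⟨⟨Hc, Hd⟩, Hg⟩ := hp
    have Hk : l - f = p.1 * p.2 := by omega
    have Hl : p.2 ≠ 0 := fun h => hT (h ▸ Hd)
    have Hq := (hS _ Hc).ne'
    simp only [mem_coe, Nat.mem_divisors]
    rw [Hk, Int.natAbs_mul, Int.natAbs_natCast]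
    exact ⟨dvd_mul_right _ _, by simp [Hl, Hq]⟩
  · intro p hp q hq hpq
    simp only [coe_filter, mem_product, Set.mem_ofPred_eq] at hp hq
    simp only at hpq
    have Hq := (hS _ hp.1.1).ne'
    have eb : (p.1:ℤ) * p.2 = p.1 * q.2 := by have := hq.2; rw [← hpq] at this; linarith [hp.2]
    have jl : p.2 = q.2 := by
      apply mul_left_cancel₀ _ eb; exact_mod_cast Hq
    exact Prod.ext hpq jl
lemma ap (S : Finset ℕ) (hS : ∀ m ∈ S, 0 < m) (T : Finset ℤ) (hT : (0:ℤ) ∉ T) (f : ℤ) (H : ℤ → ℝ) (hH : ∀ l, 0 ≤ H l) :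
    ∑ m ∈ S, ∑ n ∈ T, H (m * n + f) ≤ ∑ l ∈ (S ×ˢ T).image (fun p => (p.1:ℤ) * p.2 + f), ((l - f).natAbs.divisors.card : ℝ) * H l := by
  rw [← sum_product' (f := fun (m:ℕ) (n:ℤ) => H (m * n + f))]
  rw [← sum_fiberwise_of_maps_to (t := (S ×ˢ T).image (fun p => (p.1:ℤ) * p.2 + f)) (g := fun p => (p.1:ℤ) * p.2 + f) (fun p hp => mem_image_of_mem _ hp)]
  refine sum_le_sum fun l _ => ?_
  rw [sum_congr rfl (g := fun _ => H l), sum_const, nsmul_eq_mul]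
  · have := ao S hS T hT f l
    have Hm := hH l
    gcongr
  · intro p hp
    rw [(mem_filter.1 hp).2]
lemma aq (ε : ℝ) (Hm : 0 < ε) (Hc : ε ≤ 1) (l t : ℝ) (hl : 0 < l) (ht : 0 < t) :
    (1 + l) ^ ε ≤ (1 + 1 / t) ^ ε * Real.exp (4 * π * l * t) := by
  have Hd : 1 + l ≤ (1 + 1 / t) * Real.exp (l * t) := by
    have Hg := add_one_le_exp (l * t)
    have Hk : 1 ≤ Real.exp (l * t) := one_le_exp (by positivity)
    have Hl : l ≤ 1 / t * Real.exp (l * t) := by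
      rw [div_mul_eq_mul_div, one_mul, le_div_iff₀ ht]; linarith
    linarith
  calc (1 + l) ^ ε ≤ ((1 + 1 / t) * Real.exp (l * t)) ^ ε := by gcongr
    _ = (1 + 1/t) ^ ε * Real.exp (l * t * ε) := by
        rw [mul_rpow (by positivity) (by positivity), ← Real.exp_mul]
    _ ≤ _ := by
        have Hq : l * t * ε ≤ 4 * π * l * t := by nlinarith [pi_gt_three, mul_pos hl ht]
        exact mul_le_mul_of_nonneg_left (Real.exp_le_exp.2 Hq) (by positivity)
lemma expk (k : ℕ) (hk : 2 ≤ k) : ((1 - 1 / (k:ℝ)) ^ k)⁻¹ ≤ Real.exp 2 := by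
  have js : (2:ℝ) ≤ k := by exact_mod_cast hk
  have Hc : Real.exp (-(2 / k)) ≤ 1 - 1 / (k:ℝ) := by
    rw [Real.exp_neg, inv_le_iff_one_le_mul₀ (Real.exp_pos _)]
    have Hd := add_one_le_exp (2 / (k:ℝ))
    have Hg : 0 ≤ 1 - 1 / (k:ℝ) := by
      rw [sub_nonneg, div_le_one (by linarith)]; linarith
    have Hk : (1 / (k:ℝ)) ≤ 1/2 := one_div_le_one_div_of_le (by norm_num) js
    have Hl : 0 < 1 / (k:ℝ) := by positivity
    have Hq : 2 / (k:ℝ) = 2 * (1 / k) := by ring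
    rw [Hq] at Hd ⊢
    calc (1:ℝ) ≤ (1 - 1/k) * (2 * (1/k) + 1) := by nlinarith
      _ ≤ _ := by gcongr
  have eb : Real.exp (-2) ≤ (1 - 1 / (k:ℝ)) ^ k := by
    calc Real.exp (-2) = Real.exp (-(2/k)) ^ k := by rw [← Real.exp_nat_mul]; congr 1; field_simp
      _ ≤ _ := by gcongr
  rw [inv_le_comm₀ (lt_of_lt_of_le (Real.exp_pos _) eb) (Real.exp_pos _), ← Real.exp_neg]
  exact eb
lemma ar (k : ℕ) (hk : 0 < k) : (1 + 1 / (k:ℝ)) ^ k ≤ Real.exp 1 := by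
  have js : (0:ℝ) < k := by exact_mod_cast hk
  calc (1 + 1 / (k:ℝ)) ^ k ≤ Real.exp (1 / k) ^ k := by
        gcongr; linarith [add_one_le_exp (1 / (k:ℝ))]
    _ = _ := by rw [← Real.exp_nat_mul]; congr 1; field_simp
lemma au (ε : ℝ) (hε : 0 < ε) (jq : ε ≤ 1) : ∃ K : ℝ, 1 ≤ K ∧ ∀ (k : ℕ) (a : ℕ → ℂ) (F : UpperHalfPlane → ℂ) (B2 : ℝ),
    FD k a F B2 → 2 ≤ k → ∀ (f : ℤ), f ≠ 0 → ∀ (S : Finset ℕ) (A B : ℝ), 1 ≤ A → A ≤ B → B ≤ A * (1 + 1 / k) →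
    (∀ m ∈ S, A ≤ m ∧ (m:ℝ) ≤ B) → ∀ (y : ℝ), 0 < y → ∀ T : Finset ℤ, (0:ℤ) ∉ T →
    y ^ k * ∑ m ∈ S, (1 / (m:ℝ) ^ (k - 1)) * ∑ n ∈ T, ‖az a (m * n + f)‖ ^ 2 * Real.exp (-(4 * π * (n + f / m) * y))
      ≤ K * A * (|(f:ℝ)| * (1 + B * k / y)) ^ ε * B2 := by
  obtain ⟨K, cu, hK⟩ := pz ε hε
  refine ⟨K * Real.exp 3, one_le_mul_of_one_le_of_one_le cu (one_le_exp (by norm_num)), ?_⟩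
  intro k a F B2 h hk f hf S A B hA hAB hBA hS y hy T hT
  have gl : (0:ℝ) < k := by exact_mod_cast (by omega : 0 < k)
  have ff : (2:ℝ) ≤ k := by exact_mod_cast hk
  have hB : 0 < B := by linarith
  have pj := h.B2_nonneg
  have tx : (1:ℝ) ≤ |(f:ℝ)| := by rw [← Int.cast_abs]; exact_mod_cast Int.one_le_abs hf
  have jb : ∀ m ∈ S, 0 < m := fun m hm => by
    have := (hS m hm).1; have : (0:ℝ) < m := by linarith
    exact_mod_cast this
  have fg : 0 < 1 - 1 / (k:ℝ) := by
    rw [sub_pos, div_lt_one gl]; linarith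
  set t := y / (B * k) with ht
  have ru : 0 < t := by positivity
  set jk := y / B * (1 - 1 / k) with ja
  have av : 0 < jk := by positivity
  set H : ℤ → ℝ := fun l => ‖az a l‖ ^ 2 * Real.exp (-(4 * π * l * (y / B))) with hH
  have cm : ∀ l, 0 ≤ H l := fun l => by positivity
  set Q := (|(f:ℝ)| * (1 + B * k / y)) ^ ε with hQ
  have xi : 0 ≤ Q := by positivity
  have Hi : ∑ m ∈ S, (1 / (m:ℝ) ^ (k - 1)) * ∑ n ∈ T, ‖az a (m * n + f)‖ ^ 2 * Real.exp (-(4 * π * (n + f / m) * y))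
      ≤ 1 / A ^ (k - 1) * ∑ m ∈ S, ∑ n ∈ T, H (m * n + f) := by
    rw [mul_sum]
    refine sum_le_sum fun m hm => ?_
    obtain ⟨ph, gn⟩ := hS m hm
    have tw : (0:ℝ) < m := by linarith
    gcongr with n hn
    rcases lt_or_ge 0 ((m:ℤ) * n + f) with hl | hl
    · simp only [hH]
      gcongr ‖az a (m * n + f)‖ ^ 2 * Real.exp ?_
      have qt : (0:ℝ) < m * n + f := by exact_mod_cast hl
      rw [neg_le_neg_iff]
      push_cast
      have : ((n:ℝ) + f / m) * y = (m * n + f) * (y / m) := by field_simp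
      rw [mul_assoc _ ((n:ℝ) + f / m), this, mul_assoc]
      gcongr
    · simp [hH, az, not_lt.2 hl]
  have Hj : ∀ l : ℤ, l ≠ f → ((l - f).natAbs.divisors.card : ℝ) * H l ≤ K * Q * (‖az a l‖ ^ 2 * Real.exp (-(4 * π * l * jk))) := by
    intro l hlf
    rcases lt_or_ge 0 l with hl | hl
    · have qt : (0:ℝ) < l := by exact_mod_cast hl
      have Hg := hK (l - f).natAbs (by omega)
      have Hk : (((l - f).natAbs : ℕ) : ℝ) ≤ |(f:ℝ)| * (1 + l) := by
        rw [Nat.cast_natAbs]; push_cast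
        calc |(l:ℝ) - f| ≤ |(l:ℝ)| + |(f:ℝ)| := abs_sub _ _
          _ = l + |(f:ℝ)| := by rw [abs_of_pos qt]
          _ ≤ _ := by nlinarith
      have Hl : (((l - f).natAbs : ℕ) : ℝ) ^ ε ≤ Q * Real.exp (4 * π * l * t) := by
        calc (((l - f).natAbs : ℕ) : ℝ) ^ ε ≤ (|(f:ℝ)| * (1 + l)) ^ ε := by gcongr
          _ = |(f:ℝ)| ^ ε * (1 + l) ^ ε := by rw [mul_rpow (by positivity) (by positivity)]
          _ ≤ |(f:ℝ)| ^ ε * ((1 + 1 / t) ^ ε * Real.exp (4 * π * l * t)) := by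
              gcongr; exact aq ε hε jq l t qt ru
          _ = _ := by
              rw [hQ, mul_rpow (by positivity) (by positivity), ht, one_div_div]; ring
      have Hq : Real.exp (4 * π * l * t) * Real.exp (-(4 * π * l * (y / B))) = Real.exp (-(4 * π * l * jk)) := by
        rw [← Real.exp_add]; congr 1; rw [ht, ja]; field_simp; ring
      calc ((l - f).natAbs.divisors.card : ℝ) * H l ≤ (K * (Q * Real.exp (4 * π * l * t))) * H l := by
            have := cm l
            gcongr
            exact Hg.trans (by gcongr)
        _ = K * Q * (‖az a l‖ ^ 2 * (Real.exp (4 * π * l * t) * Real.exp (-(4 * π * l * (y / B))))) := by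
            simp only [hH]; ring
        _ = _ := by rw [Hq]
    · simp [hH, az, not_lt.2 hl]
  obtain ⟨pb, pc⟩ := h.rankin jk av
  have Hu : ∑ m ∈ S, ∑ n ∈ T, H (m * n + f) ≤ K * Q * (B2 / jk ^ k) := by
    refine (ap S jb T hT f H cm).trans ?_
    calc _ ≤ ∑ l ∈ (S ×ˢ T).image (fun p => (p.1:ℤ) * p.2 + f), K * Q * (‖az a l‖ ^ 2 * Real.exp (-(4 * π * l * jk))) := by
          refine sum_le_sum fun l hl => Hj l ?_
          obtain ⟨p, hp, rfl⟩ := mem_image.1 hl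
          rw [mem_product] at hp
          have Hl : p.2 ≠ 0 := fun h => hT (h ▸ hp.2)
          have Hq := (jb _ hp.1).ne'
          simp [Hl, Hq]
      _ = K * Q * ∑ l ∈ (S ×ˢ T).image (fun p => (p.1:ℤ) * p.2 + f), (‖az a l‖ ^ 2 * Real.exp (-(4 * π * l * jk))) := by rw [mul_sum]
      _ ≤ _ := by
          gcongr
          exact (pb.sum_le_tsum _ (fun _ _ => by positivity)).trans pc
  have et : y ^ k * (1 / A ^ (k - 1)) * (1 / jk ^ k) ≤ Real.exp 3 * A := by
    have jl := expk k hk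
    have cy := ar k (by omega)
    have ex : B ^ k ≤ A ^ k * Real.exp 1 := by
      calc B ^ k ≤ (A * (1 + 1 / k)) ^ k := by gcongr
        _ = A ^ k * (1 + 1 / k) ^ k := by rw [mul_pow]
        _ ≤ _ := by gcongr
    have tv : A ^ k = A ^ (k-1) * A := by rw [← pow_succ]; congr 1; omega
    have ce : 0 < A := by linarith
    calc y ^ k * (1 / A ^ (k - 1)) * (1 / jk ^ k) = B ^ k * (1 / A ^ (k-1)) * ((1 - 1 / (k:ℝ)) ^ k)⁻¹ := by
          rw [ja, mul_pow, div_pow]; field_simp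
      _ ≤ (A ^ k * Real.exp 1) * (1 / A ^ (k-1)) * Real.exp 2 := by gcongr
      _ = A * (Real.exp 1 * Real.exp 2) := by rw [tv]; field_simp
      _ = _ := by rw [← Real.exp_add, mul_comm]; norm_num
  have ce : 0 < A := by linarith
  calc _ ≤ y ^ k * (1 / A ^ (k - 1) * (K * Q * (B2 / jk ^ k))) := by
        gcongr; exact Hi.trans (by gcongr)
    _ = (y ^ k * (1 / A ^ (k - 1)) * (1 / jk ^ k)) * (K * Q * B2) := by ring
    _ ≤ (Real.exp 3 * A) * (K * Q * B2) := by gcongr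
    _ = _ := by ring
end
section
open Real Finset
open UpperHalfPlane hiding I
open Complex hiding I
open MeasureTheory
lemma aw (S : Finset ℕ) (γ : ℕ → ℂ) (κ : ℕ → ℕ → ℂ) :
    (∑ o ∈ S, ∑ Ha ∈ S, γ o * (starRingEnd ℂ) (γ Ha) * κ o Ha).re
      = ∑ m ∈ S, ‖γ m‖ ^ 2 * (κ m m).re + (∑ p ∈ S.offDiag, γ p.1 * (starRingEnd ℂ) (γ p.2) * κ p.1 p.2).re := by
  rw [← sum_product' (f := fun o Ha => γ o * (starRingEnd ℂ) (γ Ha) * κ o Ha), ← diag_union_offDiag,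
    sum_union (disjoint_diag_offDiag S), sum_diag, Complex.add_re, Complex.re_sum]
  congr 1
  refine sum_congr rfl fun m _ => ?_
  rw [Complex.mul_conj, Complex.re_ofReal_mul, Complex.normSq_eq_norm_sq]
lemma FD.ptw {k a F B2} (h : FD k a F B2) (f : ℤ) (S : Finset ℕ) (hS : ∀ m ∈ S, 0 < m) (w : ℕ → ℝ) (hw : ∀ m ∈ S, 0 < w m)
    (α : ℕ → ℂ) (hα : ∀ m, ‖α m‖ ≤ 1) (y : ℝ) (hy : 0 < y) (Δ ρ : ℝ) (hρ : 0 ≤ ρ)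
    (hΔ : ∀ T : Finset ℤ, (0:ℤ) ∉ T → y ^ k * ∑ m ∈ S, (1 / w m ^ 2) *
      ∑ n ∈ T, ‖az a (m * n + f)‖ ^ 2 * Real.exp (-(4 * π * (n + f / m) * y)) ≤ Δ)
    (hv : ∀ m ∈ S, ∀ Ho ∈ S, 1 / w m * Real.exp (-(2 * π * (f / m) * y)) ≤ ρ * (1 / w Ho * Real.exp (-(2 * π * (f / Ho) * y))))
    (s : Finset ℤ) (hs : (0:ℤ) ∉ s) :
    y ^ k * ∑ n ∈ s, ‖∑ m ∈ S, (α m / w m) * (az a (m * n + f) * (Real.exp (-(2 * π * (n + f / m) * y)) : ℝ))‖ ^ 2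
      ≤ (1 + ρ) * Δ + (∑ p ∈ S.offDiag, (ρ + α p.1 * (starRingEnd ℂ) (α p.2)) / (w p.1 * w p.2) * kap F f k p.1 p.2 y).re := by
  have ax : 0 ≤ Δ := by simpa using hΔ ∅ (by simp)
  have ee : ∀ t : ℝ, Real.exp (-(2 * π * t * y)) ^ 2 = Real.exp (-(4 * π * t * y)) := fun t => by
    rw [← Real.exp_nat_mul]; congr 1; push_cast; ring
  have hnn : ∀ m ∈ S, 0 ≤ (kap F f k m m y).re := fun m hm => (h.kap_diag f m (hS m hm) y hy).nonneg fun n => by positivity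
  set v : ℕ → ℝ := fun m => 1 / w m * Real.exp (-(2 * π * (f / m) * y)) with hvd
  have pe : ∀ m ∈ S, 0 < v m := fun m hm => by have := hw m hm; positivity
  set qu := y ^ k * (‖az a f‖ ^ 2 * ∑ m ∈ S, v m ^ 2) with ty
  have hG : ∑ m ∈ S, 1 / w m ^ 2 * (kap F f k m m y).re ≤ qu + Δ := by
    refine hasSum_le_of_sum_le (hasSum_sum fun m hm => (h.kap_diag f m (hS m hm) y hy).mul_left (1 / w m ^ 2)) fun T => ?_
    have ch : ∀ n : ℤ, ∑ m ∈ S, 1 / w m ^ 2 * (y ^ k * (‖az a (m * n + f)‖ ^ 2 * Real.exp (-(4 * π * (n + f / m) * y))))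
        = y ^ k * ∑ m ∈ S, 1 / w m ^ 2 * (‖az a (m * n + f)‖ ^ 2 * Real.exp (-(4 * π * (n + f / m) * y))) := fun n => by
      rw [mul_sum]; exact sum_congr rfl fun m _ => by ring
    have Hi := hΔ (T.erase 0) (by simp)
    calc _ ≤ ∑ n ∈ insert 0 (T.erase 0), ∑ m ∈ S, 1 / w m ^ 2 * (y ^ k * (‖az a (m * n + f)‖ ^ 2 * Real.exp (-(4 * π * (n + f / m) * y)))) := by
          refine sum_le_sum_of_subset_of_nonneg (insert_erase_subset 0 T) fun n _ _ => sum_nonneg fun m hm => by have := hw m hm; positivity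
      _ ≤ _ := by
          rw [sum_insert (by simp)]
          refine add_le_add (le_of_eq ?_) (le_trans (le_of_eq ?_) Hi)
          · rw [ch, ty]
            congr 1
            rw [mul_sum]
            refine sum_congr rfl fun m _ => ?_
            simp only [hvd, mul_pow, ee]; simp; ring
          · rw [sum_congr rfl fun n _ => ch n, ← mul_sum, sum_comm]
            simp only [mul_sum]
  have hgen : ∀ (α : ℕ → ℂ), (∀ m, ‖α m‖ ≤ 1) → ∀ s : Finset ℤ, y ^ k * ∑ n ∈ s, ‖∑ m ∈ S, (α m / w m) * (az a (m * n + f) * (Real.exp (-(2 * π * (n + f / m) * y)) : ℝ))‖ ^ 2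
      ≤ qu + Δ + (∑ p ∈ S.offDiag, α p.1 * (starRingEnd ℂ) (α p.2) / (w p.1 * w p.2) * kap F f k p.1 p.2 y).re := by
    intro α hα s
    refine (h.bess f S hS (fun m => α m / w m) y hy s).trans ?_
    rw [aw S (fun m => α m / w m) (fun o Ha => kap F f k o Ha y)]
    refine add_le_add (le_trans (sum_le_sum fun m hm => ?_) hG) (le_of_eq ?_)
    · have := hw m hm
      have Hc := hα m
      refine mul_le_mul_of_nonneg_right ?_ (hnn m hm)
      rw [norm_div, Complex.norm_real, Real.norm_of_nonneg this.le, div_pow]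
      gcongr
      exact pow_le_one₀ (norm_nonneg _) Hc
    · congr 1
      refine sum_congr rfl fun p _ => ?_
      rw [map_div₀, Complex.conj_ofReal, div_mul_div_comm]
  rcases Nat.lt_or_ge S.card 2 with hc | hc
  · rcases Nat.lt_or_ge S.card 1 with eu | qs
    · have : S = ∅ := card_eq_zero.1 (by omega)
      subst this; simp; positivity
    · obtain ⟨m, rfl⟩ := card_eq_one.1 (by omega : S.card = 1)
      have Hi := hΔ s hs
      have hwm := hw m (by simp)
      simp only [sum_singleton] at Hi ⊢
      have : (({m} : Finset ℕ).offDiag) = ∅ := by ext p; simp [mem_offDiag]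
      rw [this, sum_empty, Complex.zero_re, add_zero]
      refine le_trans ?_ (Hi.trans (by nlinarith))
      rw [mul_sum (a := 1 / w m ^ 2)]
      gcongr with n hn
      rw [norm_mul, norm_mul, norm_div, Complex.norm_real, Complex.norm_real, Real.norm_of_nonneg hwm.le, Real.norm_of_nonneg (Real.exp_pos _).le,
        mul_pow, mul_pow, ee, div_pow]
      gcongr
      exact pow_le_one₀ (norm_nonneg _) (hα m)
  · have Hc := hgen (fun _ => 1) (fun _ => by simp) {0}
    have Hj : y ^ k * ∑ n ∈ ({0} : Finset ℤ), ‖∑ m ∈ S, ((1:ℂ) / w m) * (az a (m * n + f) * (Real.exp (-(2 * π * (n + f / m) * y)) : ℝ))‖ ^ 2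
        = y ^ k * (‖az a f‖ ^ 2 * (∑ m ∈ S, v m) ^ 2) := by
      have : ∑ m ∈ S, ((1:ℂ) / w m) * (az a (m * (0:ℤ) + f) * (Real.exp (-(2 * π * ((0:ℤ) + f / m) * y)) : ℝ)) = az a f * ((∑ m ∈ S, v m : ℝ) : ℂ) := by
        push_cast
        rw [mul_sum]
        refine sum_congr rfl fun m _ => ?_
        simp only [hvd, mul_zero, zero_add]; push_cast; ring
      rw [sum_singleton, this, norm_mul, mul_pow, Complex.norm_real, Real.norm_eq_abs, sq_abs]
    rw [Hj] at Hc
    have Hu : (1 + ρ) * ∑ m ∈ S, v m ^ 2 ≤ ρ * (∑ m ∈ S, v m) ^ 2 := by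
      rw [sq (∑ m ∈ S, v m), sum_mul, mul_sum, mul_sum]
      refine sum_le_sum fun m hm => ?_
      obtain ⟨Ho, ej, hne⟩ := exists_mem_ne (by omega : 1 < S.card) m
      have Hd : v m + v Ho ≤ ∑ m ∈ S, v m := by
        rw [← sum_pair hne.symm]
        exact sum_le_sum_of_subset_of_nonneg (by intro x; simp; rintro (rfl | rfl) <;> assumption) fun i hi _ => (pe i hi).le
      have Hg := hv m hm Ho ej
      have Hk := pe m hm
      have Hl : ρ * (v m * (v m + v Ho)) ≤ ρ * (v m * ∑ m ∈ S, v m) := by gcongr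
      have Hq : v m * v m ≤ v m * (ρ * v Ho) := mul_le_mul_of_nonneg_left Hg Hk.le
      linarith
    have et : qu ≤ ρ * (Δ + (∑ p ∈ S.offDiag, 1 * (starRingEnd ℂ) 1 / (w p.1 * w p.2) * kap F f k p.1 p.2 y).re) := by
      have Hd : 0 ≤ y ^ k * ‖az a f‖ ^ 2 := by positivity
      have Hg := mul_le_mul_of_nonneg_left Hu Hd
      have Hk := mul_le_mul_of_nonneg_left Hc hρ
      rw [ty] at Hk ⊢
      linarith
    refine (hgen α hα s).trans ?_
    have ew : (∑ p ∈ S.offDiag, (ρ + α p.1 * (starRingEnd ℂ) (α p.2)) / (w p.1 * w p.2) * kap F f k p.1 p.2 y).re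
        = ρ * (∑ p ∈ S.offDiag, 1 * (starRingEnd ℂ) 1 / (w p.1 * w p.2) * kap F f k p.1 p.2 y).re +
        (∑ p ∈ S.offDiag, α p.1 * (starRingEnd ℂ) (α p.2) / (w p.1 * w p.2) * kap F f k p.1 p.2 y).re := by
      rw [← Complex.re_ofReal_mul, ← Complex.add_re, mul_sum, ← sum_add_distrib]
      congr 1
      refine sum_congr rfl fun p _ => ?_
      rw [map_one]; ring
    rw [ew]; linarith
end
section
open Real Finset
open MeasureTheory
lemma abel (c : ℕ → ℝ) (p : ℕ → ℂ) (L : ℕ) (cb δ : ℝ) (hcb : 0 ≤ cb) (hδ : 0 ≤ δ) (hδL : δ * L ≤ 1) (Hc : |c L| ≤ cb)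
    (Hd : ∀ i < L, |c (i + 1) - c i| ≤ δ * cb) :
    ‖∑ i ∈ range (L + 1), (c i : ℂ) * p i‖ ^ 2 ≤ 2 * cb ^ 2 * (‖∑ i ∈ range (L + 1), p i‖ ^ 2 +
      δ * ∑ j ∈ range L, ‖∑ i ∈ range (j + 1), p i‖ ^ 2) := by
  have Hg := sum_range_by_parts (fun i => (c i : ℂ)) p (L + 1)
  simp only [smul_eq_mul, Nat.add_sub_cancel] at Hg
  set Q := ∑ j ∈ range L, ‖∑ i ∈ range (j + 1), p i‖ with hQ
  set R := ‖∑ i ∈ range (L + 1), p i‖ with hR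
  have Hk : ‖∑ i ∈ range (L + 1), (c i : ℂ) * p i‖ ≤ cb * (R + δ * Q) := by
    rw [Hg]
    refine (norm_sub_le _ _).trans ?_
    rw [mul_add, norm_mul, Complex.norm_real, Real.norm_eq_abs]
    refine add_le_add (by gcongr) ((norm_sum_le _ _).trans ?_)
    rw [hQ, mul_sum, mul_sum]
    refine sum_le_sum fun i hi => ?_
    rw [norm_mul, ← Complex.ofReal_sub, Complex.norm_real, Real.norm_eq_abs, ← mul_assoc, mul_comm cb]
    gcongr
    exact Hd i (mem_range.1 hi)
  have Hl : Q ^ 2 ≤ L * ∑ j ∈ range L, ‖∑ i ∈ range (j + 1), p i‖ ^ 2 := by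
    simpa using sq_sum_le_card_mul_sum_sq (s := range L) (f := fun j => ‖∑ i ∈ range (j + 1), p i‖)
  set V := ∑ j ∈ range L, ‖∑ i ∈ range (j + 1), p i‖ ^ 2 with hV
  have ay : 0 ≤ V := by positivity
  calc _ ≤ (cb * (R + δ * Q)) ^ 2 := by gcongr
    _ = cb ^ 2 * (R + δ * Q) ^ 2 := by ring
    _ ≤ cb ^ 2 * (2 * (R ^ 2 + δ * V)) := by
        gcongr
        have Hq : (δ * Q) ^ 2 ≤ δ * V := by
          calc (δ * Q) ^ 2 = δ * δ * Q ^ 2 := by ring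
            _ ≤ δ * δ * (L * V) := by gcongr
            _ = (δ * L) * (δ * V) := by ring
            _ ≤ 1 * (δ * V) := by gcongr
            _ = _ := one_mul _
        have := sq_nonneg (R - δ * Q)
        linarith [add_sq R (δ * Q), sub_sq R (δ * Q)]
    _ = _ := by ring
lemma ba (x z D : ℝ) (hx : x ≤ D) (hz : z ≤ D) : |Real.exp x - Real.exp z| ≤ Real.exp D * |x - z| := by
  wlog hxz : z ≤ x generalizing x z
  · rw [abs_sub_comm, abs_sub_comm x]; exact this z x hz hx (by linarith)
  rw [abs_of_nonneg (sub_nonneg.2 (Real.exp_le_exp.2 hxz)), abs_of_nonneg (sub_nonneg.2 hxz)]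
  have Hc := add_one_le_exp (z - x)
  have Hd : Real.exp z = Real.exp x * Real.exp (z - x) := by rw [← Real.exp_add]; congr 1; ring
  calc Real.exp x - Real.exp z = Real.exp x * (1 - Real.exp (z - x)) := by rw [Hd]; ring
    _ ≤ Real.exp D * (x - z) := by
      refine mul_le_mul (Real.exp_le_exp.2 hx) (by linarith) ?_ (Real.exp_pos _).le
      rw [sub_nonneg, Real.exp_le_one_iff]; linarith
noncomputable def gw (k : ℕ) (y u : ℝ) : ℝ := 2 * π * u * y - ((k:ℝ) - 1) / 2 * Real.log u
lemma tz (k : ℕ) (hk : 2 ≤ k) (He y u Hf : ℝ) (ec : 0 < He) (ja : 4 * π * He * y ≤ k + 1) (hy : 0 < y)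
    (hu : He / 2 ≤ u) (pa : He / 2 ≤ Hf) : |gw k y u - gw k y Hf| ≤ 2 * k / He * |u - Hf| := by
  wlog h : Hf ≤ u generalizing u Hf
  · rw [abs_sub_comm, abs_sub_comm u]; exact this Hf u pa hu (by linarith)
  have js : (2:ℝ) ≤ k := by exact_mod_cast hk
  have hp : 0 < Hf := by linarith
  have hl : Real.log u - Real.log Hf ≤ 2 / He * (u - Hf) := by
    rw [← log_div (by linarith) hp.ne']
    refine (log_le_sub_one_of_pos (div_pos (by linarith) hp)).trans ?_
    rw [div_sub_one hp.ne', div_mul_eq_mul_div, div_le_div_iff₀ hp ec]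
    nlinarith
  have ua : 0 ≤ Real.log u - Real.log Hf := sub_nonneg.2 (log_le_log hp h)
  have hd : 0 ≤ u - Hf := by linarith
  have Hi : 2 * π * y ≤ k / He := by rw [le_div_iff₀ ec]; linarith
  have Hj : 2 * π * y * (u - Hf) ≤ k / He * (u - Hf) := by gcongr
  have Hu : 0 ≤ 2 * π * y * (u - Hf) := by positivity
  have et : ((k:ℝ) - 1) / 2 * (Real.log u - Real.log Hf) ≤ k / 2 * (2 / He * (u - Hf)) :=
    mul_le_mul (by linarith) hl ua (by positivity)
  have ew : 0 ≤ ((k:ℝ) - 1) / 2 * (Real.log u - Real.log Hf) := mul_nonneg (by linarith) ua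
  have gb : (k:ℝ) / 2 * (2 / He * (u - Hf)) = k / He * (u - Hf) := by ring
  have pk : 2 * (k:ℝ) / He * (u - Hf) = k / He * (u - Hf) + k / He * (u - Hf) := by ring
  have qv : gw k y u - gw k y Hf = 2 * π * y * (u - Hf) - ((k:ℝ) - 1) / 2 * (Real.log u - Real.log Hf) := by unfold gw; ring
  rw [abs_of_nonneg hd, abs_le, pk, qv]
  constructor <;> linarith
lemma bb (k : ℕ) (hk : 2 ≤ k) (He y : ℝ) (ec : 0 < He) (cx : k ≤ 4 * π * He * y) (ja : 4 * π * He * y ≤ k + 1) :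
    ea k * Real.exp (gw k y He + 1) ^ 2 ≤ Real.exp 3 * He * y ^ k := by
  have hpi := pi_pos
  have js : (2:ℝ) ≤ k := by exact_mod_cast hk
  have hy : 0 < y := by
    by_contra hn
    have : 4 * π * He * y ≤ 0 := mul_nonpos_of_nonneg_of_nonpos (by positivity) (by linarith)
    linarith
  have Hi : Real.exp (gw k y He + 1) ^ 2 = Real.exp 2 * Real.exp (4 * π * He * y) / He ^ (k - 1) := by
    have : He ^ (k - 1) = Real.exp (((k:ℝ) - 1) * Real.log He) := by
      rw [← Real.exp_log ec, ← Real.exp_nat_mul, Real.exp_log ec, Nat.cast_sub (by omega)]; simp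
    rw [this, ← Real.exp_nat_mul, ← Real.exp_add, ← Real.exp_sub]
    congr 1; unfold gw; push_cast; ring
  have Hj : ea k ≤ (He * y) ^ k * Real.exp (-k) := by
    have : Real.exp (-(k:ℝ)) = (Real.exp 1)⁻¹ ^ k := by rw [← Real.exp_neg, ← Real.exp_nat_mul]; congr 1; ring
    rw [ea, this, ← mul_pow]
    gcongr
    rw [← div_eq_mul_inv, ← div_div]
    gcongr
    rw [div_le_iff₀ (by positivity)]; linarith
  have Hu : He ^ k = He ^ (k - 1) * He := by rw [← pow_succ]; congr 1; omega
  rw [Hi]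
  calc _ ≤ (He * y) ^ k * Real.exp (-k) * (Real.exp 2 * Real.exp (k + 1) / He ^ (k - 1)) := by gcongr
    _ = (Real.exp (-k) * Real.exp 2 * Real.exp (k + 1)) * (He * y ^ k) := by rw [mul_pow, Hu]; field_simp
    _ = _ := by rw [← Real.exp_add, ← Real.exp_add, mul_assoc]; congr 2; ring
lemma ub (Y Hb : ℝ) (hY : 0 < Y) (hYY : Y ≤ Hb) : ∫ y in Y..Hb, 1 / y ^ 2 = 1 / Y - 1 / Hb := by
  have := integral_zpow (a := Y) (b := Hb) (n := -2) (Or.inr ⟨by norm_num, by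
    rw [Set.uIcc_of_le hYY]; intro h; linarith [h.1]⟩)
  norm_num at this
  simp only [one_div] at this ⊢
  rw [this]
  ring
lemma bc (Y Hb : ℝ) (hY : 0 < Y) (hYY : Y ≤ Hb) (P : Finset (ℕ × ℕ)) (q : ℕ × ℕ → ℂ) (κ : ℕ × ℕ → ℝ → ℂ)
    (hκ : ∀ p ∈ P, ContinuousOn (κ p) (Set.Icc Y Hb)) (ed : ℝ) :
    IntervalIntegrable (fun y => 1 / y ^ 2 * (ed + (∑ p ∈ P, q p * κ p y).re)) volume Y Hb ∧
    ∫ y in Y..Hb, 1 / y ^ 2 * (ed + (∑ p ∈ P, q p * κ p y).re) ≤ ed * (1 / Y - 1 / Hb) +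
      ∑ p ∈ P, ‖q p‖ * ‖∫ y in Y..Hb, ((1 / y ^ 2 : ℝ) : ℂ) * κ p y‖ := by
  have hc : ContinuousOn (fun y : ℝ => 1 / y ^ 2) (Set.Icc Y Hb) := by
    refine continuousOn_const.div (by fun_prop) fun y hy => ?_
    have : 0 < y := hY.trans_le hy.1
    positivity
  have hi : ∀ p ∈ P, IntervalIntegrable (fun y => q p * (((1 / y ^ 2 : ℝ) : ℂ) * κ p y)) volume Y Hb := fun p hp => by
    refine ContinuousOn.intervalIntegrable ?_
    rw [Set.uIcc_of_le hYY]
    exact continuousOn_const.mul ((Complex.continuous_ofReal.comp_continuousOn hc).mul (hκ p hp))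
  have uc : IntervalIntegrable (fun y : ℝ => 1 / y ^ 2) volume Y Hb := ContinuousOn.intervalIntegrable (by rwa [Set.uIcc_of_le hYY])
  have qw : IntervalIntegrable (fun y => ∑ p ∈ P, q p * (((1 / y ^ 2 : ℝ) : ℂ) * κ p y)) volume Y Hb := by
    have := IntervalIntegrable.sum P hi
    simpa only [sum_fn] using this
  have Hi : (fun y : ℝ => 1 / y ^ 2 * (ed + (∑ p ∈ P, q p * κ p y).re)) =
      fun y => 1 / y ^ 2 * ed + Complex.reCLM (∑ p ∈ P, q p * (((1 / y ^ 2 : ℝ) : ℂ) * κ p y)) := by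
    funext y
    rw [mul_add, ← Complex.re_ofReal_mul, mul_sum, Complex.reCLM_apply]
    congr 3 with p
    ring
  have ud : IntervalIntegrable (fun y => Complex.reCLM (∑ p ∈ P, q p * (((1 / y ^ 2 : ℝ) : ℂ) * κ p y))) volume Y Hb :=
    ⟨Complex.reCLM.integrable_comp qw.1, Complex.reCLM.integrable_comp qw.2⟩
  rw [Hi]
  refine ⟨(uc.mul_const ed).add ud, ?_⟩
  rw [intervalIntegral.integral_add (uc.mul_const ed) ud, intervalIntegral.integral_mul_const, ub Y Hb hY hYY, mul_comm ed,
    ContinuousLinearMap.intervalIntegral_comp_comm _ qw, intervalIntegral.integral_finsetSum hi]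
  gcongr
  refine (Complex.re_le_norm _).trans ((norm_sum_le _ _).trans (le_of_eq ?_))
  refine sum_congr rfl fun p _ => ?_
  rw [intervalIntegral.integral_const_mul, norm_mul]
lemma ue (S : Finset ℕ) (A L : ℕ) (hS : ∀ m ∈ S, A ≤ m) (g : ℕ → ℂ) :
    ∑ i ∈ range (L + 1), (if A + i ∈ S then g (A + i) else 0) = ∑ m ∈ S.filter (· ≤ A + L), g m := by
  rw [← sum_filter]
  refine sum_nbij (fun i => A + i) ?_ ?_ ?_ fun _ _ => rfl
  · intro i; simp; intro Hc Hd; exact ⟨Hd, by omega⟩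
  · intro i _ j _; simp
  · intro m; simp only [coe_filter, Set.mem_ofPred_eq, Set.mem_image, mem_range]
    rintro ⟨Hc, Hd⟩
    have := hS m Hc
    exact ⟨m - A, ⟨by omega, by rwa [Nat.add_sub_cancel' this]⟩, by omega⟩
end
section
open Real Finset
open MeasureTheory
noncomputable def wt (k : ℕ) (t : ℝ) : ℝ := t ^ (((k:ℝ) - 1) / 2)
lemma qx (k : ℕ) (hk : 1 ≤ k) (t : ℝ) (ht : 0 ≤ t) : wt k t ^ 2 = t ^ (k - 1) := by
  rw [wt, ← rpow_natCast, ← rpow_mul ht, ← rpow_natCast t, Nat.cast_sub hk]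
  congr 1; push_cast; ring
lemma qy (k : ℕ) (t : ℝ) (ht : 0 < t) : wt k t = Real.exp (((k:ℝ) - 1) / 2 * Real.log t) := by
  rw [wt, rpow_def_of_pos ht, mul_comm]
lemma be (k : ℕ) (a : ℕ → ℂ) (f n : ℤ) (m : ℕ) (hm : 0 < m) (y : ℝ) (hu : 0 < (n:ℝ) + f / m) :
    heckeLambda k a (m * n + f) = (Real.exp (gw k y (n + f / m)) : ℝ) *
      (1 / (wt k m : ℂ) * (az a (m * n + f) * (Real.exp (-(2 * π * (n + f / m) * y)) : ℝ))) := by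
  have ej : (0:ℝ) < m := by exact_mod_cast hm
  have ch : ((m * n + f : ℤ) : ℝ) = m * (n + f / m) := by push_cast; field_simp
  have hl : 0 < (m:ℤ) * n + f := by
    have : (0:ℝ) < ((m * n + f : ℤ) : ℝ) := by rw [ch]; positivity
    exact_mod_cast this
  have Hi : (((m:ℤ) * n + f).toNat : ℝ) = m * (n + f / m) := by
    rw [← ch]; exact_mod_cast Int.toNat_of_nonneg hl.le
  rw [heckeLambda, az, if_pos hl, if_pos hl, Hi]
  have Hj : (m * ((n:ℝ) + f / m)) ^ (-(((k:ℝ) - 1) / 2)) = Real.exp (gw k y (n + f / m)) * (1 / wt k m * Real.exp (-(2 * π * (n + f / m) * y))) := by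
    rw [rpow_def_of_pos (by positivity), log_mul ej.ne' hu.ne', qy k m ej, one_div, ← Real.exp_neg, ← Real.exp_add, ← Real.exp_add]
    congr 1; unfold gw; ring
  rw [Hj]; push_cast; ring
lemma finv (f A m Ho : ℝ) (hA : 0 < A) (hm : A ≤ m) (ej : A ≤ Ho) : |f / m - f / Ho| ≤ |f| / A ^ 2 * |m - Ho| := by
  have Hc : 0 < m := by linarith
  have Hd : 0 < Ho := by linarith
  have : f / m - f / Ho = f / (m * Ho) * (Ho - m) := by field_simp
  rw [this, abs_mul, abs_div, abs_of_pos (mul_pos Hc Hd), abs_sub_comm m, sq]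
  gcongr
lemma bg (k : ℕ) (hk : 2 ≤ k) (f : ℤ) (A L : ℕ) (hA : 1 ≤ A) (hLk : (L:ℝ) * k ≤ A) (He y : ℝ) (ec : 0 < He)
    (hfL : |(f:ℝ)| / A ^ 2 * L ≤ He / (10 * k)) (hy : 0 < y) (ja : 4 * π * He * y ≤ k + 1) (m Ho : ℕ)
    (hm : A ≤ m ∧ m ≤ A + L) (ej : A ≤ Ho ∧ Ho ≤ A + L) :
    1 / wt k m * Real.exp (-(2 * π * (f / m) * y)) ≤ 3 * (1 / wt k Ho * Real.exp (-(2 * π * (f / Ho) * y))) := by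
  have bh : (1:ℝ) ≤ A := by exact_mod_cast hA
  have js : (2:ℝ) ≤ k := by exact_mod_cast hk
  have ey : (A:ℝ) ≤ m := by exact_mod_cast hm.1
  have jn : (m:ℝ) ≤ A + L := by exact_mod_cast hm.2
  have bi : (A:ℝ) ≤ Ho := by exact_mod_cast ej.1
  have fh : (Ho:ℝ) ≤ A + L := by exact_mod_cast ej.2
  have pl : (0:ℝ) < m := by linarith
  have uf : (0:ℝ) < Ho := by linarith
  have Hi : Real.log Ho - Real.log m ≤ 1 / k := by
    rw [← log_div uf.ne' pl.ne']
    refine (log_le_sub_one_of_pos (by positivity)).trans ?_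
    rw [div_sub_one pl.ne', div_le_div_iff₀ pl (by linarith)]
    nlinarith
  have Hj : ((k:ℝ) - 1) / 2 * (Real.log Ho - Real.log m) ≤ 1 / 2 := by
    calc _ ≤ ((k:ℝ) - 1) / 2 * (1 / k) := by gcongr; linarith
      _ ≤ k / 2 * (1 / k) := by gcongr; linarith
      _ = _ := by field_simp
  have Hu : (f:ℝ) / Ho - f / m ≤ He / (10 * k) := by
    refine (le_abs_self _).trans ((finv f A Ho m (by linarith) bi ey).trans (le_trans ?_ hfL))
    gcongr
    rw [abs_le]; constructor <;> linarith
  have et : 2 * π * y * (f / Ho - f / m) ≤ 1 / 10 := by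
    have : 2 * π * y ≤ k / He := by rw [le_div_iff₀ ec]; linarith
    have hpi := pi_pos
    calc _ ≤ 2 * π * y * (He / (10 * k)) := by gcongr
      _ ≤ k / He * (He / (10 * k)) := by gcongr
      _ = _ := by field_simp
  have ew : Real.exp 1 ≤ 3 := by linarith [Real.exp_one_lt_d9]
  rw [qy k m pl, qy k Ho uf, one_div, one_div, ← Real.exp_neg, ← Real.exp_neg, ← Real.exp_add, ← Real.exp_add]
  refine le_trans ?_ (mul_le_mul_of_nonneg_right ew (Real.exp_pos _).le)
  rw [← Real.exp_add, Real.exp_le_exp]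
  linarith
lemma FD.core {k a F B2} (h : FD k a F B2) (hk : 2 ≤ k) (f : ℤ) (A L : ℕ) (hA : 1 ≤ A) (hLk : (L:ℝ) * k ≤ A) (He : ℝ) (ec : 0 < He)
    (hfL : |(f:ℝ)| / A ^ 2 * L ≤ He / (10 * k)) (S : Finset ℕ) (hS : ∀ m ∈ S, A ≤ m ∧ m ≤ A + L) (α : ℕ → ℂ) (hα : ∀ m, ‖α m‖ ≤ 1)
    (s : Finset ℤ) (hs : (0:ℤ) ∉ s) (hu : ∀ n ∈ s, ∀ j : ℕ, A ≤ j → j ≤ A + L → |(n:ℝ) + f / j - He| ≤ He / (10 * k)) (Δ : ℝ)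
    (hΔ : ∀ qz ⊆ S, ∀ y, k ≤ 4 * π * He * y → ∀ T : Finset ℤ, (0:ℤ) ∉ T → y ^ k * ∑ m ∈ qz, (1 / (m:ℝ) ^ (k - 1)) *
      ∑ n ∈ T, ‖az a (m * n + f)‖ ^ 2 * Real.exp (-(4 * π * (n + f / m) * y)) ≤ Δ)
    (Y Hb : ℝ) (hY : Y = k / (4 * π * He)) (ck : Hb = (k + 1) / (4 * π * He)) :
    ea k * (∑ n ∈ s, ‖∑ m ∈ S, α m * heckeLambda k a (m * n + f)‖ ^ 2) * (1 / Y - 1 / Hb) ≤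
      16 * Real.exp 3 * He * (Δ * (1 / Y - 1 / Hb) + ∑ p ∈ S.offDiag, 1 / (wt k p.1 * wt k p.2) *
        ‖∫ y in Y..Hb, ((1 / y ^ 2 : ℝ) : ℂ) * kap F f k p.1 p.2 y‖) := by
  have hpi := pi_pos
  have js : (2:ℝ) ≤ k := by exact_mod_cast hk
  have bh : (1:ℝ) ≤ A := by exact_mod_cast hA
  have jr : 0 < Y := by rw [hY]; positivity
  have hYY : Y ≤ Hb := by rw [hY, ck]; gcongr; linarith
  have cx : ∀ y ∈ Set.Icc Y Hb, (k:ℝ) ≤ 4 * π * He * y := fun y hy => by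
    have := hy.1; rw [hY, div_le_iff₀ (by positivity)] at this; linarith
  have ja : ∀ y ∈ Set.Icc Y Hb, 4 * π * He * y ≤ k + 1 := fun y hy => by
    have := hy.2; rw [ck, le_div_iff₀ (by positivity)] at this; linarith
  have hSp : ∀ m ∈ S, 0 < m := fun m hm => by have := (hS m hm).1; omega
  have hwp : ∀ m ∈ S, 0 < wt k m := fun m hm => rpow_pos_of_pos (by exact_mod_cast hSp m hm) _
  set Sj : ℕ → Finset ℕ := fun j => S.filter (· ≤ A + j) with hSj
  have hSjS : ∀ j, Sj j ⊆ S := fun j => filter_subset _ _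
  have hSL : Sj L = S := filter_true_of_mem fun m hm => (hS m hm).2
  set q : ℕ × ℕ → ℂ := fun p => ((3:ℝ) + α p.1 * (starRingEnd ℂ) (α p.2)) / (wt k p.1 * wt k p.2) with hq
  set Φ : ℕ → ℝ → ℝ := fun j y => (1 + 3) * Δ + (∑ p ∈ (Sj j).offDiag, q p * kap F f k p.1 p.2 y).re with hΦ
  set pp : ℝ → ℤ → ℕ → ℂ := fun y n m => (α m / wt k m) * (az a (m * n + f) * (Real.exp (-(2 * π * (n + f / m) * y)) : ℝ)) with hpp
  have hR : ∀ y ∈ Set.Icc Y Hb, ∀ j, y ^ k * ∑ n ∈ s, ‖∑ m ∈ Sj j, pp y n m‖ ^ 2 ≤ Φ j y := by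
    intro y hy j
    have jj := jr.trans_le hy.1
    refine h.ptw f (Sj j) (fun m hm => hSp m (hSjS j hm)) (fun m => wt k m) (fun m hm => hwp m (hSjS j hm)) α hα y jj Δ 3 (by norm_num) ?_ ?_ s hs
    · intro T hT
      simp only [qx k (by omega) _ (Nat.cast_nonneg _)]
      exact hΔ _ (hSjS j) y (cx y hy) T hT
    · intro m hm Ho ej
      exact bg k hk f A L hA hLk He y ec hfL jj (ja y hy) m Ho (hS m (hSjS j hm)) (hS Ho (hSjS j ej))
  set δ := 2 * k / He * (|(f:ℝ)| / A ^ 2) with hδ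
  have gi : 0 ≤ δ := by positivity
  have hδL : δ * L ≤ 1 := by
    calc δ * L = 2 * k / He * (|(f:ℝ)| / A ^ 2 * L) := by rw [hδ]; ring
      _ ≤ 2 * k / He * (He / (10 * k)) := by gcongr
      _ = 1 / 5 := by field_simp; norm_num
      _ ≤ 1 := by norm_num
  have hnear : ∀ u : ℝ, |u - He| ≤ He / (10 * k) → He / 2 ≤ u := fun u h => by
    have : He / (10 * k) ≤ He / 2 := by gcongr; linarith
    linarith [(abs_le.1 h).1]
  have hpt : ∀ y ∈ Set.Icc Y Hb, ea k * (∑ n ∈ s, ‖∑ m ∈ S, α m * heckeLambda k a (m * n + f)‖ ^ 2) ≤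
      2 * Real.exp 3 * He * (Φ L y + δ * ∑ j ∈ range L, Φ j y) := by
    intro y hy
    have jj := jr.trans_le hy.1
    set cb := Real.exp (gw k y He + 1) with hcb
    have hcl : ∀ u, |u - He| ≤ He / (10 * k) → gw k y u ≤ gw k y He + 1 := fun u hu => by
      have Hc := tz k hk He y u He ec (ja y hy) jj (hnear u hu) (by linarith)
      have Hd : 2 * (k:ℝ) / He * |u - He| ≤ 1 := by
        calc _ ≤ 2 * (k:ℝ) / He * (He / (10 * k)) := by gcongr
          _ = 1 / 5 := by field_simp; norm_num
          _ ≤ 1 := by norm_num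
      linarith [(abs_le.1 Hc).2]
    have hn : ∀ n ∈ s, ‖∑ m ∈ S, α m * heckeLambda k a (m * n + f)‖ ^ 2 ≤
        2 * cb ^ 2 * (‖∑ m ∈ Sj L, pp y n m‖ ^ 2 + δ * ∑ j ∈ range L, ‖∑ m ∈ Sj j, pp y n m‖ ^ 2) := by
      intro n hn
      have Hi := fun j => ue S A j (fun m hm => (hS m hm).1) (pp y n)
      have Hj := ue S A L (fun m hm => (hS m hm).1) (fun m => α m * heckeLambda k a (m * n + f))
      have Hu : ∑ m ∈ S, α m * heckeLambda k a (m * n + f) = ∑ i ∈ range (L + 1), ((Real.exp (gw k y (n + f / ((A + i : ℕ) : ℝ))) : ℝ) : ℂ) *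
          (if A + i ∈ S then pp y n (A + i) else 0) := by
        have et : S.filter (· ≤ A + L) = S := hSL
        rw [et] at Hj
        rw [← Hj]
        refine sum_congr rfl fun i hi => ?_
        split_ifs with hiS
        · have := mem_range.1 hi
          rw [be k a f n (A + i) (by omega) y (by linarith [hnear _ (hu n hn (A + i) (by omega) (by omega))])]
          simp only [hpp]; ring
        · simp
      rw [Hu]
      have ew := abel (fun i => Real.exp (gw k y (n + f / ((A + i : ℕ) : ℝ)))) (fun i => if A + i ∈ S then pp y n (A + i) else 0) L cb δ
        (Real.exp_pos _).le gi hδL ?_ ?_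
      · simp only [Hi] at ew
        exact ew
      · rw [abs_of_pos (Real.exp_pos _)]
        exact Real.exp_le_exp.2 (hcl _ (hu n hn _ (by omega) (by omega)))
      · intro i hi
        have Hr := hu n hn (A + i) (by omega) (by omega)
        have Hs := hu n hn (A + (i + 1)) (by omega) (by omega)
        refine (ba _ _ _ (hcl _ Hs) (hcl _ Hr)).trans ?_
        rw [mul_comm]
        refine mul_le_mul_of_nonneg_right ?_ (Real.exp_pos _).le
        refine (tz k hk He y _ _ ec (ja y hy) jj (hnear _ Hs) (hnear _ Hr)).trans ?_
        rw [hδ]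
        gcongr
        have qf := finv f A ((A + (i + 1) : ℕ) : ℝ) ((A + i : ℕ) : ℝ) (by linarith) (by push_cast; linarith [Nat.cast_nonneg (α := ℝ) i]) (by push_cast; linarith [Nat.cast_nonneg (α := ℝ) i])
        rw [add_sub_add_left_eq_sub]
        refine qf.trans (le_of_eq ?_)
        push_cast
        rw [show (A:ℝ) + (i + 1) - (A + i) = 1 by ring, abs_one, mul_one]
    have hb := bb k hk He y ec (cx y hy) (ja y hy)
    have gh := tn (k := k) (by omega)
    set V := ∑ n ∈ s, (‖∑ m ∈ Sj L, pp y n m‖ ^ 2 + δ * ∑ j ∈ range L, ‖∑ m ∈ Sj j, pp y n m‖ ^ 2) with hV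
    have ay : 0 ≤ V := by positivity
    have gb : y ^ k * V ≤ Φ L y + δ * ∑ j ∈ range L, Φ j y := by
      rw [hV, sum_add_distrib, mul_add, ← mul_sum, sum_comm, mul_left_comm, mul_sum (a := y ^ k) (s := range L)]
      gcongr
      · exact hR y hy L
      · exact hR y hy _
    calc _ ≤ ea k * ∑ n ∈ s, 2 * cb ^ 2 * (‖∑ m ∈ Sj L, pp y n m‖ ^ 2 + δ * ∑ j ∈ range L, ‖∑ m ∈ Sj j, pp y n m‖ ^ 2) := by
          gcongr with n jh
          exact hn n jh
      _ = 2 * (ea k * cb ^ 2) * V := by rw [← mul_sum]; ring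
      _ ≤ 2 * (Real.exp 3 * He * y ^ k) * V := by gcongr
      _ = 2 * Real.exp 3 * He * (y ^ k * V) := by ring
      _ ≤ _ := by gcongr
  set O := ∑ p ∈ S.offDiag, 1 / (wt k p.1 * wt k p.2) * ‖∫ y in Y..Hb, ((1 / y ^ 2 : ℝ) : ℂ) * kap F f k p.1 p.2 y‖ with hO
  set hh := 1 / Y - 1 / Hb with hhd
  have hint := fun j => bc Y Hb jr hYY (Sj j).offDiag q (fun p y => kap F f k p.1 p.2 y) (fun p hp => by
    rw [mem_offDiag] at hp
    exact (al F h.cont f k p.1 p.2 (hSp _ (hSjS j hp.1)) (hSp _ (hSjS j hp.2.1)) Y jr).mono Set.Icc_subset_Ici_self) ((1 + 3) * Δ)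
  have hI : ∀ j, ∫ y in Y..Hb, 1 / y ^ 2 * Φ j y ≤ 4 * (Δ * hh + O) := by
    intro j
    refine (hint j).2.trans ?_
    have pk : ∑ p ∈ (Sj j).offDiag, ‖q p‖ * ‖∫ y in Y..Hb, ((1 / y ^ 2 : ℝ) : ℂ) * kap F f k p.1 p.2 y‖ ≤ 4 * O := by
      rw [hO, mul_sum]
      refine (sum_le_sum_of_subset_of_nonneg (offDiag_mono (hSjS j)) fun _ _ _ => by positivity).trans (sum_le_sum fun p hp => ?_)
      rw [mem_offDiag] at hp
      have Ht := hwp _ hp.1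
      have Hy := hwp _ hp.2.1
      rw [← mul_assoc, mul_one_div]
      gcongr
      simp only [hq]
      rw [norm_div, norm_mul, Complex.norm_real, Complex.norm_real, Real.norm_of_nonneg Ht.le, Real.norm_of_nonneg Hy.le]
      gcongr
      refine (norm_add_le _ _).trans ?_
      rw [norm_mul, RCLike.norm_conj, Complex.norm_real]
      have := mul_le_mul (hα p.1) (hα p.2) (norm_nonneg _) zero_le_one
      norm_num at this ⊢
      linarith
    rw [← hhd]; linarith
  have ax : 0 ≤ Δ := by simpa using hΔ ∅ (by simp) Y (cx Y ⟨le_rfl, hYY⟩) ∅ (by simp)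
  set ed := ea k * (∑ n ∈ s, ‖∑ m ∈ S, α m * heckeLambda k a (m * n + f)‖ ^ 2) with eu
  have cp : ∀ j, IntervalIntegrable (fun y => 1 / y ^ 2 * Φ j y) volume Y Hb := fun j => (hint j).1
  have gq : IntervalIntegrable (fun y => ∑ j ∈ range L, 1 / y ^ 2 * Φ j y) volume Y Hb := by
    simpa only [sum_fn] using IntervalIntegrable.sum (range L) fun j _ => cp j
  have ps : IntervalIntegrable (fun y : ℝ => 1 / y ^ 2 * ed) volume Y Hb := by
    refine ContinuousOn.intervalIntegrable ?_
    rw [Set.uIcc_of_le hYY]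
    refine (continuousOn_const.div (by fun_prop) fun y hy => ?_).mul continuousOn_const
    have : 0 < y := jr.trans_le hy.1
    positivity
  have hm : ∫ y in Y..Hb, 1 / y ^ 2 * ed ≤ ∫ y in Y..Hb, 2 * Real.exp 3 * He * (1 / y ^ 2 * Φ L y + δ * ∑ j ∈ range L, 1 / y ^ 2 * Φ j y) := by
    refine intervalIntegral.integral_mono_on hYY ps (((cp L).add (gq.const_mul δ)).const_mul _) fun y hy => ?_
    rw [← mul_sum]
    have : 0 < y := jr.trans_le hy.1
    refine (mul_le_mul_of_nonneg_left (hpt y hy) (by positivity)).trans (le_of_eq ?_)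
    ring
  rw [intervalIntegral.integral_mul_const, ub Y Hb jr hYY, intervalIntegral.integral_const_mul,
    intervalIntegral.integral_add (cp L) (gq.const_mul δ), intervalIntegral.integral_const_mul, intervalIntegral.integral_finsetSum fun j _ => cp j] at hm
  rw [mul_comm]
  refine hm.trans ?_
  have fi : 0 ≤ O := sum_nonneg fun p hp => by
    rw [mem_offDiag] at hp
    have Ht := hwp _ hp.1
    have Hy := hwp _ hp.2.1
    positivity
  have ug : 0 ≤ hh := sub_nonneg.2 (one_div_le_one_div_of_le jr hYY)
  have qv : ∑ j ∈ range L, ∫ y in Y..Hb, 1 / y ^ 2 * Φ j y ≤ L * (4 * (Δ * hh + O)) := by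
    refine (sum_le_sum fun j _ => hI j).trans ?_
    simp
  calc _ ≤ 2 * Real.exp 3 * He * (4 * (Δ * hh + O) + δ * (L * (4 * (Δ * hh + O)))) := by gcongr; exact hI L
    _ = 8 * Real.exp 3 * He * (Δ * hh + O) * (1 + δ * L) := by ring
    _ ≤ 8 * Real.exp 3 * He * (Δ * hh + O) * (1 + 1) := by gcongr
    _ = _ := by ring
end
section
open Real Finset Complex
open MeasureTheory
lemma uh (N H : ℕ) (hH : 0 < H) : ∑ s ∈ Icc 1 N, (s.gcd H : ℝ) ≤ N * H.divisors.card := by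
  have h := qa N H hH (fun _ => 1) (fun _ => zero_le_one)
  simp only [mul_one] at h
  refine h.trans ?_
  rw [mul_comm, ← nsmul_eq_mul]
  refine sum_le_card_nsmul _ _ _ fun d hd => ?_
  simp only [sum_const, Nat.card_Icc, nsmul_eq_mul, mul_one, Nat.add_sub_cancel]
  exact_mod_cast Nat.mul_div_le N d
lemma bk (η Kt : ℝ) (hη : 0 < η) (hK : 1 ≤ Kt) (hKt : ∀ n : ℕ, 0 < n → (n.divisors.card : ℝ) ≤ Kt * (n : ℝ) ^ η) (N H : ℕ) (hH : 0 < H) :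
    ∑ o ∈ Icc 1 N, ∑ Ha ∈ Icc 1 N, (o.gcd Ha : ℝ) * (o.gcd H + Ha.gcd H) ≤ 2 * N ^ 2 * (Kt * N ^ η) * (Kt * H ^ η) := by
  have Hc : ∑ o ∈ Icc 1 N, ∑ Ha ∈ Icc 1 N, (o.gcd Ha : ℝ) * (o.gcd H) ≤ N ^ 2 * (Kt * N ^ η) * (Kt * H ^ η) := by
    calc _ ≤ ∑ o ∈ Icc 1 N, (N * (Kt * N ^ η)) * (o.gcd H : ℝ) := by
          refine sum_le_sum fun o hm => ?_
          rw [mem_Icc] at hm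
          rw [← sum_mul]
          gcongr
          simp only [Nat.gcd_comm o]
          refine (uh N o (by omega)).trans ?_
          gcongr
          refine (hKt o (by omega)).trans ?_
          gcongr
          exact_mod_cast hm.2
      _ ≤ (N * (Kt * N ^ η)) * (N * (Kt * H ^ η)) := by
          rw [← mul_sum]
          gcongr
          refine (uh N H hH).trans ?_
          gcongr
          exact hKt H hH
      _ = _ := by ring
  have Hd : ∑ o ∈ Icc 1 N, ∑ Ha ∈ Icc 1 N, (o.gcd Ha : ℝ) * (Ha.gcd H) = ∑ o ∈ Icc 1 N, ∑ Ha ∈ Icc 1 N, (o.gcd Ha : ℝ) * (o.gcd H) := by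
    rw [sum_comm]; simp only [Nat.gcd_comm]
  simp only [mul_add, sum_add_distrib]
  rw [Hd]; linarith
lemma bl (η x : ℝ) (Hc : η ≤ 1) (hx : 0 ≤ x) : (2 * x) ^ η ≤ 2 * x ^ η := by
  rw [mul_rpow (by norm_num) hx]
  gcongr
  exact (rpow_le_rpow_of_exponent_le (by norm_num) Hc).trans (rpow_one 2).le
set_option maxHeartbeats 1000000 in
lemma offbound (ε : ℝ) (hε : 0 < ε) (jq : ε ≤ 1) : ∃ K : ℝ, 1 ≤ K ∧ ∀ (k : ℕ) (a : ℕ → ℂ) (F : UpperHalfPlane → ℂ) (B2 : ℝ),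
    FD k a F B2 → 2 ≤ k → ∀ (f : ℤ), f ≠ 0 → ∀ (S : Finset ℕ) (M : ℝ), 1 ≤ M → (∀ m ∈ S, Squarefree m ∧ (m:ℝ) ≤ 2 * M) →
    ∀ Y Hb : ℝ, 0 < Y → Y ≤ Hb → Hb ≤ 2 * Y → ∀ C : ℕ, 1 ≤ C → 1 / Y ≤ C →
    ∑ p ∈ S.offDiag, 1 / (wt k p.1 * wt k p.2) * ‖∫ y in Y..Hb, ((1 / y ^ 2 : ℝ) : ℂ) * kap F f k p.1 p.2 y‖
      ≤ K * (C * M * |(f:ℝ)|) ^ ε * B2 * √(1 / Y - 1 / Hb) * √(M * (M + √C)) * M ^ 2 := by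
  set η := ε / 4 with hη
  have cd : 0 < η := by positivity
  obtain ⟨Kt, ui, hKt⟩ := pz η cd
  obtain ⟨K, cu, hK⟩ := xh η cd
  refine ⟨24 * 16 * Kt ^ 3 * K, by
    have : 1 ≤ Kt ^ 3 := one_le_pow₀ ui
    nlinarith, ?_⟩
  intro k a F B2 h hk f hf S M hM hS Y Hb hY hYY ev C hC hYC
  have pj := h.B2_nonneg
  have tx : (1:ℝ) ≤ |(f:ℝ)| := by rw [← Int.cast_abs]; exact_mod_cast Int.one_le_abs hf
  have ct : (1:ℝ) ≤ C := by exact_mod_cast hC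
  set Q := C * M * |(f:ℝ)| with hQ
  have hCM : 1 ≤ C * M := one_le_mul_of_one_le_of_one_le ct hM
  have hMQ : M ≤ Q := by rw [hQ]; nlinarith
  have hfQ : |(f:ℝ)| ≤ Q := by rw [hQ]; nlinarith
  have bn : 1 ≤ Q := hM.trans hMQ
  have bo : η ≤ 1 := by rw [hη]; linarith
  set q := Q ^ η with hq
  have bp : 1 ≤ q := one_le_rpow bn cd.le
  have bq : (2 * Q) ^ η ≤ 2 * q := bl η Q bo (by linarith)
  have br : (2 * M) ^ η ≤ 2 * q := le_trans (by gcongr) bq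
  set hh := 1 / Y - 1 / Hb with hhd
  have ug : 0 ≤ hh := sub_nonneg.2 (one_div_le_one_div_of_le hY hYY)
  have hsC : 0 ≤ √(C:ℝ) := sqrt_nonneg _
  set G := 24 * Kt * K * q ^ 2 * B2 * √hh * √(M * (M + √C)) with hG
  have jf : 0 ≤ G := by positivity
  have hfn : 0 < f.natAbs := Int.natAbs_pos.2 hf
  have hterm : ∀ p ∈ S.offDiag, 1 / (wt k p.1 * wt k p.2) * ‖∫ y in Y..Hb, ((1 / y ^ 2 : ℝ) : ℂ) * kap F f k p.1 p.2 y‖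
      ≤ G * ((p.1.gcd p.2 : ℝ) * (p.1.gcd f.natAbs + p.2.gcd f.natAbs)) := by
    rintro ⟨o, Ha⟩ hp
    obtain ⟨cc, Hz, hne⟩ := mem_offDiag.1 hp
    simp only at cc Hz hne ⊢
    obtain ⟨uj, uk⟩ := hS o cc
    obtain ⟨ul, um⟩ := hS Ha Hz
    have go : 0 < o := Nat.pos_of_ne_zero uj.ne_zero
    have pm : 0 < Ha := Nat.pos_of_ne_zero ul.ne_zero
    have un : (0:ℝ) < o := by exact_mod_cast go
    have ra : (0:ℝ) < Ha := by exact_mod_cast pm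
    set J := ‖∫ y in Y..Hb, ((1 / y ^ 2 : ℝ) : ℂ) * kap F f k o Ha y‖ with hJ
    have ez := an h hk f o Ha go pm Y Hb hY hYY ev C hYC
    have cj := hK o Ha C f uj ul hne hf hC
    set g : ℝ := (o.gcd Ha : ℝ) with hg
    set Hr : ℝ := (o.gcd f.natAbs : ℝ) with ry
    set Hs : ℝ := (Ha.gcd f.natAbs : ℝ) with rz
    have bt : 1 ≤ Hr := by rw [ry]; exact_mod_cast Nat.gcd_pos_of_pos_left _ go
    have bu : 1 ≤ Hs := by rw [rz]; exact_mod_cast Nat.gcd_pos_of_pos_left _ pm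
    have bv : 1 ≤ g := by rw [hg]; exact_mod_cast Nat.gcd_pos_of_pos_left _ go
    have uo : 1 ≤ Hr * Hs := one_le_mul_of_one_le_of_one_le bt bu
    have hmm : (o:ℝ) * Ha ≤ 4 * M ^ 2 := (mul_le_mul uk um ra.le (by linarith)).trans (le_of_eq (by ring))
    have t : ∀ m : ℕ, 0 < m → (m:ℝ) ≤ 2 * M → (m.divisors.card : ℝ) ≤ 2 * Kt * q := fun m hm hl => by
      refine (hKt m hm).trans ?_
      calc Kt * (m:ℝ) ^ η ≤ Kt * (2 * M) ^ η := by gcongr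
        _ ≤ Kt * (2 * q) := by gcongr
        _ = _ := by ring
    have fj : ((C:ℝ) * o * Ha * |(f:ℝ)|) ^ η ≤ 4 * q ^ 2 := by
      have Hi : (C:ℝ) * o * Ha * |(f:ℝ)| ≤ 2 * M * (2 * Q) := by
        calc (C:ℝ) * o * Ha * |(f:ℝ)| = (o * Ha) * (C * |(f:ℝ)|) := by ring
          _ ≤ (4 * M ^ 2) * (C * |(f:ℝ)|) := by gcongr
          _ = _ := by rw [hQ]; ring
      calc _ ≤ (2 * M * (2 * Q)) ^ η := by gcongr
        _ = (2 * M) ^ η * (2 * Q) ^ η := by rw [mul_rpow (by positivity) (by positivity)]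
        _ ≤ (2 * q) * (2 * q) := by gcongr
        _ = _ := by ring
    have fk : √((o:ℝ) * Ha) ≤ 2 * M := by
      rw [sqrt_le_left (by linarith)]; linarith [mul_pow 2 M 2]
    have fl : √(Hr * Hs) ≤ Hr * Hs := by
      rw [sqrt_le_left (by linarith)]; exact le_self_pow₀ uo (by norm_num)
    have fm : (o:ℝ) * Ha + ∑ c ∈ Icc 1 C, ‖KK c o Ha f 0 0‖ / (c : ℝ) ≤ 8 * K * q ^ 2 * (M * (M + √C)) * (g ^ 2 * (Hr + Hs) ^ 2) := by
      have Hi : 1 ≤ g ^ 2 * (Hr * Hs) := one_le_mul_of_one_le_of_one_le (one_le_pow₀ bv) uo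
      have Hj : 1 ≤ K * q ^ 2 := one_le_mul_of_one_le_of_one_le cu (one_le_pow₀ bp)
      have Hu : 1 ≤ K * q ^ 2 * (g ^ 2 * (Hr * Hs)) := one_le_mul_of_one_le_of_one_le Hj Hi
      have et : Hr * Hs ≤ (Hr + Hs) ^ 2 := by rw [add_sq]; linarith [sq_nonneg Hr, sq_nonneg Hs]
      calc _ ≤ 4 * M ^ 2 * 1 + K * (4 * q ^ 2) * (2 * M) * √C * (g ^ 2 * (Hr * Hs)) := by
            rw [mul_one]
            refine add_le_add hmm (cj.trans ?_)
            gcongr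
        _ ≤ 8 * M ^ 2 * (K * q ^ 2 * (g ^ 2 * (Hr * Hs))) + K * (4 * q ^ 2) * (2 * M) * √C * (g ^ 2 * (Hr * Hs)) := by gcongr; norm_num
        _ = 8 * K * q ^ 2 * (M * (M + √C)) * (g ^ 2 * (Hr * Hs)) := by ring
        _ ≤ _ := mul_le_mul_of_nonneg_left (mul_le_mul_of_nonneg_left et (by positivity)) (by positivity)
    have Ht : 0 < wt k o := rpow_pos_of_pos un _
    have Hy : 0 < wt k Ha := rpow_pos_of_pos ra _
    refine le_of_sq_le_sq ?_ (by positivity)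
    have ey : (wt k o * wt k Ha) ^ 2 = ((o:ℝ) * Ha) ^ (k - 2) * (o * Ha) := by
      rw [mul_pow, qx k (by omega) _ un.le, qx k (by omega) _ ra.le, ← mul_pow, ← pow_succ]; congr 1; omega
    have hP : 0 < (wt k o * wt k Ha) ^ 2 := by positivity
    rw [mul_pow, div_pow, one_pow, div_mul_eq_mul_div, one_mul, div_le_iff₀ hP]
    refine ez.trans ?_
    rw [ey]
    set U := ((o:ℝ) * Ha) ^ (k - 2) with hU
    have fn : 0 ≤ U := by positivity
    have cf := t o go uk
    have cg := t Ha pm um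
    have hsq : G ^ 2 = 576 * Kt ^ 2 * K ^ 2 * q ^ 4 * B2 ^ 2 * hh * (M * (M + √C)) := by
      rw [hG, mul_pow, mul_pow, sq_sqrt ug, sq_sqrt (by positivity)]; ring
    calc _ ≤ 18 * ((2 * Kt * q) * o * ((2 * Kt * q) * Ha)) * (U * B2 ^ 2) * hh * (8 * K * q ^ 2 * (M * (M + √C)) * (g ^ 2 * (Hr + Hs) ^ 2)) := by gcongr
      _ = 576 * Kt ^ 2 * K * q ^ 4 * B2 ^ 2 * hh * (M * (M + √C)) * (g * (Hr + Hs)) ^ 2 * (U * (o * Ha)) := by ring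
      _ ≤ 576 * Kt ^ 2 * K ^ 2 * q ^ 4 * B2 ^ 2 * hh * (M * (M + √C)) * (g * (Hr + Hs)) ^ 2 * (U * (o * Ha)) := by gcongr ?_ * q ^ 4 * B2 ^ 2 * hh * (M * (M + √C)) * (g * (Hr + Hs)) ^ 2 * (U * (o * Ha)); exact mul_le_mul_of_nonneg_left (le_self_pow₀ cu (by norm_num)) (by positivity)
      _ = _ := by rw [mul_pow G, hsq]
  set N := ⌊2 * M⌋₊ with hN
  have fo : (N:ℝ) ≤ 2 * M := Nat.floor_le (by linarith)
  refine (sum_le_sum hterm).trans ?_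
  rw [← mul_sum]
  have hsub : S.offDiag ⊆ Icc 1 N ×ˢ Icc 1 N := by
    intro p hp
    obtain ⟨cc, Hz, -⟩ := mem_offDiag.1 hp
    simp only [mem_product, mem_Icc]
    refine ⟨⟨Nat.pos_of_ne_zero (hS _ cc).1.ne_zero, Nat.le_floor (hS _ cc).2⟩, ⟨Nat.pos_of_ne_zero (hS _ Hz).1.ne_zero, Nat.le_floor (hS _ Hz).2⟩⟩
  have hfin : ∑ p ∈ S.offDiag, ((p.1.gcd p.2 : ℝ) * (p.1.gcd f.natAbs + p.2.gcd f.natAbs)) ≤ 16 * Kt ^ 2 * q ^ 2 * M ^ 2 := by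
    refine (sum_le_sum_of_subset_of_nonneg hsub fun _ _ _ => by positivity).trans ?_
    rw [sum_product]
    refine (bk η Kt cd ui hKt N f.natAbs hfn).trans ?_
    have Hi : (N:ℝ) ^ η ≤ 2 * q := le_trans (by gcongr) br
    have Hj : ((f.natAbs : ℕ) : ℝ) ^ η ≤ q := by
      rw [Nat.cast_natAbs, Int.cast_abs, hq]
      gcongr
    calc _ ≤ 2 * (2 * M) ^ 2 * (Kt * (2 * q)) * (Kt * q) := by gcongr
      _ = _ := by ring
  have bw : q ^ 4 = Q ^ ε := by
    rw [hq, ← rpow_natCast, ← rpow_mul (by linarith), hη]; congr 1; push_cast; ring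
  calc _ ≤ G * (16 * Kt ^ 2 * q ^ 2 * M ^ 2) := by gcongr
    _ = 24 * 16 * Kt ^ 3 * K * q ^ 4 * B2 * √hh * √(M * (M + √C)) * M ^ 2 := by rw [hG]; ring
    _ = _ := by rw [bw]
end
section
open Real Finset
open MeasureTheory
lemma rb (c ε x : ℝ) (hc : 1 ≤ c) (Hc : ε ≤ 1) (hx : 0 ≤ x) : (c * x) ^ ε ≤ c * x ^ ε := by
  rw [mul_rpow (by linarith) hx]
  gcongr
  exact (rpow_le_rpow_of_exponent_le hc Hc).trans (rpow_one c).le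
set_option maxHeartbeats 1000000 in
lemma piece (ε : ℝ) (hε : 0 < ε) (jq : ε ≤ 1) : ∃ K : ℝ, 1 ≤ K ∧ ∀ (k : ℕ) (a : ℕ → ℂ), IsNormalizedHeckeEigenform k a →
    ∀ (f : ℤ), f ≠ 0 → ∀ (M : ℝ) (A L : ℕ), 1 ≤ M → M ≤ A → ((A + L : ℕ) : ℝ) ≤ 2 * M → (L:ℝ) * k ≤ A → ∀ He : ℝ, 0 < He →
    |(f:ℝ)| / A ^ 2 * L ≤ He / (10 * k) → ∀ S : Finset ℕ, (∀ m ∈ S, A ≤ m ∧ m ≤ A + L) → (∀ m ∈ S, Squarefree m) →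
    ∀ α : ℕ → ℂ, (∀ m, ‖α m‖ ≤ 1) → ∀ s : Finset ℤ, (0:ℤ) ∉ s →
    (∀ n ∈ s, ∀ j : ℕ, A ≤ j → j ≤ A + L → |(n:ℝ) + f / j - He| ≤ He / (10 * k)) →
    ∑ n ∈ s, ‖∑ m ∈ S, α m * heckeLambda k a (m * n + f)‖ ^ 2 ≤
      K * (M * |(f:ℝ)| * (1 + He)) ^ ε * k ^ 7 * (M * He + √He * M ^ 2 * √(M * (M + √(1 + He)))) := by
  obtain ⟨eg, cu, hd⟩ := au ε hε jq
  obtain ⟨eh, fp, ho⟩ := offbound ε hε jq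
  have fq : 1 ≤ Real.exp 3 := one_le_exp (by norm_num)
  refine ⟨16 * Real.exp 3 * 16 * (52 * eg + 4 * eh), by nlinarith, ?_⟩
  intro k a hka f hf M A L hM hMA hAL hLk He ec hfL S hS hSq α hα s hs hu
  have ts : 12 ≤ k := hka.2.1
  have hk : (12:ℝ) ≤ k := by exact_mod_cast ts
  obtain ⟨F, B2, hF, hB⟩ := ad hka
  have gh := tn (k := k) (by omega)
  have hpi := pi_gt_three
  have fr := pi_lt_four
  have pj := hF.B2_nonneg
  have tx : (1:ℝ) ≤ |(f:ℝ)| := by rw [← Int.cast_abs]; exact_mod_cast Int.one_le_abs hf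
  have pn : 1 ≤ A := by
    have : (1:ℝ) ≤ A := by linarith
    exact_mod_cast this
  push_cast at hAL
  have ce : (0:ℝ) < A := by linarith
  set R := (M * |(f:ℝ)| * (1 + He)) ^ ε with hR
  have jz : 0 ≤ R := by positivity
  set Y := (k:ℝ) / (4 * π * He) with hY
  set Hb := ((k:ℝ) + 1) / (4 * π * He) with ck
  have jr : 0 < Y := by positivity
  have hYY : Y ≤ Hb := by rw [hY, ck]; gcongr; linarith
  have ev : Hb ≤ 2 * Y := by rw [hY, ck, ← mul_div_assoc]; gcongr; linarith
  set hh := 1 / Y - 1 / Hb with hhd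
  have hheq : hh = 4 * π * He / (k * (k + 1)) := by rw [hhd, hY, ck]; field_simp; ring
  have hhpos : 0 < hh := by rw [hheq]; positivity
  set C := ⌈1 / Y⌉₊ with hC
  have ct : 1 ≤ C := Nat.ceil_pos.2 (by positivity)
  have fs : (C:ℝ) ≤ 2 * (1 + He) := by
    have Hc := (Nat.ceil_lt_add_one (by positivity : 0 ≤ 1 / Y)).le
    have Hd : 1 / Y ≤ 2 * He := by
      rw [hY, one_div_div, div_le_iff₀ (by linarith)]; nlinarith
    linarith
  have hO := ho k a F B2 hF (by omega) f hf S M hM (fun m hm => ⟨hSq m hm, by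
    have : (m:ℝ) ≤ A + L := by exact_mod_cast (hS m hm).2
    linarith⟩) Y Hb jr hYY ev C ct (Nat.le_ceil _)
  set x := √(1 + He) with hx
  set W := √(M * (M + x)) with hW
  have ft : ∑ p ∈ S.offDiag, 1 / (wt k p.1 * wt k p.2) * ‖∫ y in Y..Hb, ((1 / y ^ 2 : ℝ) : ℂ) * kap F f k p.1 p.2 y‖ ≤
      4 * eh * R * B2 * W * M ^ 2 * (k / √He) * hh := by
    have Hi : (C * M * |(f:ℝ)|) ^ ε ≤ 2 * R := by
      refine le_trans ?_ (rb 2 ε _ (by norm_num) jq (by positivity))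
      refine rpow_le_rpow (by positivity) ?_ hε.le
      calc C * M * |(f:ℝ)| ≤ (2 * (1 + He)) * M * |(f:ℝ)| := by gcongr
        _ = _ := by ring
    have Hj : √(M * (M + √C)) ≤ 2 * W := by
      rw [sqrt_le_left (by positivity), mul_pow, hW, sq_sqrt (by positivity)]
      have : √(C:ℝ) ≤ 2 * x := by
        rw [sqrt_le_left (by positivity), mul_pow, hx, sq_sqrt (by positivity)]; linarith
      calc M * (M + √C) ≤ M * (4 * M + 4 * x) := by gcongr <;> linarith [sqrt_nonneg (1 + He)]
        _ = _ := by ring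
    have Hu : √hh ≤ (k / √He) * hh := by
      have Hc : √He / k ≤ √hh := by
        refine le_sqrt_of_sq_le ?_
        rw [div_pow, sq_sqrt ec.le, hheq, div_le_div_iff₀ (by positivity) (by positivity)]
        have : (k:ℝ) * (k + 1) ≤ 4 * π * k ^ 2 := by nlinarith
        calc He * (k * (k + 1)) ≤ He * (4 * π * k ^ 2) := by gcongr
          _ = _ := by ring
      have Hd : 0 < √He := sqrt_pos.2 ec
      calc √hh = (k / √He) * ((√He / k) * √hh) := by field_simp
        _ ≤ (k / √He) * (√hh * √hh) := by gcongr
        _ = _ := by rw [mul_self_sqrt hhpos.le]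
    calc _ ≤ eh * (2 * R) * B2 * ((k / √He) * hh) * (2 * W) * M ^ 2 := hO.trans (by gcongr)
      _ = _ := by ring
  have bx : (A:ℝ) + L ≤ A * (1 + 1 / k) := by
    rw [mul_add, mul_one, mul_one_div]; gcongr; rw [le_div_iff₀ (by linarith)]; exact hLk
  have hcore := hF.core (by omega) f A L pn hLk He ec hfL S hS α hα s hs hu (52 * eg * M * R * B2) (fun qz up y hy T hT => by
    have jj : 0 < y := by
      by_contra hn
      have : 4 * π * He * y ≤ 0 := mul_nonpos_of_nonneg_of_nonpos (by positivity) (by linarith)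
      linarith
    refine (hd k a F B2 hF (by omega) f hf qz A (A + L) (by linarith) (by linarith [Nat.cast_nonneg (α := ℝ) L]) bx (fun m hm => ⟨by exact_mod_cast (hS m (up hm)).1, by exact_mod_cast (hS m (up hm)).2⟩) y jj T hT).trans ?_
    have Hi : (|(f:ℝ)| * (1 + (A + L) * k / y)) ^ ε ≤ 26 * R := by
      have Hj : (A + L) * k / y ≤ 26 * (M * He) := by
        rw [div_le_iff₀ jj]
        calc ((A:ℝ) + L) * k ≤ (2 * M) * (4 * π * He * y) := by gcongr
          _ ≤ (2 * M) * (13 * He * y) := by gcongr; linarith [pi_lt_d2]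
          _ = _ := by ring
      refine le_trans ?_ (rb 26 ε _ (by norm_num) jq (by positivity))
      refine rpow_le_rpow (by positivity) ?_ hε.le
      have : 1 + (A + L) * k / y ≤ 26 * (M * (1 + He)) := by linarith [mul_one_add M He]
      calc _ ≤ |(f:ℝ)| * (26 * (M * (1 + He))) := by gcongr
        _ = _ := by ring
    calc _ ≤ eg * (2 * M) * (26 * R) * B2 := by
          have : (A:ℝ) ≤ 2 * M := by linarith [Nat.cast_nonneg (α := ℝ) L]
          gcongr
      _ = _ := by ring) Y Hb hY ck
  set T := ∑ n ∈ s, ‖∑ m ∈ S, α m * heckeLambda k a (m * n + f)‖ ^ 2 with hT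
  have ew : ea k * T * hh ≤ (16 * Real.exp 3 * He * R * (52 * eg * M + 4 * eh * W * M ^ 2 * (k / √He)) * (16 * k ^ 6)) * ea k * hh := by
    refine hcore.trans ?_
    calc _ ≤ 16 * Real.exp 3 * He * (52 * eg * M * R * B2 * hh + 4 * eh * R * B2 * W * M ^ 2 * (k / √He) * hh) := by gcongr
      _ = 16 * Real.exp 3 * He * R * (52 * eg * M + 4 * eh * W * M ^ 2 * (k / √He)) * B2 * hh := by ring
      _ ≤ 16 * Real.exp 3 * He * R * (52 * eg * M + 4 * eh * W * M ^ 2 * (k / √He)) * (16 * k ^ 6 * ea k) * hh := by gcongr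
      _ = _ := by ring
  have gb := le_of_mul_le_mul_right ew hhpos
  rw [mul_comm] at gb
  have pk := le_of_mul_le_mul_right gb gh
  refine pk.trans ?_
  have hsu : He / √He = √He := div_sqrt
  have fu : 0 ≤ 52 * eg + 4 * eh := by linarith
  have tu : 0 ≤ W := sqrt_nonneg _
  have qv : He * (52 * eg * M + 4 * eh * W * M ^ 2 * (k / √He)) ≤ (52 * eg + 4 * eh) * k * (M * He + √He * M ^ 2 * W) := by
    calc _ = 52 * eg * 1 * (M * He) + 4 * eh * k * ((He / √He) * M ^ 2 * W) := by ring
      _ ≤ (52 * eg + 4 * eh) * k * (M * He) + (52 * eg + 4 * eh) * k * ((He / √He) * M ^ 2 * W) := by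
          gcongr <;> linarith
      _ = _ := by rw [hsu]; ring
  calc _ = 16 * Real.exp 3 * R * (16 * k ^ 6) * (He * (52 * eg * M + 4 * eh * W * M ^ 2 * (k / √He))) := by ring
    _ ≤ 16 * Real.exp 3 * R * (16 * k ^ 6) * ((52 * eg + 4 * eh) * k * (M * He + √He * M ^ 2 * W)) := by gcongr
    _ = _ := by ring
end
section
open Real Finset Complex
lemma cells (Q : ℕ) (S : Finset ℕ) (s : Finset ℤ) (p : ℕ → ℕ) (q : ℤ → ℕ) (hp : ∀ m ∈ S, p m < Q) (hq : ∀ n ∈ s, q n < Q)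
    (g : ℕ → ℤ → ℂ) (B : ℝ) (hB : ∀ i j, ∑ n ∈ s with q n = j, ‖∑ m ∈ S with p m = i, g m n‖ ^ 2 ≤ B) :
    ∑ n ∈ s, ‖∑ m ∈ S, g m n‖ ^ 2 ≤ (Q:ℝ) ^ 3 * B := by
  have Hc : ∀ n, ‖∑ m ∈ S, g m n‖ ^ 2 ≤ Q * ∑ i ∈ range Q, ‖∑ m ∈ S with p m = i, g m n‖ ^ 2 := by
    intro n
    rw [← sum_fiberwise_of_maps_to (t := range Q) (g := p) (fun m hm => mem_range.2 (hp m hm))]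
    refine (pow_le_pow_left₀ (norm_nonneg _) (norm_sum_le _ _) 2).trans ?_
    simpa using sq_sum_le_card_mul_sum_sq (s := range Q) (f := fun i => ‖∑ m ∈ S with p m = i, g m n‖)
  rw [← sum_fiberwise_of_maps_to (t := range Q) (g := q) (fun m hm => mem_range.2 (hq m hm))]
  calc _ ≤ ∑ j ∈ range Q, (Q:ℝ) * ∑ i ∈ range Q, B := by
        refine sum_le_sum fun j _ => (sum_le_sum fun n _ => Hc n).trans ?_
        rw [← mul_sum, sum_comm]
        exact mul_le_mul_of_nonneg_left (sum_le_sum fun i _ => hB i j) (by positivity)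
    _ = _ := by simp; ring
lemma uq (M x y : ℝ) (R : ℕ) (hM : 0 < M) (hx : M ≤ x) (hy : M ≤ y)
    (h : ⌊(x - M) / M * R⌋₊ = ⌊(y - M) / M * R⌋₊) : |x - y| * R ≤ M := by
  have Hc := Nat.floor_le (a := (x - M) / M * R) (mul_nonneg (div_nonneg (by linarith) hM.le) (by positivity))
  have Hd := Nat.floor_le (a := (y - M) / M * R) (mul_nonneg (div_nonneg (by linarith) hM.le) (by positivity))
  have Hg := Nat.lt_floor_add_one ((x - M) / M * R)
  have Hk := Nat.lt_floor_add_one ((y - M) / M * R)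
  rw [h] at Hc Hg
  have Hl : |(x - M) / M * R - (y - M) / M * R| ≤ 1 := abs_le.2 ⟨by linarith, by linarith⟩
  have Hq : (x - M) / M * R - (y - M) / M * R = (x - y) * R / M := by ring
  rw [Hq, abs_div, abs_mul, abs_of_pos hM, div_le_one hM, Nat.abs_cast] at Hl
  exact Hl
lemma ur (M x : ℝ) (R : ℕ) (hM : 0 < M) (Hd : x ≤ 2 * M) :
    ⌊(x - M) / M * R⌋₊ < R + 1 := by
  rw [Nat.lt_succ_iff]
  refine Nat.floor_le_of_le ?_
  exact mul_le_of_le_one_left (by positivity) ((div_le_one hM).2 (by linarith))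
lemma numE (M N u : ℝ) (hM : 1 ≤ M) (hN : M ≤ N) (hu : 0 ≤ u) (h : u ≤ 200 * (N / M)) :
    M * u + √u * M ^ 2 * √(M * (M + √(1 + u))) ≤
      200 * (N + N ^ ((1:ℝ) / 2) * M ^ ((5:ℝ) / 2) + N ^ ((3:ℝ) / 4) * M ^ ((7:ℝ) / 4)) := by
  have jx : 0 < M := by linarith
  have us : 0 < N := by linarith
  obtain ⟨v, hv⟩ : ∃ v, v = N / M := ⟨_, rfl⟩
  rw [← hv] at h
  have fv : 1 ≤ v := by rw [hv, one_le_div jx]; exact hN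
  have hNv : N = v * M := by rw [hv]; field_simp
  obtain ⟨w, hw, hwv⟩ : ∃ w : ℝ, 0 < w ∧ v = w ^ 4 := ⟨v ^ ((1:ℝ) / 4), by positivity, by
    rw [← rpow_natCast, ← rpow_mul (by linarith)]; norm_num⟩
  obtain ⟨y, hy, hyM⟩ : ∃ y : ℝ, 0 < y ∧ M = y ^ 4 := ⟨M ^ ((1:ℝ) / 4), by positivity, by
    rw [← rpow_natCast, ← rpow_mul (by linarith)]; norm_num⟩
  have hr : ∀ (z : ℝ), 0 < z → ∀ (e : ℝ) (n : ℕ), 4 * e = n → (z ^ 4) ^ e = z ^ n := by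
    intro z hz e n he
    rw [← rpow_natCast z 4, ← rpow_mul hz.le, ← rpow_natCast]
    congr 1
  have hNw : N = (w * y) ^ 4 := by rw [hNv, hwv, hyM]; ring
  have gr : √u ≤ 15 * w ^ 2 := sqrt_le_iff.2 ⟨by positivity, by nlinarith⟩
  have tk : √(1 + u) ≤ 15 * w ^ 2 := sqrt_le_iff.2 ⟨by positivity, by nlinarith⟩
  have vb : √(M * (M + √(1 + u))) ≤ y ^ 4 + 4 * y ^ 2 * w := by
    refine sqrt_le_iff.2 ⟨by positivity, ?_⟩
    have : M * (M + √(1 + u)) ≤ y ^ 4 * (y ^ 4 + 15 * w ^ 2) := by rw [← hyM]; gcongr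
    have Hm : 0 ≤ y ^ 6 * w := by positivity
    have Hc : 0 ≤ y ^ 4 * w ^ 2 := by positivity
    nlinarith
  rw [hNw, hr _ (by positivity) _ 2 (by norm_num), hr _ (by positivity) _ 3 (by norm_num), hyM,
    hr y hy _ 10 (by norm_num), hr y hy _ 7 (by norm_num), ← hyM]
  have Hi : M * u ≤ 200 * (w * y) ^ 4 := by
    rw [← hNw, hNv]; nlinarith
  have Hj : √u * M ^ 2 * √(M * (M + √(1 + u))) ≤ 15 * w ^ 2 * M ^ 2 * (y ^ 4 + 4 * y ^ 2 * w) := by gcongr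
  have Hu : 15 * w ^ 2 * M ^ 2 * (y ^ 4 + 4 * y ^ 2 * w) = 15 * ((w * y) ^ 2 * y ^ 10) + 60 * ((w * y) ^ 3 * y ^ 7) := by
    rw [hyM]; ring
  have et : 0 ≤ (w * y) ^ 2 * y ^ 10 := by positivity
  have ew : 0 ≤ (w * y) ^ 3 * y ^ 7 := by positivity
  linarith
set_option maxHeartbeats 1000000 in
lemma cellB (ε : ℝ) (hε : 0 < ε) (jq : ε ≤ 1) : ∃ K : ℝ, 1 ≤ K ∧ ∀ (k : ℕ) (a : ℕ → ℂ), IsNormalizedHeckeEigenform k a →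
    ∀ (M X Z Ξ F N : ℝ) (f : ℤ), 1 ≤ M → 1 ≤ X → 1 ≤ Z → f ≠ 0 → F = |(f:ℝ)| → N = M * X + F →
    M * X / (100 * Z) ≤ Ξ → Ξ ≤ 100 * N → ∀ R : ℕ, 4000 * k * Z * N ≤ R * (M * X) →
    ∀ α : ℕ → ℂ, (∀ m, ‖α m‖ ≤ 1) → ∀ (S : Finset ℕ) (s : Finset ℤ), (0:ℤ) ∉ s →
    (∀ m ∈ S, Squarefree m ∧ M ≤ m ∧ m ≤ 2 * M) → (∀ m ∈ S, ∀ Ho ∈ S, |(m:ℝ) - Ho| * R ≤ M) →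
    (∀ n ∈ s, ∀ po ∈ s, |(n:ℝ) - po| * R ≤ X) → (∀ m ∈ S, ∀ n ∈ s, Ξ ≤ (m:ℝ) * n + f ∧ (m:ℝ) * n + f ≤ 2 * Ξ) →
    ∑ n ∈ s, ‖∑ m ∈ S, α m * heckeLambda k a (m * n + f)‖ ^ 2 ≤
      K * ((k * M * X * F) ^ ε) ^ 2 * k ^ 7 * (N + N ^ ((1:ℝ) / 2) * M ^ ((5:ℝ) / 2) + N ^ ((3:ℝ) / 4) * M ^ ((7:ℝ) / 4)) := by
  obtain ⟨K, hK, hpc⟩ := piece ε hε jq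
  refine ⟨K * 402 * 200, by linarith, ?_⟩
  intro k a ha M X Z Ξ F N f hM hX hZ hf hF hN rc rd R hR α hα S s Hm hS hSS hss hΞ
  have hk : (12:ℝ) ≤ k := by exact_mod_cast ha.2.1
  have ga : 1 ≤ F := by rw [hF]; exact_mod_cast Int.one_le_abs hf
  have hMX : 1 ≤ M * X := one_le_mul_of_one_le_of_one_le hM hX
  have us : 0 < N := by linarith
  have jx : 0 < M := by linarith
  have hRHS : 0 ≤ K * 402 * 200 * ((k * M * X * F) ^ ε) ^ 2 * k ^ 7 * (N + N ^ ((1:ℝ) / 2) * M ^ ((5:ℝ) / 2) + N ^ ((3:ℝ) / 4) * M ^ ((7:ℝ) / 4)) := by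
    positivity
  rcases S.eq_empty_or_nonempty with rfl | hSn
  · simpa using hRHS
  rcases s.eq_empty_or_nonempty with rfl | ⟨Hv, jo⟩
  · simpa using hRHS
  obtain ⟨A, hA⟩ : ∃ A, A = S.min' hSn := ⟨_, rfl⟩
  obtain ⟨B, hB⟩ : ∃ B, B = S.max' hSn := ⟨_, rfl⟩
  have hAS : A ∈ S := hA ▸ S.min'_mem hSn
  have hBS : B ∈ S := hB ▸ S.max'_mem hSn
  have hle : ∀ m ∈ S, A ≤ m ∧ m ≤ B := fun m hm => ⟨hA ▸ S.min'_le m hm, hB ▸ S.le_max' m hm⟩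
  obtain ⟨L, rfl⟩ := Nat.exists_eq_add_of_le (hle B hBS).1
  obtain ⟨_, pn, fw⟩ := hS A hAS
  obtain ⟨_, fx, pj⟩ := hS _ hBS
  have ce : (0:ℝ) < A := by linarith
  obtain ⟨fy, fz⟩ := hΞ A hAS Hv jo
  have hLR : (L:ℝ) * R ≤ M := by
    have := hSS _ hBS A hAS
    push_cast at this
    rwa [add_sub_cancel_left, Nat.abs_cast] at this
  have hkZ : 0 < 4000 * k * Z := by positivity
  have hkR : 4000 * k * Z ≤ R := by
    refine le_of_mul_le_mul_right ?_ (by linarith : 0 < M * X)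
    refine le_trans (mul_le_mul_of_nonneg_left (by linarith) hkZ.le) hR
  have jz : (0:ℝ) < R := by linarith
  have bz : (k:ℝ) ≤ R := by
    have := mul_le_mul_of_nonneg_left hZ (by positivity : (0:ℝ) ≤ 4000 * k)
    linarith
  obtain ⟨u, hu⟩ : ∃ u : ℝ, u = Hv + f / A := ⟨_, rfl⟩
  have huA : u * A = A * Hv + f := by rw [hu]; field_simp
  have ia : 0 < Ξ := lt_of_lt_of_le (by positivity) rc
  have gt : X / (200 * Z) ≤ u := by
    refine le_of_mul_le_mul_right ?_ ce
    calc X / (200 * Z) * A ≤ X / (200 * Z) * (2 * M) := by gcongr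
      _ = M * X / (100 * Z) := by field_simp; norm_num
      _ ≤ _ := by linarith
  have ec : 0 < u := lt_of_lt_of_le (by positivity) gt
  have pv : u ≤ 200 * (N / M) := by
    refine le_of_mul_le_mul_right ?_ jx
    calc u * M ≤ u * A := by gcongr
      _ ≤ 200 * N := by linarith
      _ = _ := by field_simp
  have hq : X / (4000 * k * Z) ≤ u / (20 * k) := by
    rw [le_div_iff₀ (by positivity)]
    refine le_trans (le_of_eq ?_) gt
    field_simp; norm_num
  have ib : X / R ≤ u / (20 * k) := by
    refine le_trans ?_ hq
    gcongr
  have da : R * (M * X) ≥ 4000 * k * Z * F := by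
    refine le_trans (mul_le_mul_of_nonneg_left (by linarith) hkZ.le) hR
  have hfL : F / A ^ 2 * L ≤ u / (20 * k) := by
    refine le_trans ?_ hq
    calc F / A ^ 2 * L ≤ F / M ^ 2 * (M / R) := by
          gcongr
          rwa [le_div_iff₀ jz]
      _ = F / (M * R) := by field_simp
      _ ≤ _ := by
        rw [div_le_div_iff₀ (by positivity) hkZ]
        linarith
  have je : u / (20 * k) + u / (20 * k) = u / (10 * k) := by field_simp; norm_num
  have ie : 0 < u / (20 * k) := by positivity
  have hp := hpc k a ha f hf M A L hM pn pj ((mul_le_mul_of_nonneg_left bz (by positivity)).trans (hLR.trans pn)) u ec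
    (by rw [← hF]; linarith) S hle (fun m hm => (hS m hm).1) α hα s Hm ?_
  swap
  · intro n hn j db dc
    have dd : (A:ℝ) ≤ j := by exact_mod_cast db
    have ig : (j:ℝ) ≤ A + L := by exact_mod_cast dc
    have Hi := finv f A j A ce dd le_rfl
    rw [← hF, abs_of_nonneg (by linarith : (0:ℝ) ≤ j - A)] at Hi
    have Hj : F / A ^ 2 * ((j:ℝ) - A) ≤ F / A ^ 2 * L := mul_le_mul_of_nonneg_left (by linarith) (by positivity)
    have Hu : |(n:ℝ) - Hv| ≤ X / R := by
      rw [le_div_iff₀ jz]; exact hss n hn Hv jo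
    have et : (n:ℝ) + f / j - u = (n - Hv) + (f / j - f / A) := by rw [hu]; ring
    rw [et, ← je]
    refine (abs_add_le _ _).trans (add_le_add (by linarith) (by linarith))
  have hnum := numE M N u hM (by linarith [mul_le_mul_of_nonneg_left hX jx.le]) ec.le pv
  have hMf : (M * |(f:ℝ)| * (1 + u)) ^ ε ≤ 402 * ((k * M * X * F) ^ ε) ^ 2 := by
    have Hi : M * |(f:ℝ)| * (1 + u) ≤ 402 * (k * M * X * F) ^ 2 := by
      rw [← hF]
      have Hj : M * (1 + u) ≤ 201 * N := by
        have : u * M ≤ 200 * N := by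
          calc _ ≤ 200 * (N / M) * M := by gcongr
            _ = _ := by field_simp
        linarith [mul_le_mul_of_nonneg_left hX jx.le]
      have Hu : N ≤ 2 * (M * X * F) := by
        rw [hN]; linarith [mul_le_mul_of_nonneg_left ga (by linarith : 0 ≤ M * X), mul_le_mul_of_nonneg_right hMX (by linarith : 0 ≤ F)]
      have et : F ≤ M * X * F := le_mul_of_one_le_left (by linarith) hMX
      have ew : M * X * F ≤ k * M * X * F := by
        rw [mul_assoc (k:ℝ), mul_assoc (k:ℝ)]; exact le_mul_of_one_le_left (by positivity) (by linarith)
      calc M * F * (1 + u) = F * (M * (1 + u)) := by ring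
        _ ≤ (k * M * X * F) * (201 * (2 * (k * M * X * F))) := by
          refine mul_le_mul (by linarith) (by linarith) (by positivity) (by positivity)
        _ = _ := by ring
    refine (rpow_le_rpow (by positivity) Hi hε.le).trans ?_
    refine (rb _ _ _ (by norm_num) jq (by positivity)).trans (le_of_eq ?_)
    rw [← rpow_natCast, ← rpow_natCast, ← rpow_mul (by positivity), ← rpow_mul (by positivity), mul_comm ε]
  refine hp.trans ?_
  calc _ ≤ K * (402 * ((k * M * X * F) ^ ε) ^ 2) * k ^ 7 * (200 * (N + N ^ ((1:ℝ) / 2) * M ^ ((5:ℝ) / 2) + N ^ ((3:ℝ) / 4) * M ^ ((7:ℝ) / 4))) := by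
        refine mul_le_mul ?_ hnum (by positivity) (by positivity)
        refine mul_le_mul_of_nonneg_right ?_ (by positivity)
        exact mul_le_mul_of_nonneg_left hMf (by positivity)
    _ = _ := by ring
end
set_option maxHeartbeats 1000000 in
theorem bilinear_shifted_hecke :
    ∀ ε : ℝ, 0 < ε → ∃ K : ℝ,
      ∀ (k : ℕ) (a : ℕ → ℂ), IsNormalizedHeckeEigenform k a →
        ∀ (M X Z Ξ : ℝ) (f σ : ℤ) (α β : ℕ → ℂ),
          1 ≤ M → 1 ≤ X → 1 ≤ Z → f ≠ 0 → (σ = 1 ∨ σ = -1) →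
          (∀ m : ℕ, ‖α m‖ ≤ 1) → (∀ n : ℕ, ‖β n‖ ≤ 1) →
          (∀ m : ℕ, α m ≠ 0 → M ≤ (m : ℝ) ∧ (m : ℝ) ≤ 2 * M) →
          (∀ n : ℕ, β n ≠ 0 → X ≤ (n : ℝ) ∧ (n : ℝ) ≤ 2 * X) →
          M * X / (100 * Z) ≤ Ξ → Ξ ≤ 100 * (M * X + |(f : ℝ)|) →
          (∀ m n : ℕ, α m * β n ≠ 0 → Squarefree m ∧
            Ξ ≤ ((σ * m * n + f : ℤ) : ℝ) ∧ ((σ * m * n + f : ℤ) : ℝ) ≤ 2 * Ξ) →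
          ‖∑' (m : ℕ) (n : ℕ), α m * β n * heckeLambda k a (σ * m * n + f)‖ ≤
            K * ((k : ℝ) * M * X * |(f : ℝ)|) ^ ε * (k : ℝ) ^ ((23 : ℝ) / 4) *
              ((k : ℝ) + Z * (1 + |(f : ℝ)| / (M * X))) ^ (4 : ℕ) *
              (X * (M * X + |(f : ℝ)|) +
                X * (M * X + |(f : ℝ)|) ^ ((1 : ℝ) / 2) * M ^ ((5 : ℝ) / 2) +
                X * (M * X + |(f : ℝ)|) ^ ((3 : ℝ) / 4) * M ^ ((7 : ℝ) / 4)) ^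
                ((1 : ℝ) / 2) := by
  intro ε hε
  obtain ⟨K, hK, hc⟩ := cellB (min ε 1) (lt_min hε one_pos) (min_le_right _ _)
  refine ⟨2 * (4002 ^ 3 * K), ?_⟩
  intro k a ha M X Z Ξ f σ α β hM hX hZ hf hσ hα hβ hαs hβs rc rd hΞ
  obtain ⟨F, hF⟩ : ∃ F, F = |(f:ℝ)| := ⟨_, rfl⟩
  obtain ⟨N, hN⟩ : ∃ N, N = M * X + F := ⟨_, rfl⟩
  rw [← hF, ← hN] at rd ⊢
  have hk : (12:ℝ) ≤ k := by exact_mod_cast ha.2.1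
  have ga : 1 ≤ F := by rw [hF]; exact_mod_cast Int.one_le_abs hf
  have jx : 0 < M := by linarith
  have ut : 0 < X := by linarith
  have hMX : 1 ≤ M * X := one_le_mul_of_one_le_of_one_le hM hX
  have us : 0 < N := by linarith
  obtain ⟨W, hW⟩ : ∃ W, W = Z * (1 + F / (M * X)) := ⟨_, rfl⟩
  have hWN : Z * N = W * (M * X) := by rw [hW, hN]; field_simp
  have de : 1 ≤ W := by
    rw [hW]; exact one_le_mul_of_one_le_of_one_le hZ (by
      have : 0 ≤ F / (M * X) := by positivity
      linarith)
  obtain ⟨E, hE⟩ : ∃ E, E = N + N ^ ((1:ℝ) / 2) * M ^ ((5:ℝ) / 2) + N ^ ((3:ℝ) / 4) * M ^ ((7:ℝ) / 4) := ⟨_, rfl⟩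
  have cw : 0 < E := by rw [hE]; positivity
  have hXE : X * N + X * N ^ ((1:ℝ) / 2) * M ^ ((5:ℝ) / 2) + X * N ^ ((3:ℝ) / 4) * M ^ ((7:ℝ) / 4) = X * E := by
    rw [hE]; ring
  rw [hXE, ← hW, ← Real.sqrt_eq_rpow]
  obtain ⟨S, hS⟩ : ∃ S : Finset ℕ, ∀ m, m ∈ S ↔ α m ≠ 0 :=
    ⟨(Finset.range (⌊2 * M⌋₊ + 1)).filter (α · ≠ 0), fun m => by
      simp only [Finset.mem_filter, Finset.mem_range, Nat.lt_succ_iff, and_iff_right_iff_imp]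
      exact fun h => Nat.le_floor (hαs m h).2⟩
  obtain ⟨s, hs⟩ : ∃ S : Finset ℕ, ∀ m, m ∈ S ↔ β m ≠ 0 :=
    ⟨(Finset.range (⌊2 * X⌋₊ + 1)).filter (β · ≠ 0), fun m => by
      simp only [Finset.mem_filter, Finset.mem_range, Nat.lt_succ_iff, and_iff_right_iff_imp]
      exact fun h => Nat.le_floor (hβs m h).2⟩
  have hcard : (s.card : ℝ) ≤ 2 * X := by
    have : s ⊆ Finset.Icc 1 ⌊2 * X⌋₊ := fun n hn => by
      have := hβs n ((hs n).1 hn)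
      exact Finset.mem_Icc.2 ⟨by exact_mod_cast hX.trans this.1, Nat.le_floor this.2⟩
    have Hc := Finset.card_le_card this
    rw [Nat.card_Icc, Nat.add_sub_cancel] at Hc
    exact (Nat.cast_le.2 Hc).trans (Nat.floor_le (by positivity))
  obtain ⟨G, hG⟩ : ∃ G : ℤ → ℂ, G = fun n => ∑ m ∈ S, α m * heckeLambda k a (m * n + f) := ⟨_, rfl⟩
  have hsum : ∑' (m : ℕ) (n : ℕ), α m * β n * heckeLambda k a (σ * m * n + f) = ∑ n ∈ s, β n * G (σ * n) := by
    have Hi : ∀ m, ∑' (n : ℕ), α m * β n * heckeLambda k a (σ * m * n + f) =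
        ∑ n ∈ s, α m * β n * heckeLambda k a (σ * m * n + f) := fun m =>
      tsum_eq_sum fun n hn => by rw [not_not.1 (fun h => hn ((hs n).2 h))]; ring
    simp_rw [Hi]
    rw [tsum_eq_sum (s := S) fun m hm => by rw [not_not.1 (fun h => hm ((hS m).2 h))]; simp, Finset.sum_comm, hG]
    refine Finset.sum_congr rfl fun n _ => ?_
    rw [Finset.mul_sum]
    refine Finset.sum_congr rfl fun m _ => ?_
    rw [show (σ * m * n + f : ℤ) = m * (σ * n) + f by ring]; ring
  have df : σ ≠ 0 := by rcases hσ with rfl | rfl <;> norm_num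
  have hσa : |(σ:ℝ)| = 1 := by rcases hσ with rfl | rfl <;> norm_num
  obtain ⟨t, ht⟩ : ∃ t : Finset ℤ, t = s.image (fun n : ℕ => σ * n) := ⟨_, rfl⟩
  have hcs : ‖∑ n ∈ s, β n * G (σ * n)‖ ^ 2 ≤ 2 * X * ∑ n ∈ t, ‖G n‖ ^ 2 := by
    have Hi : ∑ n ∈ t, ‖G n‖ ^ 2 = ∑ n ∈ s, ‖G (σ * n)‖ ^ 2 := by
      rw [ht, Finset.sum_image]
      intro x _ y _ h
      exact_mod_cast mul_left_cancel₀ df h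
    rw [Hi]
    have Hj : ‖∑ n ∈ s, β n * G (σ * n)‖ ≤ ∑ n ∈ s, ‖G (σ * n)‖ :=
      (norm_sum_le _ _).trans (Finset.sum_le_sum fun n _ => by
        rw [norm_mul]; exact mul_le_of_le_one_left (norm_nonneg _) (hβ n))
    refine (pow_le_pow_left₀ (norm_nonneg _) Hj 2).trans (sq_sum_le_card_mul_sum_sq.trans ?_)
    exact mul_le_mul_of_nonneg_right hcard (Finset.sum_nonneg fun _ _ => by positivity)
  have htm : ∀ n ∈ t, ∃ jy ∈ s, n = σ * jy ∧ X ≤ |(n:ℝ)| ∧ |(n:ℝ)| ≤ 2 * X := by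
    intro n hn
    rw [ht, Finset.mem_image] at hn
    obtain ⟨jy, Hc, rfl⟩ := hn
    refine ⟨jy, Hc, rfl, ?_⟩
    push_cast
    rw [abs_mul, hσa, one_mul, Nat.abs_cast]
    exact hβs jy ((hs jy).1 Hc)
  obtain ⟨R, hR⟩ : ∃ R : ℕ, R = ⌈4000 * k * W⌉₊ := ⟨_, rfl⟩
  have dg : 4000 * k * W ≤ R := hR ▸ Nat.le_ceil _
  have da : (R:ℝ) + 1 ≤ 4002 * k * W := by
    have := Nat.ceil_lt_add_one (a := 4000 * k * W) (by positivity)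
    rw [← hR] at this
    have : 1 ≤ k * W := one_le_mul_of_one_le_of_one_le (by linarith) de
    linarith
  obtain ⟨ν, hν⟩ : ∃ ν, ν = (k * M * X * F) ^ ε := ⟨_, rfl⟩
  have ii : 0 < ν := by rw [hν]; positivity
  have hνm : (k * M * X * F) ^ (min ε 1) ≤ ν := by
    rw [hν]
    refine Real.rpow_le_rpow_of_exponent_le ?_ (min_le_left _ _)
    rw [mul_assoc (k:ℝ)]
    exact one_le_mul_of_one_le_of_one_le (one_le_mul_of_one_le_of_one_le (by linarith) hMX) ga
  have hT : ∑ n ∈ t, ‖G n‖ ^ 2 ≤ ((R + 1 : ℕ) : ℝ) ^ 3 * (K * ν ^ 2 * k ^ 7 * E) := by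
    rw [hG]
    refine cells (R + 1) S t (fun m => ⌊((m:ℝ) - M) / M * R⌋₊) (fun n => ⌊(|(n:ℝ)| - X) / X * R⌋₊)
      (fun m hm => ur M m R jx (hαs m ((hS m).1 hm)).2)
      (fun n hn => by obtain ⟨_, _, _, _, h⟩ := htm n hn; exact ur X _ R ut h) _ _ fun i j => ?_
    have hb := hc k a ha M X Z Ξ F N f hM hX hZ hf hF hN rc rd R
      (by rw [mul_assoc (4000 * (k:ℝ)), hWN, ← mul_assoc]; exact mul_le_mul_of_nonneg_right dg (by positivity)) α hα
      (S.filter fun m => ⌊((m:ℝ) - M) / M * R⌋₊ = i) (t.filter fun n => ⌊(|(n:ℝ)| - X) / X * R⌋₊ = j) ?_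
    · rw [← hE] at hb
      by_cases hte : t.Nonempty
      · obtain ⟨n, hn⟩ := hte
        obtain ⟨jy, cq, _⟩ := htm n hn
        refine (hb ?_ ?_ ?_ ?_).trans ?_
        · intro m hm
          have hm := (hS m).1 (Finset.mem_filter.1 hm).1
          exact ⟨(hΞ m jy (mul_ne_zero hm ((hs jy).1 cq))).1, hαs m hm⟩
        · intro m hm Ho ej
          rw [Finset.mem_filter] at hm ej
          exact uq M m Ho R jx (hαs m ((hS m).1 hm.1)).1 (hαs Ho ((hS Ho).1 ej.1)).1 (hm.2.trans ej.2.symm)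
        · intro n hn po jh
          rw [Finset.mem_filter] at hn jh
          obtain ⟨x, _, hx, dh, vr⟩ := htm n hn.1
          obtain ⟨y, _, hy, cx, ja⟩ := htm po jh.1
          have := uq X |(n:ℝ)| |(po:ℝ)| R ut dh cx (hn.2.trans jh.2.symm)
          rw [hx, hy] at this ⊢
          push_cast at this ⊢
          rw [abs_mul, abs_mul, hσa, one_mul, one_mul, Nat.abs_cast, Nat.abs_cast] at this
          rwa [← mul_sub, abs_mul, hσa, one_mul]
        · intro m hm n hn
          obtain ⟨x, si, rfl, _⟩ := htm n (Finset.mem_filter.1 hn).1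
          have := (hΞ m x (mul_ne_zero ((hS m).1 (Finset.mem_filter.1 hm).1) ((hs x).1 si))).2
          push_cast at this ⊢
          rwa [show (m:ℝ) * (σ * x) = σ * m * x by ring]
        · gcongr
      · rw [Finset.not_nonempty_iff_eq_empty.1 hte]
        simp only [Finset.filter_empty, Finset.sum_empty]
        positivity
    · intro h
      obtain ⟨_, _, _, Hc, _⟩ := htm 0 (Finset.mem_filter.1 h).1
      rw [Int.cast_zero, abs_zero] at Hc
      linarith
  rw [hsum, ← hν]
  refine le_of_sq_le_sq ?_ (by positivity)
  refine hcs.trans ((mul_le_mul_of_nonneg_left hT (by positivity)).trans ?_)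
  have hkk : ((k:ℝ) ^ ((23:ℝ) / 4)) ^ 2 ≥ k ^ 10 := by
    rw [← Real.rpow_natCast, ← Real.rpow_mul (by positivity), ← Real.rpow_natCast]
    exact Real.rpow_le_rpow_of_exponent_le (by linarith) (by norm_num)
  have hP : W ^ 3 ≤ ((k:ℝ) + W) ^ 8 :=
    (pow_le_pow_left₀ (by positivity) (by linarith : W ≤ k + W) 3).trans (pow_le_pow_right₀ (by linarith) (by norm_num))
  have di : ((R + 1 : ℕ) : ℝ) ^ 3 ≤ (4002 * k * W) ^ 3 := by push_cast; gcongr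
  calc _ ≤ 2 * X * ((4002 * k * W) ^ 3 * (K * ν ^ 2 * k ^ 7 * E)) := by
        refine mul_le_mul_of_nonneg_left (mul_le_mul_of_nonneg_right di (by positivity)) (by positivity)
    _ = 2 * (4002 ^ 3 * K) * ν ^ 2 * (k ^ 10 * W ^ 3) * (X * E) := by ring
    _ ≤ (2 * (4002 ^ 3 * K)) ^ 2 * ν ^ 2 * (((k:ℝ) ^ ((23:ℝ) / 4)) ^ 2 * ((k:ℝ) + W) ^ 8) * (X * E) := by
        refine mul_le_mul_of_nonneg_right (mul_le_mul (mul_le_mul_of_nonneg_right ?_ (by positivity)) (mul_le_mul hkk hP (by positivity) (by positivity)) (by positivity) (by positivity)) (by positivity)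
        exact le_self_pow₀ (by linarith) (by norm_num)
    _ = _ := by
        have := Real.sq_sqrt (by positivity : 0 ≤ X * E)
        simp only [mul_pow, this]; ring
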